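/- Let q be a prime power, n ≥ 1, and let G be any of the groups GL_n(q), PGL_n(q), SL_n(q), PSL_n(q). Let b(G) be the largest degree of a complex irreducible character of G. Then max{1, (1/4)·(log_q((n−1)(1−1/q)+q²))^{3/4}} ≤ b(G)/q^{n(n−1)/2} < 13·(log_q(n(q−1)+q))^{2.54}. In particular, (1/4)·(log_q((n+7)/2))^{3/4} < b(G)/q^{n(n−1)/2} < 13·(1+log_q(n+1))^{2.54}. -/

import Mathlib

open scoped Classical

/-- The set of irreducible complex characters of a group `G`. -/
noncomputable def IrrChar (G : Type) [Monoid G] : Set (G → ℂ) :=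
  {f | ∃ V : FDRep ℂ G, CategoryTheory.Simple V ∧ f = FDRep.character V}

/-- The largest degree of a complex irreducible representation of `G`. -/
noncomputable def maxIrrDeg (G : Type) [Monoid G] : ℕ :=
  sSup {d : ℕ | ∃ V : FDRep ℂ G, CategoryTheory.Simple V ∧ Module.finrank ℂ V = d}

/-- `ε(G)`: ratio of the sum of squares of the degrees of the irreducible characters of
degree less than the largest degree, to the square of the largest degree. -/
noncomputable def epsG (G : Type) [Monoid G] : ℝ :=
  (∑ᶠ f ∈ {f ∈ IrrChar G | (f 1).re < (maxIrrDeg G : ℝ)}, (f 1).re ^ 2) /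
    ((maxIrrDeg G : ℝ)) ^ 2

/-- The projective general linear group `PGL_n(F)`, i.e. `GL_n(F)` modulo its center. -/
abbrev ProjGL (n : ℕ) (F : Type) [Field F] : Type :=
  Matrix.GeneralLinearGroup (Fin n) F ⧸ Subgroup.center (Matrix.GeneralLinearGroup (Fin n) F)

/-- The asserted bounds on `b(G) / q^(n(n-1)/2)` for a group `G` with largest irreducible
character degree `b`. -/
def LMTBounds (q n b : ℕ) : Prop :=
  max 1 ((1 / 4) * (Real.logb q (((n : ℝ) - 1) * (1 - 1 / (q : ℝ)) + (q : ℝ) ^ 2))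
      ^ ((3 : ℝ) / 4)) ≤ (b : ℝ) / (q : ℝ) ^ (n * (n - 1) / 2) ∧
  (b : ℝ) / (q : ℝ) ^ (n * (n - 1) / 2)
    < 13 * (Real.logb q ((n : ℝ) * ((q : ℝ) - 1) + (q : ℝ))) ^ (2.54 : ℝ) ∧
  (1 / 4) * (Real.logb q (((n : ℝ) + 7) / 2)) ^ ((3 : ℝ) / 4)
    < (b : ℝ) / (q : ℝ) ^ (n * (n - 1) / 2) ∧
  (b : ℝ) / (q : ℝ) ^ (n * (n - 1) / 2)
    < 13 * (1 + Real.logb q ((n : ℝ) + 1)) ^ (2.54 : ℝ)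


set_option linter.unusedSectionVars false
set_option linter.style.haveILetI false
set_option linter.unusedSimpArgs false
set_option linter.flexible false

namespace LMT

/-! ### sums and averages over finite types -/

noncomputable def sm {α : Type*} [Finite α] (f : α → ℂ) : ℂ := ∑ᶠ a, f a

theorem sm_eq {α : Type*} [Fintype α] (f : α → ℂ) : sm f = ∑ a, f a :=
  finsum_eq_sum_of_fintype f

noncomputable def av {α : Type*} [Finite α] (f : α → ℂ) : ℂ := (Nat.card α : ℂ)⁻¹ * sm f

section sm
variable {α β γ : Type*} [Finite α] [Finite β] [Finite γ]

theorem sm_congr {f g : α → ℂ} (h : ∀ a, f a = g a) : sm f = sm g := by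
  rw [funext h]

theorem av_congr {f g : α → ℂ} (h : ∀ a, f a = g a) : av f = av g := by
  rw [funext h]

theorem sm_equiv (e : α ≃ β) (f : β → ℂ) : sm (fun a => f (e a)) = sm f := by
  cases nonempty_fintype α; cases nonempty_fintype β
  rw [sm_eq, sm_eq]; exact Equiv.sum_comp e f

theorem av_equiv (e : α ≃ β) (f : β → ℂ) : av (fun a => f (e a)) = av f := by
  rw [av, av, sm_equiv e, Nat.card_congr e]

theorem sm_add (f g : α → ℂ) : sm (fun a => f a + g a) = sm f + sm g := by
  cases nonempty_fintype α
  simp only [sm_eq, Finset.sum_add_distrib]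

theorem sm_sub (f g : α → ℂ) : sm (fun a => f a - g a) = sm f - sm g := by
  cases nonempty_fintype α
  simp only [sm_eq, Finset.sum_sub_distrib]

theorem sm_mul_left (c : ℂ) (f : α → ℂ) : sm (fun a => c * f a) = c * sm f := by
  cases nonempty_fintype α
  simp only [sm_eq, Finset.mul_sum]

theorem sm_mul_right (c : ℂ) (f : α → ℂ) : sm (fun a => f a * c) = sm f * c := by
  cases nonempty_fintype α
  simp only [sm_eq, Finset.sum_mul]

theorem sm_zero : sm (fun _ : α => (0 : ℂ)) = 0 := by
  cases nonempty_fintype α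
  simp only [sm_eq, Finset.sum_const_zero]

theorem sm_const (c : ℂ) : sm (fun _ : α => c) = Nat.card α * c := by
  cases nonempty_fintype α
  simp [sm_eq]

theorem sm_comm (f : α → β → ℂ) :
    sm (fun a => sm (fun b => f a b)) = sm (fun b => sm (fun a => f a b)) := by
  cases nonempty_fintype α; cases nonempty_fintype β
  simp only [sm_eq]; exact Finset.sum_comm

theorem sm_prod (f : α × β → ℂ) : sm f = sm (fun a => sm (fun b => f (a, b))) := by
  cases nonempty_fintype α; cases nonempty_fintype β
  simp only [sm_eq]; exact Fintype.sum_prod_type f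

theorem sm_sigma {B : α → Type*} [∀ a, Finite (B a)] (f : (Σ a, B a) → ℂ) :
    sm f = sm (fun a => sm (fun b => f ⟨a, b⟩)) := by
  cases nonempty_fintype α
  haveI : ∀ a, Fintype (B a) := fun a => Fintype.ofFinite _
  simp only [sm_eq]; exact Fintype.sum_sigma f

/-- summation along fibres -/
theorem sm_fiber (p : α → β) (f : α → ℂ) :
    sm f = sm (fun b => sm (fun a : {a // p a = b} => f a.1)) := by
  rw [← sm_sigma (fun x : Σ b, {a // p a = b} => f x.2.1)]
  exact (sm_equiv (Equiv.sigmaFiberEquiv p) f).symm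

theorem sm_unique [Unique α] (f : α → ℂ) : sm f = f default := by
  rw [sm_eq]; simp

theorem sm_single (a : α) (f : α → ℂ) (h : ∀ b, b ≠ a → f b = 0) : sm f = f a := by
  cases nonempty_fintype α
  rw [sm_eq]; exact Finset.sum_eq_single a (fun b _ hb => h b hb) (by simp)

theorem sm_finset {ι : Type*} (s : Finset ι) (f : ι → α → ℂ) :
    sm (fun a => ∑ i ∈ s, f i a) = ∑ i ∈ s, sm (f i) := by
  cases nonempty_fintype α
  simp only [sm_eq]; exact Finset.sum_comm

theorem sm_subtype (p : α → Prop) [DecidablePred p] (f : α → ℂ) :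
    sm (fun a : {a // p a} => f a.1) = sm (fun a => if p a then f a else 0) := by
  cases nonempty_fintype α
  rw [sm_eq, sm_eq, ← Finset.sum_filter]
  exact (Finset.sum_subtype _ (by simp) f).symm

theorem av_add (f g : α → ℂ) : av (fun a => f a + g a) = av f + av g := by
  simp only [av, sm_add, mul_add]
theorem av_sub (f g : α → ℂ) : av (fun a => f a - g a) = av f - av g := by
  simp only [av, sm_sub, mul_sub]
theorem av_mul_left (c : ℂ) (f : α → ℂ) : av (fun a => c * f a) = c * av f := by
  simp only [av, sm_mul_left]; ring
theorem av_mul_right (c : ℂ) (f : α → ℂ) : av (fun a => f a * c) = av f * c := by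
  simp only [av, sm_mul_right]; ring
theorem av_zero : av (fun _ : α => (0 : ℂ)) = 0 := by simp [av, sm_zero]
theorem av_const [Nonempty α] (c : ℂ) : av (fun _ : α => c) = c := by
  have : (Nat.card α : ℂ) ≠ 0 := by exact_mod_cast Nat.card_pos.ne'
  rw [av, sm_const]; field_simp
theorem av_comm (f : α → β → ℂ) :
    av (fun a => av (fun b => f a b)) = av (fun b => av (fun a => f a b)) := by
  simp only [av, sm_mul_left]; rw [sm_comm]; ring
theorem av_sm_comm (f : α → β → ℂ) :
    av (fun a => sm (fun b => f a b)) = sm (fun b => av (fun a => f a b)) := by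
  simp only [av, sm_mul_left]; rw [sm_comm]
theorem av_prod (f : α × β → ℂ) : av f = av (fun a => av (fun b => f (a, b))) := by
  simp only [av, sm_mul_left]; rw [sm_prod, Nat.card_prod]; push_cast; rw [mul_inv]; ring
theorem av_finset {ι : Type*} (s : Finset ι) (f : ι → α → ℂ) :
    av (fun a => ∑ i ∈ s, f i a) = ∑ i ∈ s, av (f i) := by
  simp only [av, sm_finset, Finset.mul_sum]
theorem av_unique [Unique α] (f : α → ℂ) : av f = f default := by
  simp [av, sm_unique]

theorem sm_eq_card_mul_av [Nonempty α] (f : α → ℂ) : sm f = Nat.card α * av f := by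
  have : (Nat.card α : ℂ) ≠ 0 := by exact_mod_cast Nat.card_pos.ne'
  rw [av]; field_simp

/-- averages pull back along a map all of whose fibres have the same size. -/
theorem av_fiber (p : α → β) (k : ℕ) (hk : k ≠ 0) (h : ∀ b, Nat.card {a // p a = b} = k)
    (f : β → ℂ) : av (fun a => f (p a)) = av f := by
  have h1 : sm (fun a => f (p a)) = k * sm f := by
    rw [sm_fiber p, ← sm_mul_left]
    apply sm_congr; intro b
    rw [← h b, ← sm_const]
    apply sm_congr; rintro ⟨a, rfl⟩; rfl
  have h2 : Nat.card α = k * Nat.card β := by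
    cases nonempty_fintype β
    rw [← Nat.card_congr (Equiv.sigmaFiberEquiv p), Nat.card_sigma]
    simp [h, mul_comm]
  have : (k : ℂ) ≠ 0 := by exact_mod_cast hk
  rw [av, av, h1, h2]; push_cast
  rw [mul_inv]; field_simp

end sm

theorem av_hom {A B : Type*} [Group A] [Group B] [Finite A] [Finite B] (p : A →* B)
    (hp : Function.Surjective p) (f : B → ℂ) : av (fun a => f (p a)) = av f := by
  apply av_fiber p (Nat.card {a // p a = 1})
  · haveI : Nonempty {a // p a = 1} := ⟨⟨1, map_one p⟩⟩
    exact Nat.card_pos.ne'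
  · intro b
    obtain ⟨c, rfl⟩ := hp b
    apply Nat.card_congr
    exact ⟨fun a => ⟨c⁻¹ * a.1, by simp [a.2]⟩, fun a => ⟨c * a.1, by simp [a.2]⟩,
      fun a => by simp, fun a => by simp⟩

theorem av_addHom {A B : Type*} [AddGroup A] [AddGroup B] [Finite A] [Finite B] (p : A →+ B)
    (hp : Function.Surjective p) (f : B → ℂ) : av (fun a => f (p a)) = av f := by
  exact av_hom (A := Multiplicative A) (B := Multiplicative B) (AddMonoidHom.toMultiplicative p)
    hp f

/-! ### characters -/
section chars
variable {G : Type} [Group G] [Finite G]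

noncomputable def ip (φ ψ : G → ℂ) : ℂ := av (fun g => φ g * ψ g⁻¹)

theorem ip_comm (φ ψ : G → ℂ) : ip φ ψ = ip ψ φ := by
  unfold ip
  rw [← av_equiv (Equiv.inv G)]
  apply av_congr; intro g; simp [mul_comm]

theorem ip_add (φ ψ χ : G → ℂ) : ip (φ + ψ) χ = ip φ χ + ip ψ χ := by
  unfold ip; rw [← av_add]; apply av_congr; intro g; simp [add_mul]
theorem ip_add' (φ ψ χ : G → ℂ) : ip χ (φ + ψ) = ip χ φ + ip χ ψ := by
  rw [ip_comm, ip_add, ip_comm φ, ip_comm ψ]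
theorem ip_sub (φ ψ χ : G → ℂ) : ip (φ - ψ) χ = ip φ χ - ip ψ χ := by
  unfold ip; rw [← av_sub]; apply av_congr; intro g; simp [sub_mul]
theorem ip_smul (c : ℂ) (φ χ : G → ℂ) : ip (c • φ) χ = c * ip φ χ := by
  unfold ip; rw [← av_mul_left]; apply av_congr; intro g; simp [mul_assoc]
theorem ip_zero (χ : G → ℂ) : ip 0 χ = 0 := by
  unfold ip; simp [av_zero]
theorem ip_sum {ι : Type*} (s : Finset ι) (f : ι → G → ℂ) (χ : G → ℂ) :
    ip (∑ i ∈ s, f i) χ = ∑ i ∈ s, ip (f i) χ := by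
  unfold ip; rw [← av_finset]; apply av_congr; intro g; simp [Finset.sum_mul]

/-- `φ` is the character of a finite dimensional complex representation -/
def IsChar (φ : G → ℂ) : Prop :=
  ∃ (V : Type) (_ : AddCommGroup V) (_ : Module ℂ V) (_ : FiniteDimensional ℂ V)
    (ρ : Representation ℂ G V), φ = ρ.character

def IsIrr (φ : G → ℂ) : Prop := IsChar φ ∧ ip φ φ = 1

def IsCls (φ : G → ℂ) : Prop := ∀ g h : G, φ (h * g * h⁻¹) = φ g

theorem IsChar.cls {φ : G → ℂ} (h : IsChar φ) : IsCls φ := by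
  obtain ⟨V, _, _, _, ρ, rfl⟩ := h
  intro g h; simp

noncomputable instance : Invertible (Nat.card G : ℂ) :=
  invertibleOfNonzero (by exact_mod_cast Nat.card_pos.ne')

theorem ip_char_nat {φ ψ : G → ℂ} (h : IsChar φ) (h' : IsChar ψ) : ∃ n : ℕ, ip φ ψ = n := by
  obtain ⟨V, _, _, _, ρ, rfl⟩ := h
  obtain ⟨W, _, _, _, σ, rfl⟩ := h'
  cases nonempty_fintype G
  refine ⟨Module.finrank ℂ (Representation.IntertwiningMap σ ρ), ?_⟩
  · rw [ip, av, sm_eq]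
    exact Representation.card_inv_mul_sum_char_mul_char_eq_finrank σ ρ

theorem IsChar.add {φ ψ : G → ℂ} (h : IsChar φ) (h' : IsChar ψ) : IsChar (φ + ψ) := by
  obtain ⟨V, _, _, _, ρ, rfl⟩ := h
  obtain ⟨W, _, _, _, σ, rfl⟩ := h'
  refine ⟨V × W, inferInstance, inferInstance, inferInstance, ρ.prod σ, ?_⟩
  ext g
  simp only [Representation.character, Pi.add_apply]
  exact (LinearMap.trace_prodMap' (ρ g) (σ g)).symm

theorem IsChar.mul {φ ψ : G → ℂ} (h : IsChar φ) (h' : IsChar ψ) : IsChar (φ * ψ) := by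
  obtain ⟨V, _, _, _, ρ, rfl⟩ := h
  obtain ⟨W, _, _, _, σ, rfl⟩ := h'
  exact ⟨TensorProduct ℂ V W, inferInstance, inferInstance, inferInstance, ρ.tprod σ,
    (Representation.char_tensor ρ σ).symm⟩

theorem IsChar.dual {φ : G → ℂ} (h : IsChar φ) : IsChar (fun g => φ g⁻¹) := by
  obtain ⟨V, _, _, _, ρ, rfl⟩ := h
  exact ⟨Module.Dual ℂ V, inferInstance, inferInstance, inferInstance, ρ.dual, by ext g; simp⟩

theorem IsChar.zero : IsChar (0 : G → ℂ) := by
  refine ⟨PUnit, inferInstance, inferInstance, inferInstance, 1, ?_⟩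
  ext g
  simp [Representation.character, Module.finrank_zero_of_subsingleton]

theorem IsChar.comap {H : Type} [Group H] [Finite H] {φ : G → ℂ} (h : IsChar φ) (f : H →* G) :
    IsChar (fun x => φ (f x)) := by
  obtain ⟨V, _, _, _, ρ, rfl⟩ := h
  exact ⟨V, inferInstance, inferInstance, inferInstance, ρ.comp f, rfl⟩

theorem IsChar.nsmul {φ : G → ℂ} (h : IsChar φ) (n : ℕ) : IsChar ((n : ℂ) • φ) := by
  induction n with
  | zero => simpa using IsChar.zero
  | succ k ih => have := ih.add h; convert this using 1; push_cast; module

theorem IsChar.sum {ι : Type*} (s : Finset ι) (f : ι → G → ℂ) (h : ∀ i ∈ s, IsChar (f i)) :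
    IsChar (∑ i ∈ s, f i) := by
  induction s using Finset.induction_on with
  | empty => simpa using IsChar.zero
  | insert a s ha ih =>
    rw [Finset.sum_insert ha]
    exact (h a (by simp)).add (ih fun i hi => h i (by simp [hi]))

/-- one dimensional characters -/
theorem IsChar.ofHom (f : G →* ℂˣ) : IsChar (fun x => ((f x : ℂˣ) : ℂ)) := by
  refine ⟨ℂ, inferInstance, inferInstance, inferInstance,
    (Algebra.lmul ℂ ℂ).toRingHom.toMonoidHom.comp ((Units.coeHom ℂ).comp f), ?_⟩
  ext g
  have : (LinearMap.mul ℂ ℂ) (f g : ℂ) = (f g : ℂ) • LinearMap.id := by ext; simp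
  simp [Representation.character, this]

theorem rep_induction (P : ∀ (V : Type) [AddCommGroup V] [Module ℂ V] [FiniteDimensional ℂ V]
      (_ : Representation ℂ G V), Prop)
    (h0 : ∀ (V : Type) [AddCommGroup V] [Module ℂ V] [FiniteDimensional ℂ V]
      (ρ : Representation ℂ G V), Subsingleton V → P V ρ)
    (h1 : ∀ (V : Type) [AddCommGroup V] [Module ℂ V] [FiniteDimensional ℂ V]
      (ρ : Representation ℂ G V), ρ.IsIrreducible → P V ρ)
    (h2 : ∀ (V : Type) [AddCommGroup V] [Module ℂ V] [FiniteDimensional ℂ V]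
      (ρ : Representation ℂ G V) (A B : Subrepresentation ρ),
      IsCompl A.toSubmodule B.toSubmodule → P _ A.toRepresentation → P _ B.toRepresentation →
      P V ρ)
    (V : Type) [i1 : AddCommGroup V] [i2 : Module ℂ V] [i3 : FiniteDimensional ℂ V]
    (ρ : Representation ℂ G V) : P V ρ := by
  obtain ⟨n, hn⟩ : ∃ n, Module.finrank ℂ V = n := ⟨_, rfl⟩
  induction n using Nat.strong_induction_on generalizing V with
  | _ n ih =>
  by_cases hs : Subsingleton V
  · exact h0 V ρ hs
  by_cases hi : ρ.IsIrreducible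
  · exact h1 V ρ hi
  have hnt : Nontrivial (Subrepresentation ρ) := by
    refine ⟨⊥, ⊤, fun h => hs ?_⟩
    have : (⊥ : Submodule ℂ V) = ⊤ := congrArg Subrepresentation.toSubmodule h
    rw [← Submodule.subsingleton_iff ℂ]
    exact subsingleton_of_bot_eq_top this
  obtain ⟨A, hA⟩ : ∃ A : Subrepresentation ρ, ¬ (A = ⊥ ∨ A = ⊤) := by
    by_contra! hcon
    exact hi { eq_bot_or_eq_top := hcon }
  push Not at hA
  obtain ⟨B, hB⟩ := exists_isCompl A
  have hc : IsCompl A.toSubmodule B.toSubmodule := by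
    refine isCompl_iff.2 ⟨disjoint_iff.2 ?_, codisjoint_iff.2 ?_⟩
    · exact congrArg Subrepresentation.toSubmodule hB.inf_eq_bot
    · exact congrArg Subrepresentation.toSubmodule hB.sup_eq_top
  have hAb : A.toSubmodule ≠ ⊥ := fun h => hA.1 (Subrepresentation.toSubmodule_injective h)
  have hAt : A.toSubmodule ≠ ⊤ := fun h => hA.2 (Subrepresentation.toSubmodule_injective h)
  have hBt : B.toSubmodule ≠ ⊤ := by
    intro h; apply hAb; have := hc.inf_eq_bot; rwa [h, inf_top_eq] at this
  refine h2 V ρ A B hc ?_ ?_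
  · exact ih _ (hn ▸ Submodule.finrank_lt hAt) _ _ rfl
  · exact ih _ (hn ▸ Submodule.finrank_lt hBt) _ _ rfl

theorem irr_of_irreducible {V : Type} [AddCommGroup V] [Module ℂ V] [FiniteDimensional ℂ V]
    (ρ : Representation ℂ G V) (h : ρ.IsIrreducible) : IsIrr ρ.character := by
  refine ⟨⟨V, _, _, inferInstance, ρ, rfl⟩, ?_⟩
  cases nonempty_fintype G
  rw [ip, av, sm_eq, Representation.char_orthonormal ρ ρ, if_pos ⟨Representation.Equiv.refl ρ⟩]

theorem char_compl {V : Type} [AddCommGroup V] [Module ℂ V] [FiniteDimensional ℂ V]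
    (ρ : Representation ℂ G V) (A B : Subrepresentation ρ)
    (h : IsCompl A.toSubmodule B.toSubmodule) :
    ρ.character = A.toRepresentation.character + B.toRepresentation.character := by
  ext g
  simp only [Representation.character, Pi.add_apply]
  rw [← LinearMap.trace_prodMap',
    ← LinearMap.trace_conj' _ (Submodule.prodEquivOfIsCompl _ _ h)]
  congr 1
  ext v
  obtain ⟨⟨a, b⟩, rfl⟩ := (Submodule.prodEquivOfIsCompl _ _ h).surjective v
  simp [LinearEquiv.conj_apply, Subrepresentation.toRepresentation]

/-- every character is a sum of irreducible ones -/
theorem IsChar.decomp {φ : G → ℂ} (h : IsChar φ) :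
    ∃ M : Multiset (G → ℂ), (∀ χ ∈ M, IsIrr χ) ∧ φ = M.sum := by
  obtain ⟨V, _, _, _, ρ, rfl⟩ := h
  apply rep_induction (G := G) (fun V _ _ _ ρ => ∃ M : Multiset (G → ℂ), (∀ χ ∈ M, IsIrr χ) ∧
    ρ.character = M.sum)
  · intro V _ _ _ ρ hs
    refine ⟨0, by simp, ?_⟩
    ext g
    have : ρ g = 0 := Subsingleton.elim _ _
    simp [Representation.character, this]
  · intro V _ _ _ ρ hi
    exact ⟨{ρ.character}, by simpa using irr_of_irreducible ρ hi, by simp⟩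
  · rintro V _ _ _ ρ A B hAB ⟨M, hM, hM'⟩ ⟨N, hN, hN'⟩
    refine ⟨M + N, ?_, ?_⟩
    · intro χ hχ
      rcases Multiset.mem_add.1 hχ with h | h
      · exact hM _ h
      · exact hN _ h
    · rw [char_compl ρ A B hAB, hM', hN', Multiset.sum_add]

theorem simple_of {V : Type} [AddCommGroup V] [Module ℂ V] [FiniteDimensional ℂ V]
    (ρ : Representation ℂ G V) (h : ip ρ.character ρ.character = 1) :
    CategoryTheory.Simple (FDRep.of ρ) := by
  cases nonempty_fintype G
  rw [FDRep.simple_iff_char_is_norm_one]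
  rw [ip, av, sm_eq, inv_mul_eq_one₀ (by exact_mod_cast Nat.card_pos.ne')] at h
  exact h.symm

theorem irr_orth {φ ψ : G → ℂ} (h : IsIrr φ) (h' : IsIrr ψ) (hne : φ ≠ ψ) : ip φ ψ = 0 := by
  obtain ⟨⟨V, _, _, _, ρ, rfl⟩, hv⟩ := h
  obtain ⟨⟨W, _, _, _, σ, rfl⟩, hw⟩ := h'
  haveI := simple_of ρ hv
  haveI := simple_of σ hw
  cases nonempty_fintype G
  have := FDRep.char_orthonormal (FDRep.of ρ) (FDRep.of σ)
  rw [if_neg] at this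
  · rw [ip, av, sm_eq]; exact this
  · rintro ⟨e⟩
    exact hne (FDRep.char_iso e)

theorem IsIrr.one {φ : G → ℂ} (h : IsIrr φ) : ip φ φ = 1 := h.2
theorem IsIrr.char {φ : G → ℂ} (h : IsIrr φ) : IsChar φ := h.1

/-- completeness -/
theorem cls_eq_zero {φ : G → ℂ} (hφ : IsCls φ) (h : ∀ χ : G → ℂ, IsIrr χ → ip φ χ = 0) :
    φ = 0 := by
  cases nonempty_fintype G
  have key : ∀ (V : Type) [AddCommGroup V] [Module ℂ V] [FiniteDimensional ℂ V]
      (ρ : Representation ℂ G V), ∑ g, φ g⁻¹ • ρ g = 0 := by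
    apply rep_induction
    · intro V _ _ _ ρ hs
      exact Subsingleton.elim _ _
    · intro V _ _ _ ρ hi
      set T := ∑ g, φ g⁻¹ • ρ g with hT
      have hcomm : ∀ g, T ∘ₗ ρ g = ρ g ∘ₗ T := by
        intro g
        simp only [hT, ← Module.End.mul_eq_comp, Finset.sum_mul, Finset.mul_sum]
        rw [← Equiv.sum_comp (MulAut.conj g).toEquiv]
        apply Finset.sum_congr rfl
        intro x _
        have h1 : φ (g * x * g⁻¹)⁻¹ = φ x⁻¹ := by
          rw [← hφ x⁻¹ g]; congr 1; group
        simp only [MulEquiv.toEquiv_eq_coe, EquivLike.coe_coe, MulAut.conj_apply, h1,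
          smul_mul_assoc, mul_smul_comm]
        congr 1
        rw [← map_mul, ← map_mul]
        congr 1; group
      let T' : Representation.IntertwiningMap ρ ρ := ⟨T, fun g => hcomm g⟩
      obtain ⟨c, hc⟩ :=
        (Representation.IsIrreducible.algebraMap_intertwiningMap_bijective_of_isAlgClosed
          (ρ := ρ)).2 T'
      have hTc : T = c • LinearMap.id := by
        have := congrArg Representation.IntertwiningMap.toLinearMap hc
        rw [Algebra.algebraMap_eq_smul_one] at this
        exact this.symm
      have htr : LinearMap.trace ℂ V T = 0 := by
        have h2 := h _ (irr_of_irreducible ρ hi)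
        rw [ip_comm, ip, av, sm_eq, mul_eq_zero] at h2
        rcases h2 with h2 | h2
        · exact absurd h2 (by simp)
        · rw [hT, map_sum, ← h2]
          apply Finset.sum_congr rfl; intro x _
          simp [Representation.character, mul_comm]
      rw [hTc] at htr
      simp only [map_smul, LinearMap.trace_id, smul_eq_mul, mul_eq_zero] at htr
      rcases htr with h | h
      · rw [hTc, h, zero_smul]
      · haveI : Subsingleton V := by
          rw [← Module.finrank_zero_iff (R := ℂ)]; exact_mod_cast h
        exact Subsingleton.elim _ _
    · intro V _ _ _ ρ A B hAB hA hB
      ext v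
      obtain ⟨⟨a, b⟩, rfl⟩ := (Submodule.prodEquivOfIsCompl _ _ hAB).surjective v
      have h1 := congrArg Subtype.val (LinearMap.congr_fun hA a)
      have h2 := congrArg Subtype.val (LinearMap.congr_fun hB b)
      simp [LinearMap.sum_apply, Subrepresentation.toRepresentation] at h1 h2
      simp [LinearMap.sum_apply, Finset.sum_add_distrib, h1, h2]
  let ρ : Representation ℂ G (G → ℂ) :=
    { toFun := fun g => LinearMap.funLeft ℂ ℂ (fun x => x * g)
      map_one' := by ext; simp [LinearMap.funLeft]
      map_mul' := by
        intro g h; ext f x; simp [LinearMap.funLeft_apply, mul_assoc] }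
  have h3 := LinearMap.congr_fun (key (G → ℂ) ρ) (Pi.single 1 1)
  ext g
  have h4 := congrFun h3 g
  simp only [ρ, LinearMap.sum_apply, LinearMap.smul_apply, Finset.sum_apply, Pi.smul_apply,
    MonoidHom.coe_mk, OneHom.coe_mk, LinearMap.funLeft_apply, Pi.single_apply,
    LinearMap.zero_apply, Pi.zero_apply] at h4
  rw [Finset.sum_eq_single g⁻¹] at h4
  · simpa using h4
  · intro b _ hb
    rw [if_neg, smul_zero]
    intro h5; exact hb (eq_inv_of_mul_eq_one_right h5)
  · simp

theorem char_ne_zero {φ : G → ℂ} (h : IsIrr φ) : φ ≠ 0 := by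
  rintro rfl; have := h.2; rw [ip_zero] at this; exact zero_ne_one this

theorem irr_linInd : LinearIndependent ℂ (fun χ : {χ : G → ℂ // IsIrr χ} => χ.1) := by
  rw [linearIndependent_iff']
  intro s f hf i hi
  have h := congrArg (fun φ => ip φ i.1) hf
  simp only [ip_sum, ip_smul, ip_zero] at h
  rw [Finset.sum_eq_single i] at h
  · rwa [i.2.2, mul_one] at h
  · intro b _ hb
    rw [irr_orth b.2 i.2 (fun h => hb (Subtype.ext h)), mul_zero]
  · exact fun h => absurd hi h

instance irr_finite : Finite {χ : G → ℂ // IsIrr χ} := irr_linInd.finite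

variable (G) in
noncomputable def irrs : Finset (G → ℂ) :=
  Set.Finite.toFinset (s := {χ : G → ℂ | IsIrr χ}) (Set.finite_coe_iff.1 irr_finite)

@[simp] theorem mem_irrs {χ : G → ℂ} : χ ∈ irrs G ↔ IsIrr χ := by
  rw [irrs, Set.Finite.mem_toFinset]; rfl

theorem IsCls.expand {φ : G → ℂ} (h : IsCls φ) : φ = ∑ χ ∈ irrs G, ip φ χ • χ := by
  rw [← sub_eq_zero]
  apply cls_eq_zero
  · intro g k
    simp only [Pi.sub_apply, Finset.sum_apply, Pi.smul_apply, h g k]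
    congr 1
    apply Finset.sum_congr rfl
    intro χ hχ
    rw [(mem_irrs.1 hχ).char.cls g k]
  · intro χ hχ
    rw [ip_sub, ip_sum, Finset.sum_eq_single χ]
    · rw [ip_smul, hχ.one, mul_one, sub_self]
    · intro b hb hne
      rw [ip_smul, irr_orth (mem_irrs.1 hb) hχ hne, mul_zero]
    · intro h; exact absurd (mem_irrs.2 hχ) h

theorem IsCls.isChar {φ : G → ℂ} (h : IsCls φ) (h' : ∀ χ, IsIrr χ → ∃ n : ℕ, ip φ χ = n) :
    IsChar φ := by
  rw [h.expand]
  apply IsChar.sum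
  intro χ hχ
  obtain ⟨n, hn⟩ := h' χ (mem_irrs.1 hχ)
  rw [hn]
  exact (mem_irrs.1 hχ).char.nsmul n

theorem IsCls.ip_eq {φ : G → ℂ} (h : IsCls φ) (ψ : G → ℂ) :
    ip φ ψ = ∑ χ ∈ irrs G, ip φ χ * ip χ ψ := by
  conv_lhs => rw [h.expand, ip_sum]
  simp only [ip_smul]

theorem char_one_nat {φ : G → ℂ} (h : IsChar φ) : ∃ n : ℕ, φ 1 = n := by
  obtain ⟨V, _, _, _, ρ, rfl⟩ := h
  exact ⟨_, Representation.char_one ρ⟩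

theorem irr_one_pos {φ : G → ℂ} (h : IsIrr φ) : ∃ n : ℕ, 0 < n ∧ φ 1 = n := by
  have h2 := h.2
  obtain ⟨⟨V, _, _, _, ρ, rfl⟩, _⟩ := h
  refine ⟨_, Nat.pos_of_ne_zero fun h0 => ?_, Representation.char_one ρ⟩
  haveI := (Module.finrank_zero_iff (R := ℂ) (M := V)).1 h0
  have : ρ.character = 0 := by
    ext g
    have : ρ g = 0 := Subsingleton.elim _ _
    simp [Representation.character, this]
  rw [this, ip_zero] at h2
  exact zero_ne_one h2

/-- taking invariants under a normalized subgroup -/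
theorem IsChar.average {φ : G → ℂ} (h : IsChar φ) {L K : Type} [Group L] [Group K] [Finite L]
    [Finite K] (l : L →* G) (k : K →* G)
    (hn : ∀ a b, ∃ b', l a * k b = k b' * l a) :
    IsChar (fun a => av (fun b => φ (l a * k b))) := by
  obtain ⟨V, _, _, _, ρ, rfl⟩ := h
  let τ : Representation ℂ K V := ρ.comp k
  have hτ : ∀ b, τ b = ρ (k b) := fun _ => rfl
  let W := τ.invariants
  have hW : ∀ a, ∀ v ∈ W, ρ (l a) v ∈ W := by
    intro a v hv
    rw [Representation.mem_invariants] at hv ⊢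
    intro b
    obtain ⟨b', hb'⟩ := hn a⁻¹ b
    have h1 : k b * l a = l a * k b' := by
      have : l a * (l a⁻¹ * k b) * l a = l a * (k b' * l a⁻¹) * l a := by rw [hb']
      simpa [mul_assoc] using this
    have h2 := hv b'
    rw [hτ] at h2 ⊢
    rw [← Module.End.mul_apply, ← map_mul, h1, map_mul, Module.End.mul_apply, h2]
  let σ : Representation ℂ L W :=
    { toFun := fun a => (ρ (l a)).restrict (hW a)
      map_one' := by ext; simp
      map_mul' := by intro a b; ext; simp }
  refine ⟨W, inferInstance, inferInstance, inferInstance, σ, ?_⟩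
  ext a
  cases nonempty_fintype K
  have hp := Representation.isProj_averageMap τ
  have h3 : LinearMap.trace ℂ V (ρ (l a) ∘ₗ τ.averageMap) =
      LinearMap.trace ℂ W (σ a) := by
    have h4 : (ρ (l a) ∘ₗ τ.averageMap) =
        W.subtype ∘ₗ ((σ a) ∘ₗ hp.codRestrict) := by
      ext v; simp [σ]
    rw [h4, LinearMap.trace_comp_comm', LinearMap.comp_assoc]
    congr 1
    ext w
    simp
  rw [Representation.character, ← h3, av, sm_eq]
  have h5 : τ.averageMap = (Nat.card K : ℂ)⁻¹ • ∑ b, ρ (k b) := by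
    simp [GroupAlgebra.average, τ]
  rw [h5, LinearMap.comp_smul, map_smul, smul_eq_mul]
  congr 1
  rw [← Module.End.mul_eq_comp, Finset.mul_sum, map_sum]
  apply Finset.sum_congr rfl; intro b _
  rw [Representation.character, map_mul]

theorem IsIrr.comap {H : Type} [Group H] [Finite H] {φ : G → ℂ} (h : IsIrr φ) (f : H →* G)
    (hf : Function.Surjective f) : IsIrr (fun x => φ (f x)) := by
  refine ⟨h.1.comap f, ?_⟩
  rw [← h.2, ip, ip, ← av_hom f hf]
  apply av_congr; intro g; simp

theorem char_eq_zero_of_one {φ : G → ℂ} (h : IsChar φ) (h1 : φ 1 = 0) : φ = 0 := by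
  obtain ⟨V, _, _, _, ρ, rfl⟩ := h
  rw [Representation.char_one] at h1
  haveI := (Module.finrank_zero_iff (R := ℂ) (M := V)).1 (by exact_mod_cast h1)
  ext g
  have : ρ g = 0 := Subsingleton.elim _ _
  simp [Representation.character, this]

/-- a constituent has smaller degree -/
theorem deg_le {φ χ : G → ℂ} (h : IsChar φ) (hχ : IsIrr χ) (hne : ip φ χ ≠ 0) {a b : ℕ}
    (ha : χ 1 = a) (hb : φ 1 = b) : a ≤ b := by
  have h1 := congrFun h.cls.expand 1
  choose f hf using fun ψ : {ψ // ψ ∈ irrs G} => ip_char_nat h (mem_irrs.1 ψ.2).char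
  choose d hd using fun ψ : {ψ // ψ ∈ irrs G} => char_one_nat (mem_irrs.1 ψ.2).char
  rw [Finset.sum_apply, ← Finset.sum_coe_sort, hb] at h1
  simp only [Pi.smul_apply, hf, hd, smul_eq_mul] at h1
  have h2 : b = ∑ i, f i * d i := by exact_mod_cast h1
  have h3 : f ⟨χ, mem_irrs.2 hχ⟩ * d ⟨χ, mem_irrs.2 hχ⟩ ≤ b := by
    rw [h2]; exact Finset.single_le_sum (f := fun i => f i * d i) (fun _ _ => Nat.zero_le _)
      (Finset.mem_univ _)
  have h4 : d ⟨χ, mem_irrs.2 hχ⟩ = a := by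
    have := ha.symm.trans (hd ⟨χ, mem_irrs.2 hχ⟩); exact_mod_cast this.symm
  have h5 : 0 < f ⟨χ, mem_irrs.2 hχ⟩ := by
    apply Nat.pos_of_ne_zero; intro h0
    apply hne; rw [hf ⟨χ, mem_irrs.2 hχ⟩, h0]; simp
  rw [h4] at h3
  exact le_trans (Nat.le_mul_of_pos_left _ h5) h3

theorem irr_sub {H : Type} [Group H] [Finite H] (f : H →* G) (hf : Function.Injective f)
    {θ : H → ℂ} (hθ : IsIrr θ) {a : ℕ} (ha : θ 1 = a) :
    ∃ χ : G → ℂ, IsIrr χ ∧ ∃ b : ℕ, χ 1 = b ∧ a ≤ b := by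
  by_contra! hcon
  have h0 : ∀ χ : G → ℂ, IsIrr χ → ip (fun x => χ (f x)) θ = 0 := by
    intro χ hχ
    by_contra h1
    obtain ⟨b, hb⟩ := char_one_nat hχ.char
    have := deg_le (hχ.char.comap f) hθ h1 ha (by simpa using hb)
    exact absurd this (not_le.2 (hcon χ hχ b hb))
  let r : G → ℂ := fun g => if g = 1 then 1 else 0
  have hr : IsCls r := by intro g h; simp [r, conj_eq_one_iff]
  have h2 : ip (fun x => r (f x)) θ = 0 := by
    have : (fun x => r (f x)) = ∑ χ ∈ irrs G, ip r χ • (fun x => χ (f x)) := by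
      ext x; conv_lhs => rw [hr.expand]
      simp
    rw [this, ip_sum]
    apply Finset.sum_eq_zero
    intro χ hχ; rw [ip_smul, h0 χ (mem_irrs.1 hχ), mul_zero]
  rw [ip, av, sm_single 1] at h2
  · simp [r, ha] at h2
    obtain ⟨n, hn, h3⟩ := irr_one_pos hθ
    rw [ha] at h3
    have h6 : a = n := by exact_mod_cast h3
    subst h6
    have h7 : 0 < Nat.card H := Nat.card_pos
    omega
  · intro b hb
    have : f b ≠ 1 := fun h => hb (hf (by simpa using h))
    simp [r, this]

theorem mem_degs_iff {d : ℕ} :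
    (∃ V : FDRep ℂ G, CategoryTheory.Simple V ∧ Module.finrank ℂ V = d) ↔
      ∃ χ : G → ℂ, IsIrr χ ∧ χ 1 = d := by
  constructor
  · rintro ⟨V, hV, rfl⟩
    refine ⟨V.character, ⟨⟨V, inferInstance, inferInstance, inferInstance, V.ρ, rfl⟩, ?_⟩, V.char_one⟩
    cases nonempty_fintype G
    rw [FDRep.simple_iff_char_is_norm_one] at hV
    rw [ip, av, sm_eq, hV, inv_mul_cancel₀]
    exact_mod_cast Nat.card_pos.ne'
  · rintro ⟨_, ⟨⟨V, _, _, _, ρ, rfl⟩, h1⟩, hd⟩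
    refine ⟨FDRep.of ρ, simple_of ρ h1, ?_⟩
    rw [Representation.char_one] at hd
    exact_mod_cast hd

theorem degs_bdd : BddAbove {d : ℕ | ∃ V : FDRep ℂ G, CategoryTheory.Simple V ∧
    Module.finrank ℂ V = d} := by
  have : {d : ℕ | ∃ V : FDRep ℂ G, CategoryTheory.Simple V ∧ Module.finrank ℂ V = d} ⊆
      (fun χ : G → ℂ => ⌊(χ 1).re⌋₊) '' (irrs G : Set (G → ℂ)) := by
    intro d hd
    obtain ⟨χ, h1, h2⟩ := mem_degs_iff.1 hd
    exact ⟨χ, by simpa using h1, by simp [h2]⟩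
  exact ((Finset.finite_toSet _).image _).bddAbove.mono this

theorem le_maxIrrDeg {χ : G → ℂ} (h : IsIrr χ) {d : ℕ} (hd : χ 1 = d) : d ≤ maxIrrDeg G :=
  le_csSup degs_bdd (mem_degs_iff.2 ⟨χ, h, hd⟩)

theorem triv_irr : IsIrr (fun _ : G => (1 : ℂ)) := by
  refine ⟨by simpa using IsChar.ofHom (1 : G →* ℂˣ), ?_⟩
  rw [ip]; simpa using av_const (α := G) 1

variable (G) in
theorem exists_maxIrrDeg : ∃ χ : G → ℂ, IsIrr χ ∧ χ 1 = maxIrrDeg G := by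
  apply mem_degs_iff.1
  apply Nat.sSup_mem _ degs_bdd
  exact ⟨1, mem_degs_iff.2 ⟨_, triv_irr, by simp⟩⟩

theorem maxIrrDeg_le_of_surj {H : Type} [Group H] [Finite H] (f : H →* G)
    (hf : Function.Surjective f) : maxIrrDeg G ≤ maxIrrDeg H := by
  obtain ⟨χ, h1, h2⟩ := exists_maxIrrDeg G
  exact le_maxIrrDeg (h1.comap f hf) (by simpa using h2)

theorem maxIrrDeg_le_of_inj {H : Type} [Group H] [Finite H] (f : H →* G)
    (hf : Function.Injective f) : maxIrrDeg H ≤ maxIrrDeg G := by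
  obtain ⟨χ, h1, h2⟩ := exists_maxIrrDeg H
  obtain ⟨θ, h3, b, h4, h5⟩ := irr_sub f hf h1 h2
  exact h5.trans (le_maxIrrDeg h3 h4)

end chars
end LMT

namespace LMT

section CFdef
variable (F : Type) [Field F]

/-- bundled finite vector spaces -/
structure FV where
  V : Type
  [i1 : AddCommGroup V]
  [i2 : Module F V]
  [i3 : Finite V]

attribute [instance] FV.i1 FV.i2 FV.i3

/-- class functions on all finite general linear groups over `F` -/
def CFs : Submodule ℂ (∀ X : FV F, (X.V ≃ₗ[F] X.V) → ℂ) where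
  carrier := {φ | ∀ (X Y : FV F) (f : X.V ≃ₗ[F] Y.V) (g : X.V ≃ₗ[F] X.V) (g' : Y.V ≃ₗ[F] Y.V),
    (∀ v, f (g v) = g' (f v)) → φ X g = φ Y g'}
  zero_mem' := by intro _ _ _ _ _ _; rfl
  add_mem' := by
    intro φ ψ hφ hψ V V' f g g' h
    exact congrArg₂ (· + ·) (hφ V V' f g g' h) (hψ V V' f g g' h)
  smul_mem' := by
    intro c φ hφ V V' f g g' h
    exact congrArg (c * ·) (hφ V V' f g g' h)

def CF : Type 1 := ↥(CFs F)

noncomputable instance : AddCommGroup (CF F) := inferInstanceAs (AddCommGroup (CFs F))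
noncomputable instance : Module ℂ (CF F) := inferInstanceAs (Module ℂ (CFs F))
end CFdef

variable {F : Type} [Field F]
variable {V V' E Q : Type} [AddCommGroup V] [Module F V] [Finite V]
  [AddCommGroup V'] [Module F V'] [Finite V'] [AddCommGroup E] [Module F E] [Finite E]
  [AddCommGroup Q] [Module F Q] [Finite Q]

instance finLE : Finite (V ≃ₗ[F] V') := DFunLike.finite _
instance finLM : Finite (V →ₗ[F] V') := DFunLike.finite _

namespace CF
def ev (φ : CF F) (g : V ≃ₗ[F] V) : ℂ := φ.1 ⟨V⟩ g

theorem ev_inv (φ : CF F) (f : V ≃ₗ[F] V') (g : V ≃ₗ[F] V) (g' : V' ≃ₗ[F] V')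
    (h : ∀ v, f (g v) = g' (f v)) : φ.ev g = φ.ev g' := φ.2 ⟨V⟩ ⟨V'⟩ f g g' h

/-- constructor -/
def mk' (t : ∀ (V : Type) [AddCommGroup V] [Module F V] [Finite V], (V ≃ₗ[F] V) → ℂ)
    (h : ∀ (V V' : Type) [AddCommGroup V] [Module F V] [Finite V] [AddCommGroup V']
    [Module F V'] [Finite V'] (f : V ≃ₗ[F] V') (g : V ≃ₗ[F] V) (g' : V' ≃ₗ[F] V'),
    (∀ v, f (g v) = g' (f v)) → t V g = t V' g') : CF F :=
  ⟨fun X g => t X.V g, fun X Y f g g' hh => h X.V Y.V f g g' hh⟩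

@[simp] theorem ev_mk' (t : ∀ (V : Type) [AddCommGroup V] [Module F V] [Finite V],
    (V ≃ₗ[F] V) → ℂ) (h) (g : V ≃ₗ[F] V) : (mk' t h).ev g = t V g := rfl

theorem ext' {φ ψ : CF F} (h : ∀ (V : Type) [AddCommGroup V] [Module F V] [Finite V]
    (g : V ≃ₗ[F] V), φ.ev g = ψ.ev g) : φ = ψ := by
  apply Subtype.ext
  funext X g
  exact h X.V g

@[simp] theorem ev_add (φ ψ : CF F) (g : V ≃ₗ[F] V) : (φ + ψ).ev g = φ.ev g + ψ.ev g := rfl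
@[simp] theorem ev_sub (φ ψ : CF F) (g : V ≃ₗ[F] V) : (φ - ψ).ev g = φ.ev g - ψ.ev g := rfl
@[simp] theorem ev_neg (φ : CF F) (g : V ≃ₗ[F] V) : (-φ).ev g = -φ.ev g := rfl
@[simp] theorem ev_zero (g : V ≃ₗ[F] V) : (0 : CF F).ev g = 0 := rfl
@[simp] theorem ev_smul (c : ℂ) (φ : CF F) (g : V ≃ₗ[F] V) : (c • φ).ev g = c * φ.ev g := rfl

def evHom (g : V ≃ₗ[F] V) : CF F →ₗ[ℂ] ℂ :=
  { toFun := fun φ => φ.ev g, map_add' := fun _ _ => rfl, map_smul' := fun _ _ => rfl }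

@[simp] theorem ev_sum {ι : Type*} (s : Finset ι) (f : ι → CF F) (g : V ≃ₗ[F] V) :
    (∑ i ∈ s, f i).ev g = ∑ i ∈ s, (f i).ev g := map_sum (evHom g) f s

end CF

/-- restriction to a stable subspace -/
noncomputable def sub (g : V ≃ₗ[F] V) (W : Submodule F V) (h : ∀ v ∈ W, g v ∈ W) : W ≃ₗ[F] W :=
  LinearEquiv.ofBijective ((g : V →ₗ[F] V).restrict h) (by
    apply Finite.injective_iff_bijective.1
    intro a b hab
    apply Subtype.ext
    apply g.injective
    exact congrArg Subtype.val hab)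

@[simp] theorem sub_coe (g : V ≃ₗ[F] V) (W : Submodule F V) (h) (w : W) :
    (sub g W h w : V) = g w := rfl

instance finQuo (W : Submodule F V) : Finite (V ⧸ W) :=
  Finite.of_surjective W.mkQ W.mkQ_surjective

noncomputable def quo (g : V ≃ₗ[F] V) (W : Submodule F V) (h : ∀ v ∈ W, g v ∈ W) :
    (V ⧸ W) ≃ₗ[F] (V ⧸ W) :=
  LinearEquiv.ofBijective (W.mapQ W (g : V →ₗ[F] V) h) (by
    apply Finite.surjective_iff_bijective.1
    intro y
    obtain ⟨v, rfl⟩ := W.mkQ_surjective y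
    exact ⟨W.mkQ (g.symm v), by simp⟩)

@[simp] theorem quo_mk (g : V ≃ₗ[F] V) (W : Submodule F V) (h) (v : V) :
    quo g W h (Submodule.Quotient.mk v) = Submodule.Quotient.mk (g v) := rfl

instance finSub : Finite (Submodule F V) :=
  Finite.of_injective (fun W => (W : Set V)) SetLike.coe_injective

noncomputable def tm (φ ψ : CF F) (g : V ≃ₗ[F] V) (W : Submodule F V) : ℂ :=
  if h : ∀ v ∈ W, g v ∈ W then φ.ev (sub g W h) * ψ.ev (quo g W h) else 0

theorem tm_pos (φ ψ : CF F) (g : V ≃ₗ[F] V) (W : Submodule F V) (h : ∀ v ∈ W, g v ∈ W) :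
    tm φ ψ g W = φ.ev (sub g W h) * ψ.ev (quo g W h) := dif_pos h

theorem tm_inv (φ ψ : CF F) (f : V ≃ₗ[F] V') (g : V ≃ₗ[F] V) (g' : V' ≃ₗ[F] V')
    (h : ∀ v, f (g v) = g' (f v)) (W : Submodule F V) :
    tm φ ψ g W = tm φ ψ g' (W.map (f : V →ₗ[F] V')) := by
  by_cases hW : ∀ v ∈ W, g v ∈ W
  · have hW' : ∀ v ∈ W.map (f : V →ₗ[F] V'), g' v ∈ W.map (f : V →ₗ[F] V') := by
      rintro _ ⟨v, hv, rfl⟩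
      exact ⟨g v, hW v hv, h v⟩
    rw [tm_pos _ _ _ _ hW, tm_pos _ _ _ _ hW']
    congr 1
    · apply CF.ev_inv _ (f.submoduleMap W)
      intro v; apply Subtype.ext; exact h v
    · apply CF.ev_inv _ (Submodule.Quotient.equiv W _ f rfl)
      intro v
      obtain ⟨v, rfl⟩ := W.mkQ_surjective v
      simp [h]
  · rw [tm, dif_neg hW, tm, dif_neg]
    intro hW'
    apply hW
    intro v hv
    obtain ⟨w, hw, hw'⟩ := hW' (f v) ⟨v, hv, rfl⟩
    have : w = g v := f.injective (by rw [h v]; exact hw')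
    exact this ▸ hw

noncomputable instance : Mul (CF F) :=
  ⟨fun φ ψ => CF.mk' (fun V _ _ _ g => sm (fun W : Submodule F V => tm φ ψ g W)) (by
    intro V V' _ _ _ _ _ _ f g g' h
    rw [← sm_equiv (Submodule.orderIsoMapComap f).toEquiv]
    apply sm_congr
    intro W
    exact tm_inv φ ψ f g g' h W)⟩

theorem CF.ev_mul (φ ψ : CF F) (g : V ≃ₗ[F] V) :
    (φ * ψ).ev g = sm (fun W : Submodule F V => tm φ ψ g W) := rfl

noncomputable instance : One (CF F) :=
  ⟨CF.mk' (fun V _ _ _ _ => if Subsingleton V then 1 else 0) (by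
    intro V V' _ _ _ _ _ _ f g g' h
    have : Subsingleton V ↔ Subsingleton V' := f.toEquiv.subsingleton_congr
    simp only [this])⟩

theorem CF.ev_one (g : V ≃ₗ[F] V) : (1 : CF F).ev g = if Subsingleton V then 1 else 0 := rfl

theorem CF.one_mul' (φ : CF F) : 1 * φ = φ := by
  apply CF.ext'
  intro V _ _ _ g
  rw [CF.ev_mul, sm_single ⊥]
  · have h : ∀ v ∈ (⊥ : Submodule F V), g v ∈ (⊥ : Submodule F V) := by simp
    rw [tm_pos _ _ _ _ h, CF.ev_one, if_pos (inferInstance : Subsingleton (⊥ : Submodule F V)), one_mul]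
    apply CF.ev_inv _ (Submodule.quotEquivOfEqBot ⊥ rfl)
    intro v
    obtain ⟨v, rfl⟩ := (⊥ : Submodule F V).mkQ_surjective v
    simp
  · intro W hW
    by_cases h : ∀ v ∈ W, g v ∈ W
    · rw [tm_pos _ _ _ _ h, CF.ev_one, if_neg, zero_mul]
      intro hs; exact hW (Submodule.subsingleton_iff_eq_bot.1 hs)
    · rw [tm, dif_neg h]

theorem CF.mul_one' (φ : CF F) : φ * 1 = φ := by
  apply CF.ext'
  intro V _ _ _ g
  rw [CF.ev_mul, sm_single ⊤]
  · have h : ∀ v ∈ (⊤ : Submodule F V), g v ∈ (⊤ : Submodule F V) := by simp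
    rw [tm_pos _ _ _ _ h, CF.ev_one, if_pos (Submodule.Quotient.subsingleton_iff.2 rfl),
      mul_one]
    apply CF.ev_inv _ (Submodule.topEquiv)
    intro v
    simp
  · intro W hW
    by_cases h : ∀ v ∈ W, g v ∈ W
    · rw [tm_pos _ _ _ _ h, CF.ev_one, if_neg, mul_zero]
      rwa [Submodule.Quotient.subsingleton_iff]
    · rw [tm, dif_neg h]

theorem tm_add_left (φ φ' ψ : CF F) (g : V ≃ₗ[F] V) (W : Submodule F V) :
    tm (φ + φ') ψ g W = tm φ ψ g W + tm φ' ψ g W := by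
  unfold tm; split_ifs <;> simp [add_mul]
theorem tm_add_right (φ ψ ψ' : CF F) (g : V ≃ₗ[F] V) (W : Submodule F V) :
    tm φ (ψ + ψ') g W = tm φ ψ g W + tm φ ψ' g W := by
  unfold tm; split_ifs <;> simp [mul_add]

theorem CF.add_mul' (φ φ' ψ : CF F) : (φ + φ') * ψ = φ * ψ + φ' * ψ := by
  apply CF.ext'
  intro V _ _ _ g
  simp only [CF.ev_add, CF.ev_mul, tm_add_left, sm_add]
theorem CF.mul_add' (φ ψ ψ' : CF F) : φ * (ψ + ψ') = φ * ψ + φ * ψ' := by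
  apply CF.ext'
  intro V _ _ _ g
  simp only [CF.ev_add, CF.ev_mul, tm_add_right, sm_add]
theorem CF.smul_mul' (c : ℂ) (φ ψ : CF F) : (c • φ) * ψ = c • (φ * ψ) := by
  apply CF.ext'
  intro V _ _ _ g
  simp only [CF.ev_smul, CF.ev_mul, ← sm_mul_left]
  apply sm_congr; intro W; unfold tm; split_ifs <;> simp [mul_assoc]
theorem CF.mul_smul' (c : ℂ) (φ ψ : CF F) : φ * (c • ψ) = c • (φ * ψ) := by
  apply CF.ext'
  intro V _ _ _ g
  simp only [CF.ev_smul, CF.ev_mul, ← sm_mul_left]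
  apply sm_congr; intro W; unfold tm; split_ifs <;> simp [mul_left_comm]

/-! associativity -/
theorem CF.mul_assoc' (φ ψ θ : CF F) : (φ * ψ) * θ = φ * (ψ * θ) := by
  apply CF.ext'
  intro V _ _ _ g
  -- the middle sum
  let t : Submodule F V → Submodule F V → ℂ := fun A B =>
    if h : (∀ v ∈ A, g v ∈ A) ∧ (∀ v ∈ B, g v ∈ B) ∧ A ≤ B then
      φ.ev (sub g A h.1) * ψ.ev (quo (sub g B h.2.1) (A.submoduleOf B) (fun v hv => h.1 _ hv)) *
        θ.ev (quo g B h.2.1) else 0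
  have e1 : ((φ * ψ) * θ).ev g = sm (fun B => sm (fun A => t A B)) := by
    rw [CF.ev_mul]
    apply sm_congr; intro B
    by_cases hB : ∀ v ∈ B, g v ∈ B
    · rw [tm_pos _ _ _ _ hB, CF.ev_mul, ← sm_mul_right]
      have : sm (fun A => t A B) = sm (fun A : {A // A ≤ B} => t A.1 B) := by
        rw [sm_subtype (fun A => A ≤ B) (fun A => t A B)]
        apply sm_congr; intro A
        by_cases hAB : A ≤ B
        · simp [hAB]
        · simp [hAB, t]
      rw [this]
      refine (sm_congr ?_).trans (sm_equiv
        ((Submodule.mapIic B).toEquiv : Submodule F B ≃ {A : Submodule F V // A ≤ B}) _)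
      intro A'
      have hAB : A'.map B.subtype ≤ B := Submodule.map_subtype_le B A'
      by_cases hA' : ∀ v ∈ A', sub g B hB v ∈ A'
      · have hA : ∀ v ∈ A'.map B.subtype, g v ∈ A'.map B.subtype := by
          rintro _ ⟨v, hv, rfl⟩
          exact ⟨_, hA' v hv, rfl⟩
        rw [tm_pos _ _ _ _ hA']
        change _ = t (A'.map B.subtype) B
        simp only [t]
        rw [dif_pos ⟨hA, hB, hAB⟩]
        congr 1
        congr 1
        · apply CF.ev_inv _ (Submodule.equivMapOfInjective B.subtype B.injective_subtype A')
          intro v; apply Subtype.ext; simp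
        · apply CF.ev_inv _ (Submodule.quotEquivOfEq A' _ (by
            ext v; simp [Submodule.submoduleOf]))
          intro v
          obtain ⟨v, rfl⟩ := A'.mkQ_surjective v
          rfl
      · rw [tm, dif_neg hA', zero_mul]
        change _ = t (A'.map B.subtype) B
        simp only [t]
        rw [dif_neg]
        rintro ⟨h1, -, -⟩
        apply hA'
        intro v hv
        obtain ⟨w, hw, hw'⟩ := h1 v ⟨v, hv, rfl⟩
        have : w = sub g B hB v := Subtype.ext hw'
        exact this ▸ hw
    · rw [tm, dif_neg hB]
      symm
      rw [← sm_zero (α := Submodule F V)]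
      apply sm_congr; intro A
      simp [t, hB]
  have e2 : (φ * (ψ * θ)).ev g = sm (fun A => sm (fun B => t A B)) := by
    rw [CF.ev_mul]
    apply sm_congr; intro A
    by_cases hA : ∀ v ∈ A, g v ∈ A
    · rw [tm_pos _ _ _ _ hA, CF.ev_mul, ← sm_mul_left]
      have : sm (fun B => t A B) = sm (fun B : {B // A ≤ B} => t A B.1) := by
        rw [sm_subtype (fun B => A ≤ B) (fun B => t A B)]
        apply sm_congr; intro B
        by_cases hAB : A ≤ B
        · simp [hAB]
        · simp [hAB, t]
      rw [this]
      refine (sm_congr ?_).trans (sm_equiv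
        ((Submodule.comapMkQRelIso A).toEquiv : _ ≃ {B : Submodule F V // A ≤ B}) _)
      intro X
      set B := X.comap A.mkQ with hBdef
      have hAB : A ≤ B := Submodule.le_comap_mkQ A X
      have hXB : B.map A.mkQ = X := Submodule.map_comap_eq_of_surjective A.mkQ_surjective X
      change _ = t A B
      by_cases hX : ∀ v ∈ X, quo g A hA v ∈ X
      · have hB : ∀ v ∈ B, g v ∈ B := by
          intro v hv
          exact hX _ hv
        rw [tm_pos _ _ _ _ hX]
        simp only [t]
        rw [dif_pos ⟨hA, hB, hAB⟩, mul_assoc]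
        congr 1
        congr 1
        · let p : B →ₗ[F] X := (A.mkQ).restrict (p := B) (q := X) (fun v hv => hv)
          have hp : Function.Surjective p := by
            rintro ⟨y, hy⟩
            obtain ⟨v, rfl⟩ := A.mkQ_surjective y
            exact ⟨⟨v, hy⟩, rfl⟩
          have hk : LinearMap.ker p = A.submoduleOf B := by
            ext v
            rw [LinearMap.mem_ker, Subtype.ext_iff]
            change Submodule.Quotient.mk (v : V) = 0 ↔ (v : V) ∈ A
            rw [Submodule.Quotient.mk_eq_zero]
          symm
          apply CF.ev_inv _ ((Submodule.quotEquivOfEq _ _ hk.symm).trans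
            (p.quotKerEquivOfSurjective hp))
          intro v
          obtain ⟨v, rfl⟩ := (A.submoduleOf B).mkQ_surjective v
          rfl
        · let p : (V ⧸ A) →ₗ[F] (V ⧸ B) := A.mapQ B LinearMap.id hAB
          have hp : Function.Surjective p := by
            intro y
            obtain ⟨v, rfl⟩ := B.mkQ_surjective y
            exact ⟨A.mkQ v, rfl⟩
          have hk : LinearMap.ker p = X := by
            ext v
            obtain ⟨v, rfl⟩ := A.mkQ_surjective v
            rw [LinearMap.mem_ker]
            change Submodule.Quotient.mk v = 0 ↔ v ∈ B
            rw [Submodule.Quotient.mk_eq_zero]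
          apply CF.ev_inv _ ((Submodule.quotEquivOfEq _ _ hk.symm).trans
            (p.quotKerEquivOfSurjective hp))
          intro v
          obtain ⟨v, rfl⟩ := X.mkQ_surjective v
          obtain ⟨v, rfl⟩ := A.mkQ_surjective v
          rfl
      · rw [tm, dif_neg hX, mul_zero]
        simp only [t]
        rw [dif_neg]
        rintro ⟨-, h1, -⟩
        apply hX
        intro v hv
        obtain ⟨v, rfl⟩ := A.mkQ_surjective v
        exact h1 v hv
    · rw [tm, dif_neg hA]
      symm
      rw [← sm_zero (α := Submodule F V)]
      apply sm_congr; intro B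
      simp [t, hA]
  rw [e1, e2, sm_comm]

end LMT

namespace LMT
variable {F : Type} [Field F]
variable {V V' E Q E' Q' : Type} [AddCommGroup V] [Module F V] [Finite V]
  [AddCommGroup V'] [Module F V'] [Finite V'] [AddCommGroup E] [Module F E] [Finite E]
  [AddCommGroup Q] [Module F Q] [Finite Q] [AddCommGroup E'] [Module F E'] [Finite E']
  [AddCommGroup Q'] [Module F Q'] [Finite Q']

/-- block triangular automorphism -/
def bl (x : E ≃ₗ[F] E) (y : Q ≃ₗ[F] Q) (u : Q →ₗ[F] E) : (Q × E) ≃ₗ[F] (Q × E) :=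
  LinearEquiv.skewProd y x u

@[simp] theorem bl_apply (x : E ≃ₗ[F] E) (y : Q ≃ₗ[F] Q) (u : Q →ₗ[F] E) (v : Q × E) :
    bl x y u v = (y v.1, x v.2 + u v.1) := rfl

/-- the subspace `0 × E` -/
def SE (F E Q : Type) [Field F] [AddCommGroup E] [Module F E] [AddCommGroup Q] [Module F Q] :
  Submodule F (Q × E) := Submodule.prod ⊥ ⊤

@[simp] theorem mem_SE (v : Q × E) : v ∈ SE F E Q ↔ v.1 = 0 := by
  simp [SE, Submodule.mem_prod]

theorem bl_stab (x : E ≃ₗ[F] E) (y : Q ≃ₗ[F] Q) (u : Q →ₗ[F] E) :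
    ∀ v ∈ SE F E Q, bl x y u v ∈ SE F E Q := by
  intro v hv; simp_all

def SEequiv : E ≃ₗ[F] SE F E Q where
  toFun e := ⟨(0, e), by simp⟩
  map_add' a b := by ext <;> simp
  map_smul' a b := by ext <;> simp
  invFun v := v.1.2
  left_inv e := rfl
  right_inv v := by
    rcases v with ⟨⟨a, b⟩, h⟩
    simp at h; subst h; rfl

noncomputable def SQequiv : ((Q × E) ⧸ SE F E Q) ≃ₗ[F] Q :=
  (Submodule.quotEquivOfEq _ _ (by ext v; simp)).trans
    ((LinearMap.fst F Q E).quotKerEquivOfSurjective (fun q => ⟨(q, 0), rfl⟩))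

@[simp] theorem SQequiv_mk (v : Q × E) :
    SQequiv (F := F) (Submodule.Quotient.mk v : (Q × E) ⧸ SE F E Q) = v.1 := rfl

theorem tm_bl (φ ψ : CF F) (x : E ≃ₗ[F] E) (y : Q ≃ₗ[F] Q) (u : Q →ₗ[F] E) :
    tm φ ψ (bl x y u) (SE F E Q) = φ.ev x * ψ.ev y := by
  rw [tm_pos _ _ _ _ (bl_stab x y u)]
  congr 1
  · symm
    apply CF.ev_inv _ SEequiv
    intro e
    apply Subtype.ext
    simp [SEequiv]
  · apply CF.ev_inv _ SQequiv
    intro v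
    obtain ⟨v, rfl⟩ := (SE F E Q).mkQ_surjective v
    rfl

def blMap : ((E ≃ₗ[F] E) × (Q ≃ₗ[F] Q) × (Q →ₗ[F] E)) →
    {b : (Q × E) ≃ₗ[F] (Q × E) // ∀ v ∈ SE F E Q, b v ∈ SE F E Q} :=
  fun p => ⟨bl p.1 p.2.1 p.2.2, bl_stab _ _ _⟩

theorem blMap_bij : Function.Bijective (blMap (F := F) (E := E) (Q := Q)) := by
  constructor
  · rintro ⟨x, y, u⟩ ⟨x', y', u'⟩ h
    have h' : ∀ v, bl x y u v = bl x' y' u' v := fun v => by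
      have := congrArg Subtype.val h
      exact DFunLike.congr_fun this v
    have hx : x = x' := by
      ext e; simpa using congrArg Prod.snd (h' (0, e))
    have hy : y = y' := by
      ext e; simpa using congrArg Prod.fst (h' (e, 0))
    have hu : u = u' := by
      ext e; simpa using congrArg Prod.snd (h' (e, 0))
    rw [hx, hy, hu]
  · rintro ⟨b, hb⟩
    have hs : ∀ v, b v ∈ SE F E Q → v ∈ SE F E Q := by
      intro v hv
      obtain ⟨w, hw⟩ := (sub b _ hb).surjective ⟨b v, hv⟩
      have : (w : Q × E) = v := b.injective (congrArg Subtype.val hw)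
      exact this ▸ w.2
    let x0 : E →ₗ[F] E := (LinearMap.snd F Q E) ∘ₗ (b : Q × E →ₗ[F] Q × E) ∘ₗ LinearMap.inr F Q E
    let y0 : Q →ₗ[F] Q := (LinearMap.fst F Q E) ∘ₗ (b : Q × E →ₗ[F] Q × E) ∘ₗ LinearMap.inl F Q E
    let u : Q →ₗ[F] E := (LinearMap.snd F Q E) ∘ₗ (b : Q × E →ₗ[F] Q × E) ∘ₗ LinearMap.inl F Q E
    have h1 : ∀ e, (b (0, e)).1 = 0 := fun e => by
      simpa using hb (0, e) (by simp)
    have hx : Function.Injective x0 := by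
      rw [← LinearMap.ker_eq_bot, LinearMap.ker_eq_bot']
      intro e he
      have : b (0, e) = 0 := Prod.ext (h1 e) he
      have := b.map_eq_zero_iff.1 this
      exact congrArg Prod.snd this
    have hy : Function.Injective y0 := by
      rw [← LinearMap.ker_eq_bot, LinearMap.ker_eq_bot']
      intro c hc
      simpa using hs (c, 0) ((mem_SE _).2 hc)
    refine ⟨⟨LinearEquiv.ofBijective x0 (Finite.injective_iff_bijective.1 hx),
      LinearEquiv.ofBijective y0 (Finite.injective_iff_bijective.1 hy), u⟩, ?_⟩
    apply Subtype.ext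
    apply LinearEquiv.ext
    rintro ⟨c, e⟩
    have hce : ((c, e) : Q × E) = (c, 0) + (0, e) := by simp
    change (y0 c, x0 e + u c) = b (c, e)
    rw [hce, map_add]
    apply Prod.ext
    · simp [y0, h1]
    · simp [x0, u, add_comm]

noncomputable def blEquiv : ((E ≃ₗ[F] E) × (Q ≃ₗ[F] Q) × (Q →ₗ[F] E)) ≃
    {b : (Q × E) ≃ₗ[F] (Q × E) // ∀ v ∈ SE F E Q, b v ∈ SE F E Q} :=
  Equiv.ofBijective blMap blMap_bij

/-- restriction coproduct -/
noncomputable def rr (χ : CF F) (x : E ≃ₗ[F] E) (y : Q ≃ₗ[F] Q) : ℂ :=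
  av fun u : Q →ₗ[F] E => χ.ev (bl x y u)

theorem rr_inv (χ : CF F) (f : E ≃ₗ[F] E') (h : Q ≃ₗ[F] Q') (x : E ≃ₗ[F] E) (x' : E' ≃ₗ[F] E')
    (y : Q ≃ₗ[F] Q) (y' : Q' ≃ₗ[F] Q') (hx : ∀ v, f (x v) = x' (f v))
    (hy : ∀ v, h (y v) = y' (h v)) : rr χ x y = rr χ x' y' := by
  unfold rr
  rw [← av_equiv (LinearEquiv.arrowCongr h f).toEquiv]
  apply av_congr
  intro u
  apply CF.ev_inv _ (LinearEquiv.prodCongr h f)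
  rintro ⟨c, e⟩
  simp [hx, hy, LinearEquiv.arrowCongr_apply]

theorem bl_inv (x : E ≃ₗ[F] E) (y : Q ≃ₗ[F] Q) (u : Q →ₗ[F] E) :
    (bl x y u)⁻¹ = bl x⁻¹ y⁻¹ (-((x.symm : E →ₗ[F] E) ∘ₗ u ∘ₗ (y.symm : Q →ₗ[F] Q))) := by
  apply inv_eq_of_mul_eq_one_right
  apply LinearEquiv.ext
  rintro ⟨c, e⟩
  change bl x y u (bl x⁻¹ y⁻¹ _ (c, e)) = (c, e)
  have h1 : ∀ c, y (y⁻¹ c) = c := y.apply_symm_apply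
  have h2 : ∀ c, x (x⁻¹ c) = c := x.apply_symm_apply
  have h3 : ∀ c, y⁻¹ c = y.symm c := fun _ => rfl
  simp [h1, h2, h3]

/-- sum over the triangular group -/
theorem av_bl_inv (χ : CF F) (x : E ≃ₗ[F] E) (y : Q ≃ₗ[F] Q) :
    av (fun u : Q →ₗ[F] E => χ.ev (bl x y u)⁻¹) = rr χ x⁻¹ y⁻¹ := by
  unfold rr
  refine (av_congr ?_).trans (av_equiv
    ((LinearEquiv.arrowCongr y x.symm).trans (LinearEquiv.neg F)).toEquiv
    (fun u => χ.ev (bl x⁻¹ y⁻¹ u)))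
  intro u
  rw [bl_inv]
  rfl

instance fdV : FiniteDimensional F V := Module.Finite.of_finite ..

theorem sm_fib_const {α β : Type*} [Finite α] [Finite β] (p : α → β) (s : β → Prop)
    [DecidablePred s] (k : ℕ)
    (h : ∀ b, s b → Nat.card {a // p a = b} = k) (h0 : ∀ a, s (p a)) (t : β → ℂ) :
    (k : ℂ) * sm (fun b => if s b then t b else 0) = sm (fun a => t (p a)) := by
  rw [sm_fiber p, ← sm_mul_left]
  apply sm_congr; intro b
  by_cases hb : s b
  · rw [if_pos hb, ← h b hb, ← sm_const]
    apply sm_congr; rintro ⟨a, rfl⟩; rfl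
  · rw [if_neg hb, mul_zero, eq_comm, ← sm_zero (α := {a // p a = b})]
    apply sm_congr
    rintro ⟨a, rfl⟩
    exact absurd (h0 a) hb

theorem stab_map_eq {b : V ≃ₗ[F] V} {W : Submodule F V} (h : ∀ v ∈ W, b v ∈ W) :
    W.map (b : V →ₗ[F] V) = W := by
  apply le_antisymm
  · rintro _ ⟨v, hv, rfl⟩; exact h v hv
  · intro v hv
    obtain ⟨w, hw⟩ := (sub b _ h).surjective ⟨v, hv⟩
    exact ⟨w, w.2, congrArg Subtype.val hw⟩

theorem flag_exists (h : Module.finrank F Q + Module.finrank F E = Module.finrank F V)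
    (W : Submodule F V) (hW : Module.finrank F W = Module.finrank F E) :
    ∃ f : (Q × E) ≃ₗ[F] V, (SE F E Q).map (f : Q × E →ₗ[F] V) = W := by
  obtain ⟨C, hC⟩ := Submodule.exists_isCompl W
  have hd := Submodule.finrank_add_eq_of_isCompl hC
  let e1 : E ≃ₗ[F] W := LinearEquiv.ofFinrankEq _ _ hW.symm
  let e2 : Q ≃ₗ[F] C := LinearEquiv.ofFinrankEq _ _ (by omega)
  refine ⟨(LinearEquiv.prodCongr e2 e1).trans (Submodule.prodEquivOfIsCompl C W hC.symm), ?_⟩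
  ext v
  constructor
  · rintro ⟨⟨c, e⟩, hv, rfl⟩
    simp at hv
    subst hv
    simp
  · intro hv
    exact ⟨(0, e1.symm ⟨v, hv⟩), by simp, by simp⟩

/-- flag sum lemma -/
theorem flag_sum (h : Module.finrank F Q + Module.finrank F E = Module.finrank F V)
    (t : Submodule F V → ℂ) :
    (Nat.card ((E ≃ₗ[F] E) × (Q ≃ₗ[F] Q) × (Q →ₗ[F] E)) : ℂ) *
      sm (fun W : Submodule F V => if Module.finrank F W = Module.finrank F E then t W else 0) =
    sm (fun f : (Q × E) ≃ₗ[F] V => t ((SE F E Q).map (f : Q × E →ₗ[F] V))) := by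
  have hdS : Module.finrank F (SE F E Q) = Module.finrank F E := (SEequiv (F := F)).finrank_eq.symm
  apply sm_fib_const
  · intro W hW
    obtain ⟨f0, hf0⟩ := flag_exists (Q := Q) h W hW
    rw [Nat.card_congr blEquiv]
    symm
    apply Nat.card_congr
    refine ⟨fun b => ⟨b.1.trans f0, ?_⟩, fun f => ⟨f.1.trans f0.symm, ?_⟩, ?_, ?_⟩
    · have h1 := stab_map_eq b.2
      have h2 : (SE F E Q).map ((b.1.trans f0 : (Q × E) ≃ₗ[F] V) : Q × E →ₗ[F] V) =
          ((SE F E Q).map (b.1 : Q × E →ₗ[F] Q × E)).map (f0 : Q × E →ₗ[F] V) := by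
        rw [← Submodule.map_comp]; rfl
      rw [h2, h1, hf0]
    · intro v hv
      have : f.1 v ∈ W := f.2.le ⟨v, hv, rfl⟩
      obtain ⟨w, hw, hw'⟩ := hf0.ge this
      have h2 : f0.symm (f.1 v) = w := by rw [← hw']; simp
      change f0.symm (f.1 v) ∈ _
      rw [h2]; exact hw
    · intro b; apply Subtype.ext; ext v <;> simp
    · intro b; apply Subtype.ext; ext v; simp
  · intro f
    rw [LinearEquiv.finrank_map_eq f, hdS]

/-- pairing on the automorphism group of a space -/
noncomputable def prV (V : Type) [AddCommGroup V] [Module F V] [Finite V] (φ χ : CF F) : ℂ :=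
  av fun g : V ≃ₗ[F] V => φ.ev g * χ.ev g⁻¹

/-- conjugation -/
def cjE (f : V ≃ₗ[F] V') : (V ≃ₗ[F] V) ≃* (V' ≃ₗ[F] V') where
  toFun g := (f.symm.trans g).trans f
  invFun g := (f.trans g).trans f.symm
  left_inv g := by ext; simp
  right_inv g := by ext; simp
  map_mul' a b := by ext; simp

theorem ev_cjE (φ : CF F) (f : V ≃ₗ[F] V') (g : V ≃ₗ[F] V) : φ.ev (cjE f g) = φ.ev g := by
  symm; apply CF.ev_inv _ f; intro v; simp [cjE]

theorem prV_congr (f : V ≃ₗ[F] V') (φ χ : CF F) : prV V φ χ = prV V' φ χ := by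
  unfold prV
  rw [← av_equiv (cjE f).toEquiv]
  apply av_congr
  intro g
  change _ = φ.ev (cjE f g) * χ.ev (cjE f g)⁻¹
  rw [← map_inv, ev_cjE, ev_cjE]

/-- pairing with the coproduct -/
noncomputable def prr (E Q : Type) [AddCommGroup E] [Module F E] [Finite E]
    [AddCommGroup Q] [Module F Q] [Finite Q] (φ ψ χ : CF F) : ℂ :=
  av fun x : E ≃ₗ[F] E => av fun y : Q ≃ₗ[F] Q => φ.ev x * ψ.ev y * rr χ x⁻¹ y⁻¹

theorem prr_congr (f : E ≃ₗ[F] E') (h : Q ≃ₗ[F] Q') (φ ψ χ : CF F) :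
    prr E Q φ ψ χ = prr E' Q' φ ψ χ := by
  unfold prr
  rw [← av_equiv (cjE f).toEquiv]
  apply av_congr
  intro x
  rw [← av_equiv (cjE h).toEquiv]
  apply av_congr
  intro y
  change _ = φ.ev (cjE f x) * ψ.ev (cjE h y) * rr χ (cjE f x)⁻¹ (cjE h y)⁻¹
  rw [← map_inv, ← map_inv, ev_cjE, ev_cjE]
  congr 1
  apply rr_inv _ f h <;> intro v <;> simp [cjE]

theorem adj_aux (h : Module.finrank F Q + Module.finrank F E = Module.finrank F V)
    (φ ψ χ : CF F) :
    av (fun g : V ≃ₗ[F] V => sm (fun W : Submodule F V =>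
      if Module.finrank F W = Module.finrank F E then tm φ ψ g W else 0) * χ.ev g⁻¹) =
    prr E Q φ ψ χ := by
  set P := Nat.card ((E ≃ₗ[F] E) × (Q ≃ₗ[F] Q) × (Q →ₗ[F] E)) with hP
  have hP0 : (P : ℂ) ≠ 0 := by
    rw [hP]; exact_mod_cast Nat.card_pos.ne'
  have e0 : Nonempty ((Q × E) ≃ₗ[F] V) := ⟨LinearEquiv.ofFinrankEq _ _ (by simpa using h)⟩
  obtain ⟨e0⟩ := e0
  apply mul_left_cancel₀ hP0
  rw [← av_mul_left]
  have h1 : ∀ g : V ≃ₗ[F] V, (P : ℂ) * (sm (fun W : Submodule F V =>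
      if Module.finrank F W = Module.finrank F E then tm φ ψ g W else 0) * χ.ev g⁻¹) =
      sm (fun f : (Q × E) ≃ₗ[F] V => tm φ ψ ((cjE f).symm g) (SE F E Q) *
        χ.ev ((cjE f).symm g)⁻¹) := by
    intro g
    rw [← mul_assoc, flag_sum h, ← sm_mul_right]
    apply sm_congr
    intro f
    congr 1
    · symm; apply tm_inv
      intro v; simp [cjE]
    · conv_lhs => rw [← (cjE f).apply_symm_apply g, ← map_inv, ev_cjE]
  rw [av_congr h1, av_sm_comm]
  have h2 : ∀ f : (Q × E) ≃ₗ[F] V, av (fun g => tm φ ψ ((cjE f).symm g) (SE F E Q) *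
        χ.ev ((cjE f).symm g)⁻¹) = av (fun b : (Q × E) ≃ₗ[F] (Q × E) => tm φ ψ b (SE F E Q) *
        χ.ev b⁻¹) := fun f =>
    av_equiv (cjE f).symm.toEquiv (fun b : (Q × E) ≃ₗ[F] (Q × E) => tm φ ψ b (SE F E Q) *
        χ.ev b⁻¹)
  rw [sm_congr h2, sm_const]
  have h3 : Nat.card ((Q × E) ≃ₗ[F] V) = Nat.card ((Q × E) ≃ₗ[F] (Q × E)) :=
    Nat.card_congr ⟨fun f => f.trans e0.symm, fun f => f.trans e0, fun f => by ext; simp,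
      fun f => by ext <;> simp⟩
  rw [h3, ← sm_eq_card_mul_av]
  have h4 : sm (fun b : (Q × E) ≃ₗ[F] (Q × E) => tm φ ψ b (SE F E Q) * χ.ev b⁻¹) =
      sm (fun b : {b : (Q × E) ≃ₗ[F] (Q × E) // ∀ v ∈ SE F E Q, b v ∈ SE F E Q} =>
        tm φ ψ b.1 (SE F E Q) * χ.ev b.1⁻¹) := by
    rw [sm_subtype (fun b : (Q × E) ≃ₗ[F] (Q × E) => ∀ v ∈ SE F E Q, b v ∈ SE F E Q)
      (fun b => tm φ ψ b (SE F E Q) * χ.ev b⁻¹)]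
    apply sm_congr
    intro b
    split_ifs with hb
    · rfl
    · rw [tm, dif_neg hb, zero_mul]
  rw [h4, ← sm_equiv blEquiv, sm_eq_card_mul_av, av_prod]
  congr 1
  unfold prr
  apply av_congr
  intro x
  rw [av_prod]
  apply av_congr
  intro y
  rw [← av_bl_inv, ← av_mul_left]
  apply av_congr
  intro u
  change tm φ ψ (bl x y u) (SE F E Q) * χ.ev (bl x y u)⁻¹ = _
  rw [tm_bl]

/-- the standard spaces -/
abbrev St (F : Type) (n : ℕ) : Type := Fin n → F

abbrev ad (n : ℕ) : Finset (ℕ × ℕ) := Finset.HasAntidiagonal.antidiagonal n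

/-- adjunction -/
theorem adjunction [Finite F] {n : ℕ} (hV : Module.finrank F V = n) (φ ψ χ : CF F) :
    prV V (φ * ψ) χ = ∑ p ∈ ad n, prr (St F p.1) (St F p.2) φ ψ χ := by
  have h1 : ∀ g : V ≃ₗ[F] V, (φ * ψ).ev g * χ.ev g⁻¹ = ∑ p ∈ ad n,
      sm (fun W : Submodule F V =>
      if Module.finrank F W = Module.finrank F (St F p.1) then tm φ ψ g W else 0) * χ.ev g⁻¹ := by
    intro g
    rw [← Finset.sum_mul, ← sm_finset, CF.ev_mul]
    congr 1
    apply sm_congr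
    intro W
    have hle := Submodule.finrank_le W
    rw [Finset.sum_eq_single (Module.finrank F W, n - Module.finrank F W)]
    · simp
    · rintro ⟨a, b⟩ hab hne
      rw [if_neg]
      intro h
      simp at h
      simp [ad] at hab
      apply hne
      ext <;> simp <;> omega
    · intro h
      simp at h
      omega
  unfold prV
  rw [av_congr h1, av_finset]
  apply Finset.sum_congr rfl
  rintro ⟨a, b⟩ hab
  apply adj_aux
  simp at hab ⊢
  omega

end LMT

namespace LMT
variable {F : Type} [Field F]
variable {V V' E Q E' Q' : Type} [AddCommGroup V] [Module F V] [Finite V]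
  [AddCommGroup V'] [Module F V'] [Finite V'] [AddCommGroup E] [Module F E] [Finite E]
  [AddCommGroup Q] [Module F Q] [Finite Q] [AddCommGroup E'] [Module F E'] [Finite E']
  [AddCommGroup Q'] [Module F Q'] [Finite Q']

/-- sheared product subspace -/
def shp (E1 : Submodule F E) (Q1 : Submodule F Q) (s : Q →ₗ[F] E) : Submodule F (Q × E) :=
  (Q1.prod E1).map (bl (LinearEquiv.refl F E) (LinearEquiv.refl F Q) s : Q × E →ₗ[F] Q × E)

theorem mem_shp (E1 : Submodule F E) (Q1 : Submodule F Q) (s : Q →ₗ[F] E) (v : Q × E) :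
    v ∈ shp E1 Q1 s ↔ v.1 ∈ Q1 ∧ v.2 - s v.1 ∈ E1 := by
  constructor
  · rintro ⟨⟨c, e⟩, ⟨h1, h2⟩, rfl⟩
    simpa using ⟨h1, h2⟩
  · rintro ⟨h1, h2⟩
    exact ⟨(v.1, v.2 - s v.1), ⟨h1, h2⟩, by simp⟩

/-- maps preserving the filtration -/
def KK (E1 : Submodule F E) (Q1 : Submodule F Q) : Submodule F (Q →ₗ[F] E) where
  carrier := {u | ∀ c ∈ Q1, u c ∈ E1}
  zero_mem' := by intro c _; simp
  add_mem' := by intro a b ha hb c hc; exact E1.add_mem (ha c hc) (hb c hc)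
  smul_mem' := by intro a b hb c hc; exact E1.smul_mem _ (hb c hc)

theorem mem_KK (E1 : Submodule F E) (Q1 : Submodule F Q) (u : Q →ₗ[F] E) :
    u ∈ KK E1 Q1 ↔ ∀ c ∈ Q1, u c ∈ E1 := Iff.rfl

theorem shear_sum (E1 : Submodule F E) (Q1 : Submodule F Q) (t : Submodule F (Q × E) → ℂ) :
    (Nat.card (KK E1 Q1) : ℂ) * sm (fun W : Submodule F (Q × E) =>
      if (W.comap (LinearMap.inr F Q E), W.map (LinearMap.fst F Q E)) = (E1, Q1)
      then t W else 0) = sm (fun s : Q →ₗ[F] E => t (shp E1 Q1 s)) := by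
  apply sm_fib_const
  · intro W hW
    obtain ⟨hW1, hW2⟩ := Prod.mk.inj hW
    have hmem1 : ∀ e, ((0 : Q), e) ∈ W ↔ e ∈ E1 := fun e => by rw [← hW1]; rfl
    have hmem2 : ∀ v ∈ W, v.1 ∈ Q1 := fun v hv => by rw [← hW2]; exact ⟨v, hv, rfl⟩
    -- a section
    let p : W →ₗ[F] Q1 := (LinearMap.fst F Q E).restrict hmem2
    have hp : Function.Surjective p := by
      rintro ⟨c, hc⟩
      rw [← hW2] at hc
      obtain ⟨v, hv, rfl⟩ := hc
      exact ⟨⟨v, hv⟩, rfl⟩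
    obtain ⟨σ, hσ⟩ := LinearMap.exists_rightInverse_of_surjective p (LinearMap.range_eq_top.2 hp)
    have hσ' : ∀ c, ((σ c : W) : Q × E).1 = c := fun c =>
      congrArg Subtype.val (LinearMap.congr_fun hσ c)
    obtain ⟨s0, hs0⟩ := LinearMap.exists_extend (LinearMap.snd F Q E ∘ₗ W.subtype ∘ₗ σ)
    have hs0' : ∀ c (hc : c ∈ Q1), (c, s0 c) ∈ W := by
      intro c hc
      have h1 : s0 c = ((σ ⟨c, hc⟩ : W) : Q × E).2 := LinearMap.congr_fun hs0 ⟨c, hc⟩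
      have h2 : (c, s0 c) = ((σ ⟨c, hc⟩ : W) : Q × E) := Prod.ext (hσ' ⟨c, hc⟩).symm h1
      rw [h2]; exact (σ _).2
    have hmem : ∀ v, v ∈ W ↔ v.1 ∈ Q1 ∧ v.2 - s0 v.1 ∈ E1 := by
      rintro ⟨c, e⟩
      have hd : ((0 : Q), e - s0 c) = (c, e) - (c, s0 c) := by simp
      constructor
      · intro hv
        refine ⟨hmem2 _ hv, (hmem1 _).1 ?_⟩
        simp only
        rw [hd]
        exact W.sub_mem hv (hs0' c (hmem2 _ hv))
      · rintro ⟨h1, h2⟩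
        have h3 := (hmem1 _).2 h2
        simp only at h3 h1
        rw [hd] at h3
        simpa using W.add_mem h3 (hs0' c h1)
    apply Nat.card_congr
    have key : ∀ s, shp E1 Q1 s = W ↔ s - s0 ∈ KK E1 Q1 := by
      intro s
      constructor
      · intro h c hc
        have h1 : (c, s c) ∈ shp E1 Q1 s := (mem_shp _ _ _ _).2 ⟨hc, by simp⟩
        rw [h] at h1
        simpa using ((hmem _).1 h1).2
      · intro h
        ext v
        rw [mem_shp, hmem]
        refine and_congr_right fun h1 => ?_
        have h2 := h _ h1
        have h3 : v.2 - s0 v.1 = (v.2 - s v.1) + (s - s0) v.1 := by simp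
        rw [h3]
        exact (Submodule.add_mem_iff_left _ h2).symm
    exact ⟨fun s => ⟨s.1 - s0, (key s.1).1 s.2⟩, fun u => ⟨u.1 + s0, (key _).2 (by simp)⟩,
      fun s => by simp, fun u => by simp⟩
  · intro s
    apply Prod.ext
    · ext e
      simp [mem_shp]
    · ext c
      constructor
      · rintro ⟨v, hv, rfl⟩
        exact ((mem_shp _ _ _ _).1 hv).1
      · intro hc
        exact ⟨(c, s c), (mem_shp _ _ _ _).2 ⟨hc, by simp⟩, rfl⟩

/-- the restriction map to sub and quotient -/
noncomputable def KKmap (E1 : Submodule F E) (Q1 : Submodule F Q) :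
    KK E1 Q1 →+ (Q1 →ₗ[F] E1) × ((Q ⧸ Q1) →ₗ[F] (E ⧸ E1)) where
  toFun u := (u.1.restrict u.2, Q1.mapQ E1 u.1 u.2)
  map_zero' := by
    apply Prod.ext
    · rfl
    · ext; simp
  map_add' a b := by
    apply Prod.ext
    · rfl
    · ext; rfl

theorem KKmap_surj (E1 : Submodule F E) (Q1 : Submodule F Q) :
    Function.Surjective (KKmap E1 Q1) := by
  rintro ⟨u1, u2⟩
  obtain ⟨π, hπ⟩ := LinearMap.exists_extend (LinearMap.id : Q1 →ₗ[F] Q1)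
  obtain ⟨σ, hσ⟩ := LinearMap.exists_rightInverse_of_surjective E1.mkQ
    (LinearMap.range_eq_top.2 E1.mkQ_surjective)
  have hπ' : ∀ c : Q1, π c = c := fun c => LinearMap.congr_fun hπ c
  have hσ' : ∀ c, E1.mkQ (σ c) = c := fun c => LinearMap.congr_fun hσ c
  let u : Q →ₗ[F] E := E1.subtype ∘ₗ u1 ∘ₗ π + σ ∘ₗ u2 ∘ₗ Q1.mkQ
  have hu : ∀ c (hc : c ∈ Q1), u c = u1 ⟨c, hc⟩ := by
    intro c hc
    have h1 := hπ' ⟨c, hc⟩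
    have h2 : Q1.mkQ c = 0 := by simpa using hc
    simp only at h1
    simp only [u, LinearMap.add_apply, LinearMap.comp_apply, h1, h2]
    simp
  refine ⟨⟨u, fun c hc => by rw [hu c hc]; exact (u1 _).2⟩, ?_⟩
  apply Prod.ext
  · ext c
    exact hu c.1 c.2
  · apply LinearMap.ext
    intro c
    obtain ⟨c, rfl⟩ := Q1.mkQ_surjective c
    change E1.mkQ (u c) = u2 (Q1.mkQ c)
    simp only [u, LinearMap.add_apply, LinearMap.comp_apply, map_add, hσ']
    simp

def prodSubEquiv (E1 : Submodule F E) (Q1 : Submodule F Q) : Q1.prod E1 ≃ₗ[F] Q1 × E1 where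
  toFun v := (⟨v.1.1, v.2.1⟩, ⟨v.1.2, v.2.2⟩)
  invFun v := ⟨(v.1.1, v.2.1), ⟨v.1.2, v.2.2⟩⟩
  map_add' _ _ := rfl
  map_smul' _ _ := rfl
  left_inv _ := rfl
  right_inv _ := rfl

theorem tm_prod (φ ψ : CF F) (x : E ≃ₗ[F] E) (y : Q ≃ₗ[F] Q) (u : Q →ₗ[F] E)
    (E1 : Submodule F E) (Q1 : Submodule F Q) (hx : ∀ v ∈ E1, x v ∈ E1)
    (hy : ∀ v ∈ Q1, y v ∈ Q1) (hu : u ∈ KK E1 Q1) :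
    tm φ ψ (bl x y u) (Q1.prod E1) =
      φ.ev (bl (sub x E1 hx) (sub y Q1 hy) (KKmap E1 Q1 ⟨u, hu⟩).1) *
      ψ.ev (bl (quo x E1 hx) (quo y Q1 hy) (KKmap E1 Q1 ⟨u, hu⟩).2) := by
  have hs : ∀ v ∈ Q1.prod E1, bl x y u v ∈ Q1.prod E1 := by
    rintro ⟨c, e⟩ ⟨h1, h2⟩
    exact ⟨hy _ h1, E1.add_mem (hx _ h2) (hu _ h1)⟩
  rw [tm_pos _ _ _ _ hs]
  congr 1
  · apply CF.ev_inv _ (prodSubEquiv E1 Q1)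
    intro v
    rfl
  · let p : Q × E →ₗ[F] (Q ⧸ Q1) × (E ⧸ E1) := (Q1.mkQ).prodMap E1.mkQ
    have hp : Function.Surjective p := by
      rintro ⟨a, b⟩
      obtain ⟨a, rfl⟩ := Q1.mkQ_surjective a
      obtain ⟨b, rfl⟩ := E1.mkQ_surjective b
      exact ⟨(a, b), rfl⟩
    have hk : LinearMap.ker p = Q1.prod E1 := by
      ext v
      simp [p, LinearMap.mem_ker, Submodule.mem_prod, Prod.ext_iff]
    apply CF.ev_inv _ ((Submodule.quotEquivOfEq _ _ hk.symm).trans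
      (p.quotKerEquivOfSurjective hp))
    intro v
    obtain ⟨v, rfl⟩ := (Q1.prod E1).mkQ_surjective v
    rfl

/-- summand in the Hopf formula -/
noncomputable def htm (φ ψ : CF F) (x : E ≃ₗ[F] E) (y : Q ≃ₗ[F] Q)
    (E1 : Submodule F E) (Q1 : Submodule F Q) : ℂ :=
  if h : (∀ v ∈ E1, x v ∈ E1) ∧ (∀ v ∈ Q1, y v ∈ Q1) then
    rr φ (sub x E1 h.1) (sub y Q1 h.2) * rr ψ (quo x E1 h.1) (quo y Q1 h.2) else 0

theorem htm_sum (φ ψ : CF F) (x : E ≃ₗ[F] E) (y : Q ≃ₗ[F] Q)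
    (E1 : Submodule F E) (Q1 : Submodule F Q) :
    sm (fun u : Q →ₗ[F] E => tm φ ψ (bl x y u) (Q1.prod E1)) =
      Nat.card (KK E1 Q1) * htm φ ψ x y E1 Q1 := by
  by_cases h : (∀ v ∈ E1, x v ∈ E1) ∧ (∀ v ∈ Q1, y v ∈ Q1)
  · rw [htm, dif_pos h]
    have h1 : sm (fun u : Q →ₗ[F] E => tm φ ψ (bl x y u) (Q1.prod E1)) =
        sm (fun u : KK E1 Q1 => tm φ ψ (bl x y u.1) (Q1.prod E1)) := by
      rw [sm_subtype (fun u => u ∈ KK E1 Q1) (fun u => tm φ ψ (bl x y u) (Q1.prod E1))]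
      apply sm_congr
      intro u
      split_ifs with hu
      · rfl
      · rw [tm, dif_neg]
        intro hs
        apply hu
        intro c hc
        simpa using (hs (c, 0) ⟨hc, E1.zero_mem⟩).2
    rw [h1, sm_eq_card_mul_av]
    congr 1
    rw [av_congr (fun u : KK E1 Q1 => tm_prod φ ψ x y u.1 E1 Q1 h.1 h.2 u.2)]
    rw [av_addHom (KKmap E1 Q1) (KKmap_surj E1 Q1) (fun p =>
      φ.ev (bl (sub x E1 h.1) (sub y Q1 h.2) p.1) *
      ψ.ev (bl (quo x E1 h.1) (quo y Q1 h.2) p.2)), av_prod]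
    unfold rr
    rw [← av_mul_right]
    apply av_congr
    intro a
    rw [← av_mul_left]
  · rw [htm, dif_neg h, mul_zero, ← sm_zero (α := Q →ₗ[F] E)]
    apply sm_congr
    intro u
    rw [tm, dif_neg]
    intro hs
    apply h
    constructor
    · intro e he
      simpa using (hs (0, e) ⟨Q1.zero_mem, he⟩).2
    · intro c hc
      exact (hs (c, 0) ⟨hc, E1.zero_mem⟩).1

theorem hopf (φ ψ : CF F) (x : E ≃ₗ[F] E) (y : Q ≃ₗ[F] Q) :
    rr (φ * ψ) x y = sm (fun E1 => sm (fun Q1 => htm φ ψ x y E1 Q1)) := by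
  unfold rr
  have h1 : ∀ u : Q →ₗ[F] E, (φ * ψ).ev (bl x y u) =
      sm (fun p : Submodule F E × Submodule F Q => sm (fun W : Submodule F (Q × E) =>
        if (W.comap (LinearMap.inr F Q E), W.map (LinearMap.fst F Q E)) = p
        then tm φ ψ (bl x y u) W else 0)) := by
    intro u
    rw [CF.ev_mul, sm_fiber (fun W : Submodule F (Q × E) =>
      (W.comap (LinearMap.inr F Q E), W.map (LinearMap.fst F Q E)))]
    apply sm_congr
    intro p
    exact sm_subtype (fun W : Submodule F (Q × E) =>
      (W.comap (LinearMap.inr F Q E), W.map (LinearMap.fst F Q E)) = p)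
      (fun W => tm φ ψ (bl x y u) W)
  rw [av_congr h1, av_sm_comm, sm_prod]
  apply sm_congr
  intro E1
  apply sm_congr
  intro Q1
  have hK : (Nat.card (KK E1 Q1) : ℂ) ≠ 0 := by exact_mod_cast Nat.card_pos.ne'
  apply mul_left_cancel₀ hK
  rw [← av_mul_left, av_congr (fun u => shear_sum E1 Q1 (fun W => tm φ ψ (bl x y u) W))]
  rw [av_sm_comm, ← htm_sum]
  have h2 : ∀ s : Q →ₗ[F] E, av (fun u : Q →ₗ[F] E => tm φ ψ (bl x y u) (shp E1 Q1 s)) =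
      av (fun u : Q →ₗ[F] E => tm φ ψ (bl x y u) (Q1.prod E1)) := by
    intro s
    refine (av_congr ?_).trans (av_equiv (Equiv.addRight ((x : E →ₗ[F] E) ∘ₗ s - s ∘ₗ
      (y : Q →ₗ[F] Q))) (fun u : Q →ₗ[F] E => tm φ ψ (bl x y u) (Q1.prod E1)))
    intro u
    symm
    apply tm_inv
    rintro ⟨c, e⟩
    simp
    abel
  rw [sm_congr h2, sm_const, ← sm_eq_card_mul_av]

end LMT

namespace LMT
variable {F : Type} [Field F]
variable {V V' E Q E' Q' : Type} [AddCommGroup V] [Module F V] [Finite V]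
  [AddCommGroup V'] [Module F V'] [Finite V'] [AddCommGroup E] [Module F E] [Finite E]
  [AddCommGroup Q] [Module F Q] [Finite Q] [AddCommGroup E'] [Module F E'] [Finite E']
  [AddCommGroup Q'] [Module F Q'] [Finite Q']

noncomputable def rL (χ : CF F) (y : Q ≃ₗ[F] Q) : CF F :=
  CF.mk' (fun _ _ _ _ x => rr χ x y) (by
    intro V V' _ _ _ _ _ _ f g g' h
    exact rr_inv χ f (LinearEquiv.refl F Q) g g' y y h (fun _ => rfl))

noncomputable def rR (χ : CF F) (x : E ≃ₗ[F] E) : CF F :=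
  CF.mk' (fun _ _ _ _ y => rr χ x y) (by
    intro V V' _ _ _ _ _ _ f g g' h
    exact rr_inv χ (LinearEquiv.refl F E) f x x g g' (fun _ => rfl) h)

@[simp] theorem rL_ev (χ : CF F) (x : E ≃ₗ[F] E) (y : Q ≃ₗ[F] Q) : (rL χ y).ev x = rr χ x y := rfl
@[simp] theorem rR_ev (χ : CF F) (x : E ≃ₗ[F] E) (y : Q ≃ₗ[F] Q) : (rR χ x).ev y = rr χ x y := rfl

theorem rr_sub' (χ χ' : CF F) (x : E ≃ₗ[F] E) (y : Q ≃ₗ[F] Q) :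
    rr (χ - χ') x y = rr χ x y - rr χ' x y := by
  simp [rr, av_sub]
theorem rr_add (χ χ' : CF F) (x : E ≃ₗ[F] E) (y : Q ≃ₗ[F] Q) :
    rr (χ + χ') x y = rr χ x y + rr χ' x y := by
  simp [rr, av_add]
theorem rr_smul (c : ℂ) (χ : CF F) (x : E ≃ₗ[F] E) (y : Q ≃ₗ[F] Q) :
    rr (c • χ) x y = c * rr χ x y := by
  simp [rr, av_mul_left]

theorem hopfL (φ ψ : CF F) (x : E ≃ₗ[F] E) (y : Q ≃ₗ[F] Q) :
    rr (φ * ψ) x y = sm (fun Q1 : Submodule F Q => if h : ∀ v ∈ Q1, y v ∈ Q1 then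
      (rL φ (sub y Q1 h) * rL ψ (quo y Q1 h)).ev x else 0) := by
  rw [hopf, sm_comm]
  apply sm_congr
  intro Q1
  split_ifs with h
  · rw [CF.ev_mul]
    apply sm_congr
    intro E1
    simp only [htm, tm, rL_ev]
    by_cases h' : ∀ v ∈ E1, x v ∈ E1
    · rw [dif_pos ⟨h', h⟩, dif_pos h']
    · rw [dif_neg (fun hh => h' hh.1), dif_neg h']
  · rw [← sm_zero (α := Submodule F E)]
    apply sm_congr
    intro E1
    rw [htm, dif_neg (fun hh => h hh.2)]

theorem hopfR (φ ψ : CF F) (x : E ≃ₗ[F] E) (y : Q ≃ₗ[F] Q) :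
    rr (φ * ψ) x y = sm (fun E1 : Submodule F E => if h : ∀ v ∈ E1, x v ∈ E1 then
      (rR φ (sub x E1 h) * rR ψ (quo x E1 h)).ev y else 0) := by
  rw [hopf]
  apply sm_congr
  intro E1
  split_ifs with h
  · rw [CF.ev_mul]
    apply sm_congr
    intro Q1
    simp only [htm, tm, rR_ev]
    by_cases h' : ∀ v ∈ Q1, y v ∈ Q1
    · rw [dif_pos ⟨h, h'⟩, dif_pos h']
    · rw [dif_neg (fun hh => h' hh.2), dif_neg h']
  · rw [← sm_zero (α := Submodule F Q)]
    apply sm_congr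
    intro Q1
    rw [htm, dif_neg (fun hh => h hh.1)]

theorem rr_comm_aux (φ ψ : CF F) (x : E ≃ₗ[F] E) (y : Q ≃ₗ[F] Q)
    (hE : ∀ (φ ψ : CF F), (φ * ψ).ev x = (ψ * φ).ev x)
    (hQ : ∀ (φ ψ : CF F), (φ * ψ).ev y = (ψ * φ).ev y) :
    rr (φ * ψ) x y = rr (ψ * φ) x y := by
  rw [hopfL, hopfR]
  have h1 : ∀ Q1 : Submodule F Q, (if h : ∀ v ∈ Q1, y v ∈ Q1 then
      (rL φ (sub y Q1 h) * rL ψ (quo y Q1 h)).ev x else 0) = sm (fun E1 : Submodule F E =>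
      if h : (∀ v ∈ E1, x v ∈ E1) ∧ (∀ v ∈ Q1, y v ∈ Q1) then
      rr ψ (sub x E1 h.1) (quo y Q1 h.2) * rr φ (quo x E1 h.1) (sub y Q1 h.2) else 0) := by
    intro Q1
    by_cases h : ∀ v ∈ Q1, y v ∈ Q1
    · rw [dif_pos h, hE, CF.ev_mul]
      apply sm_congr
      intro E1
      simp only [tm, rL_ev]
      by_cases h' : ∀ v ∈ E1, x v ∈ E1
      · rw [dif_pos h', dif_pos ⟨h', h⟩]
      · rw [dif_neg h', dif_neg (fun hh => h' hh.1)]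
    · rw [dif_neg h]
      refine (sm_zero (α := Submodule F E)).symm.trans (sm_congr fun E1 => ?_)
      rw [dif_neg (fun hh => h hh.2)]
  have h2 : ∀ E1 : Submodule F E, (if h : ∀ v ∈ E1, x v ∈ E1 then
      (rR ψ (sub x E1 h) * rR φ (quo x E1 h)).ev y else 0) = sm (fun Q1 : Submodule F Q =>
      if h : (∀ v ∈ E1, x v ∈ E1) ∧ (∀ v ∈ Q1, y v ∈ Q1) then
      rr ψ (sub x E1 h.1) (quo y Q1 h.2) * rr φ (quo x E1 h.1) (sub y Q1 h.2) else 0) := by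
    intro E1
    by_cases h : ∀ v ∈ E1, x v ∈ E1
    · rw [dif_pos h, hQ, CF.ev_mul]
      apply sm_congr
      intro Q1
      simp only [tm, rR_ev]
      by_cases h' : ∀ v ∈ Q1, y v ∈ Q1
      · rw [dif_pos h', dif_pos ⟨h, h'⟩, mul_comm]
      · rw [dif_neg h', dif_neg (fun hh => h' hh.2)]
    · rw [dif_neg h]
      refine (sm_zero (α := Submodule F Q)).symm.trans (sm_congr fun E1 => ?_)
      rw [dif_neg (fun hh => h hh.1)]
  rw [sm_congr h1, sm_congr h2, sm_comm]

/-- the conjugate dual -/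
noncomputable def til (φ : CF F) : CF F :=
  CF.mk' (fun _ _ _ _ g => (starRingEnd ℂ) (φ.ev g⁻¹)) (by
    intro V V' _ _ _ _ _ _ f g g' h
    congr 1
    apply CF.ev_inv _ f
    intro v
    change f (g.symm v) = g'.symm (f v)
    rw [LinearEquiv.eq_symm_apply, ← h, LinearEquiv.apply_symm_apply])

@[simp] theorem til_ev (φ : CF F) (g : V ≃ₗ[F] V) :
    (til φ).ev g = (starRingEnd ℂ) (φ.ev g⁻¹) := rfl

theorem stab_inv {b : V ≃ₗ[F] V} {W : Submodule F V} (h : ∀ v ∈ W, b v ∈ W) :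
    ∀ v ∈ W, b⁻¹ v ∈ W := by
  intro v hv
  obtain ⟨w, hw⟩ := (sub b _ h).surjective ⟨v, hv⟩
  have : b w = v := congrArg Subtype.val hw
  have h2 : b⁻¹ v = w := by rw [← this]; exact b.symm_apply_apply _
  rw [h2]; exact w.2

theorem sub_inv (b : V ≃ₗ[F] V) (W : Submodule F V) (h : ∀ v ∈ W, b v ∈ W) :
    (sub b W h)⁻¹ = sub b⁻¹ W (stab_inv h) := by
  apply inv_eq_of_mul_eq_one_right
  apply LinearEquiv.ext
  intro w
  apply Subtype.ext
  exact b.apply_symm_apply _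

theorem quo_inv (b : V ≃ₗ[F] V) (W : Submodule F V) (h : ∀ v ∈ W, b v ∈ W) :
    (quo b W h)⁻¹ = quo b⁻¹ W (stab_inv h) := by
  apply inv_eq_of_mul_eq_one_right
  apply LinearEquiv.ext
  intro w
  obtain ⟨w, rfl⟩ := W.mkQ_surjective w
  exact congrArg W.mkQ (b.apply_symm_apply _)

theorem sm_conj {α : Type*} [Finite α] (f : α → ℂ) :
    (starRingEnd ℂ) (sm f) = sm (fun a => (starRingEnd ℂ) (f a)) := by
  cases nonempty_fintype α
  simp [sm_eq]

theorem til_mul (φ ψ : CF F) : til (φ * ψ) = til φ * til ψ := by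
  apply CF.ext'
  intro V _ _ _ g
  rw [til_ev, CF.ev_mul, CF.ev_mul, sm_conj]
  apply sm_congr
  intro W
  by_cases h : ∀ v ∈ W, g v ∈ W
  · rw [tm_pos _ _ _ _ h, tm_pos _ _ _ _ (stab_inv h), map_mul, til_ev, til_ev, sub_inv, quo_inv]
  · rw [tm, tm, dif_neg h, dif_neg, map_zero]
    intro hh
    apply h
    have := stab_inv hh
    rwa [inv_inv] at this

theorem til_sub (φ ψ : CF F) : til (φ - ψ) = til φ - til ψ := by
  apply CF.ext'
  intro V _ _ _ g
  simp

theorem prV_sub (V : Type) [AddCommGroup V] [Module F V] [Finite V] (φ ψ χ : CF F) :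
    prV V (φ - ψ) χ = prV V φ χ - prV V ψ χ := by
  simp [prV, ← av_sub, sub_mul]
theorem prV_add (V : Type) [AddCommGroup V] [Module F V] [Finite V] (φ ψ χ : CF F) :
    prV V (φ + ψ) χ = prV V φ χ + prV V ψ χ := by
  simp [prV, ← av_add, add_mul]
theorem prV_smul (V : Type) [AddCommGroup V] [Module F V] [Finite V] (c : ℂ) (ψ χ : CF F) :
    prV V (c • ψ) χ = c * prV V ψ χ := by
  simp [prV, ← av_mul_left, mul_assoc]
theorem prV_comm (V : Type) [AddCommGroup V] [Module F V] [Finite V] (φ χ : CF F) :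
    prV V φ χ = prV V χ φ := by
  unfold prV
  rw [← av_equiv (Equiv.inv (V ≃ₗ[F] V))]
  apply av_congr; intro g
  simp [mul_comm]

theorem til_pos (κ : CF F) (h : prV V (til κ) κ = 0) (g : V ≃ₗ[F] V) : κ.ev g = 0 := by
  have h1 : prV V (til κ) κ = av (fun g : V ≃ₗ[F] V => ((‖κ.ev g⁻¹‖ ^ 2 : ℝ) : ℂ)) := by
    unfold prV
    apply av_congr
    intro g
    rw [til_ev, Complex.conj_mul']
    push_cast
    rfl
  rw [h1] at h
  cases nonempty_fintype (V ≃ₗ[F] V)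
  rw [av, sm_eq, mul_eq_zero] at h
  rcases h with h | h
  · simp at h
  · rw [← Complex.ofReal_sum] at h
    have h2 := (Finset.sum_eq_zero_iff_of_nonneg (fun i _ => by positivity)).1
      (Complex.ofReal_eq_zero.1 h) g⁻¹ (Finset.mem_univ _)
    simpa using h2

theorem rr_of_subsingleton_right [Subsingleton Q] (χ : CF F) (x : E ≃ₗ[F] E) (y : Q ≃ₗ[F] Q) :
    rr χ x y = χ.ev x := by
  unfold rr
  have h : ∀ u : Q →ₗ[F] E, χ.ev (bl x y u) = χ.ev x := by
    intro u
    haveI : Unique Q := ⟨⟨0⟩, fun _ => Subsingleton.elim _ _⟩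
    apply CF.ev_inv _ (LinearEquiv.uniqueProd (R := F) (M := E) (M₂ := Q))
    rintro ⟨c, e⟩
    obtain rfl : c = 0 := Subsingleton.elim _ _
    simp [bl]
  rw [av_congr h, av_const]

theorem rr_of_subsingleton_left [Subsingleton E] (χ : CF F) (x : E ≃ₗ[F] E) (y : Q ≃ₗ[F] Q) :
    rr χ x y = χ.ev y := by
  unfold rr
  have h : ∀ u : Q →ₗ[F] E, χ.ev (bl x y u) = χ.ev y := by
    intro u
    haveI : Unique E := ⟨⟨0⟩, fun _ => Subsingleton.elim _ _⟩
    apply CF.ev_inv _ (LinearEquiv.prodUnique (R := F) (M := Q) (M₂ := E))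
    rintro ⟨c, e⟩
    simp [bl]
  rw [av_congr h, av_const]

theorem prr_left [Subsingleton E] (φ ψ χ : CF F) :
    prr E Q φ ψ χ = φ.ev (1 : E ≃ₗ[F] E) * prV Q ψ χ := by
  unfold prr prV
  haveI : Unique (E ≃ₗ[F] E) := ⟨⟨1⟩, fun a => by ext v; exact Subsingleton.elim _ _⟩
  rw [av_unique, ← av_mul_left]
  apply av_congr
  intro y
  rw [rr_of_subsingleton_left, mul_assoc, Subsingleton.elim (default : E ≃ₗ[F] E) 1]

theorem prr_right [Subsingleton Q] (φ ψ χ : CF F) :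
    prr E Q φ ψ χ = ψ.ev (1 : Q ≃ₗ[F] Q) * prV E φ χ := by
  unfold prr prV
  haveI : Unique (Q ≃ₗ[F] Q) := ⟨⟨1⟩, fun a => by ext v; exact Subsingleton.elim _ _⟩
  rw [← av_mul_left]
  apply av_congr
  intro x
  rw [av_unique, rr_of_subsingleton_right, mul_comm (φ.ev x), mul_assoc,
    Subsingleton.elim (default : Q ≃ₗ[F] Q) 1]

theorem comm_aux [Finite F] (n : ℕ) : ∀ (φ ψ : CF F) (V : Type) [AddCommGroup V] [Module F V]
    [Finite V], Module.finrank F V = n → ∀ g : V ≃ₗ[F] V, (φ * ψ).ev g = (ψ * φ).ev g := by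
  induction n using Nat.strong_induction_on with
  | _ n ih =>
  intro φ ψ V _ _ _ hV g
  have hr : ∀ p ∈ ad n, p.1 ≠ 0 → p.2 ≠ 0 → ∀ (x : St F p.1 ≃ₗ[F] St F p.1)
      (y : St F p.2 ≃ₗ[F] St F p.2), rr (φ * ψ - ψ * φ) x y = 0 := by
    rintro ⟨a, b⟩ hab h1 h2 x y
    simp [ad] at hab h1 h2
    rw [rr_sub', rr_comm_aux φ ψ x y, sub_self]
    · intro φ ψ
      exact ih a (by omega) φ ψ _ (by simp) x
    · intro φ ψ
      exact ih b (by omega) φ ψ _ (by simp) y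
  have key : prV V (til φ * til ψ) (φ * ψ - ψ * φ) = prV V (til ψ * til φ) (φ * ψ - ψ * φ) := by
    have e : ∑ p ∈ ad n, prr (St F p.2) (St F p.1) (til ψ) (til φ) (φ * ψ - ψ * φ) =
        ∑ p ∈ ad n, prr (St F p.1) (St F p.2) (til ψ) (til φ) (φ * ψ - ψ * φ) := by
      apply Finset.sum_equiv (Equiv.prodComm ℕ ℕ)
      · intro p; simp [ad, add_comm]
      · intro p _; rfl
    rw [adjunction hV, adjunction hV, ← e]
    · apply Finset.sum_congr rfl
      rintro ⟨a, b⟩ hab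
      dsimp only
      rcases Nat.eq_zero_or_pos a with rfl | ha
      · rw [prr_left, prr_right]
      rcases Nat.eq_zero_or_pos b with rfl | hb
      · rw [prr_right, prr_left]
      have h1 := hr (a, b) hab ha.ne' hb.ne'
      have h2 := hr (b, a) (by simp [ad] at hab ⊢; omega) hb.ne' ha.ne'
      simp only [prr]
      simp only at h1 h2
      simp [h1, h2, av_zero]
  have h0 : prV V (til (φ * ψ - ψ * φ)) (φ * ψ - ψ * φ) = 0 := by
    rw [til_sub, til_mul, til_mul, prV_sub, key, sub_self]
  have := til_pos _ h0 g
  rw [CF.ev_sub] at this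
  exact sub_eq_zero.1 this

noncomputable instance [Finite F] : CommRing (CF F) :=
  { (inferInstance : AddCommGroup (CF F)) with
    mul := (· * ·)
    one := 1
    mul_assoc := CF.mul_assoc'
    one_mul := CF.one_mul'
    mul_one := CF.mul_one'
    left_distrib := CF.mul_add'
    right_distrib := CF.add_mul'
    zero_mul := fun a => by
      have h := CF.smul_mul' (0 : ℂ) a a
      rwa [zero_smul, zero_smul] at h
    mul_zero := fun a => by
      have h := CF.mul_smul' (0 : ℂ) a a
      rwa [zero_smul, zero_smul] at h
    mul_comm := fun a b => CF.ext' fun V _ _ _ g => comm_aux _ a b V rfl g }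

noncomputable instance [Finite F] : Algebra ℂ (CF F) :=
  Algebra.ofModule (fun c a b => CF.smul_mul' c a b) (fun c a b => CF.mul_smul' c a b)

end LMT

namespace LMT
variable {F : Type} [Field F]
variable {V V' E Q E' Q' : Type} [AddCommGroup V] [Module F V] [Finite V]
  [AddCommGroup V'] [Module F V'] [Finite V'] [AddCommGroup E] [Module F E] [Finite E]
  [AddCommGroup Q] [Module F Q] [Finite Q] [AddCommGroup E'] [Module F E'] [Finite E']
  [AddCommGroup Q'] [Module F Q'] [Finite Q']


variable [Finite F]

theorem sm_zero' {α : Type*} [Finite α] {f : α → ℂ} (h : ∀ a, f a = 0) : sm f = 0 := by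
  rw [sm_congr h]; exact sm_zero
theorem av_zero' {α : Type*} [Finite α] {f : α → ℂ} (h : ∀ a, f a = 0) : av f = 0 := by
  rw [av_congr h]; exact av_zero

/-- the standard general linear group -/
abbrev GS (F : Type) [Field F] (n : ℕ) : Type := St F n ≃ₗ[F] St F n

/-- supported in dimension `n` -/
def Hm (n : ℕ) (φ : CF F) : Prop := ∀ (V : Type) [AddCommGroup V] [Module F V] [Finite V]
  (g : V ≃ₗ[F] V), Module.finrank F V ≠ n → φ.ev g = 0

/-- pairing in degree `n` -/
noncomputable def pr (n : ℕ) (φ χ : CF F) : ℂ := prV (St F n) φ χ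

theorem stEq {n : ℕ} (h : Module.finrank F V = n) : Nonempty (V ≃ₗ[F] St F n) :=
  ⟨LinearEquiv.ofFinrankEq _ _ (by simpa using h)⟩

theorem Hm.ext {n : ℕ} {φ ψ : CF F} (h : Hm n φ) (h' : Hm n ψ)
    (he : ∀ g : GS F n, φ.ev g = ψ.ev g) : φ = ψ := by
  apply CF.ext'
  intro V _ _ _ g
  by_cases hV : Module.finrank F V = n
  · obtain ⟨f⟩ := stEq hV
    rw [← ev_cjE φ f, ← ev_cjE ψ f, he]
  · rw [h V g hV, h' V g hV]

/-- extension of a class function -/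
noncomputable def ext (n : ℕ) (c : GS F n → ℂ) (hc : IsCls c) : CF F :=
  CF.mk' (fun V _ _ _ g => if h : Module.finrank F V = n then
      c (cjE (Classical.choice (stEq h)) g) else 0) (by
    intro V V' _ _ _ _ _ _ f g g' h
    have e : Module.finrank F V = Module.finrank F V' := f.finrank_eq
    by_cases hV : Module.finrank F V = n
    · have hV' : Module.finrank F V' = n := by rw [← e, hV]
      rw [dif_pos hV, dif_pos hV']
      set a := Classical.choice (stEq hV)
      set b := Classical.choice (stEq hV')
      have hg' : g' = (f.symm.trans g).trans f := by
        ext v; simp [h]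
      have := hc (cjE a g) (a.symm.trans (f.trans b))
      rw [← this]
      congr 1
      ext1 v
      subst hg'
      have hi : ∀ w, (a.symm.trans (f.trans b))⁻¹ w = a (f.symm (b.symm w)) := by
        intro w; rfl
      simp [cjE, hi]
    · rw [dif_neg hV, dif_neg (by rwa [← e])])

theorem ext_hm (n : ℕ) (c : GS F n → ℂ) (hc : IsCls c) : Hm n (ext n c hc) := by
  intro V _ _ _ g h
  simp [ext, h]

@[simp] theorem ext_ev (n : ℕ) (c : GS F n → ℂ) (hc : IsCls c) (g : GS F n) :
    (ext n c hc).ev g = c g := by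
  have h : Module.finrank F (St F n) = n := by simp
  simp only [ext, CF.ev_mk', h, dif_pos]
  set a := Classical.choice (stEq (F := F) (V := St F n) h)
  rw [← hc g a]
  rfl

theorem ev_cls (φ : CF F) : IsCls (fun g : V ≃ₗ[F] V => φ.ev g) := by
  intro g h
  exact ev_cjE φ h g

theorem one_ev0 (g : GS F 0) : (1 : CF F).ev g = 1 := by
  rw [CF.ev_one, if_pos]
  exact (inferInstance : Subsingleton (Fin 0 → F))

/-- characters of degree `n` -/
def Ch (n : ℕ) (φ : CF F) : Prop := Hm n φ ∧ IsChar (fun g : GS F n => φ.ev g)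
/-- irreducible characters of degree `n` -/
def Ir (n : ℕ) (φ : CF F) : Prop := Hm n φ ∧ IsIrr (fun g : GS F n => φ.ev g)

theorem pr_ip (n : ℕ) (φ χ : CF F) : pr n φ χ = ip (fun g : GS F n => φ.ev g) (fun g => χ.ev g) := rfl

theorem Hm.zero (n : ℕ) : Hm n (0 : CF F) := fun _ _ _ _ _ _ => rfl
theorem Hm.add {n : ℕ} {φ ψ : CF F} (h : Hm n φ) (h' : Hm n ψ) : Hm n (φ + ψ) := by
  intro V _ _ _ g hV; simp [h V g hV, h' V g hV]
theorem Hm.sub {n : ℕ} {φ ψ : CF F} (h : Hm n φ) (h' : Hm n ψ) : Hm n (φ - ψ) := by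
  intro V _ _ _ g hV; simp [h V g hV, h' V g hV]
theorem Hm.smul {n : ℕ} {φ : CF F} (h : Hm n φ) (c : ℂ) : Hm n (c • φ) := by
  intro V _ _ _ g hV; simp [h V g hV]
theorem Hm.sum {n : ℕ} {ι : Type*} {s : Finset ι} {f : ι → CF F} (h : ∀ i ∈ s, Hm n (f i)) :
    Hm n (∑ i ∈ s, f i) := by
  intro V _ _ _ g hV
  rw [CF.ev_sum]
  exact Finset.sum_eq_zero fun i hi => h i hi V g hV
theorem Hm.mul {n m : ℕ} {φ ψ : CF F} (h : Hm n φ) (h' : Hm m ψ) : Hm (n + m) (φ * ψ) := by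
  intro V _ _ _ g hV
  rw [CF.ev_mul]
  apply sm_zero'
  intro W
  rw [tm]
  split_ifs with hW
  · have := Submodule.finrank_quotient_add_finrank W
    by_cases h1 : Module.finrank F W = n
    · rw [h' _ _ (by omega), mul_zero]
    · rw [h _ _ h1, zero_mul]
  · rfl
theorem Hm.one : Hm 0 (1 : CF F) := by
  intro V _ _ _ g hV
  rw [CF.ev_one, if_neg]
  rwa [← Module.finrank_zero_iff (R := F)]

theorem pr_comm (n : ℕ) (φ χ : CF F) : pr n φ χ = pr n χ φ := prV_comm _ _ _
theorem pr_add (n : ℕ) (φ ψ χ : CF F) : pr n (φ + ψ) χ = pr n φ χ + pr n ψ χ := prV_add _ _ _ _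
theorem pr_sub (n : ℕ) (φ ψ χ : CF F) : pr n (φ - ψ) χ = pr n φ χ - pr n ψ χ := prV_sub _ _ _ _
theorem pr_smul (n : ℕ) (c : ℂ) (φ χ : CF F) : pr n (c • φ) χ = c * pr n φ χ := prV_smul _ _ _ _
theorem pr_add' (n : ℕ) (φ ψ χ : CF F) : pr n χ (φ + ψ) = pr n χ φ + pr n χ ψ := by
  rw [pr_comm, pr_add, pr_comm n φ, pr_comm n ψ]
theorem pr_sub' (n : ℕ) (φ ψ χ : CF F) : pr n χ (φ - ψ) = pr n χ φ - pr n χ ψ := by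
  rw [pr_comm, pr_sub, pr_comm n φ, pr_comm n ψ]
theorem pr_smul' (n : ℕ) (c : ℂ) (φ χ : CF F) : pr n χ (c • φ) = c * pr n χ φ := by
  rw [pr_comm, pr_smul, pr_comm n φ]
theorem pr_zero (n : ℕ) (χ : CF F) : pr n 0 χ = 0 := by
  simpa using pr_smul n 0 0 χ
theorem pr_zero' (n : ℕ) (χ : CF F) : pr n χ 0 = 0 := by rw [pr_comm, pr_zero]
theorem pr_sum {ι : Type*} (n : ℕ) (s : Finset ι) (f : ι → CF F) (χ : CF F) :
    pr n (∑ i ∈ s, f i) χ = ∑ i ∈ s, pr n (f i) χ := by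
  induction s using Finset.induction_on with
  | empty => simp [pr_zero]
  | insert a s ha ih => rw [Finset.sum_insert ha, Finset.sum_insert ha, pr_add, ih]
theorem pr_sum' {ι : Type*} (n : ℕ) (s : Finset ι) (f : ι → CF F) (χ : CF F) :
    pr n χ (∑ i ∈ s, f i) = ∑ i ∈ s, pr n χ (f i) := by
  rw [pr_comm, pr_sum]; simp only [pr_comm n χ]
theorem pr_hm {n m : ℕ} {φ : CF F} (h : Hm m φ) (hne : m ≠ n) (χ : CF F) : pr n φ χ = 0 := by
  unfold pr prV
  apply av_zero'
  intro g
  rw [h _ _ (by simpa using hne.symm), zero_mul]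

theorem pr_nondeg {κ : CF F} (h : ∀ n φ, pr n φ κ = 0) : κ = 0 := by
  apply CF.ext'
  intro V _ _ _ g
  obtain ⟨f⟩ := stEq (F := F) (V := V) rfl
  rw [← ev_cjE κ f]
  exact til_pos κ (h _ _) _

/-- adjoint of multiplication by (the degree `k` part of) `X` -/
noncomputable def st (k : ℕ) (X χ : CF F) : CF F :=
  CF.mk' (fun V _ _ _ x => av fun y : GS F k => X.ev y * rr χ x y⁻¹) (by
    intro V V' _ _ _ _ _ _ f g g' h
    apply av_congr
    intro y
    rw [rr_inv χ f (LinearEquiv.refl F _) g g' y⁻¹ y⁻¹ h (fun _ => rfl)])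

theorem st_ev (k : ℕ) (X χ : CF F) (x : V ≃ₗ[F] V) :
    (st k X χ).ev x = av fun y : GS F k => X.ev y * rr χ x y⁻¹ := rfl

theorem prr_st (a b : ℕ) (φ ψ χ : CF F) :
    prr (St F a) (St F b) φ ψ χ = pr a φ (st b ψ χ) := by
  unfold prr pr prV
  apply av_congr
  intro x
  rw [st_ev, ← av_mul_left]
  apply av_congr; intro y; ring

theorem adj (n : ℕ) (φ ψ χ : CF F) : pr n (φ * ψ) χ = ∑ p ∈ ad n, pr p.1 φ (st p.2 ψ χ) := by
  unfold pr
  rw [adjunction (n := n) (by simp)]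
  apply Finset.sum_congr rfl
  intro p _
  exact prr_st _ _ _ _ _

theorem st_hm_ne {k m : ℕ} {X : CF F} (h : Hm m X) (hne : m ≠ k) (χ : CF F) : st k X χ = 0 := by
  apply CF.ext'
  intro V _ _ _ g
  rw [st_ev, CF.ev_zero]
  apply av_zero'
  intro y
  rw [h _ _ (by simpa using hne.symm), zero_mul]

theorem adj' {k : ℕ} {X : CF F} (hX : Hm k X) (n : ℕ) (φ χ : CF F) :
    pr (n + k) (φ * X) χ = pr n φ (st k X χ) := by
  rw [adj, Finset.sum_eq_single (n, k)]
  · rintro ⟨a, b⟩ hab hne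
    rw [st_hm_ne hX, pr_zero']
    rintro rfl
    apply hne
    simp [ad] at hab ⊢
    omega
  · simp [ad]

theorem st_add (k : ℕ) (X Y χ : CF F) : st k (X + Y) χ = st k X χ + st k Y χ := by
  apply CF.ext'; intro V _ _ _ g
  simp [st_ev, ← av_add, add_mul]
theorem st_smul (k : ℕ) (c : ℂ) (X χ : CF F) : st k (c • X) χ = c • st k X χ := by
  apply CF.ext'; intro V _ _ _ g
  simp [st_ev, ← av_mul_left, mul_assoc]
theorem st_add' (k : ℕ) (X χ χ' : CF F) : st k X (χ + χ') = st k X χ + st k X χ' := by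
  apply CF.ext'; intro V _ _ _ g
  simp [st_ev, ← av_add, rr_add, mul_add]
theorem st_smul' (k : ℕ) (c : ℂ) (X χ : CF F) : st k X (c • χ) = c • st k X χ := by
  apply CF.ext'; intro V _ _ _ g
  simp only [st_ev, CF.ev_smul, ← av_mul_left, rr_smul]
  apply av_congr; intro y; ring
theorem st_zero (k : ℕ) (χ : CF F) : st k 0 χ = 0 := by simpa using st_smul k 0 0 χ
theorem st_zero' (k : ℕ) (χ : CF F) : st k χ 0 = 0 := by simpa using st_smul' k 0 χ 0
theorem st_sub (k : ℕ) (X Y χ : CF F) : st k (X - Y) χ = st k X χ - st k Y χ := by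
  rw [eq_sub_iff_add_eq, ← st_add, sub_add_cancel]
theorem st_sub' (k : ℕ) (X Y χ : CF F) : st k χ (X - Y) = st k χ X - st k χ Y := by
  rw [eq_sub_iff_add_eq, ← st_add', sub_add_cancel]
theorem st_sum {ι : Type*} (k : ℕ) (s : Finset ι) (f : ι → CF F) (χ : CF F) :
    st k (∑ i ∈ s, f i) χ = ∑ i ∈ s, st k (f i) χ := by
  induction s using Finset.induction_on with
  | empty => simp [st_zero]
  | insert a s ha ih => rw [Finset.sum_insert ha, Finset.sum_insert ha, st_add, ih]
theorem st_sum' {ι : Type*} (k : ℕ) (s : Finset ι) (f : ι → CF F) (χ : CF F) :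
    st k χ (∑ i ∈ s, f i) = ∑ i ∈ s, st k χ (f i) := by
  induction s using Finset.induction_on with
  | empty => simp [st_zero']
  | insert a s ha ih => rw [Finset.sum_insert ha, Finset.sum_insert ha, st_add', ih]

theorem st_st {k l : ℕ} {X Y : CF F} (hX : Hm k X) (hY : Hm l Y) (χ : CF F) :
    st k X (st l Y χ) = st (k + l) (X * Y) χ := by
  rw [← sub_eq_zero]
  apply pr_nondeg
  intro n φ
  rw [pr_sub', ← adj' hX, ← adj' hY, ← adj' (hX.mul hY), mul_assoc, add_assoc, sub_self]

theorem st_comm {k l : ℕ} {X Y : CF F} (hX : Hm k X) (hY : Hm l Y) (χ : CF F) :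
    st k X (st l Y χ) = st l Y (st k X χ) := by
  rw [st_st hX hY, st_st hY hX, mul_comm, add_comm]

theorem rr_hm {n : ℕ} {χ : CF F} (h : Hm n χ) (x : E ≃ₗ[F] E) (y : Q ≃ₗ[F] Q)
    (hne : Module.finrank F E + Module.finrank F Q ≠ n) : rr χ x y = 0 := by
  unfold rr
  apply av_zero'
  intro u
  apply h
  rw [Module.finrank_prod]; omega

theorem st_hm {n k : ℕ} {χ : CF F} (h : Hm (n + k) χ) (X : CF F) : Hm n (st k X χ) := by
  intro V _ _ _ x hV
  rw [st_ev]
  apply av_zero'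
  intro y
  rw [rr_hm h, mul_zero]
  simpa using hV

theorem st_hm_lt {n k : ℕ} {χ : CF F} (h : Hm n χ) (hk : n < k) (X : CF F) : st k X χ = 0 := by
  apply CF.ext'
  intro V _ _ _ x
  rw [st_ev, CF.ev_zero]
  apply av_zero'
  intro y
  rw [rr_hm h, mul_zero]
  simp; omega

/-- `st` on products -/
theorem st_mul {ι : Type*} {k : ℕ} {X : CF F} (s : ℕ × ℕ → Finset ι) (A B : ℕ × ℕ → ι → CF F)
    (h : ∀ p ∈ ad k, ∀ (y₁ : GS F p.1) (y₂ : GS F p.2), rr X y₁ y₂ =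
      ∑ i ∈ s p, (A p i).ev y₁ * (B p i).ev y₂) (φ ψ : CF F) :
    st k X (φ * ψ) = ∑ p ∈ ad k, ∑ i ∈ s p, st p.1 (A p i) φ * st p.2 (B p i) ψ := by
  apply CF.ext'
  intro V _ _ _ x
  simp only [CF.ev_sum, CF.ev_mul]
  simp only [← sm_finset]
  rw [st_ev]
  simp only [hopfR, ← sm_mul_left]
  rw [av_sm_comm]
  apply sm_congr
  intro E1
  by_cases hE : ∀ v ∈ E1, x v ∈ E1
  · simp only [dif_pos hE, tm_pos _ _ _ _ hE]
    have h1 : av (fun y : GS F k => X.ev y * (rR φ (sub x E1 hE) * rR ψ (quo x E1 hE)).ev y⁻¹) =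
      pr k (rR φ (sub x E1 hE) * rR ψ (quo x E1 hE)) X := by rw [pr_comm]; rfl
    rw [h1, pr, adjunction (n := k) (by simp)]
    apply Finset.sum_congr rfl
    intro p hp
    unfold prr
    simp only [h p hp, Finset.mul_sum, av_finset]
    apply Finset.sum_congr rfl
    intro i _
    rw [st_ev, st_ev, ← av_mul_right, ← av_equiv (Equiv.inv (GS F p.1))]
    apply av_congr
    intro y₁
    rw [← av_mul_left, ← av_equiv (Equiv.inv (GS F p.2))]
    apply av_congr
    intro y₂
    simp only [Equiv.inv_apply, inv_inv, rR_ev]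
    ring
  · simp [dif_neg hE, tm, av_zero]

theorem st_zero_one (φ : CF F) : st 0 1 φ = φ := by
  apply CF.ext'
  intro V _ _ _ x
  rw [st_ev]
  haveI : Unique (GS F 0) := ⟨⟨1⟩, fun a => by ext v i; exact i.elim0⟩
  rw [av_unique, rr_of_subsingleton_right, one_ev0, one_mul]

theorem st_full {n : ℕ} {φ : CF F} (hφ : Hm n φ) (X : CF F) :
    st n X φ = pr n X φ • 1 := by
  apply Hm.ext (n := 0) (st_hm (by simpa using hφ) X) (Hm.one.smul _)
  intro g
  rw [st_ev, CF.ev_smul, one_ev0, mul_one]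
  apply av_congr
  intro y
  rw [rr_of_subsingleton_left]

/-- cuspidality -/
def Cu (k : ℕ) (X : CF F) : Prop := ∀ a b, a ≠ 0 → b ≠ 0 → a + b = k →
  ∀ (x : GS F a) (y : GS F b), rr X x y = 0

theorem st_deriv {k : ℕ} (hk : k ≠ 0) {X : CF F} (hX : Cu k X) (φ ψ : CF F) :
    st k X (φ * ψ) = st k X φ * ψ + φ * st k X ψ := by
  rw [st_mul (k := k) (X := X) (fun p => if p.1 = 0 ∨ p.2 = 0 then {()} else ∅)
    (fun p _ => if p.1 = 0 then 1 else X) (fun p _ => if p.1 = 0 then X else 1)]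
  · rw [← Finset.sum_subset (s₁ := {(k, 0), (0, k)})]
    · rw [Finset.sum_pair (by simp [hk])]
      simp [hk, st_zero_one]
    · intro p hp; simp at hp; rcases hp with rfl | rfl <;> simp [ad]
    · rintro ⟨a, b⟩ hp h2
      simp [ad] at hp h2
      rw [if_neg]
      · simp
      · simp only; omega
  · rintro ⟨a, b⟩ hp y₁ y₂
    simp [ad] at hp
    rcases Nat.eq_zero_or_pos a with rfl | ha
    · simp [rr_of_subsingleton_left, one_ev0]
    rcases Nat.eq_zero_or_pos b with rfl | hb
    · simp [rr_of_subsingleton_right, one_ev0, ha.ne']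
    · simp [ha.ne', hb.ne', hX a b ha.ne' hb.ne' hp]

theorem st_glike {X : CF F} {k : ℕ} (h : ∀ (a b : ℕ), a + b = k → ∀ (x : GS F a) (y : GS F b),
    rr X x y = X.ev x * X.ev y)
    (φ ψ : CF F) : st k X (φ * ψ) = ∑ p ∈ ad k, st p.1 X φ * st p.2 X ψ := by
  rw [st_mul (k := k) (X := X) (fun p => {()}) (fun p _ => X) (fun p _ => X)]
  · simp
  · rintro ⟨a, b⟩ hp x y
    simp [ad] at hp
    simp [h a b hp]

end LMT

namespace LMT
variable {F : Type} [Field F]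
variable {V V' E Q E' Q' : Type} [AddCommGroup V] [Module F V] [Finite V]
  [AddCommGroup V'] [Module F V'] [Finite V'] [AddCommGroup E] [Module F E] [Finite E]
  [AddCommGroup Q] [Module F Q] [Finite Q] [AddCommGroup E'] [Module F E'] [Finite E']
  [AddCommGroup Q'] [Module F Q'] [Finite Q']


/-- the block triangular group -/
@[ext] structure BG (F E Q : Type) [Field F] [AddCommGroup E] [Module F E] [AddCommGroup Q]
    [Module F Q] where
  x : E ≃ₗ[F] E
  y : Q ≃ₗ[F] Q
  u : Q →ₗ[F] E

namespace BG

instance : Mul (BG F E Q) := ⟨fun a b => ⟨a.x * b.x, a.y * b.y, a.x.toLinearMap ∘ₗ b.u +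
  a.u ∘ₗ b.y.toLinearMap⟩⟩
instance : One (BG F E Q) := ⟨⟨1, 1, 0⟩⟩
instance : Inv (BG F E Q) := ⟨fun a => ⟨a.x⁻¹, a.y⁻¹, - (a.x⁻¹.toLinearMap ∘ₗ a.u ∘ₗ
  a.y⁻¹.toLinearMap)⟩⟩
@[simp] theorem mul_x (a b : BG F E Q) : (a * b).x = a.x * b.x := rfl
@[simp] theorem mul_y (a b : BG F E Q) : (a * b).y = a.y * b.y := rfl
@[simp] theorem mul_u (a b : BG F E Q) : (a * b).u = a.x.toLinearMap ∘ₗ b.u +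
  a.u ∘ₗ b.y.toLinearMap := rfl
@[simp] theorem one_x : (1 : BG F E Q).x = 1 := rfl
@[simp] theorem one_y : (1 : BG F E Q).y = 1 := rfl
@[simp] theorem one_u : (1 : BG F E Q).u = 0 := rfl

instance : Group (BG F E Q) := Group.ofLeftAxioms
  (by
    intro a b c
    ext v
    · rfl
    · rfl
    · simp [add_assoc])
  (by
    intro a
    ext v
    · rfl
    · rfl
    · change a.u v + 0 = _
      simp)
  (by
    intro a
    ext v
    · change a.x.symm (a.x v) = v; simp
    · change a.y.symm (a.y v) = v; simp
    · change a.x.symm (a.u v) + -(a.x.symm (a.u (a.y.symm (a.y v)))) = 0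
      simp)

def eqv : BG F E Q ≃ (E ≃ₗ[F] E) × (Q ≃ₗ[F] Q) × (Q →ₗ[F] E) where
  toFun a := (a.x, a.y, a.u)
  invFun a := ⟨a.1, a.2.1, a.2.2⟩
  left_inv _ := rfl
  right_inv _ := rfl

instance : Finite (BG F E Q) := Finite.of_equiv _ eqv.symm

def toG : BG F E Q →* ((Q × E) ≃ₗ[F] (Q × E)) where
  toFun a := bl a.x a.y a.u
  map_one' := by ext v <;> simp
  map_mul' a b := by
    ext v <;> simp [add_assoc]

def hx : BG F E Q →* (E ≃ₗ[F] E) := ⟨⟨BG.x, rfl⟩, fun _ _ => rfl⟩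
def hy : BG F E Q →* (Q ≃ₗ[F] Q) := ⟨⟨BG.y, rfl⟩, fun _ _ => rfl⟩
def lx : (E ≃ₗ[F] E) →* BG F E Q where
  toFun x := ⟨x, 1, 0⟩
  map_one' := rfl
  map_mul' a b := by ext v <;> simp

def kerE : (hx (F := F) (E := E) (Q := Q)).ker ≃ (Q ≃ₗ[F] Q) × (Q →ₗ[F] E) where
  toFun a := (a.1.y, a.1.u)
  invFun a := ⟨⟨1, a.1, a.2⟩, rfl⟩
  left_inv a := by
    apply Subtype.ext
    have h : a.1.x = 1 := a.2
    ext1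
    · exact h.symm
    · rfl
    · rfl
  right_inv _ := rfl

end BG

variable [Finite F]

theorem Ch.isCharV {n : ℕ} {χ : CF F} (h : Ch n χ) (hV : Module.finrank F V = n) :
    IsChar (fun g : V ≃ₗ[F] V => χ.ev g) := by
  obtain ⟨f⟩ := stEq hV
  have := h.2.comap (cjE f).toMonoidHom
  convert this using 2 with g
  exact (ev_cjE χ f g).symm

theorem Ch.st {n k : ℕ} {X χ : CF F} (hX : Ch k X) (h : Ch (n + k) χ) : Ch n (st k X χ) := by
  refine ⟨st_hm h.1 X, ?_⟩
  have hc : IsChar (fun p : BG F (St F n) (St F k) => X.ev (p.y)⁻¹ * χ.ev (bl p.x p.y p.u)) := by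
    apply IsChar.mul
    · exact (hX.2.dual).comap BG.hy
    · exact (h.isCharV (V := St F k × St F n) (by simp [add_comm])).comap BG.toG
  have := hc.average (L := GS F n) (K := (BG.hx (F := F) (E := St F n) (Q := St F k)).ker)
    BG.lx (Subgroup.subtype _) (by
      intro a b
      refine ⟨⟨BG.lx a * b.1 * (BG.lx a)⁻¹, ?_⟩, ?_⟩
      · exact (MonoidHom.normal_ker _).conj_mem _ b.2 _
      · simp)
  convert this using 2 with x
  rw [st_ev]
  rw [← av_equiv BG.kerE.symm, av_prod, ← av_equiv (Equiv.inv (GS F k))]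
  apply av_congr
  intro y
  rw [Equiv.inv_apply, inv_inv, rr, ← av_mul_left]
  rw [← av_equiv (LinearEquiv.congrRight (M := St F k) x).toEquiv]
  apply av_congr
  intro u
  have h1 : ((BG.lx x : BG F (St F n) (St F k)) *
      (Subgroup.subtype _) (BG.kerE.symm (y, u))) = ⟨x, y, x.toLinearMap ∘ₗ u⟩ := by
    ext v
    · rfl
    · rfl
    · simp [BG.lx, BG.kerE]
  rw [h1]
  rfl

theorem Ch.hm {n : ℕ} {χ : CF F} (h : Ch n χ) : Hm n χ := h.1
theorem Ir.hm {n : ℕ} {χ : CF F} (h : Ir n χ) : Hm n χ := h.1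
theorem Ir.ch {n : ℕ} {χ : CF F} (h : Ir n χ) : Ch n χ := ⟨h.1, h.2.1⟩
theorem Ir.self {n : ℕ} {χ : CF F} (h : Ir n χ) : pr n χ χ = 1 := h.2.2
theorem Ir.mk' {n : ℕ} {χ : CF F} (h : Ch n χ) (h1 : pr n χ χ = 1) : Ir n χ := ⟨h.1, h.2, h1⟩
theorem Ir.orth {n : ℕ} {χ ψ : CF F} (h : Ir n χ) (h' : Ir n ψ) (hne : χ ≠ ψ) : pr n χ ψ = 0 := by
  apply irr_orth h.2 h'.2
  intro he
  exact hne (h.1.ext h'.1 (fun g => congrFun he g))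
theorem pr_nat {n : ℕ} {χ ψ : CF F} (h : Ch n χ) (h' : Ch n ψ) : ∃ m : ℕ, pr n χ ψ = m :=
  ip_char_nat h.2 h'.2

theorem Ch.zero (n : ℕ) : Ch n (0 : CF F) := ⟨Hm.zero n, IsChar.zero⟩
theorem Ch.add {n : ℕ} {χ ψ : CF F} (h : Ch n χ) (h' : Ch n ψ) : Ch n (χ + ψ) :=
  ⟨h.1.add h'.1, h.2.add h'.2⟩
theorem Ch.sum {n : ℕ} {ι : Type*} {s : Finset ι} {f : ι → CF F} (h : ∀ i ∈ s, Ch n (f i)) :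
    Ch n (∑ i ∈ s, f i) := by
  induction s using Finset.induction_on with
  | empty => simpa using Ch.zero n
  | insert a s ha ih =>
    rw [Finset.sum_insert ha]
    exact (h a (by simp)).add (ih fun i hi => h i (by simp [hi]))

theorem isCls_comp (n : ℕ) (φ : CF F) : IsCls (fun g : GS F n => φ.ev g) := ev_cls φ

theorem irr_ext {n : ℕ} {c : GS F n → ℂ} (h : IsIrr c) : Ir n (ext n c h.1.cls) := by
  refine ⟨ext_hm _ _ _, ?_⟩
  simpa using h

theorem Ch.of_nat {n : ℕ} {χ : CF F} (h : Hm n χ) (h' : ∀ π, Ir n π → ∃ m : ℕ, pr n χ π = m) :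
    Ch n χ := by
  refine ⟨h, (isCls_comp n χ).isChar ?_⟩
  intro c hc
  obtain ⟨m, hm⟩ := h' _ (irr_ext hc)
  refine ⟨m, ?_⟩
  rw [← hm, pr_ip]
  simp

theorem Ch.mul {n m : ℕ} {χ ψ : CF F} (h : Ch n χ) (h' : Ch m ψ) : Ch (n + m) (χ * ψ) := by
  apply Ch.of_nat (h.1.mul h'.1)
  intro π hπ
  rw [adj' h'.1]
  exact pr_nat h (h'.st hπ.ch)

/-- the finite set of irreducible characters in degree `n` -/
noncomputable def irF (F : Type) [Field F] [Finite F] (n : ℕ) : Finset (CF F) :=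
  (irrs (GS F n)).attach.image (fun c => ext n c.1 (mem_irrs.1 c.2).1.cls)

@[simp] theorem mem_irF {n : ℕ} {π : CF F} : π ∈ irF F n ↔ Ir n π := by
  simp only [irF, Finset.mem_image, Finset.mem_attach, true_and, Subtype.exists]
  constructor
  · rintro ⟨c, hc, rfl⟩
    exact irr_ext (mem_irrs.1 hc)
  · intro h
    refine ⟨_, mem_irrs.2 h.2, ?_⟩
    apply Hm.ext (ext_hm _ _ _) h.1
    intro g
    simp

theorem Hm.eq_zero {n : ℕ} {φ : CF F} (h : Hm n φ) (h' : ∀ π, Ir n π → pr n φ π = 0) : φ = 0 := by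
  apply h.ext (Hm.zero n)
  intro g
  refine congrFun (cls_eq_zero (isCls_comp n φ) ?_) g
  intro c hc
  rw [← h' _ (irr_ext hc), pr_ip]
  simp

theorem pr_irF {n : ℕ} (c : CF F → ℂ) {π : CF F} (h : Ir n π) :
    pr n (∑ χ ∈ irF F n, c χ • χ) π = c π := by
  rw [pr_sum, Finset.sum_eq_single π]
  · rw [pr_smul, h.self, mul_one]
  · intro χ hχ hne
    rw [pr_smul, (mem_irF.1 hχ).orth h hne, mul_zero]
  · intro hh; exact absurd (mem_irF.2 h) hh

theorem Hm.expand {n : ℕ} {φ : CF F} (h : Hm n φ) : φ = ∑ π ∈ irF F n, pr n φ π • π := by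
  rw [← sub_eq_zero]
  apply Hm.eq_zero (n := n)
  · exact h.sub (Hm.sum fun π hπ => (mem_irF.1 hπ).hm.smul _)
  · intro π hπ
    rw [pr_sub, pr_irF _ hπ, sub_self]

theorem Hm.pr_eq {n : ℕ} {φ : CF F} (h : Hm n φ) (ψ : CF F) :
    pr n φ ψ = ∑ π ∈ irF F n, pr n φ π * pr n π ψ := by
  conv_lhs => rw [h.expand, pr_sum]
  simp only [pr_smul]

theorem Ch.ex_irr {n : ℕ} {φ : CF F} (h : Ch n φ) (h0 : φ ≠ 0) : ∃ π, Ir n π ∧ pr n φ π ≠ 0 := by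
  by_contra! hc
  exact h0 (h.1.eq_zero hc)

theorem Ch.sub_irr {n : ℕ} {φ π : CF F} (h : Ch n φ) (hπ : Ir n π) (hne : pr n φ π ≠ 0) :
    Ch n (φ - π) := by
  apply Ch.of_nat (h.1.sub hπ.1)
  intro σ hσ
  rw [pr_sub]
  obtain ⟨m, hm⟩ := pr_nat h hσ.ch
  by_cases he : π = σ
  · subst he
    rw [hπ.self]
    have : m ≠ 0 := by rintro rfl; simp [hm] at hne
    refine ⟨m - 1, ?_⟩
    rw [hm, Nat.cast_sub (by omega)]; simp
  · rw [hπ.orth hσ he]; exact ⟨m, by simp [hm]⟩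

theorem Ch.eq_zero_of_norm {n : ℕ} {φ : CF F} (h : Ch n φ) (h0 : pr n φ φ = 0) : φ = 0 := by
  apply h.1.eq_zero
  intro π hπ
  rw [h.1.pr_eq] at h0
  choose! m hm using fun π (hπ : Ir n π) => pr_nat h hπ.ch
  rw [Finset.sum_congr rfl (g := fun π => ((m π * m π : ℕ) : ℂ))] at h0
  · rw [← Nat.cast_sum] at h0
    have h1 : ∑ π ∈ irF F n, m π * m π = 0 := by exact_mod_cast h0
    rw [Finset.sum_eq_zero_iff] at h1
    have := h1 π (mem_irF.2 hπ)
    rw [hm π hπ]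
    simp at this; simp [this]
  · intro σ hσ
    rw [pr_comm n σ, hm σ (mem_irF.1 hσ)]; push_cast; ring

theorem Ch.mult {n : ℕ} {φ ψ : CF F} (h : Ch n φ) (h' : Ch n ψ) {π : CF F} (hπ : Ir n π)
    (h1 : pr n φ π ≠ 0) (h2 : pr n ψ π ≠ 0) : pr n φ ψ ≠ 0 := by
  choose! m hm using fun π (hπ : Ir n π) => pr_nat h hπ.ch
  choose! l hl using fun π (hπ : Ir n π) => pr_nat h' hπ.ch
  rw [h.1.pr_eq, Finset.sum_congr rfl (g := fun π => ((m π * l π : ℕ) : ℂ))]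
  · rw [← Nat.cast_sum]
    rw [hm π hπ] at h1
    rw [hl π hπ] at h2
    have h1' : m π ≠ 0 := by rintro h; simp [h] at h1
    have h2' : l π ≠ 0 := by rintro h; simp [h] at h2
    have := Finset.single_le_sum (f := fun π => m π * l π) (fun i _ => Nat.zero_le _)
      (mem_irF.2 hπ)
    have h3 : 0 < m π * l π := Nat.mul_pos (Nat.pos_of_ne_zero h1') (Nat.pos_of_ne_zero h2')
    have h4 : ∑ π ∈ irF F n, m π * l π ≠ 0 := by
      omega
    exact_mod_cast h4
  · intro σ hσ
    rw [pr_comm n σ, hm σ (mem_irF.1 hσ), hl σ (mem_irF.1 hσ)]; push_cast; ring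

theorem Ir.ne_zero {n : ℕ} {π : CF F} (h : Ir n π) : π ≠ 0 := by
  rintro rfl
  have := h.self
  rw [pr_zero] at this
  exact zero_ne_one this

theorem Ir.one : Ir 0 (1 : CF F) := by
  refine ⟨Hm.one, ?_⟩
  have h : (fun g : GS F 0 => (1 : CF F).ev g) = fun _ => 1 := by
    ext g; exact one_ev0 g
  rw [h]
  exact triv_irr

theorem Ir.eq_one {π : CF F} (h : Ir 0 π) : π = 1 := by
  by_contra hne
  have h3 := h.orth Ir.one hne
  have h2 := h.self
  haveI : Unique (GS F 0) := ⟨⟨1⟩, fun a => by ext v i; exact i.elim0⟩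
  simp only [pr, prV, av_unique, one_ev0] at h3 h2
  rw [mul_one] at h3
  rw [h3] at h2
  simp at h2

/-- degree zero characters -/
theorem Hm.deg_zero {φ : CF F} (h : Hm 0 φ) : φ = pr 0 φ 1 • 1 := by
  apply h.ext (Hm.one.smul _)
  intro g
  haveI : Unique (GS F 0) := ⟨⟨1⟩, fun a => by ext v i; exact i.elim0⟩
  rw [CF.ev_smul, one_ev0, mul_one]
  simp only [pr, prV, av_unique, one_ev0, mul_one]
  congr 1
  exact Subsingleton.elim _ _

end LMT

namespace LMT
variable {F : Type} [Field F]
variable {V V' E Q E' Q' : Type} [AddCommGroup V] [Module F V] [Finite V]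
  [AddCommGroup V'] [Module F V'] [Finite V'] [AddCommGroup E] [Module F E] [Finite E]
  [AddCommGroup Q] [Module F Q] [Finite Q] [AddCommGroup E'] [Module F E'] [Finite E']
  [AddCommGroup Q'] [Module F Q'] [Finite Q']


theorem card_hom (F E Q : Type) [Field F] [AddCommGroup E] [Module F E] [Finite E]
    [AddCommGroup Q] [Module F Q] [Finite Q] :
    Nat.card (Q →ₗ[F] E) = Nat.card F ^ (Module.finrank F E * Module.finrank F Q) := by
  rw [Module.natCard_eq_pow_finrank (K := F), Module.finrank_linearMap, mul_comm]

variable [Finite F]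

/-- field size -/
noncomputable abbrev qF (F : Type) : ℂ := (Nat.card F : ℂ)

/-- the group-like element attached to the degree -/
noncomputable def om (F : Type) [Field F] : CF F :=
  CF.mk' (fun V _ _ _ g => if g = 1 then qF F ^ ((Module.finrank F V).choose 2) else 0) (by
    intro V V' _ _ _ _ _ _ f g g' h
    have hg' : g' = cjE f g := by
      ext v; have := h (f.symm v); simp at this; simp [cjE, this]
    subst hg'
    have e : cjE f g = 1 ↔ g = 1 := by
      rw [← map_one (cjE f)]; exact (cjE f).injective.eq_iff
    simp only [e, f.finrank_eq])

theorem om_ev (g : V ≃ₗ[F] V) :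
    (om F).ev g = if g = 1 then qF F ^ ((Module.finrank F V).choose 2) else 0 := rfl

/-- `q^dim` twist -/
noncomputable def om' (F : Type) [Field F] : CF F :=
  CF.mk' (fun V _ _ _ g => qF F ^ Module.finrank F V * (om F).ev g) (by
    intro V V' _ _ _ _ _ _ f g g' h
    rw [CF.ev_inv _ f g g' h, f.finrank_eq])

theorem om'_ev (g : V ≃ₗ[F] V) :
    (om' F).ev g = qF F ^ Module.finrank F V * (om F).ev g := rfl

theorem qF_ne : qF F ≠ 0 := by
  have : Nat.card F ≠ 0 := Nat.card_pos.ne'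
  exact_mod_cast this

theorem om_glike (x : E ≃ₗ[F] E) (y : Q ≃ₗ[F] Q) : rr (om F) x y = (om F).ev x * (om F).ev y := by
  have h1 : ∀ u : Q →ₗ[F] E, bl x y u = 1 ↔ x = 1 ∧ y = 1 ∧ u = 0 := by
    intro u
    constructor
    · intro h
      have h' : ∀ c e, (y c, x e + u c) = (c, e) := fun c e => LinearEquiv.congr_fun h (c, e)
      have hu : u = 0 := by ext c; simpa using (Prod.ext_iff.1 (h' c 0)).2
      refine ⟨?_, ?_, hu⟩
      · ext e; simpa using (Prod.ext_iff.1 (h' 0 e)).2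
      · ext c; simpa using (Prod.ext_iff.1 (h' c 0)).1
    · rintro ⟨rfl, rfl, rfl⟩; ext v <;> simp
  unfold rr
  simp only [om_ev, h1]
  by_cases hx : x = 1
  · by_cases hy : y = 1
    · simp only [hx, hy, true_and, if_true]
      rw [av, sm_single (0 : Q →ₗ[F] E) _ (fun b hb => by simp [hb]), card_hom, Module.finrank_prod]
      have hq : qF F ≠ 0 := qF_ne
      have h2 : (Module.finrank F Q + Module.finrank F E).choose 2 = (Module.finrank F Q).choose 2
        + (Module.finrank F E).choose 2 + Module.finrank F E * Module.finrank F Q := by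
        have h3 : ∀ a b : ℕ, (a + b).choose 2 = a.choose 2 + b.choose 2 + b * a := by
          intro a b
          have : (((a + b).choose 2 : ℕ) : ℚ) = ((a.choose 2 + b.choose 2 + b * a : ℕ) : ℚ) := by
            push_cast [Nat.cast_choose_two]; ring
          exact_mod_cast this
        exact h3 _ _
      rw [h2]
      push_cast
      simp only [if_true]
      field_simp
      ring
    · simp [hy, av_zero]
  · simp [hx, av_zero]

/-- group-like elements -/
def GLike (X : CF F) : Prop := ∀ (E Q : Type) [AddCommGroup E] [Module F E] [Finite E]
  [AddCommGroup Q] [Module F Q] [Finite Q] (x : E ≃ₗ[F] E) (y : Q ≃ₗ[F] Q),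
  rr X x y = X.ev x * X.ev y

theorem om_gl : GLike (om F) := fun _ _ _ _ _ _ _ _ x y => om_glike x y

theorem GLike.st {X : CF F} (h : GLike X) (m : ℕ) (ψ : CF F) : st m ψ X = pr m ψ X • X := by
  apply CF.ext'
  intro V _ _ _ x
  rw [st_ev, CF.ev_smul]
  unfold pr prV
  rw [← av_mul_right]
  apply av_congr
  intro y
  rw [h]; ring

theorem GLike.pr_mul {X : CF F} (h : GLike X) (a : ℕ) {b : ℕ} (φ : CF F) {ψ : CF F} (hψ : Hm b ψ) :
    pr (a + b) (φ * ψ) X = pr a φ X * pr b ψ X := by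
  rw [adj' hψ, h.st, pr_smul', mul_comm]

theorem GLike.st_mul {X : CF F} (h : GLike X) (k : ℕ) (φ ψ : CF F) :
    LMT.st k X (φ * ψ) = ∑ p ∈ ad k, LMT.st p.1 X φ * LMT.st p.2 X ψ :=
  st_glike (fun _ _ _ x y => h _ _ x y) φ ψ

/-- order factor -/
noncomputable def cN (F : Type) (n : ℕ) : ℂ := ∏ i ∈ Finset.range n, (qF F ^ (i + 1) - 1)

theorem card_pow_ne (i : ℕ) : qF F ^ (i + 1) - 1 ≠ 0 := by
  have h : 1 < Nat.card F := Finite.one_lt_card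
  have : 1 < Nat.card F ^ (i + 1) := Nat.one_lt_pow (by omega) h
  rw [sub_ne_zero]
  intro h2
  have h3 : Nat.card F ^ (i + 1) = 1 := by exact_mod_cast h2
  omega

theorem cN_ne (n : ℕ) : cN F n ≠ 0 := Finset.prod_ne_zero_iff.2 fun i _ => card_pow_ne i

theorem card_GS (n : ℕ) : (Nat.card (GS F n) : ℂ) = qF F ^ (n.choose 2) * cN F n := by
  cases nonempty_fintype F
  have h1 : Nat.card (GS F n) = Nat.card (GL (Fin n) F) :=
    Nat.card_congr ((Matrix.GeneralLinearGroup.toLin (n := Fin n) (R := F)).trans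
      (LinearMap.GeneralLinearGroup.generalLinearEquiv F (Fin n → F))).symm.toEquiv
  rw [h1, Matrix.card_GL_field]
  have hq : ((Fintype.card F : ℕ) : ℂ) = qF F := by simp [qF]
  have h2 : ∀ i : Fin n, ((Fintype.card F ^ n - Fintype.card F ^ (i : ℕ) : ℕ) : ℂ) =
      qF F ^ (i : ℕ) * (qF F ^ (n - 1 - (i : ℕ) + 1) - 1) := by
    intro i
    have hi := i.2
    rw [Nat.cast_sub (Nat.pow_le_pow_right Fintype.card_pos hi.le)]
    push_cast
    rw [hq, mul_sub, ← pow_add, mul_one]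
    congr 2; omega
  push_cast
  rw [Finset.prod_congr rfl (fun i _ => h2 i), Finset.prod_mul_distrib, Finset.prod_pow_eq_pow_sum]
  congr 1
  · rw [Fin.sum_univ_eq_sum_range (fun i => i), Finset.sum_range_id, Nat.choose_two_right]
  · rw [Fin.prod_univ_eq_prod_range (fun i => qF F ^ (n - 1 - i + 1) - 1) n,
      Finset.prod_range_reflect (fun i => qF F ^ (i + 1) - 1) n]
    rfl

/-- normalized degree -/
noncomputable def fd (n : ℕ) (χ : CF F) : ℂ := pr n χ (om F)

theorem fd_eq (n : ℕ) (χ : CF F) : fd n χ = χ.ev (1 : GS F n) / cN F n := by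
  unfold fd pr prV
  have hq : qF F ≠ 0 := qF_ne
  have := cN_ne (F := F) n
  rw [av, sm_single 1, om_ev, card_GS]
  · simp
    field_simp
  · intro b hb
    rw [om_ev, if_neg, mul_zero]
    simpa using hb

theorem fd_mul (a : ℕ) {b : ℕ} (φ : CF F) {ψ : CF F} (hψ : Hm b ψ) :
    fd (a + b) (φ * ψ) = fd a φ * fd b ψ := om_gl.pr_mul a φ hψ

end LMT

namespace LMT
variable {F : Type} [Field F]
variable {V V' E Q E' Q' : Type} [AddCommGroup V] [Module F V] [Finite V]
  [AddCommGroup V'] [Module F V'] [Finite V'] [AddCommGroup E] [Module F E] [Finite E]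
  [AddCommGroup Q] [Module F Q] [Finite Q] [AddCommGroup E'] [Module F E'] [Finite E']
  [AddCommGroup Q'] [Module F Q'] [Finite Q']

variable [Finite F]

/-- iterated Whittaker-type averages -/
noncomputable def AA (ψ : AddChar F ℂ) (χ : CF F) : (k : ℕ) → ∀ (W : Type) [AddCommGroup W]
    [Module F W] [Finite W], (W ≃ₗ[F] W) → (W →ₗ[F] F) → ℂ
  | 0, _, _, _, _, g, _ => χ.ev g
  | k + 1, W, _, _, _, g, l => av fun u : F →ₗ[F] W => ψ (-(l (u 1))) *
      AA ψ χ k (F × W) (bl g 1 u) (LinearMap.fst F F W)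

variable (ψ : AddChar F ℂ)

theorem AA_zero (χ : CF F) (g : V ≃ₗ[F] V) (l : V →ₗ[F] F) : AA ψ χ 0 V g l = χ.ev g := rfl
theorem AA_succ (χ : CF F) (k : ℕ) (g : V ≃ₗ[F] V) (l : V →ₗ[F] F) :
    AA ψ χ (k + 1) V g l = av fun u : F →ₗ[F] V => ψ (-(l (u 1))) *
      AA ψ χ k (F × V) (bl g 1 u) (LinearMap.fst F F V) := rfl

theorem AA_inv (χ : CF F) (k : ℕ) : ∀ (W W' : Type) [AddCommGroup W] [Module F W] [Finite W]
    [AddCommGroup W'] [Module F W'] [Finite W'] (f : W ≃ₗ[F] W') (g : W ≃ₗ[F] W) (g' : W' ≃ₗ[F] W')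
    (l : W →ₗ[F] F) (l' : W' →ₗ[F] F) (_ : ∀ v, f (g v) = g' (f v)) (_ : ∀ v, l v = l' (f v)),
    AA ψ χ k W g l = AA ψ χ k W' g' l' := by
  induction k with
  | zero => intro W W' _ _ _ _ _ _ f g g' l l' h _; exact CF.ev_inv χ f g g' h
  | succ k ih =>
    intro W W' _ _ _ _ _ _ f g g' l l' h hl
    rw [AA_succ, AA_succ, ← av_equiv (LinearEquiv.congrRight (M := F) f).toEquiv]
    apply av_congr
    intro u
    have h1 : l (u 1) = l' ((LinearEquiv.congrRight (M := F) f u) 1) := by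
      rw [hl]; rfl
    simp only [LinearEquiv.coe_toEquiv]
    rw [h1]
    congr 1
    apply ih _ _ ((LinearEquiv.refl F F).prodCongr f)
    · rintro ⟨c, w⟩
      simp [LinearEquiv.congrRight, h]
    · rintro ⟨c, w⟩; rfl

theorem AA_congr (k : ℕ) : ∀ (W : Type) [AddCommGroup W] [Module F W] [Finite W]
    (χ χ' : CF F) (_ : ∀ (U : Type) [AddCommGroup U] [Module F U] [Finite U] (g : U ≃ₗ[F] U),
      Module.finrank F U = k + Module.finrank F W → χ.ev g = χ'.ev g)
    (g : W ≃ₗ[F] W) (l : W →ₗ[F] F), AA ψ χ k W g l = AA ψ χ' k W g l := by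
  induction k with
  | zero => intro W _ _ _ χ χ' h g l; exact h W g (by simp)
  | succ k ih =>
    intro W _ _ _ χ χ' h g l
    rw [AA_succ, AA_succ]
    apply av_congr
    intro u
    rw [ih (F × W) χ χ']
    intro U _ _ _ g hU
    apply h U g
    rw [hU, Module.finrank_prod, Module.finrank_self]; ring

theorem AA_lin (k : ℕ) : ∀ (W : Type) [AddCommGroup W] [Module F W] [Finite W]
    (c : ℂ) (χ χ' : CF F) (g : W ≃ₗ[F] W) (l : W →ₗ[F] F),
    AA ψ (c • χ + χ') k W g l = c * AA ψ χ k W g l + AA ψ χ' k W g l := by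
  induction k with
  | zero => intro W _ _ _ c χ χ' g l; simp [AA_zero]
  | succ k ih =>
    intro W _ _ _ c χ χ' g l
    rw [AA_succ, AA_succ, AA_succ, ← av_mul_left, ← av_add]
    apply av_congr
    intro u
    rw [ih]; ring

theorem AA_zero_cf (k : ℕ) (g : V ≃ₗ[F] V) (l : V →ₗ[F] F) : AA ψ 0 k V g l = 0 := by
  have := AA_lin ψ k V (-1) (0 : CF F) 0 g l
  simpa using this

theorem AA_sum {ι : Type*} (k : ℕ) (s : Finset ι) (c : ι → ℂ) (f : ι → CF F) (g : V ≃ₗ[F] V)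
    (l : V →ₗ[F] F) :
    AA ψ (∑ i ∈ s, c i • f i) k V g l = ∑ i ∈ s, c i * AA ψ (f i) k V g l := by
  induction s using Finset.induction_on with
  | empty => simp [AA_zero_cf]
  | insert a s ha ih => rw [Finset.sum_insert ha, Finset.sum_insert ha, AA_lin, ih]

theorem AA_rR (χ : CF F) (x : E ≃ₗ[F] E) (k : ℕ) : ∀ (W : Type) [AddCommGroup W] [Module F W]
    [Finite W] (y : W ≃ₗ[F] W) (l : W →ₗ[F] F), AA ψ (rR χ x) k W y l =
      av fun u : W →ₗ[F] E => AA ψ χ k (W × E) (bl x y u) (l ∘ₗ LinearMap.fst F W E) := by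
  induction k with
  | zero => intro W _ _ _ y l; rfl
  | succ k ih =>
    intro W _ _ _ y l
    simp only [AA_succ]
    have h1 : ∀ v : F →ₗ[F] W, ψ (-(l (v 1))) * AA ψ (rR χ x) k (F × W) (bl y 1 v)
        (LinearMap.fst F F W) = av fun u : W →ₗ[F] E => av fun z : F →ₗ[F] E =>
          ψ (-(l (v 1))) * AA ψ χ k (F × (W × E)) (bl (bl x y u) 1 (v.prod z))
            (LinearMap.fst F F (W × E)) := by
      intro v
      rw [ih, ← av_equiv (LinearMap.coprodEquiv (R := F) (S := F) (M := F) (M₂ := W)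
        (M₃ := E)).toEquiv, av_prod, av_comm, ← av_mul_left]
      apply av_congr
      intro u
      rw [← av_mul_left]
      apply av_congr
      intro z
      congr 1
      apply AA_inv ψ χ k _ _ (LinearEquiv.prodAssoc F F W E)
      · rintro ⟨⟨c, w⟩, e⟩
        simp
        abel_nf
      · rintro ⟨⟨c, w⟩, e⟩; rfl
    rw [av_congr h1, av_comm]
    apply av_congr
    intro u
    rw [← av_equiv (LinearMap.prodEquiv (R := F) F (M := F) (M₂ := W) (M₃ := E)).toEquiv,
      av_prod]
    apply av_congr
    intro v
    apply av_congr
    intro z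
    rfl

/-- Gelfand-Graev element -/
noncomputable def Gm : CF F :=
  CF.mk' (fun V _ _ _ g => ∑ π ∈ irF F (Module.finrank F V),
      AA ψ π (Module.finrank F V) (St F 0) 1 0 * π.ev g) (by
    intro V V' _ _ _ _ _ _ f g g' h
    rw [f.finrank_eq]
    apply Finset.sum_congr rfl
    intro π _
    rw [CF.ev_inv _ f g g' h])

theorem Gm_ev {n : ℕ} (g : GS F n) : (Gm ψ).ev g = (∑ π ∈ irF F n,
      AA ψ π n (St F 0) 1 0 • π).ev g := by
  rw [CF.ev_sum]
  have : Module.finrank F (St F n) = n := by simp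
  simp only [Gm, CF.ev_mk', CF.ev_smul, this]

theorem pr_Gm (n : ℕ) (χ : CF F) : pr n χ (Gm ψ) = AA ψ χ n (St F 0) 1 0 := by
  have h1 : pr n χ (Gm ψ) = pr n χ (∑ π ∈ irF F n, AA ψ π n (St F 0) 1 0 • π) := by
    unfold pr prV
    simp only [Gm_ev]
  set χ' := ext n (fun g : GS F n => χ.ev g) (ev_cls χ) with hχ'
  have h2 : AA ψ χ n (St F 0) 1 0 = AA ψ χ' n (St F 0) 1 0 := by
    apply AA_congr
    intro U _ _ _ g hU
    obtain ⟨f⟩ := stEq (F := F) (V := U) (n := n) (by rw [hU]; simp)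
    rw [← ev_cjE _ f, ← ev_cjE χ' f, hχ', ext_ev]
  have h3 : ∀ π, pr n χ π = pr n χ' π := by
    intro π
    unfold pr prV
    simp only [hχ', ext_ev]
  have h4 : χ' = ∑ π ∈ irF F n, pr n χ' π • π := Hm.expand (ext_hm n _ (ev_cls χ))
  have h5 : AA ψ χ' n (St F 0) 1 0 = ∑ π ∈ irF F n, pr n χ' π * AA ψ π n (St F 0) 1 0 := by
    conv_lhs => rw [h4]
    rw [AA_sum]
  rw [h1, h2, pr_sum', h5]
  apply Finset.sum_congr rfl
  intro π _
  rw [pr_smul', h3, mul_comm]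

theorem st_Gm (k : ℕ) (χ : CF F) (x : V ≃ₗ[F] V) : (st k (Gm ψ) χ).ev x = AA ψ χ k V x 0 := by
  have h1 : (st k (Gm ψ) χ).ev x = pr k (Gm ψ) (rR χ x) := by
    rw [st_ev]; rfl
  rw [h1, pr_comm, pr_Gm, AA_rR]
  have : Unique (St F 0 →ₗ[F] V) := ⟨⟨0⟩, fun u => by ext i; exact i.elim0⟩
  rw [av_unique]
  apply AA_inv ψ χ k _ _ (LinearEquiv.prodUnique (R := F) (M := V) (M₂ := St F 0) |>.symm |>.trans (LinearEquiv.prodComm F V (St F 0)) |>.symm)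
  · rintro ⟨c, w⟩
    have : c = 0 := Subsingleton.elim _ _
    subst this
    have h0 : (default : St F 0 →ₗ[F] V) 0 = 0 := map_zero _
    simp [h0, -Matrix.zero_empty]
  · rintro ⟨c, w⟩; simp
end LMT

namespace LMT
variable {F : Type} [Field F]
variable {V V' E Q E' Q' : Type} [AddCommGroup V] [Module F V] [Finite V]
  [AddCommGroup V'] [Module F V'] [Finite V'] [AddCommGroup E] [Module F E] [Finite E]
  [AddCommGroup Q] [Module F Q] [Finite Q] [AddCommGroup E'] [Module F E'] [Finite E']
  [AddCommGroup Q'] [Module F Q'] [Finite Q']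

variable [Finite F] {ψ : AddChar F ℂ}

theorem dual_sum (hψ : ψ ≠ 1) {w : E} (hw : w ≠ 0) : sm (fun a : E →ₗ[F] F => ψ (-(a w))) = 0 := by
  obtain ⟨c, hc⟩ := (AddChar.ne_one_iff).1 hψ
  have h1 : ∃ b : E →ₗ[F] F, b w ≠ 0 := by
    by_contra! h
    exact hw ((Module.forall_dual_apply_eq_zero_iff F w).1 h)
  obtain ⟨b, hb⟩ := h1
  set b' : E →ₗ[F] F := (-(c / b w)) • b with hb'
  have hbw : -(b' w) = c := by simp [hb']; field_simp
  have h2 : sm (fun a : E →ₗ[F] F => ψ (-(a w))) = ψ c * sm (fun a : E →ₗ[F] F => ψ (-(a w))) := by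
    conv_lhs => rw [← sm_equiv (Equiv.addLeft b')]
    rw [← sm_mul_left]
    apply sm_congr
    intro a
    rw [← hbw, ← AddChar.map_add_eq_mul]
    congr 1
    simp; ring
  have h3 : (1 - ψ c) * sm (fun a : E →ₗ[F] F => ψ (-(a w))) = 0 := by linear_combination h2
  rcases mul_eq_zero.1 h3 with h | h
  · exact absurd (sub_eq_zero.1 h).symm hc
  · exact h

theorem fst_iso (a : E →ₗ[F] F) (ha : a ≠ 0) {j : ℕ} (hE : Module.finrank F E = j + 1) :
    ∃ f : E ≃ₗ[F] (F × St F j), ∀ v, a v = (f v).1 := by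
  have hs : Function.Surjective a := LinearMap.surjective ha
  obtain ⟨w, hw⟩ := hs 1
  have hk : Module.finrank F (LinearMap.ker a) = j := by
    have h1 := LinearMap.finrank_range_add_finrank_ker a
    rw [LinearMap.range_eq_top.2 hs, finrank_top, Module.finrank_self] at h1
    omega
  obtain ⟨e⟩ := stEq hk
  let f0 : E →ₗ[F] F × LinearMap.ker a := a.prod
    ((LinearMap.id - (LinearMap.toSpanSingleton F E w) ∘ₗ a).codRestrict _ (by
      intro v; simp [hw]))
  have hinj : Function.Injective f0 := by
    rw [← LinearMap.ker_eq_bot, LinearMap.ker_eq_bot']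
    intro v hv
    have h1 : a v = 0 := congrArg Prod.fst hv
    have h2 : v - a v • w = 0 := congrArg (fun z => ((Prod.snd z : LinearMap.ker a) : E)) hv
    simpa [h1] using h2
  let f1 : E ≃ₗ[F] F × LinearMap.ker a := LinearEquiv.ofInjectiveOfFinrankEq f0 hinj (by
    rw [Module.finrank_prod, Module.finrank_self, hk, hE]; ring)
  refine ⟨f1.trans ((LinearEquiv.refl F F).prodCongr e), fun v => rfl⟩

variable (ψ) in
/-- recursion pieces -/
noncomputable def aA (χ : CF F) (j k : ℕ) : ℂ := AA ψ χ k (St F j) 1 0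
variable (ψ) in
noncomputable def aB (χ : CF F) (j k : ℕ) : ℂ := AA ψ χ k (F × St F j) 1 (LinearMap.fst F F _)

theorem aB_sum (hψ : ψ ≠ 1) (χ : CF F) (j k : ℕ) :
    aB ψ χ j k = sm fun a : St F j →ₗ[F] F => AA ψ χ (k + 1) (St F j) 1 a := by
  simp only [AA_succ]
  rw [← av_sm_comm, av, sm_single 0]
  · simp only [LinearMap.zero_apply, map_zero, neg_zero, AddChar.map_zero_eq_one, one_mul]
    rw [sm_const, card_hom, card_hom]
    have hq : qF F ≠ 0 := qF_ne
    have h1 : (bl 1 1 0 : (F × St F j) ≃ₗ[F] (F × St F j)) = 1 := by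
      apply LinearEquiv.ext; rintro ⟨c, w⟩; simp
    rw [h1]
    have : Module.finrank F F = 1 := Module.finrank_self F
    rw [this]
    unfold aB
    simp only [mul_one, one_mul]
    have : (((Nat.card F ^ Module.finrank F (St F j) : ℕ)) : ℂ) ≠ 0 := by
      push_cast; exact pow_ne_zero _ hq
    field_simp
  · intro u hu
    rw [sm_mul_right, dual_sum hψ, zero_mul]
    intro h
    apply hu
    refine LinearMap.ext_ring ?_; simpa using h

theorem aB_zero (hψ : ψ ≠ 1) (χ : CF F) (k : ℕ) : aB ψ χ 0 k = aA ψ χ 0 (k + 1) := by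
  rw [aB_sum hψ]
  have : Unique (St F 0 →ₗ[F] F) := ⟨⟨0⟩, fun u => by ext i; exact i.elim0⟩
  rw [sm_unique]
  have h : ∀ u : St F 0 →ₗ[F] F, u = 0 := fun _ => Subsingleton.elim _ _
  unfold aA; congr 1; exact h _

theorem aB_succ (hψ : ψ ≠ 1) (χ : CF F) (j k : ℕ) : aB ψ χ (j + 1) k = aA ψ χ (j + 1) (k + 1) +
    (qF F ^ (j + 1) - 1) * aB ψ χ j (k + 1) := by
  rw [aB_sum hψ]
  have h1 : ∀ a : St F (j + 1) →ₗ[F] F, AA ψ χ (k + 1) (St F (j + 1)) 1 a = aB ψ χ j (k + 1) +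
      (if a = 0 then aA ψ χ (j + 1) (k + 1) - aB ψ χ j (k + 1) else 0) := by
    intro a
    split_ifs with ha
    · subst ha; simp [aA]
    · obtain ⟨f, hf⟩ := fst_iso a ha (j := j) (by simp)
      rw [add_zero]
      exact AA_inv ψ χ _ _ _ f _ _ _ _ (fun _ => rfl) hf
  rw [sm_congr h1, sm_add, sm_const, sm_single 0 (fun a => if a = 0 then _ else _)
    (fun b hb => if_neg hb), card_hom]
  simp
  ring

theorem aB_expand (hψ : ψ ≠ 1) (χ : CF F) (j : ℕ) : ∀ k, aB ψ χ j k / cN F j =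
    ∑ i ∈ Finset.range (j + 1), aA ψ χ (j - i) (k + 1 + i) / cN F (j - i) := by
  induction j with
  | zero => intro k; simp [aB_zero hψ]
  | succ j ih =>
    intro k
    have h1 := cN_ne (F := F) j
    have h2 := card_pow_ne (F := F) j
    have h3 : cN F (j + 1) = cN F j * (qF F ^ (j + 1) - 1) := Finset.prod_range_succ _ _
    rw [Finset.sum_range_succ', aB_succ hψ, add_div]
    have h4 : (qF F ^ (j + 1) - 1) * aB ψ χ j (k + 1) / cN F (j + 1) = aB ψ χ j (k + 1) / cN F j := by
      rw [h3]; field_simp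
    rw [h4, ih, add_comm]
    congr 1
    apply Finset.sum_congr rfl
    intro i _
    rw [show j + 1 - (i + 1) = j - i by omega, show k + 1 + (i + 1) = k + 1 + 1 + i by omega]

theorem om_Gm (hψ : ψ ≠ 1) : om F * Gm ψ = om' F := by
  rw [← sub_eq_zero]
  apply pr_nondeg
  intro n χ
  rw [pr_sub', sub_eq_zero, pr_comm, adj]
  have h1 : pr n χ (om' F) = qF F ^ n * (χ.ev (1 : GS F n) / cN F n) := by
    rw [← fd_eq]
    unfold fd pr prV
    rw [← av_mul_left]
    apply av_congr
    intro g
    rw [om'_ev]; simp; ring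
  have h2 : ∀ p ∈ ad n, pr p.1 (om F) (st p.2 (Gm ψ) χ) = aA ψ χ p.1 p.2 / cN F p.1 := by
    intro p _
    rw [pr_comm]
    change fd _ _ = _
    rw [fd_eq, st_Gm]; rfl
  rw [h1, Finset.sum_congr rfl h2]
  rcases n with _ | n
  · simp [aA, AA_zero]
  · unfold ad; rw [Finset.Nat.antidiagonal_succ', Finset.sum_cons, Finset.sum_map]
    have h3 : aA ψ χ (n + 1) 0 = χ.ev (1 : GS F (n + 1)) := rfl
    have h4 : ∑ x ∈ ad n, aA ψ χ x.1 (x.2 + 1) / cN F x.1 = aB ψ χ n 0 / cN F n := by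
      unfold ad; rw [aB_expand hψ, Finset.Nat.sum_antidiagonal_eq_sum_range_succ_mk,
        ← Finset.sum_range_reflect]
      apply Finset.sum_congr rfl
      intro i hi
      have := Finset.mem_range.1 hi
      rw [show n.succ - 1 - i = n - i by omega, show n - (n - i) = i by omega,
        show 0 + 1 + i = i + 1 by omega]
    have h5 : aB ψ χ n 0 = χ.ev (1 : GS F (n + 1)) := by
      unfold aB
      rw [AA_zero]
      obtain ⟨f⟩ := stEq (F := F) (V := F × St F n) (n := n + 1) (by
        rw [Module.finrank_prod]; simp [add_comm])
      exact CF.ev_inv χ f _ _ (fun _ => rfl)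
    have h6 : cN F (n + 1) = cN F n * (qF F ^ (n + 1) - 1) := Finset.prod_range_succ _ _
    have h7 := cN_ne (F := F) n
    have h8 := card_pow_ne (F := F) n
    simp only [Function.Embedding.prodMap, Function.Embedding.coeFn_mk, Prod.map,
      Function.Embedding.refl_apply, Nat.succ_eq_add_one]
    rw [h4, h3, h5, h6]
    field_simp
    ring

end LMT

namespace LMT
variable {F : Type} [Field F]
variable {V V' E Q E' Q' : Type} [AddCommGroup V] [Module F V] [Finite V]
  [AddCommGroup V'] [Module F V'] [Finite V'] [AddCommGroup E] [Module F E] [Finite E]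
  [AddCommGroup Q] [Module F Q] [Finite Q] [AddCommGroup E'] [Module F E'] [Finite E']
  [AddCommGroup Q'] [Module F Q'] [Finite Q']

variable [Finite F] {ψ : AddChar F ℂ}

theorem om_sub [Subsingleton V] (g : V ≃ₗ[F] V) : (om F).ev g = 1 := by
  rw [om_ev, if_pos (by ext v; exact Subsingleton.elim _ _)]
  simp [Module.finrank_zero_of_subsingleton]

theorem ev_quo_bot (φ : CF F) (g : V ≃ₗ[F] V) (h) : φ.ev (quo g ⊥ h) = φ.ev g := by
  symm
  apply CF.ev_inv _ (Submodule.quotEquivOfEqBot ⊥ rfl).symm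
  intro v
  rfl

theorem quot_lt (W : Submodule F V) (hW : W ≠ ⊥) :
    Module.finrank F (V ⧸ W) < Module.finrank F V := by
  have h1 := Submodule.finrank_quotient_add_finrank W
  have h2 : Module.finrank F W ≠ 0 := fun h => hW (Submodule.finrank_eq_zero.1 h)
  omega

theorem Gm_gl (hψ : ψ ≠ 1) : GLike (Gm ψ) := by
  have key : ∀ N : ℕ, ∀ (E Q : Type) [AddCommGroup E] [Module F E] [Finite E]
      [AddCommGroup Q] [Module F Q] [Finite Q] (x : E ≃ₗ[F] E) (y : Q ≃ₗ[F] Q),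
      Module.finrank F E + Module.finrank F Q = N →
      rr (Gm ψ) x y = (Gm ψ).ev x * (Gm ψ).ev y := by
    intro N
    induction N using Nat.strong_induction_on with
    | _ N ih =>
    intro E Q _ _ _ _ _ _ x y hN
    have h1 : rr (om' F) x y = (om' F).ev x * (om' F).ev y := by
      have h0 : rr (om' F) x y = qF F ^ (Module.finrank F Q + Module.finrank F E) * rr (om F) x y := by
        unfold rr
        rw [← av_mul_left]
        apply av_congr
        intro u
        rw [om'_ev, Module.finrank_prod]
      rw [h0, om_glike, om'_ev, om'_ev]; ring
    rw [← om_Gm hψ, hopf, CF.ev_mul, CF.ev_mul] at h1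
    have h2 : ∀ E1 Q1, ((E1, Q1) : Submodule F E × Submodule F Q) ≠ (⊥, ⊥) →
        htm (om F) (Gm ψ) x y E1 Q1 = tm (om F) (Gm ψ) x E1 * tm (om F) (Gm ψ) y Q1 := by
      intro E1 Q1 hne
      unfold htm tm
      by_cases hx : ∀ v ∈ E1, x v ∈ E1
      · by_cases hy : ∀ v ∈ Q1, y v ∈ Q1
        · rw [dif_pos ⟨hx, hy⟩, dif_pos hx, dif_pos hy, om_glike, ih _ _ _ _ _ _ rfl]
          · ring
          · rw [← hN]
            have e1 := Submodule.finrank_quotient_le E1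
            have e2 := Submodule.finrank_quotient_le Q1
            by_cases hE : E1 = ⊥
            · have := quot_lt Q1 (fun h => hne (by rw [hE, h]))
              omega
            · have := quot_lt E1 hE
              omega
        · rw [dif_neg (fun h => hy h.2), dif_neg hy, mul_zero]
      · rw [dif_neg (fun h => hx h.1), dif_neg hx, zero_mul]
    have h3 : sm (fun p : Submodule F E × Submodule F Q => htm (om F) (Gm ψ) x y p.1 p.2 -
        tm (om F) (Gm ψ) x p.1 * tm (om F) (Gm ψ) y p.2) = 0 := by
      rw [sm_sub, sm_prod, sm_prod, h1]
      simp only [sm_mul_left, sm_mul_right]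
      ring
    rw [sm_single (⊥, ⊥) _ (fun p hp => by rw [h2 p.1 p.2 hp, sub_self]), sub_eq_zero] at h3
    have hbx : ∀ v ∈ (⊥ : Submodule F E), x v ∈ (⊥ : Submodule F E) := by
      intro v hv; rw [Submodule.mem_bot] at hv ⊢; rw [hv, map_zero]
    have hby : ∀ v ∈ (⊥ : Submodule F Q), y v ∈ (⊥ : Submodule F Q) := by
      intro v hv; rw [Submodule.mem_bot] at hv ⊢; rw [hv, map_zero]
    simp only [htm] at h3
    rw [dif_pos ⟨hbx, hby⟩, tm_pos _ _ _ _ hbx, tm_pos _ _ _ _ hby, om_glike, om_sub, om_sub,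
      ev_quo_bot, ev_quo_bot, one_mul, one_mul, one_mul, one_mul] at h3
    rw [← h3]
    apply rr_inv _ (Submodule.quotEquivOfEqBot ⊥ rfl).symm (Submodule.quotEquivOfEqBot ⊥ rfl).symm
    · intro v; rfl
    · intro v; rfl
  intro E Q _ _ _ _ _ _ x y
  exact key _ E Q x y rfl

/-- stabilizer of a functional -/
def stb (l : V →ₗ[F] F) : Subgroup (V ≃ₗ[F] V) where
  carrier := {g | ∀ v, l (g v) = l v}
  one_mem' := fun v => rfl
  mul_mem' := by intro a b ha hb v; exact (ha _).trans (hb v)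
  inv_mem' := by
    intro a ha v
    rw [← ha (a⁻¹ v)]
    congr 1
    exact LinearEquiv.apply_symm_apply a v

def stP (l : V →ₗ[F] F) : Subgroup (BG F V F) where
  carrier := {a | a.y = 1 ∧ a.x ∈ stb l}
  one_mem' := ⟨rfl, one_mem _⟩
  mul_mem' := by
    intro a b ha hb
    exact ⟨by simp [ha.1, hb.1], mul_mem ha.2 hb.2⟩
  inv_mem' := by
    intro a ha
    refine ⟨?_, inv_mem ha.2⟩
    have : (a⁻¹).y = a.y⁻¹ := rfl
    rw [this, ha.1, inv_one]

def stPl (l : V →ₗ[F] F) : stb l →* stP l where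
  toFun a := ⟨⟨a.1, 1, 0⟩, rfl, a.2⟩
  map_one' := rfl
  map_mul' a b := by
    apply Subtype.ext
    apply BG.ext
    · rfl
    · rfl
    · ext; simp

def stPk (l : V →ₗ[F] F) : Multiplicative (F →ₗ[F] V) →* stP l where
  toFun u := ⟨⟨1, 1, u.toAdd⟩, rfl, one_mem _⟩
  map_one' := rfl
  map_mul' a b := by
    apply Subtype.ext
    apply BG.ext
    · rfl
    · rfl
    · ext; simp [add_comm]

def stPf (l : V →ₗ[F] F) : stP l →* stb (LinearMap.fst F F V) where
  toFun a := ⟨BG.toG a.1, by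
    rintro ⟨c, v⟩
    have : a.1.y = 1 := a.2.1
    simp [BG.toG, this]⟩
  map_one' := by apply Subtype.ext; exact map_one BG.toG
  map_mul' a b := by apply Subtype.ext; exact map_mul BG.toG _ _

noncomputable def stPc (ψ : AddChar F ℂ) (l : V →ₗ[F] F) : stP l →* ℂˣ :=
  MonoidHom.toHomUnits
  { toFun := fun a => ψ (-(l (a.1.u 1)))
    map_one' := by simp
    map_mul' := by
      intro a b
      have h1 : b.1.y = 1 := b.2.1
      have h2 : ∀ v, l (a.1.x v) = l v := a.2.2
      rw [← AddChar.map_add_eq_mul]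
      congr 1
      simp [h1, h2] }

theorem AA_char {n : ℕ} {χ : CF F} (h : Ch n χ) (k : ℕ) : ∀ (W : Type) [AddCommGroup W] [Module F W]
    [Finite W] (l : W →ₗ[F] F), k + Module.finrank F W = n →
    IsChar (fun g : stb l => AA ψ χ k W g.1 l) := by
  induction k with
  | zero =>
    intro W _ _ _ l hn
    exact (h.isCharV (V := W) (by omega)).comap (stb l).subtype
  | succ k ih =>
    intro W _ _ _ l hn
    have h1 := (ih (F × W) (LinearMap.fst F F W) (by
      rw [Module.finrank_prod, Module.finrank_self]; omega)).comap (stPf l)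
    have h2 := ((IsChar.ofHom (stPc ψ l)).mul h1).average (stPl l) (stPk l) (by
      intro a b
      refine ⟨Multiplicative.ofAdd (a.1.toLinearMap ∘ₗ b.toAdd), ?_⟩
      apply Subtype.ext
      apply BG.ext
      · simp [stPl, stPk]
      · simp [stPl, stPk]
      · ext; simp [stPl, stPk])
    convert h2 using 1
    funext g
    rw [AA_succ, ← av_equiv ((LinearEquiv.congrRight (M := F) g.1).toEquiv : (F →ₗ[F] W) ≃ _)]
    refine (av_equiv (Multiplicative.toAdd : Multiplicative (F →ₗ[F] W) ≃ _) _).symm.trans ?_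
    apply av_congr
    intro u
    have hu : ((stPl l g) * (stPk l u)).1 = ⟨g.1, 1, g.1.toLinearMap ∘ₗ u.toAdd⟩ := by
      apply BG.ext
      · simp [stPl, stPk]
      · simp [stPl, stPk]
      · ext; simp [stPl, stPk]
    congr 1
    · change _ = ψ (-(l (((stPl l g) * (stPk l u)).1.u 1)))
      rw [hu]; rfl
    · change _ = AA ψ χ k (F × W) (BG.toG ((stPl l g) * (stPk l u)).1) _
      rw [hu]; rfl

theorem Gm_nat {n : ℕ} {χ : CF F} (h : Ch n χ) : ∃ m : ℕ, pr n χ (Gm ψ) = m := by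
  rw [pr_Gm]
  exact char_one_nat (AA_char h n (St F 0) 0 (by simp))
end LMT

namespace LMT
variable {F : Type} [Field F]
variable {V V' E Q E' Q' : Type} [AddCommGroup V] [Module F V] [Finite V]
  [AddCommGroup V'] [Module F V'] [Finite V'] [AddCommGroup E] [Module F E] [Finite E]
  [AddCommGroup Q] [Module F Q] [Finite Q] [AddCommGroup E'] [Module F E'] [Finite E']
  [AddCommGroup Q'] [Module F Q'] [Finite Q']

variable [Finite F]

theorem exists_ps (F : Type) [Field F] [Finite F] : ∃ ψ : AddChar F ℂ, ψ ≠ 1 := by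
  obtain ⟨ψ, h⟩ := AddChar.exists_apply_ne_zero.2 (one_ne_zero (α := F))
  refine ⟨ψ, fun h' => h (by simp [h'])⟩

/-- the Gelfand-Graev element for a chosen character -/
noncomputable def GG (F : Type) [Field F] [Finite F] : CF F := Gm (exists_ps F).choose

theorem GG_gl : GLike (GG F) := Gm_gl (exists_ps F).choose_spec
theorem om_GG : om F * GG F = om' F := om_Gm (exists_ps F).choose_spec

/-- Whittaker multiplicity -/
noncomputable def de (n : ℕ) (χ : CF F) : ℂ := pr n χ (GG F)

theorem de_nat {n : ℕ} {χ : CF F} (h : Ch n χ) : ∃ m : ℕ, de n χ = m := Gm_nat h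
theorem de_mul (a : ℕ) {b : ℕ} (φ : CF F) {ψ : CF F} (hψ : Hm b ψ) :
    de (a + b) (φ * ψ) = de a φ * de b ψ := GG_gl.pr_mul a φ hψ

theorem pr_om' (n : ℕ) (χ : CF F) : pr n χ (om' F) = qF F ^ n * fd n χ := by
  unfold fd pr prV
  rw [← av_mul_left]
  apply av_congr
  intro g
  rw [om'_ev]; simp; ring

theorem fd_rec (n : ℕ) (χ : CF F) : qF F ^ n * fd n χ = ∑ p ∈ ad n, fd p.1 (st p.2 (GG F) χ) := by
  rw [← pr_om', ← om_GG, pr_comm, adj]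
  apply Finset.sum_congr rfl
  intro p _
  rw [pr_comm]; rfl

theorem fd_om (n : ℕ) : fd n (om F) = qF F ^ (n.choose 2) / cN F n := by
  rw [fd_eq, om_ev]; simp

theorem q_sum (n : ℕ) : ∑ i ∈ Finset.range (n + 1), qF F ^ (i.choose 2) / cN F i =
    qF F ^ n * (qF F ^ (n.choose 2) / cN F n) := by
  induction n with
  | zero => simp
  | succ n ih =>
    have h1 := cN_ne (F := F) n
    have h2 := card_pow_ne (F := F) n
    have h3 : cN F (n + 1) = cN F n * (qF F ^ (n + 1) - 1) := Finset.prod_range_succ _ _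
    have h4 : (n + 1).choose 2 = n + n.choose 2 := by rw [Nat.choose_succ_succ' n 1]; simp
    rw [Finset.sum_range_succ, ih, h3, h4, pow_add]
    field_simp
    ring

theorem pr00 (φ χ : CF F) : pr 0 φ χ = φ.ev (1 : GS F 0) * χ.ev (1 : GS F 0) := by
  unfold pr prV
  have : Unique (GS F 0) := ⟨⟨1⟩, fun g => by ext v i; exact i.elim0⟩
  rw [av_unique]
  congr 2 <;> exact Subsingleton.elim _ _

theorem fd_GG (n : ℕ) : fd n (GG F) = 1 := by
  have h0 : ∀ n, qF F ^ n * fd n (om F) = ∑ p ∈ ad n, fd p.1 (om F) * fd p.2 (GG F) := by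
    intro n
    rw [fd_rec]
    apply Finset.sum_congr rfl
    intro p _
    rw [om_gl.st]
    unfold fd
    rw [pr_smul, mul_comm]
  induction n using Nat.strong_induction_on with
  | _ n ih =>
  have h1 := h0 n
  unfold ad at h1
  rw [Finset.Nat.sum_antidiagonal_eq_sum_range_succ_mk] at h1
  have h2 := q_sum (F := F) n
  rw [← fd_om n, h1, Finset.sum_range_succ', Finset.sum_range_succ', ] at h2
  have h5 : ∑ k ∈ Finset.range n, fd (k + 1, n - (k + 1)).1 (om F) * fd (k + 1, n - (k + 1)).2 (GG F)
      = ∑ i ∈ Finset.range n, qF F ^ ((i + 1).choose 2) / cN F (i + 1) := by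
    apply Finset.sum_congr rfl
    intro i hi
    have := Finset.mem_range.1 hi
    rw [fd_om]
    rw [ih _ (by simp only; omega), mul_one]
  rw [h5] at h2
  have h3 := add_left_cancel h2
  rw [fd_om] at h3
  simpa [cN] using h3.symm

theorem GG_norm_sum (n : ℕ) : ∑ i ∈ Finset.range (n + 1), pr i (GG F) (GG F) = qF F ^ n := by
  have h1 := fd_rec n (GG F)
  rw [fd_GG, mul_one] at h1
  rw [h1]
  unfold ad
  rw [Finset.Nat.sum_antidiagonal_eq_sum_range_succ_mk, ← Finset.sum_range_reflect]
  apply Finset.sum_congr rfl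
  intro i hi
  have := Finset.mem_range.1 hi
  rw [GG_gl.st]
  unfold fd
  rw [pr_smul]
  change _ = _ * fd _ _
  rw [fd_GG, mul_one]
  congr 1

theorem GG_norm (n : ℕ) : pr (n + 1) (GG F) (GG F) = qF F ^ (n + 1) - qF F ^ n := by
  have h1 := GG_norm_sum (F := F) (n + 1)
  rw [Finset.sum_range_succ, GG_norm_sum] at h1
  rw [← h1]; ring

theorem de_sq (n : ℕ) : ∑ π ∈ irF F n, de n π ^ 2 = pr n (GG F) (GG F) := by
  set G := ext n (fun g : GS F n => (GG F).ev g) (ev_cls _) with hG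
  have h3 : ∀ π, pr n π (GG F) = pr n π G := by
    intro π
    unfold pr prV
    simp only [hG, ext_ev]
  have h4 : pr n (GG F) (GG F) = pr n G G := by rw [h3, pr_comm, h3]
  rw [h4, Hm.pr_eq (ext_hm n _ (ev_cls _))]
  apply Finset.sum_congr rfl
  intro π _
  unfold de
  rw [h3, pr_comm]
  ring
end LMT

namespace LMT
variable {F : Type} [Field F]
variable {V V' E Q E' Q' : Type} [AddCommGroup V] [Module F V] [Finite V]
  [AddCommGroup V'] [Module F V'] [Finite V'] [AddCommGroup E] [Module F E] [Finite E]
  [AddCommGroup Q] [Module F Q] [Finite Q] [AddCommGroup E'] [Module F E'] [Finite E']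
  [AddCommGroup Q'] [Module F Q'] [Finite Q']


theorem schur_avg {G : Type} [Group G] [Fintype G] {V : Type} [AddCommGroup V] [Module ℂ V]
    [FiniteDimensional ℂ V] (ρ : Representation ℂ G V) (h : ip ρ.character ρ.character = 1)
    (X : V →ₗ[ℂ] V) : ∃ c : ℂ, (∑ g, ρ g * X * ρ g⁻¹ = c • (1 : V →ₗ[ℂ] V)) ∧
      c * LinearMap.trace ℂ V 1 = (Fintype.card G : ℂ) * LinearMap.trace ℂ V X := by
  have h1 : Module.finrank ℂ (Representation.IntertwiningMap ρ ρ) = 1 := by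
    have := Representation.card_inv_mul_sum_char_mul_char_eq_finrank ρ ρ
    rw [ip, av, sm_eq] at h
    rw [h] at this
    exact_mod_cast this.symm
  have hne : (Representation.IntertwiningMap.id ρ) ≠ 0 := by
    intro h0
    have : ∀ v : V, v = 0 := fun v => by
      have := congrArg (fun f : Representation.IntertwiningMap ρ ρ => f v) h0
      simpa using this
    have : Subsingleton V := ⟨fun a b => by rw [this a, this b]⟩
    have h2 : ρ.character = 0 := by
      ext g
      have : ρ g = 0 := LinearMap.ext fun v => Subsingleton.elim _ _
      simp [Representation.character, this]
    rw [h2] at h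
    simp [ip, av_zero] at h
  have key := (finrank_eq_one_iff_of_nonzero' _ hne).1 h1
  let T : Representation.IntertwiningMap ρ ρ :=
    { toLinearMap := ∑ g, ρ g * X * ρ g⁻¹
      isIntertwining' := by
        intro x
        change (∑ g, ρ g * X * ρ g⁻¹) * ρ x = ρ x * (∑ g, ρ g * X * ρ g⁻¹)
        rw [Finset.sum_mul, Finset.mul_sum, ← Equiv.sum_comp (Equiv.mulLeft x)]
        apply Finset.sum_congr rfl
        intro g _
        have e : ρ x⁻¹ * ρ x = 1 := by rw [← map_mul, inv_mul_cancel, map_one]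
        rw [Equiv.coe_mulLeft, mul_inv_rev, map_mul ρ x g, map_mul ρ g⁻¹ x⁻¹, mul_assoc _ _ (ρ x),
          mul_assoc _ _ (ρ x), e, mul_one]
        simp only [mul_assoc]}
  obtain ⟨c, hc⟩ := key T
  refine ⟨c, ?_, ?_⟩
  · ext v
    have := congrArg (fun f : Representation.IntertwiningMap ρ ρ => f v) hc
    exact this.symm
  · have h3 : ∑ g, ρ g * X * ρ g⁻¹ = c • (1 : V →ₗ[ℂ] V) := by
      ext v
      have := congrArg (fun f : Representation.IntertwiningMap ρ ρ => f v) hc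
      exact this.symm
    have h4 := congrArg (LinearMap.trace ℂ V) h3
    rw [map_sum, map_smul] at h4
    rw [smul_eq_mul] at h4
    rw [← h4]
    have : ∀ g, LinearMap.trace ℂ V (ρ g * X * ρ g⁻¹) = LinearMap.trace ℂ V X := by
      intro g
      rw [LinearMap.trace_mul_comm, ← mul_assoc, ← map_mul]; simp
    simp [this]

/-- Gelfand's trick, twisted by a linear character -/
theorem gelfand {G : Type} [Group G] [Finite G] {χ : G → ℂ} (hχ : IsIrr χ) {U : Type} [Finite U]
    (j : U → G) (hj : Function.Injective j) (u₁ : U) (mu : U → U → U)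
    (hmu : ∀ u v, j (mu u v) = j u * j v) (th th' : U → ℂ) (hth : ∀ u v, th (mu u v) = th u * th v)
    (hth' : ∀ u, th u * th' u = 1) (τ : G → G) (hτ : ∀ g h, τ (g * h) = τ h * τ g)
    (τU : U → U) (hτU : Function.Bijective τU) (hτj : ∀ u, τ (j u) = j (τU u))
    (hτth : ∀ u, th (τU u) = th u)
    (H : ∀ f : G → ℂ, (∀ u g, f (j u * g) = th u * f g) → (∀ u g, f (g * j u) = th u * f g) →
      ∀ g, f (τ g) = f g) :
    av (fun u => th' u * χ (j u)) = 0 ∨ av (fun u => th' u * χ (j u)) = 1 := by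
  obtain ⟨⟨V, _, _, _, ρ, rfl⟩, hip⟩ := hχ
  cases nonempty_fintype G
  cases nonempty_fintype U
  have hne : Nonempty U := ⟨u₁⟩
  have hcard : (Fintype.card U : ℂ) ≠ 0 := by exact_mod_cast Fintype.card_ne_zero
  have hcardG : (Fintype.card G : ℂ) ≠ 0 := by exact_mod_cast Fintype.card_ne_zero
  have hth0 : ∀ u, th u ≠ 0 := fun u h => by have := hth' u; simp [h] at this
  have hth'e : ∀ u, th' u = (th u)⁻¹ := fun u => by
    have := hth' u; field_simp [hth0 u]; linear_combination this
  have hL : ∀ u, Function.Bijective (mu u) := fun u => Finite.injective_iff_bijective.1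
    fun a b hab => hj (by
      have := congrArg j hab
      simp only [hmu] at this
      exact mul_left_cancel this)
  have hR : ∀ u, Function.Bijective (fun a => mu a u) := fun u => Finite.injective_iff_bijective.1
    fun a b hab => hj (by
      have := congrArg j hab
      simp only [hmu] at this
      exact mul_right_cancel this)
  obtain ⟨P, hP⟩ : ∃ P : V →ₗ[ℂ] V, P = (Fintype.card U : ℂ)⁻¹ • ∑ u, th' u • ρ (j u) := ⟨_, rfl⟩
  have hPl : ∀ u, ρ (j u) * P = th u • P := by
    intro u
    rw [hP, mul_smul_comm, smul_comm]
    congr 1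
    rw [Finset.mul_sum, Finset.smul_sum]
    conv_rhs => rw [← (Equiv.ofBijective _ (hL u)).sum_comp]
    apply Finset.sum_congr rfl
    intro v _
    simp only [Equiv.ofBijective_apply, hth'e, hth, hmu, map_mul]
    rw [mul_smul_comm, smul_smul]
    congr 1
    field_simp [hth0 u, hth0 v]
  have hPr : ∀ u, P * ρ (j u) = th u • P := by
    intro u
    rw [hP, smul_mul_assoc, smul_comm]
    congr 1
    rw [Finset.sum_mul, Finset.smul_sum]
    conv_rhs => rw [← (Equiv.ofBijective _ (hR u)).sum_comp]
    apply Finset.sum_congr rfl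
    intro v _
    simp only [Equiv.ofBijective_apply, hth'e, hth, hmu, map_mul]
    rw [smul_mul_assoc, smul_smul]
    congr 1
    field_simp [hth0 u, hth0 v]
  have hPP : P * P = P := by
    have e : P * P = ((Fintype.card U : ℂ)⁻¹ • ∑ u, th' u • ρ (j u)) * P := by rw [← hP]
    rw [e, smul_mul_assoc, Finset.sum_mul]
    have : ∀ u, th' u • ρ (j u) * P = P := fun u => by
      rw [smul_mul_assoc, hPl, smul_smul, mul_comm, hth', one_smul]
    simp only [this]
    rw [Finset.sum_const, Finset.card_univ, ← Nat.cast_smul_eq_nsmul ℂ, smul_smul,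
      inv_mul_cancel₀ hcard, one_smul]
  have hPτ : ∀ g, P * ρ (τ g) * P = P * ρ g * P := by
    intro g
    rw [← sub_eq_zero, ← Module.forall_dual_apply_eq_zero_iff ℂ]
    intro l
    rw [map_sub, sub_eq_zero]
    apply H (fun g => l (P * ρ g * P))
    · intro u g
      rw [map_mul ρ, ← mul_assoc, hPr, smul_mul_assoc, smul_mul_assoc, map_smul, smul_eq_mul]
    · intro u g
      rw [map_mul ρ, mul_assoc, mul_assoc, hPl, mul_smul_comm, mul_smul_comm, map_smul, smul_eq_mul,
        mul_assoc]
  have hexp : ∀ g h, P * ρ g * P * ρ h * P =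
      (Fintype.card U : ℂ)⁻¹ • ∑ u, th' u • (P * ρ (g * j u * h) * P) := by
    intro g h
    have e : P * ρ g * P * ρ h * P = P * ρ g * ((Fintype.card U : ℂ)⁻¹ • ∑ u, th' u • ρ (j u)) *
        ρ h * P := by rw [← hP]
    rw [e, mul_smul_comm, smul_mul_assoc, smul_mul_assoc, Finset.mul_sum, Finset.sum_mul,
      Finset.sum_mul]
    congr 1
    apply Finset.sum_congr rfl
    intro u _
    simp only [map_mul, smul_mul_assoc, mul_smul_comm, mul_assoc]
  have hcomm : ∀ g h, P * ρ g * P * ρ h * P = P * ρ h * P * ρ g * P := by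
    intro g h
    have h1 : P * ρ g * P * ρ h * P = P * ρ (τ h) * P * ρ (τ g) * P := by
      rw [hexp, hexp]
      conv_rhs => rw [← (Equiv.ofBijective _ hτU).sum_comp]
      congr 1
      apply Finset.sum_congr rfl
      intro u _
      simp only [Equiv.ofBijective_apply, hth'e, hτth]
      rw [← hPτ, hτ, hτ, hτj, mul_assoc (τ h)]
    rw [h1]
    have e : ∀ a b : V →ₗ[ℂ] V, P * a * P * b * P = (P * a * P) * (P * b * P) := by
      intro a b
      simp only [mul_assoc]
      rw [← mul_assoc P P (b * P), hPP]
    rw [e, e, hPτ, hPτ]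
  have htr : av (fun u => th' u * ρ.character (j u)) = LinearMap.trace ℂ V P := by
    rw [hP, map_smul, map_sum, av, sm_eq]
    simp [Representation.character, Nat.card_eq_fintype_card]
  rw [htr]
  by_cases hP0 : P = 0
  · left; rw [hP0, map_zero]
  right
  obtain ⟨x, hx⟩ : ∃ x, P x ≠ 0 := by
    by_contra! h; exact hP0 (LinearMap.ext h)
  have hIs : LinearMap.IsProj (LinearMap.range P) P :=
    ⟨fun v => LinearMap.mem_range_self _ _, fun v hv => by
      obtain ⟨w, rfl⟩ := hv
      exact congrArg (fun f : V →ₗ[ℂ] V => f w) hPP⟩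
  have htrP : LinearMap.trace ℂ V P = (Module.finrank ℂ (LinearMap.range P) : ℂ) := hIs.trace
  have htrP0 : LinearMap.trace ℂ V P ≠ 0 := by
    rw [htrP]
    have : Nontrivial (LinearMap.range P) :=
      ⟨⟨⟨P x, LinearMap.mem_range_self _ _⟩, 0, fun h => hx (congrArg Subtype.val h)⟩⟩
    exact_mod_cast Module.finrank_pos.ne'
  have sch := schur_avg ρ hip
  obtain ⟨cP, hcP, hcPt⟩ := sch P
  have hcP0 : cP ≠ 0 := by
    rintro rfl
    rw [zero_mul] at hcPt
    exact (mul_ne_zero hcardG htrP0) hcPt.symm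
  -- each `P ρ(h) P` is a multiple of `P`
  have hmult : ∀ h, ∃ t : ℂ, P * ρ h * P = t • P := by
    intro h
    obtain ⟨c, hc, -⟩ := sch (P * ρ h * P)
    refine ⟨cP⁻¹ * c, ?_⟩
    have e1 : ∑ g, P * ρ g * (P * ρ h * P) * ρ g⁻¹ * P = c • P := by
      have : ∀ g, P * ρ g * (P * ρ h * P) * ρ g⁻¹ * P =
          P * (ρ g * (P * ρ h * P) * ρ g⁻¹) * P := fun g => by simp only [mul_assoc]
      simp only [this]
      rw [← Finset.sum_mul, ← Finset.mul_sum, hc, mul_smul_comm, mul_one, smul_mul_assoc, hPP]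
    have e2 : ∑ g, P * ρ g * (P * ρ h * P) * ρ g⁻¹ * P = cP • (P * ρ h * P) := by
      have : ∀ g, P * ρ g * (P * ρ h * P) * ρ g⁻¹ * P =
          P * ρ h * P * (ρ g * P * ρ g⁻¹) * P := fun g => by
        have := congrArg (fun a => a * (ρ g⁻¹ * P)) (hcomm g h)
        simp only [mul_assoc] at this ⊢
        exact this
      simp only [this]
      rw [← Finset.sum_mul, ← Finset.mul_sum, hcP, mul_smul_comm, mul_one, smul_mul_assoc,
        mul_assoc (P * ρ h), hPP]
    rw [mul_smul, ← e1, e2, smul_smul, inv_mul_cancel₀ hcP0, one_smul]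
  choose t ht using hmult
  have hX : ∀ X : V →ₗ[ℂ] V, ∃ c : ℂ, (∑ h, t h * t h⁻¹) • (P * X * P) = c • P ∧
      c * LinearMap.trace ℂ V 1 = (Fintype.card G : ℂ) * LinearMap.trace ℂ V (P * X * P) := by
    intro X
    obtain ⟨c, hc, hct⟩ := sch (P * X * P)
    refine ⟨c, ?_, hct⟩
    have e1 : ∑ g, P * ρ g * (P * X * P) * ρ g⁻¹ * P = c • P := by
      have : ∀ g, P * ρ g * (P * X * P) * ρ g⁻¹ * P =
          P * (ρ g * (P * X * P) * ρ g⁻¹) * P := fun g => by simp only [mul_assoc]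
      simp only [this]
      rw [← Finset.sum_mul, ← Finset.mul_sum, hc, mul_smul_comm, mul_one, smul_mul_assoc, hPP]
    rw [← e1, Finset.sum_smul]
    apply Finset.sum_congr rfl
    intro g _
    have : P * ρ g * (P * X * P) * ρ g⁻¹ * P = (P * ρ g * P) * X * (P * ρ g⁻¹ * P) := by
      simp only [mul_assoc]
    rw [this, ht, ht, smul_mul_assoc, smul_mul_assoc, mul_smul_comm, smul_smul]
  have hk0 : (∑ h, t h * t h⁻¹) ≠ 0 := by
    intro h0
    obtain ⟨c, hc, hct⟩ := hX 1
    rw [h0, zero_smul] at hc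
    have : c = 0 := by
      rcases smul_eq_zero.1 hc.symm with h | h
      · exact h
      · exact absurd h hP0
    rw [this, zero_mul, mul_one, hPP] at hct
    exact (mul_ne_zero hcardG htrP0) hct.symm
  rw [htrP]
  have : Module.finrank ℂ (LinearMap.range P) = 1 := by
    rw [finrank_eq_one_iff_of_nonzero' (⟨P x, LinearMap.mem_range_self _ _⟩ : LinearMap.range P)
      (fun h => hx (congrArg Subtype.val h))]
    rintro ⟨_, ⟨w, rfl⟩⟩
    obtain ⟨l, hl⟩ : ∃ l : Module.Dual ℂ V, l (P x) ≠ 0 := by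
      by_contra! h
      exact hx ((Module.forall_dual_apply_eq_zero_iff ℂ _).1 h)
    obtain ⟨c, hc, -⟩ := hX (l.smulRight w)
    have e := congrArg (fun f : V →ₗ[ℂ] V => f x) hc
    simp only [LinearMap.smul_apply, Module.End.mul_apply, LinearMap.smulRight_apply, map_smul] at e
    refine ⟨((∑ h, t h * t h⁻¹) * l (P x))⁻¹ * c, ?_⟩
    apply Subtype.ext
    change (((∑ h, t h * t h⁻¹) * l (P x))⁻¹ * c) • P x = P w
    rw [mul_smul, ← e, smul_smul, smul_smul, mul_assoc, inv_mul_cancel₀ (mul_ne_zero hk0 hl), one_smul]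
  rw [this]; simp
end LMT

namespace LMT
variable {F : Type} [Field F]
variable {V V' E Q E' Q' : Type} [AddCommGroup V] [Module F V] [Finite V]
  [AddCommGroup V'] [Module F V'] [Finite V'] [AddCommGroup E] [Module F E] [Finite E]
  [AddCommGroup Q] [Module F Q] [Finite Q] [AddCommGroup E'] [Module F E'] [Finite E']
  [AddCommGroup Q'] [Module F Q'] [Finite Q']


theorem perm_sym_nat {n : ℕ} {s : ℕ → ℕ} {a : ℕ → F} (h1 : ∀ r < n, s r < n)
    (h2 : ∀ r < n, ∀ r' < n, s r = s r' → r = r') (h3 : ∀ c < n, ∃ r < n, s r = c)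
    (hI : ∀ r < n, ∀ r' < n, r < r' → s r' < s r → ((r + 1 = r' ↔ s r' + 1 = s r) ∧
      (r + 1 = r' → a r = a r'))) :
    ∀ r < n, s (s r) = r ∧ a (s r) = a r := by
  have key : ∀ m ≤ n, ∃ m', m ≤ m' ∧ m' ≤ n ∧ ∀ r < m', s r < m' ∧ s (s r) = r ∧ a (s r) = a r := by
    intro m
    induction m with
    | zero => intro _; exact ⟨0, le_rfl, by omega, fun r hr => by omega⟩
    | succ m ih =>
      intro hm
      obtain ⟨m', h4, h5, h6⟩ := ih (by omega)
      by_cases hlt : m + 1 ≤ m'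
      · exact ⟨m', hlt, h5, h6⟩
      obtain rfl : m = m' := by omega
      have hj : m ≤ s m := by
        by_contra hcon
        have h7 := h6 (s m) (by omega)
        have := h2 _ (by omega) _ (by omega) h7.2.1
        omega
      have hjn := h1 m (by omega)
      have hk : ∀ k, ∀ i ≤ k, m + i ≤ s m → s (m + i) + i = s m ∧ a (m + i) = a m := by
        intro k
        induction k with
        | zero => intro i hi _; obtain rfl : i = 0 := by omega
                  simp
        | succ k ihk =>
          intro i hi him
          by_cases hik : i ≤ k
          · exact ihk i hik him
          obtain rfl : i = k + 1 := by omega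
          obtain ⟨r, hr, hrs⟩ := h3 (s m - (k + 1)) (by omega)
          have hrm : m + k < r := by
            by_contra hcon
            rcases lt_or_ge r m with h | h
            · have := (h6 r h).1; omega
            · have h8 := ihk (r - m) (by omega) (by omega)
              rw [show m + (r - m) = r by omega] at h8
              omega
          have h9 := ihk k le_rfl (by omega)
          have h10 := hI (m + k) (by omega) r hr hrm (by omega)
          have h11 : m + k + 1 = r := h10.1.2 (by omega)
          subst h11
          rw [show m + (k + 1) = m + k + 1 by omega]
          refine ⟨by omega, ?_⟩
          rw [← h10.2 rfl, h9.2]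
      refine ⟨s m + 1, by omega, by omega, ?_⟩
      intro r hr
      rcases lt_or_ge r m with h | h
      · have := h6 r h
        exact ⟨by omega, this.2⟩
      · have h8 := hk (r - m) (r - m) le_rfl (by omega)
        rw [show m + (r - m) = r by omega] at h8
        have h9 := hk (s r - m) (s r - m) le_rfl (by omega)
        rw [show m + (s r - m) = s r by omega] at h9
        refine ⟨by omega, by omega, ?_⟩
        rw [h9.2, h8.2]
  intro r hr
  obtain ⟨m', h4, h5, h6⟩ := key n le_rfl
  exact (h6 r (by omega)).2

theorem perm_sym {n : ℕ} {s : Fin n → Fin n} {a : Fin n → F} (hs : Function.Injective s)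
    (hI : ∀ r r', r < r' → s r' < s r → (((r : ℕ) + 1 = r' ↔ (s r' : ℕ) + 1 = s r) ∧
      ((r : ℕ) + 1 = r' → a r = a r'))) (r : Fin n) : s (s r) = r ∧ a (s r) = a r := by
  have hb := Finite.injective_iff_surjective.1 hs
  let S : ℕ → ℕ := fun i => if h : i < n then (s ⟨i, h⟩ : ℕ) else 0
  let A : ℕ → F := fun i => if h : i < n then a ⟨i, h⟩ else 0
  have hS : ∀ i : Fin n, S i = s i := fun i => by simp [S]
  have hA : ∀ i : Fin n, A i = a i := fun i => by simp [A]
  have := perm_sym_nat (n := n) (s := S) (a := A)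
    (fun r hr => by rw [hS ⟨r, hr⟩]; exact (s ⟨r, hr⟩).2)
    (fun r hr r' hr' h => by
      rw [hS ⟨r, hr⟩, hS ⟨r', hr'⟩] at h
      exact congrArg Fin.val (hs (Fin.ext h)))
    (fun c hc => by
      obtain ⟨r, hr⟩ := hb ⟨c, hc⟩
      exact ⟨r, r.2, by rw [hS, hr]⟩)
    (fun r hr r' hr' h h' => by
      rw [hS ⟨r, hr⟩, hS ⟨r', hr'⟩] at *
      rw [hA ⟨r, hr⟩, hA ⟨r', hr'⟩]
      exact hI ⟨r, hr⟩ ⟨r', hr'⟩ h h') r r.2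
  rw [hS, hS, hA, hA] at this
  exact ⟨Fin.ext this.1, this.2⟩

/-- lower unitriangular matrices -/
def LU {n : ℕ} (m : Matrix (Fin n) (Fin n) F) : Prop := (∀ i, m i i = 1) ∧ ∀ i j, i < j → m i j = 0

/-- sum of subdiagonal entries -/
noncomputable def sd {n : ℕ} (m : Matrix (Fin n) (Fin n) F) : F :=
  ∑ i : Fin n, ∑ j : Fin n, if (j : ℕ) + 1 = (i : ℕ) then m i j else 0

theorem LU.mul {n : ℕ} {u v : Matrix (Fin n) (Fin n) F} (hu : LU u) (hv : LU v) : LU (u * v) := by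
  constructor
  · intro i
    rw [Matrix.mul_apply, Finset.sum_eq_single i]
    · rw [hu.1, hv.1, one_mul]
    · intro k _ hk
      rcases lt_or_gt_of_ne hk with h | h
      · rw [hv.2 _ _ h, mul_zero]
      · rw [hu.2 _ _ h, zero_mul]
    · simp
  · intro i j hij
    rw [Matrix.mul_apply]
    apply Finset.sum_eq_zero
    intro k _
    rcases lt_or_ge i k with h | h
    · rw [hu.2 _ _ h, zero_mul]
    · rw [hv.2 _ _ (lt_of_le_of_lt h hij), mul_zero]

theorem LU.one {n : ℕ} : LU (1 : Matrix (Fin n) (Fin n) F) :=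
  ⟨fun i => Matrix.one_apply_eq i, fun _ _ h => Matrix.one_apply_ne h.ne⟩

theorem LU.det {n : ℕ} {u : Matrix (Fin n) (Fin n) F} (hu : LU u) : u.det = 1 := by
  rw [Matrix.det_of_isLowerTriangular u (fun i j h => hu.2 i j h)]
  simp [hu.1]

theorem sd_mul {n : ℕ} {u v : Matrix (Fin n) (Fin n) F} (hu : LU u) (hv : LU v) :
    sd (u * v) = sd u + sd v := by
  unfold sd
  rw [← Finset.sum_add_distrib]
  apply Finset.sum_congr rfl
  intro i _
  rw [← Finset.sum_add_distrib]
  apply Finset.sum_congr rfl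
  intro j _
  split_ifs with h
  · rw [Matrix.mul_apply, Fintype.sum_eq_add i j (by rintro rfl; omega)]
    · rw [hu.1, hv.1]; ring
    · rintro k ⟨hk1, hk2⟩
      rcases lt_or_gt_of_ne hk1 with h' | h'
      · have : k < j := by
          rw [Fin.lt_def] at *
          have := Fin.val_ne_of_ne hk2
          omega
        rw [hv.2 _ _ this, mul_zero]
      · rw [hu.2 _ _ h', zero_mul]
  · simp

/-- elementary rank one perturbation -/
theorem LU.elem {n : ℕ} (k : Fin n) (a : Fin n → F) (ha : ∀ i ≤ k, a i = 0) :
    LU (1 + Matrix.vecMulVec a (Pi.single k 1)) := by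
  constructor
  · intro i
    simp only [Matrix.add_apply, Matrix.one_apply_eq, Matrix.vecMulVec_apply]
    by_cases h : i = k
    · subst h; simp [ha i le_rfl]
    · simp [Pi.single_eq_of_ne h]
  · intro i j hij
    simp only [Matrix.add_apply, Matrix.one_apply_ne hij.ne, Matrix.vecMulVec_apply]
    by_cases h : j = k
    · subst h; simp [ha i hij.le]
    · simp [Pi.single_eq_of_ne h]

theorem bruhat_step {n : ℕ} (h : Matrix (Fin n) (Fin n) F) (k : Fin n) (hk : ∃ j, h k j ≠ 0) :
    ∃ (u v h2 : Matrix (Fin n) (Fin n) F) (j : Fin n) (a b : Fin n → F), LU u ∧ LU v ∧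
      h = u * h2 * v.transpose ∧ h k j ≠ 0 ∧ (∀ c < j, h k c = 0) ∧
      (∀ i, a i = if k < i then h i j / h k j else 0) ∧
      (∀ c, b c = if j < c then h k c / h k j else 0) ∧
      ∀ i c, h2 i c = h i c - a i * h k c - h i j * b c + a i * h k j * b c := by
  let S := Finset.univ.filter fun j => h k j ≠ 0
  have hS : S.Nonempty := by obtain ⟨j, hj⟩ := hk; exact ⟨j, by simpa [S] using hj⟩
  let j := S.min' hS
  have hj : h k j ≠ 0 := (Finset.mem_filter.1 (S.min'_mem hS)).2
  have hjm : ∀ c < j, h k c = 0 := by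
    intro c hc
    by_contra hne
    exact absurd (S.min'_le c (by simpa [S] using hne)) (not_le.2 hc)
  let a : Fin n → F := fun i => if k < i then h i j / h k j else 0
  let b : Fin n → F := fun c => if j < c then h k c / h k j else 0
  have ha : a k = 0 := by simp [a]
  have hb : b j = 0 := by simp [b]
  have inv : ∀ (k : Fin n) (a : Fin n → F), a k = 0 →
      (1 + Matrix.vecMulVec a (Pi.single k 1)) * (1 - Matrix.vecMulVec a (Pi.single k 1)) = 1 := by
    intro k a ha
    have h0 : Matrix.vecMulVec a (Pi.single k 1) * Matrix.vecMulVec a (Pi.single k (1 : F)) = 0 := by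
      rw [Matrix.vecMulVec_mul_vecMulVec]
      ext i j
      simp [ha]
    rw [mul_sub, mul_one, add_mul, h0]; simp
  refine ⟨1 + Matrix.vecMulVec a (Pi.single k 1), 1 + Matrix.vecMulVec b (Pi.single j 1),
    (1 - Matrix.vecMulVec a (Pi.single k 1)) * h * (1 - Matrix.vecMulVec b (Pi.single j 1)).transpose,
    j, a, b, LU.elem _ _ ?_, LU.elem _ _ ?_, ?_, hj, hjm, fun i => rfl, fun i => rfl, ?_⟩
  · intro i hi; simp [a, not_lt.2 hi]
  · intro i hi; simp [b, not_lt.2 hi]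
  · rw [← mul_assoc, ← mul_assoc, inv k a ha, one_mul, mul_assoc, ← Matrix.transpose_mul,
      inv j b hb, Matrix.transpose_one, mul_one]
  · intro i c
    rw [Matrix.transpose_sub, Matrix.transpose_one, sub_mul, mul_sub, mul_one, sub_mul, one_mul]
    have e1 : ∀ (M : Matrix (Fin n) (Fin n) F) i c, (Matrix.vecMulVec a (Pi.single k 1) * M) i c =
        a i * M k c := by
      intro M i c
      rw [Matrix.mul_apply, Finset.sum_eq_single k]
      · simp [Matrix.vecMulVec_apply]
      · intro x _ hx; simp [Matrix.vecMulVec_apply, Pi.single_eq_of_ne hx]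
      · simp
    have e2 : ∀ (M : Matrix (Fin n) (Fin n) F) i c,
        (M * (Matrix.vecMulVec b (Pi.single j 1)).transpose) i c = M i j * b c := by
      intro M i c
      rw [Matrix.mul_apply, Finset.sum_eq_single j]
      · simp [Matrix.vecMulVec_apply]
      · intro x _ hx; simp [Matrix.vecMulVec_apply, Pi.single_eq_of_ne hx]
      · simp
    simp only [Matrix.sub_apply, Matrix.sub_mul, e1, e2]
    ring

theorem bruhat {n : ℕ} (h : Matrix (Fin n) (Fin n) F) (hd : h.det ≠ 0) : ∀ k ≤ n,
    ∃ (u v h1 : Matrix (Fin n) (Fin n) F) (s : Fin n → Fin n), LU u ∧ LU v ∧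
      h = u * h1 * v.transpose ∧ ∀ r : Fin n, (r : ℕ) < k → h1 r (s r) ≠ 0 ∧
        (∀ c, c ≠ s r → h1 r c = 0) ∧ ∀ i, i ≠ r → h1 i (s r) = 0 := by
  intro k
  induction k with
  | zero => intro _; exact ⟨1, 1, h, id, LU.one, LU.one, by simp, fun r hr => by omega⟩
  | succ k ih =>
    intro hk
    obtain ⟨u, v, h1, s, hu, hv, he, hs⟩ := ih (by omega)
    have hd1 : h1.det ≠ 0 := by
      intro h0
      apply hd
      rw [he, Matrix.det_mul, Matrix.det_mul, h0]; simp
    let K : Fin n := ⟨k, by omega⟩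
    have hrow : ∃ j, h1 K j ≠ 0 := by
      by_contra! hcon
      exact hd1 (Matrix.det_eq_zero_of_row_eq_zero K hcon)
    obtain ⟨u', v', h2, j, a, b, hu', hv', he', hj, hjm, ha, hb, h2e⟩ := bruhat_step h1 K hrow
    have hne : ∀ r : Fin n, (r : ℕ) < k → j ≠ s r := by
      rintro r hr rfl
      exact hj ((hs r hr).2.2 K (by rintro rfl; simp [K] at hr))
    have haK : a K = 0 := by simp [ha]
    have hbj : b j = 0 := by simp [hb]
    refine ⟨u * u', v * v', h2, Function.update s K j, hu.mul hu', hv.mul hv', ?_, ?_⟩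
    · rw [he, he', Matrix.transpose_mul]; simp only [mul_assoc]
    intro r hr
    by_cases hrK : r = K
    · subst hrK
      rw [Function.update_self]
      refine ⟨?_, ?_, ?_⟩
      · rw [h2e, haK, hbj]; simpa using hj
      · intro c hc
        rw [h2e, haK, hb]
        rcases lt_or_gt_of_ne hc with h | h
        · rw [if_neg (not_lt.2 h.le), hjm c h]; ring
        · rw [if_pos h]; field_simp; ring
      · intro i hi
        rw [h2e, hbj, ha]
        rcases lt_or_gt_of_ne hi with h | h
        · rw [if_neg (not_lt.2 h.le), (hs i h).2.1 j (hne i h)]; ring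
        · rw [if_pos h]; field_simp; ring
    · have hrk : (r : ℕ) < k := by
        have : (r : ℕ) ≠ k := fun h => hrK (Fin.ext h)
        omega
      obtain ⟨g1, g2, g3⟩ := hs r hrk
      have har : a r = 0 := by rw [ha, if_neg (not_lt.2 (show r ≤ K from hrk.le))]
      have hbs : b (s r) = 0 := by
        rw [hb]; split_ifs with h
        · rw [g3 K (Ne.symm hrK), zero_div]
        · rfl
      rw [Function.update_of_ne hrK]
      refine ⟨?_, ?_, ?_⟩
      · rw [h2e, har, hbs]; simpa using g1
      · intro c hc
        rw [h2e, har, g2 c hc, g2 j (hne r hrk)]; ring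
      · intro i hi
        rw [h2e, hbs, g3 i hi, g3 K (Ne.symm hrK)]; ring

theorem sd_elem {n : ℕ} {r r' : Fin n} (t : F) :
    sd (1 + Matrix.vecMulVec (Pi.single r' t) (Pi.single r 1) : Matrix (Fin n) (Fin n) F) =
      if (r : ℕ) + 1 = r' then t else 0 := by
  unfold sd
  have : ∀ i j : Fin n, (if (j : ℕ) + 1 = i then ((1 + Matrix.vecMulVec (Pi.single r' t)
      (Pi.single r 1) : Matrix (Fin n) (Fin n) F)) i j else 0) =
      if i = r' then (if j = r then (if (r : ℕ) + 1 = r' then t else 0) else 0) else 0 := by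
    intro i j
    by_cases h : (j : ℕ) + 1 = i
    · have hij : i ≠ j := by rintro rfl; omega
      rw [if_pos h, Matrix.add_apply, Matrix.one_apply_ne hij, Matrix.vecMulVec_apply]
      by_cases h1 : i = r'
      · subst h1
        by_cases h2 : j = r
        · subst h2; simp [h]
        · simp [h2]
      · simp [h1]
    · rw [if_neg h]
      split_ifs with h1 h2 h3
      · subst h1 h2; exact absurd h3 h
      all_goals rfl
  simp only [this]
  simp

theorem bessel_supp {n : ℕ} {ψ : AddChar F ℂ} (hψ : ψ ≠ 1) (f : Matrix (Fin n) (Fin n) F → ℂ)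
    (hf : ∀ u v h, LU u → LU v → f (u * h * v.transpose) = ψ (sd u + sd v) * f h)
    (h : Matrix (Fin n) (Fin n) F) (hd : h.det ≠ 0) (h0 : f h ≠ 0) :
    ∃ u v h1, LU u ∧ LU v ∧ h = u * h1 * v.transpose ∧ h1.transpose = h1 := by
  obtain ⟨u, v, h1, s, hu, hv, he, hs'⟩ := bruhat h hd n le_rfl
  have hs := fun r => hs' r r.2
  refine ⟨u, v, h1, hu, hv, he, ?_⟩
  have hf1 : f h1 ≠ 0 := by
    intro h2; rw [he, hf u v h1 hu hv, h2, mul_zero] at h0; exact h0 rfl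
  have hinj : Function.Injective s := by
    intro r r' hrr
    by_contra hne
    have := (hs r').2.2 r hne
    rw [← hrr] at this
    exact (hs r).1 this
  obtain ⟨x, hx⟩ := (AddChar.ne_one_iff).1 hψ
  have hI : ∀ r r', r < r' → s r' < s r → (((r : ℕ) + 1 = r' ↔ (s r' : ℕ) + 1 = s r) ∧
      ((r : ℕ) + 1 = r' → h1 r (s r) = h1 r' (s r'))) := by
    intro r r' hrr hss
    have key : ∀ t : F, ψ (if (r : ℕ) + 1 = r' then t else 0) =
        ψ (if (s r' : ℕ) + 1 = s r then t * h1 r (s r) / h1 r' (s r') else 0) := by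
      intro t
      have hu1 : LU (1 + Matrix.vecMulVec (Pi.single r' t) (Pi.single r 1)) := by
        apply LU.elem
        intro i hi
        rw [Pi.single_eq_of_ne]
        rintro rfl
        exact absurd hrr (not_lt.2 hi)
      have hv1 : LU (1 + Matrix.vecMulVec (Pi.single (s r) (t * h1 r (s r) / h1 r' (s r')))
          (Pi.single (s r') 1)) := by
        apply LU.elem
        intro i hi
        rw [Pi.single_eq_of_ne]
        rintro rfl
        exact absurd hss (not_lt.2 hi)
      have e1 := hf _ _ h1 hu1 LU.one
      have e2 := hf _ _ h1 LU.one hv1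
      have hsd1 : sd (1 : Matrix (Fin n) (Fin n) F) = 0 := by
        have := sd_mul (F := F) (LU.one (n := n)) LU.one
        rw [one_mul] at this
        exact left_eq_add.1 this
      rw [sd_elem, hsd1, add_zero, Matrix.transpose_one, mul_one] at e1
      rw [sd_elem, hsd1, zero_add, one_mul] at e2
      have e3 : (1 + Matrix.vecMulVec (Pi.single r' t) (Pi.single r 1)) * h1 =
          h1 * (1 + Matrix.vecMulVec (Pi.single (s r) (t * h1 r (s r) / h1 r' (s r')))
          (Pi.single (s r') 1)).transpose := by
        rw [add_mul, one_mul, Matrix.transpose_add, Matrix.transpose_one, mul_add, mul_one]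
        congr 1
        ext i c
        rw [Matrix.mul_apply, Matrix.mul_apply, Finset.sum_eq_single r, Finset.sum_eq_single (s r')]
        · simp only [Matrix.vecMulVec_apply, Matrix.transpose_apply, Pi.single_eq_same, mul_one]
          by_cases hi : i = r'
          · subst hi
            by_cases hc : c = s r
            · subst hc
              have := (hs i).1
              simp; field_simp
            · simp [Pi.single_eq_of_ne hc, (hs r).2.1 c hc]
          · simp [Pi.single_eq_of_ne hi, (hs r').2.2 i hi]
        · intro k _ hk; simp [Matrix.vecMulVec_apply, Pi.single_eq_of_ne hk]
        · simp
        · intro k _ hk; simp [Matrix.vecMulVec_apply, Pi.single_eq_of_ne hk]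
        · simp
      rw [← e3, e1] at e2
      exact mul_right_cancel₀ hf1 e2
    have hr0 := (hs r).1
    have hr1 := (hs r').1
    refine ⟨⟨?_, ?_⟩, ?_⟩
    · intro h2
      by_contra h3
      have := key x
      rw [if_pos h2, if_neg h3, AddChar.map_zero_eq_one] at this
      exact hx this
    · intro h2
      by_contra h3
      have := key (x * h1 r' (s r') / h1 r (s r))
      rw [if_neg h3, if_pos h2, AddChar.map_zero_eq_one] at this
      apply hx
      rw [this]; congr 1; field_simp
    · intro h2
      have h3 : (s r' : ℕ) + 1 = s r := by
        by_contra h3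
        have := key x
        rw [if_pos h2, if_neg h3, AddChar.map_zero_eq_one] at this
        exact hx this
      by_contra h4
      have h5 : 1 - h1 r (s r) / h1 r' (s r') ≠ 0 := by
        intro h6
        apply h4
        have h7 := (div_eq_one_iff_eq hr1).1 (sub_eq_zero.1 h6).symm
        exact h7
      have := key (x / (1 - h1 r (s r) / h1 r' (s r')))
      rw [if_pos h2, if_pos h3] at this
      apply hx
      have h7 : x = x / (1 - h1 r (s r) / h1 r' (s r')) -
          x / (1 - h1 r (s r) / h1 r' (s r')) * h1 r (s r) / h1 r' (s r') := by
        rw [mul_div_assoc]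
        generalize h1 r (s r) / h1 r' (s r') = z at *
        rw [← mul_one_sub, div_mul_cancel₀ _ h5]
      rw [h7, AddChar.map_sub_eq_div, this]
      exact div_self (ψ.val_isUnit _).ne_zero
  have hps := perm_sym (a := fun r => h1 r (s r)) hinj hI
  ext i c
  rw [Matrix.transpose_apply]
  by_cases hc : c = s i
  · subst hc
    have := hps i
    rw [← this.2, this.1]
  · rw [(hs i).2.1 c hc]
    apply (hs c).2.1
    rintro rfl
    exact hc (hps c).1.symm

theorem bessel_sym {n : ℕ} {ψ : AddChar F ℂ} (hψ : ψ ≠ 1) (f : Matrix (Fin n) (Fin n) F → ℂ)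
    (hf : ∀ u v h, LU u → LU v → f (u * h * v.transpose) = ψ (sd u + sd v) * f h)
    (h : Matrix (Fin n) (Fin n) F) (hd : h.det ≠ 0) : f h.transpose = f h := by
  have key : ∀ h : Matrix (Fin n) (Fin n) F, h.det ≠ 0 → f h ≠ 0 → f h.transpose = f h := by
    intro h hd h0
    obtain ⟨u, v, h1, hu, hv, rfl, hsym⟩ := bessel_supp hψ f hf h hd h0
    rw [Matrix.transpose_mul, Matrix.transpose_mul, Matrix.transpose_transpose, hsym, ← mul_assoc,
      hf _ _ _ hv hu, hf _ _ _ hu hv, add_comm]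
  by_cases h0 : f h = 0
  · by_contra h1
    rw [h0] at h1
    have := key h.transpose (by rwa [Matrix.det_transpose]) h1
    rw [Matrix.transpose_transpose, h0] at this
    exact h1 this.symm
  · exact key h hd h0
end LMT

namespace LMT
variable {F : Type} [Field F]
variable {V V' E Q E' Q' : Type} [AddCommGroup V] [Module F V] [Finite V]
  [AddCommGroup V'] [Module F V'] [Finite V'] [AddCommGroup E] [Module F E] [Finite E]
  [AddCommGroup Q] [Module F Q] [Finite Q] [AddCommGroup E'] [Module F E'] [Finite E']
  [AddCommGroup Q'] [Module F Q'] [Finite Q']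

variable [Finite F]

noncomputable abbrev glE (F : Type) [Field F] (n : ℕ) : Matrix.GeneralLinearGroup (Fin n) F ≃* GS F n :=
  (Matrix.GeneralLinearGroup.toLin (n := Fin n) (R := F)).trans
    (LinearMap.GeneralLinearGroup.generalLinearEquiv F (Fin n → F))

theorem glE_apply {n : ℕ} (g : Matrix.GeneralLinearGroup (Fin n) F) (v : St F n) :
    glE F n g v = (g : Matrix (Fin n) (Fin n) F).mulVec v := rfl

abbrev LUt (F : Type) [Field F] (n : ℕ) : Type := {m : Matrix (Fin n) (Fin n) F // LU m}

noncomputable def lu {n : ℕ} (m : LUt F n) : Matrix.GeneralLinearGroup (Fin n) F :=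
  Matrix.GeneralLinearGroup.mkOfDetNeZero m.1 (by rw [m.2.det]; exact one_ne_zero)

theorem lu_val {n : ℕ} (m : LUt F n) : (lu m : Matrix (Fin n) (Fin n) F) = m.1 := rfl

noncomputable def lc (F : Type) [Field F] (n : ℕ) : St F n →ₗ[F] F :=
  if h : 0 < n then LinearMap.proj ⟨0, h⟩ else 0

noncomputable def luM {n : ℕ} (p : (F →ₗ[F] St F n) × LUt F n) : Matrix (Fin (n + 1)) (Fin (n + 1)) F :=
  Matrix.of fun i => Fin.cases (Fin.cons 1 0) (fun i' => Fin.cons (p.1 1 i') (p.2.1 i')) i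

@[simp] theorem luM_00 {n : ℕ} (p : (F →ₗ[F] St F n) × LUt F n) : luM p 0 0 = 1 := rfl
@[simp] theorem luM_0s {n : ℕ} (p : (F →ₗ[F] St F n) × LUt F n) (j) : luM p 0 (Fin.succ j) = 0 := rfl
@[simp] theorem luM_s0 {n : ℕ} (p : (F →ₗ[F] St F n) × LUt F n) (i) : luM p (Fin.succ i) 0 = p.1 1 i := rfl
@[simp] theorem luM_ss {n : ℕ} (p : (F →ₗ[F] St F n) × LUt F n) (i j) :
  luM p (Fin.succ i) (Fin.succ j) = p.2.1 i j := rfl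

theorem luM_LU {n : ℕ} (p : (F →ₗ[F] St F n) × LUt F n) : LU (luM p) := by
  constructor
  · intro i
    refine Fin.cases ?_ (fun i => ?_) i
    · simp
    · simp [p.2.2.1]
  · intro i j
    refine Fin.cases ?_ (fun i => ?_) i
    · refine Fin.cases ?_ (fun j => ?_) j
      · simp
      · simp
    · refine Fin.cases ?_ (fun j => ?_) j
      · intro h; exact absurd h (not_lt.2 (Fin.zero_le _))
      · intro h; rw [luM_ss]; exact p.2.2.2 i j (Fin.succ_lt_succ_iff.1 h)

theorem luM_bij {n : ℕ} : Function.Bijective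
    (fun p : (F →ₗ[F] St F n) × LUt F n => (⟨luM p, luM_LU p⟩ : LUt F (n + 1))) := by
  constructor
  · intro p p' h
    have h' : luM p = luM p' := congrArg Subtype.val h
    apply Prod.ext
    · apply LinearMap.ext_ring
      ext i
      have := congrFun (congrFun h' (Fin.succ i)) 0
      simpa using this
    · apply Subtype.ext
      ext i j
      have := congrFun (congrFun h' (Fin.succ i)) (Fin.succ j)
      simpa using this
  · rintro ⟨m, hm⟩
    refine ⟨⟨LinearMap.toSpanSingleton F _ (fun i => m (Fin.succ i) 0),
      ⟨m.submatrix Fin.succ Fin.succ, fun i => hm.1 _, fun i j h => hm.2 _ _ (Fin.succ_lt_succ_iff.2 h)⟩⟩, ?_⟩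
    apply Subtype.ext
    ext i j
    change luM _ i j = m i j
    refine Fin.cases ?_ (fun i => ?_) i
    · refine Fin.cases ?_ (fun j => ?_) j
      · simp [hm.1]
      · rw [luM_0s, hm.2 _ _ (Fin.succ_pos j)]
    · refine Fin.cases ?_ (fun j => ?_) j
      · simp
      · simp

theorem sd_luM {n : ℕ} (p : (F →ₗ[F] St F n) × LUt F n) : sd (luM p) = lc F n (p.1 1) + sd p.2.1 := by
  unfold sd
  rw [Fin.sum_univ_succ]
  simp only [Fin.sum_univ_succ, luM_s0, luM_ss, Fin.val_zero, Fin.val_succ]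
  rw [Finset.sum_add_distrib]
  simp only [Nat.add_right_cancel_iff, Nat.add_eq_zero_iff, one_ne_zero, and_false, if_false,
    Finset.sum_const_zero, zero_add]
  congr 1
  · unfold lc
    cases n with
    | zero => simp
    | succ n =>
      rw [Fin.sum_univ_succ]
      simp

theorem AA_LU (ψ : AddChar F ℂ) (χ : CF F) (k : ℕ) : ∀ (j n : ℕ), n = j + k →
    (av fun m : LUt F j => ψ (-(sd m.1)) * AA ψ χ k (St F j) (glE F j (lu m)) (lc F j)) =
      av fun m : LUt F n => ψ (-(sd m.1)) * χ.ev (glE F n (lu m)) := by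
  induction k with
  | zero => rintro j n rfl; rfl
  | succ k ih =>
    intro j n hn
    rw [← ih (j + 1) n (by omega), ← av_equiv (Equiv.ofBijective _ luM_bij), av_prod, av_comm]
    apply av_congr
    intro m
    rw [AA_succ, ← av_mul_left]
    apply av_congr
    intro u
    simp only [Equiv.ofBijective_apply]
    rw [sd_luM, neg_add, AddChar.map_add_eq_mul, ← mul_assoc, mul_comm (ψ (-(sd m.1)))]
    congr 1
    apply AA_inv ψ χ k _ _ (Fin.consLinearEquiv F (fun _ : Fin (j + 1) => F))
    · rintro ⟨c, e⟩
      rw [glE_apply, lu_val, bl_apply]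
      ext i
      have huc : u c = c • u 1 := by rw [← map_smul, smul_eq_mul, mul_one]
      refine Fin.cases ?_ (fun i => ?_) i
      · simp [Matrix.mulVec, dotProduct, Fin.sum_univ_succ]
      · simp [Matrix.mulVec, dotProduct, Fin.sum_univ_succ, huc, lu_val]
        ring
    · rintro ⟨c, e⟩
      simp [lc]

theorem pr_Gm_LU (ψ : AddChar F ℂ) (χ : CF F) (n : ℕ) :
    pr n χ (Gm ψ) = av fun m : LUt F n => ψ (-(sd m.1)) * χ.ev (glE F n (lu m)) := by
  rw [pr_Gm, ← AA_LU ψ χ n 0 n (by omega)]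
  have : Unique (LUt F 0) := ⟨⟨⟨1, LU.one⟩⟩, fun a => Subtype.ext (Subsingleton.elim _ _)⟩
  rw [av_unique]
  have h1 : glE F 0 (lu default) = 1 := by ext v i; exact i.elim0
  have h2 : sd (default : LUt F 0).1 = 0 := by simp [sd]
  have h3 : lc F 0 = 0 := by simp [lc]
  rw [h1, h2, h3]; simp

theorem LU.tau {n : ℕ} {m : Matrix (Fin n) (Fin n) F} (hm : LU m) :
    LU (m.transpose.submatrix Fin.rev Fin.rev) :=
  ⟨fun i => hm.1 _, fun i j h => hm.2 _ _ (Fin.rev_lt_rev.2 h)⟩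

theorem sd_tau {n : ℕ} (m : Matrix (Fin n) (Fin n) F) :
    sd (m.transpose.submatrix Fin.rev Fin.rev) = sd m := by
  unfold sd
  rw [Finset.sum_comm, ← Equiv.sum_comp Fin.revPerm]
  apply Finset.sum_congr rfl
  intro i _
  rw [← Equiv.sum_comp Fin.revPerm]
  apply Finset.sum_congr rfl
  intro j _
  simp only [Fin.revPerm_apply, Matrix.submatrix_apply, Matrix.transpose_apply, Fin.rev_rev,
    Fin.val_rev]
  have h1 := i.2
  have h2 := j.2
  congr 1
  apply propext
  constructor <;> intro <;> omega

theorem Gm_mult_one {ψ : AddChar F ℂ} (hψ : ψ ≠ 1) {n : ℕ} {χ : CF F} (h : Ir n χ) :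
    pr n χ (Gm ψ) = 0 ∨ pr n χ (Gm ψ) = 1 := by
  rw [pr_Gm_LU]
  have hirr : IsIrr (fun g => χ.ev (glE F n g)) := h.2.comap (glE F n).toMonoidHom (glE F n).surjective
  have hrr : ∀ m : Matrix (Fin n) (Fin n) F, (m.transpose.submatrix Fin.rev Fin.rev).transpose.submatrix
      Fin.rev Fin.rev = m := fun m => by ext i j; simp
  refine gelfand hirr lu (fun a b hab => Subtype.ext ?_) ⟨1, LU.one⟩
    (fun u v => ⟨u.1 * v.1, u.2.mul v.2⟩) (fun u v => ?_) (fun u => ψ (sd u.1)) (fun u => ψ (-(sd u.1)))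
    (fun u v => ?_) (fun u => ?_)
    (fun g => Matrix.GeneralLinearGroup.mkOfDetNeZero
      ((g : Matrix (Fin n) (Fin n) F).transpose.submatrix Fin.rev Fin.rev) ?_) (fun g h => ?_)
    (fun u => ⟨_, u.2.tau⟩) ?_ (fun u => ?_) (fun u => ?_) ?_
  · have := congrArg (fun g : Matrix.GeneralLinearGroup (Fin n) F => (g : Matrix (Fin n) (Fin n) F)) hab
    exact this
  · apply Units.ext; rfl
  · simp only [sd_mul u.2 v.2, AddChar.map_add_eq_mul]
  · rw [← AddChar.map_add_eq_mul, add_neg_cancel, AddChar.map_zero_eq_one]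
  · have := Matrix.det_submatrix_equiv_self Fin.revPerm (g : Matrix (Fin n) (Fin n) F).transpose
    rw [Matrix.det_transpose] at this
    exact this ▸ (Matrix.GeneralLinearGroup.det_ne_zero g)
  · apply Units.ext
    change ((g : Matrix (Fin n) (Fin n) F) * (h : Matrix (Fin n) (Fin n) F)).transpose.submatrix
      Fin.rev Fin.rev = (h : Matrix (Fin n) (Fin n) F).transpose.submatrix Fin.rev Fin.rev *
        (g : Matrix (Fin n) (Fin n) F).transpose.submatrix Fin.rev Fin.rev
    rw [Matrix.transpose_mul]
    exact (Matrix.submatrix_mul_equiv _ _ Fin.rev Fin.revPerm Fin.rev).symm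
  · apply Function.Involutive.bijective
    intro u
    exact Subtype.ext (hrr u.1)
  · apply Units.ext; rfl
  · simp only [sd_tau]
  · intro f hl hr g
    let f2 : Matrix (Fin n) (Fin n) F → ℂ := fun m => if hd : m.det ≠ 0 then
      f (Matrix.GeneralLinearGroup.mkOfDetNeZero m hd) else 0
    have hf2 : ∀ g : Matrix.GeneralLinearGroup (Fin n) F, f2 (g : Matrix (Fin n) (Fin n) F) = f g := by
      intro g
      have : (g : Matrix (Fin n) (Fin n) F).det ≠ 0 := Matrix.GeneralLinearGroup.det_ne_zero g
      simp only [f2, dif_pos this]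
      congr 1
      apply Units.ext; rfl
    have hl2 : ∀ (u m : Matrix (Fin n) (Fin n) F), LU u → f2 (u * m) = ψ (sd u) * f2 m := by
      intro u m hu
      by_cases hd : m.det = 0
      · simp [f2, hd]
      · have e1 := hf2 (lu ⟨u, hu⟩ * Matrix.GeneralLinearGroup.mkOfDetNeZero m hd)
        rw [hl] at e1
        have e2 := hf2 (Matrix.GeneralLinearGroup.mkOfDetNeZero m hd)
        rw [← e2] at e1
        exact e1
    have hr2 : ∀ (u m : Matrix (Fin n) (Fin n) F), LU u → f2 (m * u) = ψ (sd u) * f2 m := by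
      intro u m hu
      by_cases hd : m.det = 0
      · simp [f2, hd]
      · have e1 := hf2 (Matrix.GeneralLinearGroup.mkOfDetNeZero m hd * lu ⟨u, hu⟩)
        rw [hr] at e1
        have e2 := hf2 (Matrix.GeneralLinearGroup.mkOfDetNeZero m hd)
        rw [← e2] at e1
        exact e1
    have key := bessel_sym hψ (fun h => f2 (h.submatrix id Fin.rev)) (fun u v h hu hv => by
      have e : (u * h * v.transpose).submatrix id Fin.rev =
          u * (h.submatrix id Fin.rev) * (v.transpose.submatrix Fin.rev Fin.rev) := by
        have e1 := Matrix.submatrix_mul_equiv (u * h) v.transpose id Fin.revPerm Fin.rev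
        have e2 := Matrix.submatrix_mul_equiv u h id (Equiv.refl _) Fin.rev
        exact e1.symm.trans (congrArg (fun x => x * v.transpose.submatrix Fin.rev Fin.rev) e2.symm)
      simp only [e]
      rw [hr2 _ _ hv.tau, hl2 _ _ hu, sd_tau, AddChar.map_add_eq_mul]; ring)
      ((g : Matrix (Fin n) (Fin n) F).submatrix id Fin.rev) (by
        have := Matrix.det_permute' Fin.revPerm (g : Matrix (Fin n) (Fin n) F)
        change (Matrix.submatrix _ id Fin.revPerm).det ≠ 0
        rw [this]
        apply mul_ne_zero
        · rcases Int.units_eq_one_or (Equiv.Perm.sign (Fin.revPerm (n := n))) with h | h <;> rw [h] <;> simp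
        · exact Matrix.GeneralLinearGroup.det_ne_zero g)
    have e3 : ((g : Matrix (Fin n) (Fin n) F).submatrix id Fin.rev).submatrix id Fin.rev =
        (g : Matrix (Fin n) (Fin n) F) := by ext i j; simp
    have e4 : ((g : Matrix (Fin n) (Fin n) F).submatrix id Fin.rev).transpose.submatrix id Fin.rev =
        (g : Matrix (Fin n) (Fin n) F).transpose.submatrix Fin.rev Fin.rev := by
      ext i j; simp
    simp only [e3, e4, hf2] at key
    rw [← key, ← hf2]
    rfl

theorem de_01 {n : ℕ} {χ : CF F} (h : Ir n χ) : de n χ = 0 ∨ de n χ = 1 :=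
  Gm_mult_one (exists_ps F).choose_spec h
end LMT

namespace LMT
variable {F : Type} [Field F]
variable {V V' E Q E' Q' : Type} [AddCommGroup V] [Module F V] [Finite V]
  [AddCommGroup V'] [Module F V'] [Finite V'] [AddCommGroup E] [Module F E] [Finite E]
  [AddCommGroup Q] [Module F Q] [Finite Q] [AddCommGroup E'] [Module F E'] [Finite E']
  [AddCommGroup Q'] [Module F Q'] [Finite Q']

variable [Finite F]

/-- cuspidal irreducible characters -/
structure IC (d : ℕ) (ρ : CF F) : Prop where
  ne : d ≠ 0
  ir : Ir d ρ
  cu : Cu d ρ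

theorem st_one {k : ℕ} (hk : k ≠ 0) (X : CF F) : st k X (1 : CF F) = 0 :=
  st_hm_lt Hm.one (Nat.pos_of_ne_zero hk) X

theorem Cu.st_zero {d k : ℕ} {ρ : CF F} (h : Cu d ρ) (hρ : Hm d ρ) (hk : k ≠ 0) (hkd : k ≠ d) (X : CF F) :
    st k X ρ = 0 := by
  rcases lt_or_gt_of_ne hkd with hlt | hgt
  · apply Hm.ext (n := d - k) (st_hm (by rwa [Nat.sub_add_cancel hlt.le]) X) (Hm.zero _)
    intro x
    rw [st_ev, CF.ev_zero]
    apply av_zero'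
    intro y
    rw [h (d - k) k (by omega) hk (by omega), mul_zero]
  · exact st_hm_lt hρ hgt X

theorem IC.st_self {d : ℕ} {ρ : CF F} (h : IC d ρ) : st d ρ ρ = 1 := by
  rw [st_full h.ir.hm, h.ir.self, one_smul]

theorem IC.st_ne {d d' : ℕ} {ρ ρ' : CF F} (h : IC d ρ) (h' : IC d' ρ') (hne : ρ ≠ ρ') : st d ρ ρ' = 0 := by
  by_cases hd : d = d'
  · subst hd
    rw [st_full h'.ir.hm, h.ir.orth h'.ir hne, zero_smul]
  · exact h'.cu.st_zero h'.ir.hm h.ne hd _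

theorem IC.deriv {d : ℕ} {ρ : CF F} (h : IC d ρ) (φ ψ : CF F) :
    st d ρ (φ * ψ) = st d ρ φ * ψ + φ * st d ρ ψ := st_deriv h.ne h.cu φ ψ

/-- `π` occurs in `φ` -/
theorem ex_factor {n m : ℕ} {A B π : CF F} (hA : Ch n A) (hB : Ch m B) (hπ : Ir (n + m) π)
    (h : pr (n + m) (A * B) π ≠ 0) : ∃ α, Ir n α ∧ pr n A α ≠ 0 ∧ pr (n + m) (α * B) π ≠ 0 := by
  rw [adj' hB.hm, hA.hm.pr_eq] at h
  obtain ⟨α, hα, hne⟩ := Finset.exists_ne_zero_of_sum_ne_zero h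
  refine ⟨α, mem_irF.1 hα, left_ne_zero_of_mul hne, ?_⟩
  rw [adj' hB.hm]
  exact right_ne_zero_of_mul hne

theorem not_cu {n : ℕ} {π : CF F} (hπ : Ir n π) (h : ¬ Cu n π) : ∃ a b σ τ, a ≠ 0 ∧ b ≠ 0 ∧ a + b = n ∧
    Ir a σ ∧ Ir b τ ∧ pr n (σ * τ) π ≠ 0 := by
  unfold Cu at h
  push Not at h
  obtain ⟨a, b, ha, hb, hab, x, y, hxy⟩ := h
  subst hab
  by_contra! hcon
  apply hxy
  have h1 : ∀ τ, Ir b τ → st b τ π = 0 := by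
    intro τ hτ
    apply Hm.eq_zero (st_hm hπ.hm τ)
    intro σ hσ
    rw [pr_comm, ← adj' hτ.hm]
    exact hcon a b σ τ ha hb rfl hσ hτ
  have h2 : (rR π x) = rR π x := rfl
  have h3 := cls_eq_zero (isCls_comp b (rR π x)) (by
    intro c hc
    have h4 := h1 _ (irr_ext hc)
    have h5 := congrArg (fun φ : CF F => φ.ev x) h4
    simp only [st_ev, CF.ev_zero] at h5
    rw [ip_comm, ← h5]
    unfold ip
    apply av_congr
    intro y
    rw [ext_ev]; rfl)
  exact congrFun h3 y

theorem GG_ev0 (g : GS F 0) : (GG F).ev g = 1 := by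
  have h := fd_GG (F := F) 0
  rw [fd_eq] at h
  have : g = 1 := by ext v i; exact i.elim0
  rw [this]
  simpa [cN] using h

theorem st_zero_GG (φ : CF F) : st 0 (GG F) φ = φ := by
  conv_rhs => rw [← st_zero_one φ]
  apply CF.ext'
  intro V _ _ _ x
  rw [st_ev, st_ev]
  apply av_congr; intro y
  rw [GG_ev0, one_ev0]

theorem fd_one : fd 0 (1 : CF F) = 1 := by
  rw [fd_eq, one_ev0]; simp [cN]

theorem fd_smul (n : ℕ) (c : ℂ) (φ : CF F) : fd n (c • φ) = c * fd n φ := pr_smul _ _ _ _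
theorem fd_zero (n : ℕ) : fd n (0 : CF F) = 0 := pr_zero _ _

theorem fd_ic {d : ℕ} {ρ : CF F} (h : IC d ρ) : (qF F ^ d - 1) * fd d ρ = de d ρ := by
  have h1 := fd_rec d ρ
  rw [← Finset.sum_subset (s₁ := {(d, 0), (0, d)})] at h1
  · rw [Finset.sum_pair (by simp [h.ne])] at h1
    simp only at h1
    rw [st_zero_GG, st_full h.ir.hm, fd_smul, fd_one, pr_comm] at h1
    have : de d ρ = pr d ρ (GG F) := rfl
    rw [this]
    linear_combination h1
  · intro p hp
    simp only [Finset.mem_insert, Finset.mem_singleton] at hp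
    unfold ad
    rw [Finset.HasAntidiagonal.mem_antidiagonal]
    rcases hp with rfl | rfl <;> simp
  · intro p hp hp'
    unfold ad at hp
    rw [Finset.HasAntidiagonal.mem_antidiagonal] at hp
    simp only [Finset.mem_insert, Finset.mem_singleton, not_or] at hp'
    rw [h.cu.st_zero h.ir.hm, fd_zero]
    · intro h0; exact hp'.1 (by ext <;> simp <;> omega)
    · intro h0; exact hp'.2 (by ext <;> simp <;> omega)

theorem fd_irr_ne {n : ℕ} {π : CF F} (h : Ir n π) : fd n π ≠ 0 := by
  obtain ⟨m, hm, h1⟩ := irr_one_pos h.2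
  rw [fd_eq, h1]
  exact div_ne_zero (by exact_mod_cast hm.ne') (cN_ne _)

theorem de_ic {d : ℕ} {ρ : CF F} (h : IC d ρ) : de d ρ = 1 := by
  rcases de_01 h.ir with h0 | h1
  · exfalso
    have := fd_ic h
    rw [h0] at this
    have h3 := card_pow_ne (F := F) (d - 1)
    rw [Nat.sub_add_cancel (Nat.pos_of_ne_zero h.ne)] at h3
    exact (mul_ne_zero h3 (fd_irr_ne h.ir)) this
  · exact h1

end LMT

namespace LMT
variable {F : Type} [Field F]
variable {V V' E Q E' Q' : Type} [AddCommGroup V] [Module F V] [Finite V]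
  [AddCommGroup V'] [Module F V'] [Finite V'] [AddCommGroup E] [Module F E] [Finite E]
  [AddCommGroup Q] [Module F Q] [Finite Q] [AddCommGroup E'] [Module F E'] [Finite E']
  [AddCommGroup Q'] [Module F Q'] [Finite Q']

variable [Finite F]

theorem mul_mono {n m : ℕ} {A σ τ π : CF F} (hA : Ch n A) (hσ : Ir n σ) (hτ : Ch m τ) (hπ : Ir (n + m) π)
    (h1 : pr n A σ ≠ 0) (h2 : pr (n + m) (σ * τ) π ≠ 0) : pr (n + m) (A * τ) π ≠ 0 := by
  rw [adj' hτ.hm] at h2 ⊢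
  rw [pr_comm] at h2
  exact hA.mult (hτ.st hπ.ch) hσ h1 h2

/-- the type of cuspidal irreducible characters -/
abbrev Cs (F : Type) [Field F] [Finite F] := {p : ℕ × CF F // IC p.1 p.2}

abbrev Cs.w (t : Cs F) : ℕ := t.1.1
abbrev Cs.c (t : Cs F) : CF F := t.1.2

theorem Cs.w_pos (t : Cs F) : 0 < t.w := Nat.pos_of_ne_zero t.2.ne

theorem Cs.st_eq (t t' : Cs F) : st t.w t.c t'.c = if t = t' then 1 else 0 := by
  split_ifs with h
  · subst h; exact t.2.st_self
  · by_cases hd : t.w = t'.w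
    · apply t.2.st_ne t'.2
      intro hc
      exact h (Subtype.ext (Prod.ext hd hc))
    · exact t'.2.cu.st_zero t'.2.ir.hm t.2.ne hd _

noncomputable def dg (M : Multiset (Cs F)) : ℕ := (M.map Cs.w).sum
noncomputable def pd (M : Multiset (Cs F)) : CF F := (M.map Cs.c).prod

@[simp] theorem dg_zero : dg (0 : Multiset (Cs F)) = 0 := rfl
@[simp] theorem pd_zero : pd (0 : Multiset (Cs F)) = 1 := rfl
theorem dg_cons (t : Cs F) (M : Multiset (Cs F)) : dg (t ::ₘ M) = dg M + t.w := by
  unfold dg; rw [Multiset.map_cons, Multiset.sum_cons, add_comm]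
theorem pd_cons (t : Cs F) (M : Multiset (Cs F)) : pd (t ::ₘ M) = pd M * t.c := by
  unfold pd; rw [Multiset.map_cons, Multiset.prod_cons, mul_comm]
theorem dg_add (M N : Multiset (Cs F)) : dg (M + N) = dg M + dg N := by
  unfold dg; rw [Multiset.map_add, Multiset.sum_add]
theorem pd_add (M N : Multiset (Cs F)) : pd (M + N) = pd M * pd N := by
  unfold pd; rw [Multiset.map_add, Multiset.prod_add]

theorem Ir.chOne : Ch 0 (1 : CF F) := Ir.one.ch

theorem pd_ch (M : Multiset (Cs F)) : Ch (dg M) (pd M) := by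
  induction M using Multiset.induction_on with
  | empty => exact Ir.chOne
  | cons t M ih => rw [dg_cons, pd_cons]; exact ih.mul t.2.ir.ch

theorem de_one : de 0 (1 : CF F) = 1 := by
  unfold de; rw [pr00, one_ev0, GG_ev0, one_mul]

theorem de_pd (M : Multiset (Cs F)) : de (dg M) (pd M) = 1 := by
  induction M using Multiset.induction_on with
  | empty => exact de_one
  | cons t M ih => rw [dg_cons, pd_cons, de_mul _ _ t.2.ir.hm, ih, one_mul]; exact de_ic t.2

theorem st_pd (t : Cs F) (M : Multiset (Cs F)) :
    st t.w t.c (pd M) = (M.count t : ℂ) • pd (M.erase t) := by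
  induction M using Multiset.induction_on with
  | empty => simp [st_one t.2.ne]
  | cons a M ih =>
    rw [pd_cons, t.2.deriv, Cs.st_eq, ih]
    by_cases h : t = a
    · subst h
      rw [if_pos rfl, Multiset.erase_cons_head, Multiset.count_cons_self, mul_one, smul_mul_assoc]
      by_cases hM : t ∈ M
      · rw [← pd_cons, Multiset.cons_erase hM]
        push_cast; module
      · simp [Multiset.count_eq_zero_of_notMem hM]
    · rw [if_neg h, Multiset.erase_cons_tail _ (Ne.symm h), Multiset.count_cons_of_ne h, mul_zero, add_zero, pd_cons,
        smul_mul_assoc]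

theorem pd_orth {M M' : Multiset (Cs F)} {n : ℕ} (hn : dg M = n) (h : M ≠ M') : pr n (pd M) (pd M') = 0 := by
  induction M using Multiset.induction_on generalizing M' n with
  | empty =>
    subst hn
    rw [pr_comm]
    apply pr_hm (pd_ch M').hm
    intro h0
    obtain ⟨t, ht⟩ := Multiset.exists_mem_of_ne_zero (Ne.symm h)
    rw [← Multiset.cons_erase ht, dg_cons] at h0
    have := t.w_pos
    simp at h0
    omega
  | cons t M ih =>
    subst hn
    rw [pd_cons, dg_cons, adj' t.2.ir.hm, st_pd, pr_smul']
    by_cases ht : t ∈ M'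
    · rw [ih rfl, mul_zero]
      rintro rfl
      exact h (Multiset.cons_erase ht)
    · simp [Multiset.count_eq_zero_of_notMem ht]

theorem pd_norm {M : Multiset (Cs F)} (h : M.Nodup) : pr (dg M) (pd M) (pd M) = 1 := by
  induction M using Multiset.induction_on with
  | empty => exact Ir.one.self
  | cons t M ih =>
    rw [Multiset.nodup_cons] at h
    conv_lhs => enter [2]; rw [pd_cons]
    rw [dg_cons, adj' t.2.ir.hm, st_pd, pr_smul', Multiset.erase_cons_head, ih h.2, Multiset.count_cons_self,
      Multiset.count_eq_zero_of_notMem h.1]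
    simp

theorem ex_cs {n : ℕ} {π : CF F} (hπ : Ir n π) : ∃ M : Multiset (Cs F), dg M = n ∧ pr n (pd M) π ≠ 0 := by
  induction n using Nat.strong_induction_on generalizing π with
  | _ n ih =>
    rcases Nat.eq_zero_or_pos n with rfl | hn
    · refine ⟨0, rfl, ?_⟩
      rw [hπ.eq_one]
      have := (Ir.one (F := F)).self
      simp [this]
    by_cases hc : Cu n π
    · refine ⟨{⟨(n, π), ⟨hn.ne', hπ, hc⟩⟩}, by simp [dg], ?_⟩
      have : pd ({⟨(n, π), ⟨hn.ne', hπ, hc⟩⟩} : Multiset (Cs F)) = π := by simp [pd]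
      rw [this, hπ.self]
      exact one_ne_zero
    · obtain ⟨a, b, σ, τ, ha, hb, hab, hσ, hτ, hne⟩ := not_cu hπ hc
      obtain ⟨M, hM, hM'⟩ := ih a (by omega) hσ
      obtain ⟨N, hN, hN'⟩ := ih b (by omega) hτ
      refine ⟨M + N, by rw [dg_add, hM, hN, hab], ?_⟩
      subst hM; subst hN
      rw [pd_add]
      subst hab
      have h1 := mul_mono (pd_ch M) hσ hτ.ch hπ hM' hne
      rw [mul_comm] at h1 ⊢
      rw [add_comm] at h1 hπ ⊢
      exact mul_mono (pd_ch N) hτ (pd_ch M) hπ hN' h1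

theorem ex_gen {n : ℕ} {φ : CF F} (h : Ch n φ) (h1 : de n φ = 1) :
    ∃ π, Ir n π ∧ de n π = 1 ∧ pr n φ π = 1 ∧ ∀ σ, Ir n σ → de n σ = 1 → pr n φ σ ≠ 0 → σ = π := by
  unfold de at h1
  have h2 := h.hm.pr_eq (GG F)
  rw [h1] at h2
  choose! m hm using fun (π : CF F) (hπ : Ir n π) => pr_nat h hπ.ch
  choose! l hl using fun (π : CF F) (hπ : Ir n π) => de_nat hπ.ch
  have h3 : ∑ π ∈ irF F n, m π * l π = 1 := by
    have h4 : ((∑ π ∈ irF F n, m π * l π : ℕ) : ℂ) = ((1 : ℕ) : ℂ) := by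
      push_cast
      rw [h2]
      apply Finset.sum_congr rfl
      intro π hπ
      rw [← hm π (mem_irF.1 hπ), ← hl π (mem_irF.1 hπ)]; rfl
    exact_mod_cast h4
  obtain ⟨π, hπ, hne⟩ : ∃ π ∈ irF F n, m π * l π ≠ 0 := by
    by_contra! hc
    rw [Finset.sum_eq_zero hc] at h3
    exact zero_ne_one h3
  have h5 : m π * l π = 1 := by
    have := Finset.single_le_sum (f := fun π => m π * l π) (fun _ _ => Nat.zero_le _) hπ
    omega
  have h6 := Nat.eq_one_of_mul_eq_one_right h5
  have h7 := Nat.eq_one_of_mul_eq_one_left h5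
  have hI := mem_irF.1 hπ
  refine ⟨π, hI, by rw [hl π hI, h7]; simp, by rw [hm π hI, h6]; simp, ?_⟩
  intro σ hσ hd hs
  by_contra hne'
  have h8 : m π * l π + m σ * l σ ≤ 1 := by
    rw [← h3, ← Finset.sum_pair (f := fun π => m π * l π) (Ne.symm hne')]
    apply Finset.sum_le_sum_of_subset
    intro x hx
    simp only [Finset.mem_insert, Finset.mem_singleton] at hx
    rcases hx with rfl | rfl
    · exact hπ
    · exact mem_irF.2 hσ
  have h9 : l σ = 1 := by
    rw [hl σ hσ] at hd; exact_mod_cast hd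
  have h10 : m σ ≠ 0 := by
    intro h0; rw [hm σ hσ, h0] at hs; simp at hs
  rw [h9, h5] at h8
  omega

/-- multisets of cuspidals and generic characters -/
theorem gen_equiv (n : ℕ) : Nonempty ({M : Multiset (Cs F) // dg M = n} ≃ {π : CF F // π ∈ (irF F n).filter fun π => de n π = 1}) := by
  have h1 : ∀ M : {M : Multiset (Cs F) // dg M = n}, _ := fun M => by
    have h2 := pd_ch M.1; have h3 := de_pd M.1
    rw [M.2] at h2 h3
    exact ex_gen h2 h3
  choose f hf hf1 hf2 hf3 using h1
  refine ⟨Equiv.ofBijective (fun M => ⟨f M, Finset.mem_filter.2 ⟨mem_irF.2 (hf M), hf1 M⟩⟩) ⟨?_, ?_⟩⟩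
  · intro M N hMN
    have h4 : f M = f N := congrArg Subtype.val hMN
    by_contra hne
    have h5 := pd_orth M.2 (fun h => hne (Subtype.ext h))
    have h2 := pd_ch M.1
    have h3 := pd_ch N.1
    rw [M.2] at h2
    rw [N.2] at h3
    refine h2.mult h3 (hf M) ?_ ?_ h5
    · rw [hf2]; exact one_ne_zero
    · rw [h4, hf2]; exact one_ne_zero
  · rintro ⟨π, hπ⟩
    rw [Finset.mem_filter, mem_irF] at hπ
    obtain ⟨M, hM, hM'⟩ := ex_cs hπ.1
    exact ⟨⟨M, hM⟩, Subtype.ext (hf3 ⟨M, hM⟩ π hπ.1 hπ.2 hM').symm⟩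

theorem ms_finite (n : ℕ) : Finite {M : Multiset (Cs F) // dg M = n} := by
  obtain ⟨e⟩ := gen_equiv (F := F) n
  exact Finite.of_equiv _ e.symm

theorem ms_card (n : ℕ) : (Nat.card {M : Multiset (Cs F) // dg M = n} : ℂ) = pr n (GG F) (GG F) := by
  obtain ⟨e⟩ := gen_equiv (F := F) n
  rw [Nat.card_congr e, ← de_sq]
  rw [Nat.card_eq_fintype_card, Fintype.card_coe, Finset.card_filter]
  push_cast
  apply Finset.sum_congr rfl
  intro π hπ
  rcases de_01 (mem_irF.1 hπ) with h | h <;> rw [h] <;> simp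

theorem ms_card0 : Nat.card {M : Multiset (Cs F) // dg M = 0} = 1 := by
  have h := ms_card (F := F) 0
  rw [pr00, GG_ev0, one_mul] at h
  exact_mod_cast h

theorem ms_card_succ (n : ℕ) : Nat.card {M : Multiset (Cs F) // dg M = n + 1} + Nat.card F ^ n = Nat.card F ^ (n + 1) := by
  have h := ms_card (F := F) (n + 1)
  rw [GG_norm] at h
  have h2 : (((Nat.card {M : Multiset (Cs F) // dg M = n + 1} + Nat.card F ^ n : ℕ)) : ℂ) = ((Nat.card F ^ (n + 1) : ℕ) : ℂ) := by
    push_cast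
    rw [h]
    unfold qF
    ring
  exact_mod_cast h2
end LMT

namespace LMT
variable {F : Type} [Field F]
variable {V V' E Q E' Q' : Type} [AddCommGroup V] [Module F V] [Finite V]
  [AddCommGroup V'] [Module F V'] [Finite V'] [AddCommGroup E] [Module F E] [Finite E]
  [AddCommGroup Q] [Module F Q] [Finite Q] [AddCommGroup E'] [Module F E'] [Finite E']
  [AddCommGroup Q'] [Module F Q'] [Finite Q']

variable [Finite F]

noncomputable def Ms (F : Type) [Field F] [Finite F] (n : ℕ) : Finset (Multiset (Cs F)) :=
  (Set.finite_coe_iff.1 (ms_finite (F := F) n) : Set.Finite {M | dg M = n}).toFinset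

theorem mem_Ms {n : ℕ} {M : Multiset (Cs F)} : M ∈ Ms F n ↔ dg M = n := by
  unfold Ms; rw [Set.Finite.mem_toFinset]; rfl

theorem Ms_card (n : ℕ) : (Ms F n).card = Nat.card {M : Multiset (Cs F) // dg M = n} := by
  rw [← Nat.card_eq_finsetCard]
  exact Nat.card_congr (Equiv.subtypeEquivRight fun M => mem_Ms)

theorem w_fin (d : ℕ) : Set.Finite {t : Cs F | t.w = d} := by
  have := Set.Finite.preimage (f := fun t : Cs F => ({t} : Multiset (Cs F))) (s := {M | dg M = d})
    (fun a _ b _ h => Multiset.singleton_inj.1 h) (Set.finite_coe_iff.1 (ms_finite (F := F) d))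
  refine this.subset ?_
  intro t ht
  simpa [dg] using ht

noncomputable def Wd (F : Type) [Field F] [Finite F] (d : ℕ) : Finset (Cs F) := (w_fin d).toFinset
theorem mem_Wd {d : ℕ} {t : Cs F} : t ∈ Wd F d ↔ t.w = d := by
  unfold Wd; rw [Set.Finite.mem_toFinset]; rfl

/-- number of cuspidals of degree `d` -/
noncomputable def nc (F : Type) [Field F] [Finite F] (d : ℕ) : ℕ := (Wd F d).card

noncomputable def TT (F : Type) [Field F] [Finite F] (n : ℕ) : Finset (Cs F) := (Finset.Icc 1 n).biUnion (Wd F)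
theorem mem_TT {n : ℕ} {t : Cs F} : t ∈ TT F n ↔ t.w ≤ n := by
  unfold TT
  simp only [Finset.mem_biUnion, Finset.mem_Icc, mem_Wd]
  have := t.w_pos
  constructor
  · rintro ⟨a, ha, rfl⟩; exact ha.2
  · intro h; exact ⟨t.w, ⟨this, h⟩, rfl⟩

theorem sum_TT {A : Type*} [AddCommMonoid A] (n : ℕ) (f : Cs F → A) :
    ∑ t ∈ TT F n, f t = ∑ d ∈ Finset.Icc 1 n, ∑ t ∈ Wd F d, f t := by
  unfold TT
  rw [Finset.sum_biUnion]
  intro a _ b _ hab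
  refine Finset.disjoint_left.2 fun t h1 h2 => hab ?_
  rw [mem_Wd] at h1 h2
  rw [← h1, h2]

theorem sum_TT_w {A : Type*} [AddCommMonoid A] (n : ℕ) (f : ℕ → A) :
    ∑ t ∈ TT F n, f t.w = ∑ d ∈ Finset.Icc 1 n, nc F d • f d := by
  rw [sum_TT]
  apply Finset.sum_congr rfl
  intro d _
  rw [nc, ← Finset.sum_const]
  apply Finset.sum_congr rfl
  intro t ht
  rw [mem_Wd.1 ht]

theorem count_w_le (t : Cs F) (M : Multiset (Cs F)) : M.count t * t.w ≤ dg M := by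
  have h : Multiset.replicate (M.count t) t ≤ M := Multiset.le_count_iff_replicate_le.1 le_rfl
  obtain ⟨N, hN⟩ := Multiset.le_iff_exists_add.1 h
  conv_rhs => rw [hN]
  rw [dg_add]
  simp [dg]

theorem dg_count {n : ℕ} {M : Multiset (Cs F)} (h : dg M = n) : n = ∑ t ∈ TT F n, M.count t * t.w := by
  rw [← h]
  conv_lhs => unfold dg
  rw [Finset.sum_multiset_map_count]
  apply Finset.sum_subset
  · intro t ht
    rw [mem_TT]
    have h1 := count_w_le t M
    have h2 : 1 ≤ M.count t := Multiset.one_le_count_iff_mem.2 (Multiset.mem_toFinset.1 ht)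
    nlinarith
  · intro t _ ht
    rw [Multiset.mem_toFinset] at ht
    rw [Multiset.count_eq_zero_of_notMem ht, zero_smul]

theorem card_filter_Ms (n j : ℕ) (t : Cs F) : ((Ms F n).filter fun M => j ≤ M.count t).card =
    if j * t.w ≤ n then (Ms F (n - j * t.w)).card else 0 := by
  have hr : dg (Multiset.replicate j t) = j * t.w := by simp [dg]
  split_ifs with h
  · refine Finset.card_bij' (fun M _ => M - Multiset.replicate j t) (fun M _ => M + Multiset.replicate j t) ?_ ?_ ?_ ?_
    · intro M hM
      rw [Finset.mem_filter, mem_Ms, Multiset.le_count_iff_replicate_le] at hM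
      obtain ⟨N, hN⟩ := Multiset.le_iff_exists_add.1 hM.2
      rw [mem_Ms, hN, add_tsub_cancel_left]
      rw [← hM.1, hN, dg_add, hr]; omega
    · intro M hM
      rw [mem_Ms] at hM
      rw [Finset.mem_filter, mem_Ms, dg_add, hM, hr]
      refine ⟨by omega, by simp⟩
    · intro M hM
      rw [Finset.mem_filter, mem_Ms, Multiset.le_count_iff_replicate_le] at hM
      exact tsub_add_cancel_of_le hM.2
    · intro M hM
      simp
  · rw [Finset.card_eq_zero, Finset.filter_eq_empty_iff]
    intro M hM hj
    rw [mem_Ms] at hM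
    have := count_w_le t M
    have h3 := Nat.mul_le_mul_right t.w hj
    omega

theorem ms_rec (n : ℕ) : n * (Ms F n).card =
    ∑ k ∈ Finset.Icc 1 n, (∑ d ∈ k.divisors, d * nc F d) * (Ms F (n - k)).card := by
  have h1 : n * (Ms F n).card = ∑ M ∈ Ms F n, ∑ t ∈ TT F n, ∑ j ∈ Finset.Icc 1 n, if j ≤ M.count t then t.w else 0 := by
    rw [mul_comm, ← smul_eq_mul, ← Finset.sum_const]
    apply Finset.sum_congr rfl
    intro M hM
    rw [mem_Ms] at hM
    conv_lhs => rw [dg_count hM]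
    apply Finset.sum_congr rfl
    intro t ht
    rw [← Finset.sum_filter, Finset.sum_const, smul_eq_mul]
    congr 1
    have h2 := count_w_le t M
    have h3 : M.count t ≤ n := by
      have := t.w_pos
      nlinarith
    have : (Finset.Icc 1 n).filter (fun j => j ≤ M.count t) = Finset.Icc 1 (M.count t) := by
      ext j; simp only [Finset.mem_filter, Finset.mem_Icc]; omega
    rw [this]; simp
  rw [h1, Finset.sum_comm]
  have h2 : ∀ t ∈ TT F n, (∑ M ∈ Ms F n, ∑ j ∈ Finset.Icc 1 n, if j ≤ M.count t then t.w else 0) =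
      ∑ j ∈ Finset.Icc 1 n, ∑ k ∈ Finset.Icc 1 n, (if j * t.w = k then t.w else 0) * (Ms F (n - k)).card := by
    intro t ht
    rw [Finset.sum_comm]
    apply Finset.sum_congr rfl
    intro j hj
    rw [← Finset.sum_filter, Finset.sum_const, card_filter_Ms]
    simp only [ite_mul, zero_mul]
    rw [Finset.sum_ite_eq]
    have := t.w_pos
    have hj1 := (Finset.mem_Icc.1 hj).1
    have h3 : 1 ≤ j * t.w := Nat.mul_pos hj1 this
    simp only [Finset.mem_Icc, h3, true_and]
    split_ifs
    · simp [mul_comm]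
    · simp
  rw [Finset.sum_congr rfl h2, sum_TT_w n (fun w => ∑ j ∈ Finset.Icc 1 n, ∑ k ∈ Finset.Icc 1 n, (if j * w = k then w else 0) * (Ms F (n - k)).card)]
  simp only [Finset.smul_sum]
  simp only [Finset.sum_comm (s := Finset.Icc 1 n) (t := Finset.Icc 1 n) (f := fun j k => _ • ((if j * _ = k then _ else 0) * _))]
  rw [Finset.sum_comm]
  apply Finset.sum_congr rfl
  intro k hk
  rw [Finset.mem_Icc] at hk
  rw [Finset.sum_mul]
  have h4 : k.divisors ⊆ Finset.Icc 1 n := by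
    intro d hd
    have h5 := Nat.divisor_le hd
    have h6 := Nat.pos_of_mem_divisors hd
    rw [Finset.mem_Icc]; omega
  rw [← Finset.sum_subset h4]
  · apply Finset.sum_congr rfl
    intro d hd
    rw [Nat.mem_divisors] at hd
    obtain ⟨⟨e, he⟩, _⟩ := hd
    have hd0 : 0 < d := Nat.pos_of_ne_zero (by rintro rfl; simp at he; omega)
    have he0 : 0 < e := Nat.pos_of_ne_zero (by rintro rfl; simp at he; omega)
    rw [Finset.sum_eq_single e]
    · rw [if_pos (by rw [he, mul_comm])]; simp; ring
    · intro j _ hj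
      rw [if_neg]; · simp
      intro h; rw [he, mul_comm] at h; exact hj (Nat.eq_of_mul_eq_mul_left hd0 h)
    · intro h
      exfalso; apply h
      rw [Finset.mem_Icc]
      refine ⟨he0, ?_⟩
      nlinarith
  · intro d hd hd'
    apply Finset.sum_eq_zero
    intro j _
    rw [if_neg]; · simp
    intro h
    exact hd' (Nat.mem_divisors.2 ⟨⟨j, by rw [← h, mul_comm]⟩, by omega⟩)

theorem Ms0 : (Ms F 0).card = 1 := by rw [Ms_card, ms_card0]
theorem Ms_succ (n : ℕ) : (Ms F (n + 1)).card + Nat.card F ^ n = Nat.card F ^ (n + 1) := by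
  rw [Ms_card, ms_card_succ]

theorem nc_sum {n : ℕ} (hn : n ≠ 0) : ∑ d ∈ n.divisors, d * nc F d + 1 = Nat.card F ^ n := by
  induction n using Nat.strong_induction_on with
  | _ n ih =>
    obtain ⟨m, rfl⟩ := Nat.exists_eq_succ_of_ne_zero hn
    have h := ms_rec (F := F) (m + 1)
    rw [← Finset.insert_Icc_right_eq_Icc_add_one (by omega), Finset.sum_insert (by simp)] at h
    simp only [Nat.sub_self, Ms0, mul_one] at h
    have hq0 : (0 : ℤ) < (Nat.card F : ℤ) := by exact_mod_cast Nat.card_pos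
    set q : ℤ := (Nat.card F : ℤ) with hq
    have h1 : ∀ k ∈ Finset.Icc 1 m, (((∑ d ∈ k.divisors, d * nc F d) * (Ms F (m + 1 - k)).card : ℕ) : ℤ)
        = (q ^ (m + 1) - q ^ m) - (q ^ (m + 1 - k) - q ^ (m - k)) := by
      intro k hk
      rw [Finset.mem_Icc] at hk
      have h2 := ih k (by omega) (by omega)
      have h3 := Ms_succ (F := F) (m - k)
      have e : m + 1 - k = m - k + 1 := by omega
      rw [e]
      zify at h2 h3
      rw [← hq] at h2 h3
      push_cast
      rw [eq_sub_of_add_eq h2, eq_sub_of_add_eq h3]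
      have e1 : q ^ (m + 1) = q ^ (m - k + 1) * q ^ k := by rw [← pow_add]; congr 1; omega
      have e2 : q ^ m = q ^ (m - k) * q ^ k := by rw [← pow_add]; congr 1; omega
      rw [e1, e2]; ring
    have h4 : ∑ k ∈ Finset.Icc 1 m, (q ^ (m + 1 - k) - q ^ (m - k)) = q ^ m - 1 := by
      have e : Finset.Icc 1 m = Finset.Ico 1 (m + 1) := by ext; simp [Nat.lt_succ_iff]
      rw [e, Finset.sum_Ico_eq_sum_range]
      have := Finset.sum_range_sub (fun i => - q ^ (m - i)) m
      simp only [Nat.sub_self, Nat.sub_zero, pow_zero] at this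
      rw [show q ^ m - 1 = -1 - -q ^ m by ring, ← this]
      apply Finset.sum_congr (by simp)
      intro i _
      rw [show m + 1 - (1 + i) = m - i by omega, show m - (1 + i) = m - (i + 1) by omega]
      ring
    have h5 := Ms_succ (F := F) m
    zify at h h5 ⊢
    rw [← hq] at h5 ⊢
    have h6 := Finset.sum_congr rfl h1
    push_cast at h6
    rw [h6, Finset.sum_sub_distrib, h4, Finset.sum_const, Nat.card_Icc, eq_sub_of_add_eq h5] at h
    simp only [nsmul_eq_mul, Nat.add_sub_cancel] at h
    push_cast at h ⊢
    rw [Nat.succ_eq_add_one]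
    linear_combination -h
end LMT

namespace LMT
variable {F : Type} [Field F]
variable {V V' E Q E' Q' : Type} [AddCommGroup V] [Module F V] [Finite V]
  [AddCommGroup V'] [Module F V'] [Finite V'] [AddCommGroup E] [Module F E] [Finite E]
  [AddCommGroup Q] [Module F Q] [Finite Q] [AddCommGroup E'] [Module F E'] [Finite E']
  [AddCommGroup Q'] [Module F Q'] [Finite Q']

variable [Finite F]

theorem pd_replicate (t : Cs F) (m : ℕ) : pd (Multiset.replicate m t) = t.c ^ m := by simp [pd]
theorem dg_replicate (t : Cs F) (m : ℕ) : dg (Multiset.replicate m t) = m * t.w := by simp [dg]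

theorem pw_ch (t : Cs F) (m : ℕ) : Ch (m * t.w) (t.c ^ m) := by
  rw [← pd_replicate, ← dg_replicate]; exact pd_ch _

theorem st_pw (t : Cs F) (m : ℕ) : st t.w t.c (t.c ^ (m + 1)) = ((m + 1 : ℕ) : ℂ) • t.c ^ m := by
  rw [← pd_replicate, st_pd, Multiset.count_replicate_self, Multiset.replicate_succ, Multiset.erase_cons_head, pd_replicate]

/-- `σ` is an irreducible constituent of `ρ^m` -/
structure Oc (t : Cs F) (m : ℕ) (σ : CF F) : Prop where
  ir : Ir (m * t.w) σ
  ne : pr (m * t.w) (t.c ^ m) σ ≠ 0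

theorem supp {t : Cs F} {m n k : ℕ} {σ τ π : CF F} (hσ : Ir n σ) (hτ : Ir k τ) (hπ : Oc t m π)
    (hnk : n + k = m * t.w) (h : pr (n + k) (σ * τ) π ≠ 0) :
    ∃ a b, a + b = m ∧ n = a * t.w ∧ k = b * t.w ∧ Oc t a σ ∧ Oc t b τ := by
  obtain ⟨M, hM, hM'⟩ := ex_cs hσ
  obtain ⟨N, hN, hN'⟩ := ex_cs hτ
  have hπ1 := hπ.ir
  rw [← hnk] at hπ1
  subst hM; subst hN
  have h1 := mul_mono (pd_ch M) hσ hτ.ch hπ1 hM' h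
  have h2 : pr (dg N + dg M) (pd N * pd M) π ≠ 0 := by
    rw [mul_comm] at h1
    rw [add_comm] at h1 hπ1
    exact mul_mono (pd_ch N) hτ (pd_ch M) hπ1 hN' h1
  have h3 : M + N = Multiset.replicate m t := by
    by_contra hne
    have h4 := pd_orth (M := M + N) (n := m * t.w) (by rw [dg_add, hnk]) hne
    rw [pd_replicate] at h4
    have h5 := pd_ch (M + N)
    rw [dg_add, hnk] at h5
    refine h5.mult (pw_ch t m) hπ.ir ?_ hπ.ne h4
    rw [pd_add, ← hnk, mul_comm, add_comm]; exact h2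
  have h6 : M = Multiset.replicate M.card t := Multiset.eq_replicate_card.2 fun b hb =>
    Multiset.eq_of_mem_replicate (n := m) (h3 ▸ Multiset.mem_add.2 (Or.inl hb))
  have h7 : N = Multiset.replicate N.card t := Multiset.eq_replicate_card.2 fun b hb =>
    Multiset.eq_of_mem_replicate (n := m) (h3 ▸ Multiset.mem_add.2 (Or.inr hb))
  have h8 : dg M = M.card * t.w := by conv_lhs => rw [h6, dg_replicate]
  have h9 : dg N = N.card * t.w := by conv_lhs => rw [h7, dg_replicate]
  refine ⟨M.card, N.card, by rw [← Multiset.card_add, h3, Multiset.card_replicate], h8, h9, ⟨by rwa [← h8], ?_⟩, ⟨by rwa [← h9], ?_⟩⟩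
  · rw [← h8, ← pd_replicate, ← h6]; exact hM'
  · rw [← h9, ← pd_replicate, ← h7]; exact hN'

theorem Ch.oc {t : Cs F} {m n : ℕ} {A σ : CF F} (hA : Ch n A) (hσ : Ir n σ) (h : pr n A σ ≠ 0)
    (hn : n = m * t.w) (hA' : A = t.c ^ m) : Oc t m σ := by
  subst hn; subst hA'; exact ⟨hσ, h⟩

/-- if `de φ = 0` then no generic constituents -/
theorem de_zero_pr {n : ℕ} {φ π : CF F} (h : Ch n φ) (h0 : de n φ = 0) (hπ : Ir n π) (h1 : de n π ≠ 0) :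
    pr n φ π = 0 := by
  by_contra hne
  have h2 := h.sub_irr hπ hne
  obtain ⟨m, hm⟩ := de_nat h2
  obtain ⟨l, hl⟩ := de_nat hπ.ch
  have h3 : de n (φ - π) = de n φ - de n π := pr_sub _ _ _ _
  rw [h0, hm, hl] at h3
  have h4 : ((m + l : ℕ) : ℂ) = ((0 : ℕ) : ℂ) := by push_cast; rw [h3]; ring
  have h5 : m + l = 0 := by exact_mod_cast h4
  apply h1; rw [hl]; simp; omega

theorem eg_ex (t : Cs F) (m : ℕ) : ∃ π, Oc t m π ∧ de (m * t.w) π = 1 ∧ pr (m * t.w) (t.c ^ m) π = 1 ∧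
    ∀ σ, Oc t m σ → de (m * t.w) σ = 1 → σ = π := by
  have h := de_pd (Multiset.replicate m t)
  rw [pd_replicate, dg_replicate] at h
  obtain ⟨π, h1, h2, h3, h4⟩ := ex_gen (pw_ch t m) h
  exact ⟨π, ⟨h1, by rw [h3]; exact one_ne_zero⟩, h2, h3, fun σ hσ hd => h4 σ hσ.ir hd hσ.ne⟩

/-- generic constituent of `ρ^m` -/
noncomputable def eg (t : Cs F) (m : ℕ) : CF F := (eg_ex t m).choose
theorem eg_oc (t : Cs F) (m : ℕ) : Oc t m (eg t m) := (eg_ex t m).choose_spec.1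
theorem eg_ir (t : Cs F) (m : ℕ) : Ir (m * t.w) (eg t m) := (eg_oc t m).ir
theorem eg_de (t : Cs F) (m : ℕ) : de (m * t.w) (eg t m) = 1 := (eg_ex t m).choose_spec.2.1
theorem eg_pr (t : Cs F) (m : ℕ) : pr (m * t.w) (t.c ^ m) (eg t m) = 1 := (eg_ex t m).choose_spec.2.2.1
theorem eg_uniq {t : Cs F} {m : ℕ} {σ : CF F} (h : Oc t m σ) (h1 : de (m * t.w) σ = 1) : σ = eg t m :=
  (eg_ex t m).choose_spec.2.2.2 σ h h1

theorem eg_zero (t : Cs F) : eg t 0 = 1 := by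
  have := eg_ir t 0
  rw [zero_mul] at this
  exact this.eq_one

theorem eg_one (t : Cs F) : eg t 1 = t.c := by
  symm
  apply eg_uniq
  · refine ⟨by rw [one_mul]; exact t.2.ir, ?_⟩
    rw [one_mul, pow_one, t.2.ir.self]; exact one_ne_zero
  · rw [one_mul]; exact de_ic t.2

theorem Oc.mul {t : Cs F} {a b : ℕ} {σ τ π : CF F} (hσ : Oc t a σ) (hτ : Oc t b τ) (hπ : Ir (a * t.w + b * t.w) π)
    (h : pr (a * t.w + b * t.w) (σ * τ) π ≠ 0) : Oc t (a + b) π := by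
  have h1 := mul_mono (pw_ch t a) hσ.ir hτ.ir.ch hπ hσ.ne h
  rw [mul_comm (t.c ^ a)] at h1
  rw [add_comm] at h1 hπ
  have h2 := mul_mono (pw_ch t b) hτ.ir (pw_ch t a) hπ hτ.ne h1
  rw [← pow_add, ← add_mul, add_comm] at h2
  rw [← add_mul, add_comm] at hπ
  exact ⟨hπ, h2⟩

theorem eg_mul (t : Cs F) (a b : ℕ) : pr (a * t.w + b * t.w) (eg t a * eg t b) (eg t (a + b)) = 1 := by
  have h1 := (eg_ir t a).ch.mul (eg_ir t b).ch
  have h2 : de (a * t.w + b * t.w) (eg t a * eg t b) = 1 := by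
    rw [de_mul _ _ (eg_ir t b).hm, eg_de, eg_de, one_mul]
  obtain ⟨π, h3, h4, h5, h6⟩ := ex_gen h1 h2
  have h7 := (eg_oc t a).mul (eg_oc t b) h3 (by rw [h5]; exact one_ne_zero)
  have h8 := eg_uniq h7 (by rw [add_mul]; exact h4)
  rw [← h8]; exact h5

theorem eg_mul1 (t : Cs F) (m : ℕ) : pr (m * t.w + t.w) (eg t m * t.c) (eg t (m + 1)) = 1 := by
  have := eg_mul t m 1
  rwa [eg_one, one_mul] at this

theorem succ_mul' (m w : ℕ) : (m + 1) * w = m * w + w := Nat.succ_mul m w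

theorem st_eg (t : Cs F) (m : ℕ) : st t.w t.c (eg t (m + 1)) = eg t m := by
  have hi := eg_ir t (m + 1)
  rw [succ_mul'] at hi
  have hA := t.2.ir.ch.st hi.ch
  have h1 : pr (m * t.w) (eg t m) (st t.w t.c (eg t (m + 1))) = 1 := by
    rw [← adj' t.2.ir.hm]; exact eg_mul1 t m
  have h1' := h1
  rw [pr_comm] at h1'
  have hB := hA.sub_irr (eg_ir t m) (by rw [h1']; exact one_ne_zero)
  rw [← sub_eq_zero]
  by_contra hne
  obtain ⟨σ, hσ, hs⟩ := hB.ex_irr hne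
  have h2 : pr (m * t.w) (st t.w t.c (eg t (m + 1)) - eg t m) (t.c ^ m) = 0 := by
    rw [pr_sub, pr_comm, ← adj' t.2.ir.hm, pr_comm (m * t.w), eg_pr, ← pow_succ]
    have := eg_pr t (m + 1)
    rw [succ_mul'] at this
    rw [this, sub_self]
  have h3 : pr (m * t.w + t.w) (σ * t.c) (eg t (m + 1)) ≠ 0 := by
    rw [adj' t.2.ir.hm, pr_comm]
    intro h0
    rw [pr_sub, h0] at hs
    obtain ⟨l, hl⟩ := pr_nat (eg_ir t m).ch hσ.ch
    obtain ⟨j, hj⟩ := pr_nat hB hσ.ch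
    rw [pr_sub, h0] at hj
    rw [hl] at hs hj
    have h4 : ((j + l : ℕ) : ℂ) = ((0 : ℕ) : ℂ) := by push_cast; rw [← hj]; ring
    have h5 : j + l = 0 := by exact_mod_cast h4
    apply hs
    have : l = 0 := by omega
    rw [this]; simp
  obtain ⟨a, b, hab, ha, hb, h4, h5⟩ := supp hσ t.2.ir (eg_oc t (m + 1)) (succ_mul' m t.w).symm h3
  have : a = m := (Nat.eq_of_mul_eq_mul_right t.w_pos ha).symm
  subst this
  exact hB.mult (pw_ch t a) hσ hs h4.ne h2
end LMT

namespace LMT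
variable {F : Type} [Field F]
variable {V V' E Q E' Q' : Type} [AddCommGroup V] [Module F V] [Finite V]
  [AddCommGroup V'] [Module F V'] [Finite V'] [AddCommGroup E] [Module F E] [Finite E]
  [AddCommGroup Q] [Module F Q] [Finite Q] [AddCommGroup E'] [Module F E'] [Finite E']
  [AddCommGroup Q'] [Module F Q'] [Finite Q']

variable [Finite F]

/-- the nongeneric constituent of `ρ^2` -/
noncomputable def h2 (t : Cs F) : CF F := t.c ^ 2 - eg t 2

theorem pw_norm2 (t : Cs F) : pr (2 * t.w) (t.c ^ 2) (t.c ^ 2) = 2 := by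
  rw [show 2 * t.w = 1 * t.w + t.w by ring]
  conv_lhs => enter [2]; rw [pow_two]
  rw [adj' t.2.ir.hm, st_pw t 1, pr_smul', pow_one, one_mul, t.2.ir.self]
  norm_num

theorem h2_ir (t : Cs F) : Ir (2 * t.w) (h2 t) := by
  apply Ir.mk'
  · exact (pw_ch t 2).sub_irr (eg_ir t 2) (by rw [eg_pr]; exact one_ne_zero)
  · unfold h2
    rw [pr_sub, pr_sub', pr_sub', pw_norm2, (eg_ir t 2).self, eg_pr, pr_comm, eg_pr]
    norm_num

theorem pw_eq (t : Cs F) : t.c ^ 2 = eg t 2 + h2 t := by unfold h2; ring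

theorem h2_de (t : Cs F) : de (2 * t.w) (h2 t) = 0 := by
  have h := de_pd (Multiset.replicate 2 t)
  rw [pd_replicate, dg_replicate] at h
  have h1 := eg_de t 2
  unfold h2
  unfold de at *
  rw [pr_sub, h, h1, sub_self]

theorem h2_oc (t : Cs F) : Oc t 2 (h2 t) := by
  refine ⟨h2_ir t, ?_⟩
  rw [pw_eq, pr_add, (h2_ir t).self]
  have : pr (2 * t.w) (eg t 2) (h2 t) = 0 := by
    apply (eg_ir t 2).orth (h2_ir t)
    intro h
    have h1 := h2_de t
    rw [← h, eg_de] at h1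
    exact one_ne_zero h1
  rw [this]; norm_num

theorem st_h2 (t : Cs F) : st t.w t.c (h2 t) = t.c := by
  unfold h2
  rw [st_sub', st_pw t 1, st_eg, eg_one, pow_one]
  push_cast
  module

/-- characters with a nongeneric factor do not contain `e_m` -/
theorem mul_eg_zero {t : Cs F} {m n k : ℕ} {A B : CF F} (hA : Ch n A) (hB : Ch k B) (h0 : de k B = 0)
    (hnk : n + k = m * t.w) : pr (n + k) (A * B) (eg t m) = 0 := by
  apply de_zero_pr (hA.mul hB)
  · rw [de_mul _ _ hB.hm, h0, mul_zero]
  · rw [hnk]; exact eg_ir t m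
  · rw [hnk, eg_de]; exact one_ne_zero

theorem st_eg_zero {t : Cs F} {m k : ℕ} {B : CF F} (hB : Ch k B) (h0 : de k B = 0) : st k B (eg t m) = 0 := by
  by_cases hk : m * t.w < k
  · exact st_hm_lt (eg_ir t m).hm hk B
  · have e : m * t.w - k + k = m * t.w := by omega
    have h1 := (eg_ir t m)
    rw [← e] at h1
    apply (hB.st h1.ch).hm.eq_zero
    intro σ hσ
    rw [pr_comm, ← adj' hB.hm]
    exact mul_eg_zero hσ.ch hB h0 e

theorem st_c_ch {t : Cs F} {n : ℕ} {φ : CF F} (h : Ch n φ) : Ch (n - t.w) (st t.w t.c φ) := by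
  by_cases hk : n < t.w
  · rw [st_hm_lt h.hm hk]; exact Ch.zero _
  · apply t.2.ir.ch.st
    rwa [Nat.sub_add_cancel (by omega)]

theorem eg_rho_norm (t : Cs F) (m : ℕ) : pr ((m + 1) * t.w + t.w) (eg t (m + 1) * t.c) (eg t (m + 1) * t.c) = 2 := by
  rw [adj' t.2.ir.hm, t.2.deriv, st_eg, t.2.st_self, pr_add', mul_one, (eg_ir t (m+1)).self, pr_comm]
  have := eg_mul1 t m
  rw [← succ_mul'] at this
  rw [this]; norm_num

theorem h2_eg_rho (t : Cs F) (m : ℕ) : pr (m * t.w + 2 * t.w) (eg t m * h2 t) (eg t (m + 1) * t.c) = 1 := by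
  rw [show m * t.w + 2 * t.w = (m + 1) * t.w + t.w by ring, pr_comm, adj' t.2.ir.hm, t.2.deriv, st_h2, pr_add', pr_comm _ _ (eg t m * t.c)]
  have := eg_mul1 t m
  rw [← succ_mul'] at this
  rw [this]
  have h3 : pr ((m + 1) * t.w) (eg t (m + 1)) (st t.w t.c (eg t m) * h2 t) = 0 := by
    rcases m with _ | m
    · rw [eg_zero, st_one t.2.ne, zero_mul, pr_zero']
    · rw [st_eg, pr_comm, show (m + 1 + 1) * t.w = m * t.w + 2 * t.w by ring]
      apply mul_eg_zero (m := m + 1 + 1) (eg_ir t m).ch (h2_ir t).ch (h2_de t) (by ring)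
  rw [h3, zero_add]

theorem eg_of_h2 {t : Cs F} {m : ℕ} {π : CF F} (hπ : Oc t m π) (h : st (2 * t.w) (h2 t) π = 0) : π = eg t m := by
  induction m generalizing π with
  | zero =>
    have := hπ.ir
    rw [zero_mul] at this
    rw [this.eq_one, eg_zero]
  | succ m ih =>
    have hi := hπ.ir
    rw [succ_mul'] at hi
    have h1 : pr (m * t.w + t.w) (t.c ^ m * t.c) π ≠ 0 := by
      rw [← pow_succ, ← succ_mul']; exact hπ.ne
    obtain ⟨σ, hσ, h2', h3⟩ := ex_factor (pw_ch t m) t.2.ir.ch hi h1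
    have hσo : Oc t m σ := ⟨hσ, h2'⟩
    have h4 : st (2 * t.w) (h2 t) σ = 0 := by
      by_cases hm : m < 2
      · apply st_hm_lt hσ.hm
        exact Nat.mul_lt_mul_of_pos_right hm t.w_pos
      obtain ⟨l, rfl⟩ := Nat.exists_eq_add_of_le' (not_lt.1 hm)
      rw [add_mul] at hσ
      have hc := (h2_ir t).ch.st hσ.ch
      apply hc.hm.eq_zero
      intro τ hτ
      by_contra hne
      rw [pr_comm, ← adj' (h2_ir t).hm] at hne
      rw [← add_mul] at hne hσ
      have h5 := mul_mono (A := τ * h2 t) (n := (l + 2) * t.w) (by rw [add_mul]; exact hτ.ch.mul (h2_ir t).ch) hσ t.2.ir.ch hi hne h3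
      rw [mul_assoc, mul_comm (h2 t), ← mul_assoc, show (l + 2) * t.w + t.w = (l * t.w + t.w) + 2 * t.w by ring, adj' (h2_ir t).hm, h, pr_zero'] at h5
      exact h5 rfl
    have h5 := ih hσo h4
    subst h5
    rcases m with _ | m
    · rw [eg_zero, one_mul, zero_mul, zero_add] at h3
      rw [zero_mul, zero_add] at hi
      rw [zero_add, eg_one]
      by_contra hne
      exact h3 (t.2.ir.orth hi (Ne.symm hne))
    · by_contra hne
      have hA := (eg_ir t (m + 1)).ch.mul t.2.ir.ch
      have hg := eg_ir t (m + 1 + 1)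
      rw [succ_mul'] at hg
      have hB := hA.sub_irr hg (by rw [eg_mul1]; exact one_ne_zero)
      have h7 : pr ((m + 1) * t.w + t.w) (eg t (m + 1) * t.c - eg t (m + 1 + 1)) π ≠ 0 := by
        rwa [pr_sub, hg.orth hi (Ne.symm hne), sub_zero]
      have hBI : Ir ((m + 1) * t.w + t.w) (eg t (m + 1) * t.c - eg t (m + 1 + 1)) := by
        apply Ir.mk' hB
        rw [pr_sub, pr_sub', pr_sub', eg_rho_norm, eg_mul1, hg.self, pr_comm, eg_mul1]; norm_num
      have h8 : eg t (m + 1) * t.c - eg t (m + 1 + 1) = π := by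
        by_contra h9; exact h7 (hBI.orth hi h9)
      have h10 := h2_eg_rho t m
      rw [show eg t (m + 1) * t.c = eg t (m + 1 + 1) + π by rw [← h8]; ring, pr_add', adj' (h2_ir t).hm, adj' (h2_ir t).hm, h,
        st_eg_zero (h2_ir t).ch (h2_de t), pr_zero', zero_add] at h10
      exact zero_ne_one h10
end LMT

namespace LMT
variable {F : Type} [Field F]
variable {V V' E Q E' Q' : Type} [AddCommGroup V] [Module F V] [Finite V]
  [AddCommGroup V'] [Module F V'] [Finite V'] [AddCommGroup E] [Module F E] [Finite E]
  [AddCommGroup Q] [Module F Q] [Finite Q] [AddCommGroup E'] [Module F E'] [Finite E']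
  [AddCommGroup Q'] [Module F Q'] [Finite Q']

variable [Finite F]

/-- homogeneous part of `GG` -/
noncomputable def gk (F : Type) [Field F] [Finite F] (k : ℕ) : CF F := ext k (fun g : GS F k => (GG F).ev g) (isCls_comp k _)

theorem gk_hm (k : ℕ) : Hm k (gk F k) := ext_hm _ _ _

theorem st_gk (k : ℕ) (φ : CF F) : st k (GG F) φ = st k (gk F k) φ := by
  apply CF.ext'
  intro V _ _ _ x
  rw [st_ev, st_ev]
  apply av_congr; intro y
  rw [gk, ext_ev]

theorem pr_gk (k : ℕ) (φ : CF F) : pr k (gk F k) φ = de k φ := by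
  unfold de
  rw [pr_comm, pr_ip, pr_ip]
  congr 1
  ext g
  rw [gk, ext_ev]

theorem gk_ch (k : ℕ) : Ch k (gk F k) := by
  apply Ch.of_nat (gk_hm k)
  intro π hπ
  rw [pr_gk]
  exact de_nat hπ.ch

theorem de_ne_one {n : ℕ} {π : CF F} (h : Ir n π) (h0 : de n π ≠ 0) : de n π = 1 := (de_01 h).resolve_left h0

theorem eg_split {t : Cs F} {m n k : ℕ} {σ τ : CF F} (hσ : Ir n σ) (hτ : Ir k τ)
    (hnk : n + k = m * t.w) (h : pr (n + k) (σ * τ) (eg t m) ≠ 0) :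
    ∃ a b, a + b = m ∧ n = a * t.w ∧ k = b * t.w ∧ σ = eg t a ∧ τ = eg t b := by
  obtain ⟨a, b, hab, ha, hb, h1, h2⟩ := supp hσ hτ (eg_oc t m) hnk h
  have h3 : de n σ = 1 := by
    apply de_ne_one hσ
    intro h0
    apply h
    rw [mul_comm, add_comm]
    exact mul_eg_zero hτ.ch hσ.ch h0 (by omega)
  have h4 : de k τ = 1 := by
    apply de_ne_one hτ
    intro h0
    exact h (mul_eg_zero hσ.ch hτ.ch h0 hnk)
  refine ⟨a, b, hab, ha, hb, eg_uniq h1 (ha ▸ h3), eg_uniq h2 (hb ▸ h4)⟩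

theorem gg_split {t : Cs F} {m n k : ℕ} {σ : CF F} (hσ : Ir n σ) (hnk : n + k = m * t.w)
    (h : pr n σ (st k (GG F) (eg t m)) ≠ 0) :
    ∃ a b, a + b = m ∧ n = a * t.w ∧ k = b * t.w ∧ σ = eg t a := by
  rw [st_gk, ← adj' (gk_hm k), mul_comm, add_comm] at h
  have hi := eg_ir t m
  rw [← hnk, add_comm] at hi
  obtain ⟨τ, hτ, _, h2⟩ := ex_factor (gk_ch k) hσ.ch hi h
  obtain ⟨a, b, hab, ha, hb, h3, h4⟩ := eg_split hτ hσ (by omega) h2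
  exact ⟨b, a, by omega, hb, ha, h4⟩

theorem st_GG_ndvd {t : Cs F} {m k : ℕ} (hk : ¬ t.w ∣ k) : st k (GG F) (eg t m) = 0 := by
  by_cases hlt : m * t.w < k
  · exact st_hm_lt (eg_ir t m).hm hlt _
  · have e : m * t.w - k + k = m * t.w := by omega
    have hm : Hm (m * t.w - k) (st k (GG F) (eg t m)) := st_hm (by rw [e]; exact (eg_ir t m).hm) _
    apply hm.eq_zero
    intro σ hσ
    rw [pr_comm]
    by_contra hne
    obtain ⟨a, b, hab, ha, hb, _⟩ := gg_split hσ e hne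
    exact hk ⟨b, by rw [hb, mul_comm]⟩

theorem st_GG_eg (t : Cs F) (a b : ℕ) : st (b * t.w) (GG F) (eg t (a + b)) = eg t a := by
  have hi := eg_ir t (a + b)
  rw [add_mul] at hi
  have hm : Hm (a * t.w) (st (b * t.w) (GG F) (eg t (a + b))) := st_hm hi.hm _
  have h1 : pr (a * t.w) (eg t a) (st (b * t.w) (GG F) (eg t (a + b))) = 1 := by
    rw [st_gk, ← adj' (gk_hm _), mul_comm (eg t a), add_comm, adj' (eg_ir t a).hm, pr_gk]
    have hi' := hi
    rw [add_comm] at hi'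
    have hC := (eg_ir t a).ch.st hi'.ch
    have h2 := hC.hm.pr_eq (GG F)
    unfold de
    rw [h2, Finset.sum_eq_single (eg t b)]
    · rw [pr_comm, ← adj' (eg_ir t a).hm, mul_comm (eg t b), add_comm (b * t.w), eg_mul, one_mul]
      exact eg_de t b
    · intro τ hτ hne
      rw [mem_irF] at hτ
      by_contra h3
      have h4 := left_ne_zero_of_mul h3
      rw [pr_comm, ← adj' (eg_ir t a).hm, mul_comm τ, add_comm (b * t.w)] at h4
      obtain ⟨a', b', hab, ha, hb, h5, h6⟩ := eg_split (eg_ir t a) hτ (by ring) h4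
      have : b' = b := (Nat.eq_of_mul_eq_mul_right t.w_pos hb).symm
      subst this
      exact hne h6
    · intro h; exact absurd (mem_irF.2 (eg_ir t b)) h
  rw [hm.expand, Finset.sum_eq_single (eg t a)]
  · rw [pr_comm, h1, one_smul]
  · intro σ hσ hne
    rw [mem_irF] at hσ
    have : pr (a * t.w) σ (st (b * t.w) (GG F) (eg t (a + b))) = 0 := by
      by_contra h3
      obtain ⟨a', b', hab, ha, hb, h5⟩ := gg_split hσ (by ring) h3
      have : a' = a := (Nat.eq_of_mul_eq_mul_right t.w_pos ha).symm
      subst this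
      exact hne h5
    rw [pr_comm, this, zero_smul]
  · intro h; exact absurd (mem_irF.2 (eg_ir t a)) h

theorem fd_eg_sum (t : Cs F) (m : ℕ) : qF F ^ (m * t.w) * fd (m * t.w) (eg t m) =
    ∑ a ∈ Finset.range (m + 1), fd (a * t.w) (eg t a) := by
  rw [fd_rec]
  symm
  apply Finset.sum_of_injOn (fun a => (a * t.w, (m - a) * t.w))
  · intro a _ b _ h
    simp only [Prod.mk.injEq] at h
    exact Nat.eq_of_mul_eq_mul_right t.w_pos h.1
  · intro a ha
    have ha := Finset.mem_range.1 ha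
    unfold ad
    simp only [Finset.mem_coe, Finset.HasAntidiagonal.mem_antidiagonal]
    rw [← add_mul]
    congr 1; omega
  · intro p hp hp'
    unfold ad at hp
    rw [Finset.HasAntidiagonal.mem_antidiagonal] at hp
    have : ¬ t.w ∣ p.2 := by
      rintro ⟨b, hb⟩
      apply hp'
      have h1 : b ≤ m := by
        have : t.w * b ≤ m * t.w := by omega
        rw [mul_comm] at this
        exact Nat.le_of_mul_le_mul_right this t.w_pos
      refine ⟨m - b, Finset.mem_coe.2 (Finset.mem_range.2 (by omega)), ?_⟩
      ext
      · simp only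
        have : (m - b) * t.w + t.w * b = m * t.w := by rw [mul_comm t.w, ← add_mul]; congr 1; omega
        omega
      · simp only
        rw [hb, mul_comm]; congr 1; omega
    rw [st_GG_ndvd this, fd_zero]
  · intro a ha
    have ha := Finset.mem_range.1 ha
    simp only
    have h1 := st_GG_eg t a (m - a)
    rw [show a + (m - a) = m by omega] at h1
    rw [h1]

theorem fd_eg_succ (t : Cs F) (m : ℕ) : (qF F ^ ((m + 1) * t.w) - 1) * fd ((m + 1) * t.w) (eg t (m + 1)) =
    qF F ^ (m * t.w) * fd (m * t.w) (eg t m) := by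
  have h1 := fd_eg_sum t (m + 1)
  rw [Finset.sum_range_succ, ← fd_eg_sum] at h1
  linear_combination h1

/-- normalised degree -/
noncomputable def gc (n : ℕ) (φ : CF F) : ℂ := qF F ^ n * fd n φ

theorem gc_mul (a : ℕ) {b : ℕ} (φ : CF F) {ψ : CF F} (hψ : Hm b ψ) : gc (a + b) (φ * ψ) = gc a φ * gc b ψ := by
  unfold gc; rw [fd_mul _ _ hψ]; ring

theorem gc_add (n : ℕ) (φ ψ : CF F) : gc n (φ + ψ) = gc n φ + gc n ψ := by
  unfold gc fd; rw [pr_add]; ring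

theorem pow_sub_ne (t : Cs F) (m : ℕ) : (qF F ^ ((m + 1) * t.w) - 1) ≠ 0 := by
  have h3 := card_pow_ne (F := F) ((m + 1) * t.w - 1)
  rwa [Nat.sub_add_cancel (Nat.mul_pos (by omega) t.w_pos)] at h3

theorem gc_eg_succ (t : Cs F) (m : ℕ) : gc ((m + 1) * t.w) (eg t (m + 1)) =
    (qF F ^ t.w) ^ (m + 1) / ((qF F ^ t.w) ^ (m + 1) - 1) * gc (m * t.w) (eg t m) := by
  have h1 := fd_eg_succ t m
  have h2 := pow_sub_ne t m
  unfold gc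
  rw [← h1]
  rw [← pow_mul, mul_comm t.w]
  field_simp

theorem gc_eg (t : Cs F) (m : ℕ) : gc (m * t.w) (eg t m) =
    ∏ i ∈ Finset.range m, (qF F ^ t.w) ^ (i + 1) / ((qF F ^ t.w) ^ (i + 1) - 1) := by
  induction m with
  | zero => simp [gc, eg_zero, fd_one]
  | succ m ih => rw [gc_eg_succ, ih, Finset.prod_range_succ, mul_comm]

theorem gc_ic (t : Cs F) : gc t.w t.c = qF F ^ t.w / (qF F ^ t.w - 1) := by
  have := gc_eg t 1
  rw [eg_one, one_mul] at this
  rw [this]; simp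
end LMT

namespace LMT
variable {F : Type} [Field F]
variable {V V' E Q E' Q' : Type} [AddCommGroup V] [Module F V] [Finite V]
  [AddCommGroup V'] [Module F V'] [Finite V'] [AddCommGroup E] [Module F E] [Finite E]
  [AddCommGroup Q] [Module F Q] [Finite Q] [AddCommGroup E'] [Module F E'] [Finite E']
  [AddCommGroup Q'] [Module F Q'] [Finite Q']

variable [Finite F]

noncomputable def qr (F : Type) : ℝ := Nat.card F
noncomputable def cNr (F : Type) (n : ℕ) : ℝ := ∏ i ∈ Finset.range n, (qr F ^ (i + 1) - 1)

theorem qr_two : 2 ≤ qr F := by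
  have h : 1 < Nat.card F := Finite.one_lt_card
  unfold qr; exact_mod_cast h

theorem qr_pow_gt (i : ℕ) : 0 < qr F ^ (i + 1) - 1 := by
  have h := qr_two (F := F)
  have := one_lt_pow₀ (show 1 < qr F by linarith) (show i + 1 ≠ 0 by omega)
  linarith

theorem cNr_pos (n : ℕ) : 0 < cNr F n := Finset.prod_pos fun i _ => qr_pow_gt i
theorem cN_eq (n : ℕ) : cN F n = (cNr F n : ℂ) := by
  unfold cN cNr qF qr; push_cast; rfl
theorem qF_eq : qF F = (qr F : ℂ) := by unfold qF qr; push_cast; rfl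

noncomputable def gr (n : ℕ) (φ : CF F) : ℝ := (gc n φ).re

theorem Ch.ev1 {n : ℕ} {φ : CF F} (h : Ch n φ) : ∃ D : ℕ, φ.ev (1 : GS F n) = D := char_one_nat h.2

theorem gc_of {n : ℕ} {φ : CF F} {D : ℕ} (h : φ.ev (1 : GS F n) = D) : gc n φ = ((qr F ^ n * D / cNr F n : ℝ) : ℂ) := by
  unfold gc; rw [fd_eq, h, cN_eq, qF_eq]; push_cast; ring

theorem gr_of {n : ℕ} {φ : CF F} {D : ℕ} (h : φ.ev (1 : GS F n) = D) : gr n φ = qr F ^ n * D / cNr F n := by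
  unfold gr; rw [gc_of h, Complex.ofReal_re]

theorem Ch.gc_real {n : ℕ} {φ : CF F} (h : Ch n φ) : gc n φ = (gr n φ : ℂ) := by
  obtain ⟨D, hD⟩ := h.ev1
  rw [gc_of hD, gr_of hD]

theorem Ch.gr_nonneg {n : ℕ} {φ : CF F} (h : Ch n φ) : 0 ≤ gr n φ := by
  obtain ⟨D, hD⟩ := h.ev1
  rw [gr_of hD]
  have := cNr_pos (F := F) n
  have := qr_two (F := F)
  positivity

theorem gr_mul {a b : ℕ} {φ ψ : CF F} (h : Ch a φ) (h' : Ch b ψ) : gr (a + b) (φ * ψ) = gr a φ * gr b ψ := by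
  have h1 := gc_mul a φ h'.hm
  rw [(h.mul h').gc_real, h.gc_real, h'.gc_real] at h1
  exact_mod_cast h1

theorem gr_le {n : ℕ} {φ π : CF F} (h : Ch n φ) (hπ : Ir n π) (hne : pr n φ π ≠ 0) : gr n π ≤ gr n φ := by
  have h1 := (h.sub_irr hπ hne).gr_nonneg
  have h2 : gc n φ = gc n (φ - π) + gc n π := by rw [← gc_add]; congr 1; ring
  have h3 := congrArg Complex.re h2
  rw [Complex.add_re] at h3
  unfold gr at *
  linarith

/-- closed form upper bound of `∏ 1/(1-Q^{-h})` -/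
noncomputable def CC (Q : ℝ) : ℝ := Q ^ 2 / (Q ^ 2 - Q - 1)

theorem prod_lower {x : ℝ} (h0 : 0 ≤ x) (h1 : x ≤ 1 / 2) (m : ℕ) : 1 - x - x ^ 2 + x ^ (m + 2) ≤ ∏ i ∈ Finset.range (m + 1), (1 - x ^ (i + 1)) := by
  induction m with
  | zero => simp
  | succ m ih =>
    rw [Finset.prod_range_succ]
    have h2 : 0 ≤ 1 - x ^ (m + 1 + 1) := by
      have := pow_le_one₀ (n := m + 1 + 1) h0 (by linarith)
      linarith
    refine le_trans ?_ (mul_le_mul_of_nonneg_right ih h2)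
    have h3 : x ^ (2 * m + 4) ≤ x ^ (m + 4) := pow_le_pow_of_le_one h0 (by linarith) (by omega)
    have e : (1 - x - x ^ 2 + x ^ (m + 2)) * (1 - x ^ (m + 1 + 1)) = 1 - x - x ^ 2 + x ^ (m + 3) + (x ^ (m + 4) - x ^ (2 * m + 4)) := by ring
    rw [e, show m + 1 + 2 = m + 3 by ring]
    linarith

theorem prod_upper {Q : ℝ} (hQ : 2 ≤ Q) (m : ℕ) : ∏ i ∈ Finset.range m, Q ^ (i + 1) / (Q ^ (i + 1) - 1) ≤ CC Q := by
  have hC : 1 ≤ CC Q := by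
    unfold CC
    rw [le_div_iff₀ (by nlinarith)]; nlinarith
  rcases m with _ | m
  · simpa using hC
  have hx : (1 : ℝ) / Q ≤ 1 / 2 := one_div_le_one_div_of_le (by norm_num) hQ
  have hx0 : 0 < 1 / Q := by positivity
  have h1 := prod_lower hx0.le hx m
  have h2 : 0 < 1 - 1 / Q - (1 / Q) ^ 2 := by nlinarith
  have h3 : (∏ i ∈ Finset.range (m + 1), Q ^ (i + 1) / (Q ^ (i + 1) - 1)) = (∏ i ∈ Finset.range (m + 1), (1 - (1 / Q) ^ (i + 1)))⁻¹ := by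
    rw [← Finset.prod_inv_distrib]
    apply Finset.prod_congr rfl
    intro i _
    have : 0 < Q ^ (i + 1) := by positivity
    rw [one_div, inv_pow]
    have h4 : 1 < Q ^ (i + 1) := one_lt_pow₀ (by linarith) (by omega)
    rw [eq_comm, inv_eq_iff_eq_inv, inv_div]
    field_simp
  rw [h3]
  have h5 : CC Q = (1 - 1 / Q - (1 / Q) ^ 2)⁻¹ := by
    unfold CC
    have : Q ≠ 0 := by positivity
    rw [eq_comm, inv_eq_iff_eq_inv, inv_div]
    field_simp
  rw [h5]
  apply inv_anti₀ h2
  have : 0 ≤ (1 / Q) ^ (m + 2) := by positivity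
  linarith

theorem gr_eg (t : Cs F) (m : ℕ) : gr (m * t.w) (eg t m) =
    ∏ i ∈ Finset.range m, (qr F ^ t.w) ^ (i + 1) / ((qr F ^ t.w) ^ (i + 1) - 1) := by
  have h := gc_eg t m
  rw [(eg_ir t m).ch.gc_real, qF_eq] at h
  exact_mod_cast h

theorem qw_two (t : Cs F) : 2 ≤ qr F ^ t.w := by
  have h := qr_two (F := F)
  exact le_trans h (le_self_pow₀ (by linarith) t.2.ne)

theorem gr_eg_le (t : Cs F) (m : ℕ) : gr (m * t.w) (eg t m) ≤ CC (qr F ^ t.w) := by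
  rw [gr_eg]; exact prod_upper (qw_two t) m

theorem gr_h2 (t : Cs F) (h3 : 3 ≤ qr F ^ t.w) : gr (2 * t.w) (h2 t) ≤ 1 := by
  have h1 : gc (2 * t.w) (t.c ^ 2) = gc (2 * t.w) (eg t 2) + gc (2 * t.w) (h2 t) := by rw [pw_eq, gc_add]
  rw [(eg_ir t 2).ch.gc_real, (h2_ir t).ch.gc_real, (pw_ch t 2).gc_real] at h1
  have h2' : gr (2 * t.w) (t.c ^ 2) = gr (2 * t.w) (eg t 2) + gr (2 * t.w) (h2 t) := by exact_mod_cast h1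
  have h4 : gr (2 * t.w) (t.c ^ 2) = gr t.w t.c * gr t.w t.c := by
    rw [pow_two, two_mul, gr_mul t.2.ir.ch t.2.ir.ch]
  have h5 : gr t.w t.c = qr F ^ t.w / (qr F ^ t.w - 1) := by
    have := gr_eg t 1
    rw [eg_one, one_mul] at this
    rw [this]; simp
  have h6 := gr_eg t 2
  rw [Finset.prod_range_succ, Finset.prod_range_one] at h6
  rw [h4, h5, h6] at h2'
  set Q := qr F ^ t.w
  simp only [zero_add, pow_one] at h2'
  have e : gr (2 * t.w) (h2 t) = Q ^ 2 / ((Q - 1) ^ 2 * (Q + 1)) := by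
    rw [eq_sub_of_add_eq' h2'.symm]
    have a1 : Q - 1 ≠ 0 := by linarith
    have a2 : Q + 1 ≠ 0 := by linarith
    rw [show Q ^ (1 + 1) - 1 = (Q - 1) * (Q + 1) by ring]
    field_simp
    ring
  rw [e, div_le_one (by nlinarith)]
  nlinarith [mul_nonneg (by linarith : (0:ℝ) ≤ Q - 3) (by nlinarith : (0:ℝ) ≤ Q^2 + Q + 2)]

/-- extraction of a constituent along `st` -/
theorem st_ex {t : Cs F} {m k : ℕ} {X π : CF F} (hX : Ir k X) (hπ : Oc t m π) (h : st k X π ≠ 0) :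
    ∃ a b τ, a + b = m ∧ k = b * t.w ∧ Oc t a τ ∧ Oc t b X ∧ pr (a * t.w + k) (τ * X) π ≠ 0 := by
  have hk : ¬ m * t.w < k := fun hlt => h (st_hm_lt hπ.ir.hm hlt X)
  have e : m * t.w - k + k = m * t.w := by omega
  have hi := hπ.ir
  rw [← e] at hi
  obtain ⟨τ, hτ, h1⟩ := (hX.ch.st hi.ch).ex_irr h
  rw [pr_comm, ← adj' hX.hm] at h1
  obtain ⟨a, b, hab, ha, hb, h2, h3⟩ := supp hτ hX hπ e h1
  refine ⟨a, b, τ, hab, hb, h2, h3, by rwa [← ha]⟩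

theorem bd_three {t : Cs F} (h3 : 3 ≤ qr F ^ t.w) {m : ℕ} {σ : CF F} (hσ : Oc t m σ) :
    gr (m * t.w) σ ≤ CC (qr F ^ t.w) := by
  induction m using Nat.strong_induction_on generalizing σ with
  | _ m ih =>
    by_cases h : st (2 * t.w) (h2 t) σ = 0
    · rw [eg_of_h2 hσ h]; exact gr_eg_le t m
    · obtain ⟨a, b, τ, hab, hb, h1, h2', h4⟩ := st_ex (h2_ir t) hσ h
      have : b = 2 := (Nat.eq_of_mul_eq_mul_right t.w_pos hb).symm
      subst this
      subst hab
      have hi := hσ.ir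
      rw [add_mul] at hi ⊢
      refine (gr_le (h1.ir.ch.mul (h2_ir t).ch) hi h4).trans ?_
      rw [gr_mul h1.ir.ch (h2_ir t).ch]
      have h5 := ih a (by omega) h1
      have h6 := gr_h2 t h3
      have h7 := (h2_ir t).ch.gr_nonneg
      have h8 := h1.ir.ch.gr_nonneg
      nlinarith
end LMT

namespace LMT
variable {F : Type} [Field F]
variable {V V' E Q E' Q' : Type} [AddCommGroup V] [Module F V] [Finite V]
  [AddCommGroup V'] [Module F V'] [Finite V'] [AddCommGroup E] [Module F E] [Finite E]
  [AddCommGroup Q] [Module F Q] [Finite Q] [AddCommGroup E'] [Module F E'] [Finite E']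
  [AddCommGroup Q'] [Module F Q'] [Finite Q']

variable [Finite F]

/-- the constant function one -/
noncomputable def tr (F : Type) [Field F] : CF F := CF.mk' (fun _ _ _ _ _ => 1) (by intros; rfl)
theorem tr_ev (g : V ≃ₗ[F] V) : (tr F).ev g = 1 := rfl
theorem tr_gl : GLike (tr F) := by
  intro E Q _ _ _ _ _ _ x y
  unfold rr
  simp only [tr_ev]
  rw [av_const, one_mul]

/-- trivial character in degree `k` -/
noncomputable def tk (F : Type) [Field F] [Finite F] (k : ℕ) : CF F := ext k (fun _ : GS F k => 1) triv_irr.1.cls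
theorem tk_ir (k : ℕ) : Ir k (tk F k) := irr_ext triv_irr
theorem tk_ev {k : ℕ} (g : GS F k) : (tk F k).ev g = 1 := by rw [tk, ext_ev]
theorem tk_ev' {k : ℕ} (hV : Module.finrank F V = k) (g : V ≃ₗ[F] V) : (tk F k).ev g = 1 := by
  obtain ⟨f⟩ := stEq hV
  rw [CF.ev_inv (tk F k) f g (cjE f g) (fun v => by simp [cjE])]
  exact tk_ev _

theorem st_tk (k : ℕ) (φ : CF F) : st k (tr F) φ = st k (tk F k) φ := by
  apply CF.ext'
  intro V _ _ _ x
  rw [st_ev, st_ev]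
  apply av_congr; intro y
  rw [tk_ev, tr_ev]

theorem st_tr_zero (φ : CF F) : st 0 (tr F) φ = φ := by
  conv_rhs => rw [← st_zero_one φ]
  apply CF.ext'
  intro V _ _ _ x
  rw [st_ev, st_ev]
  apply av_congr; intro y
  rw [tr_ev, one_ev0]

theorem st_tk_tk (n k : ℕ) : st k (tk F k) (tk F (n + k)) = tk F n := by
  apply Hm.ext (st_hm (tk_ir _).hm _) (tk_ir n).hm
  intro x
  rw [st_ev, tk_ev]
  rw [← av_const (α := GS F k) 1]
  apply av_congr
  intro y
  rw [tk_ev, one_mul]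
  unfold rr
  rw [← av_const (α := St F k →ₗ[F] St F n) 1]
  apply av_congr
  intro u
  apply tk_ev'
  simp [add_comm]

/-- trivial character of `GL_1` -/
noncomputable def t1 (F : Type) [Field F] [Finite F] : Cs F :=
  ⟨(1, tk F 1), ⟨one_ne_zero, tk_ir 1, by intro a b ha hb hab; omega⟩⟩

theorem t1_w : (t1 F).w = 1 := rfl
theorem t1_c : (t1 F).c = tk F 1 := rfl

theorem tk_oc (m : ℕ) : Oc (t1 F) m (tk F m) := by
  induction m with
  | zero =>
    have : tk F 0 = 1 := (tk_ir 0).eq_one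
    rw [this]
    refine ⟨by rw [zero_mul]; exact Ir.one, ?_⟩
    rw [zero_mul, pow_zero, Ir.one.self]; exact one_ne_zero
  | succ m ih =>
    refine ⟨by rw [t1_w, mul_one]; exact tk_ir _, ?_⟩
    rw [succ_mul', pow_succ, adj' (t1 F).2.ir.hm]
    have : st (t1 F).1.1 (t1 F).1.2 (tk F (m + 1)) = tk F m := st_tk_tk (F := F) m 1
    rw [this]
    exact ih.ne

theorem gr_tk (n : ℕ) : gr n (tk F n) = qr F ^ n / cNr F n := by
  rw [gr_of (D := 1) (by rw [tk_ev]; simp)]; simp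

theorem tk_two : tk F 2 = h2 (t1 F) := by
  by_contra hne
  have h1 := (tk_oc (F := F) 2).ne
  have hI : Ir (2 * (t1 F).w) (tk F 2) := (tk_oc (F := F) 2).ir
  rw [pw_eq, pr_add, (h2_ir _).orth hI (Ne.symm hne), add_zero] at h1
  have h2' : eg (t1 F) 2 = tk F 2 := by
    by_contra h; exact h1 ((eg_ir _ 2).orth hI h)
  have h3 := gr_eg (t1 F) 2
  rw [h2', t1_w, Finset.prod_range_succ, Finset.prod_range_one, mul_one, gr_tk, cNr, Finset.prod_range_succ, Finset.prod_range_one] at h3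
  have hq := qr_two (F := F)
  have a1 := qr_pow_gt (F := F) 0
  have a2 := qr_pow_gt (F := F) 1
  simp only [zero_add, pow_one] at *
  have a3 : 0 < qr F ^ (1 + 1) := by positivity
  field_simp at h3
  have a4 : qr F ^ (1 + 1) = qr F * qr F := by ring
  nlinarith

theorem de_tk3 : de 3 (tk F 3) = 0 := by
  by_contra h
  have h1 := (h2_ir (t1 F)).ch.mul (t1 F).2.ir.ch
  have h2' : de (2 * (t1 F).w + (t1 F).w) (h2 (t1 F) * (t1 F).c) = 0 := by
    rw [de_mul _ _ (t1 F).2.ir.hm, h2_de, zero_mul]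
  have h3 := de_zero_pr h1 h2' (tk_ir 3) h
  rw [adj' (t1 F).2.ir.hm] at h3
  have : st (t1 F).1.1 (t1 F).1.2 (tk F 3) = h2 (t1 F) := by
    rw [← tk_two]; exact st_tk_tk (F := F) 2 1
  rw [this] at h3
  exact one_ne_zero ((h2_ir (t1 F)).self.symm.trans h3)

theorem st2_mul (φ ψ : CF F) : st 2 (tk F 2) (φ * ψ) = φ * st 2 (tk F 2) ψ + st 1 (tk F 1) φ * st 1 (tk F 1) ψ + st 2 (tk F 2) φ * ψ := by
  simp only [← st_tk]
  rw [tr_gl.st_mul]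
  unfold ad
  rw [Finset.Nat.sum_antidiagonal_eq_sum_range_succ_mk]
  simp [Finset.sum_range_succ, st_tr_zero]

theorem st3_mul (φ ψ : CF F) : st 3 (tk F 3) (φ * ψ) = φ * st 3 (tk F 3) ψ + st 1 (tk F 1) φ * st 2 (tk F 2) ψ +
    st 2 (tk F 2) φ * st 1 (tk F 1) ψ + st 3 (tk F 3) φ * ψ := by
  simp only [← st_tk]
  rw [tr_gl.st_mul]
  unfold ad
  rw [Finset.Nat.sum_antidiagonal_eq_sum_range_succ_mk]
  simp [Finset.sum_range_succ, st_tr_zero]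
end LMT

namespace LMT
variable {F : Type} [Field F]
variable {V V' E Q E' Q' : Type} [AddCommGroup V] [Module F V] [Finite V]
  [AddCommGroup V'] [Module F V'] [Finite V'] [AddCommGroup E] [Module F E] [Finite E]
  [AddCommGroup Q] [Module F Q] [Finite Q] [AddCommGroup E'] [Module F E'] [Finite E']
  [AddCommGroup Q'] [Module F Q'] [Finite Q']

variable [Finite F]

/-- Steinberg character -/
noncomputable def es (F : Type) [Field F] [Finite F] (k : ℕ) : CF F := eg (t1 F) k

theorem es_ir (k : ℕ) : Ir k (es F k) := by
  have := eg_ir (t1 F) k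
  rwa [t1_w, mul_one] at this

theorem es_st (k : ℕ) : st 1 (tk F 1) (es F (k + 1)) = es F k := st_eg (t1 F) k

theorem es_zero : es F 0 = 1 := eg_zero _
theorem es_one : es F 1 = tk F 1 := eg_one (t1 F)

theorem de_tk2 : de 2 (tk F 2) = 0 := by rw [tk_two]; exact h2_de (t1 F)

theorem es_st2 (k : ℕ) : st 2 (tk F 2) (es F k) = 0 := st_eg_zero (tk_ir 2).ch de_tk2
theorem es_st3 (k : ℕ) : st 3 (tk F 3) (es F k) = 0 := st_eg_zero (tk_ir 3).ch de_tk3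

theorem tk_zero : tk F 0 = 1 := (tk_ir 0).eq_one

theorem tk_self (k : ℕ) : st k (tk F k) (tk F k) = 1 := by
  have := st_tk_tk (F := F) 0 k
  rwa [zero_add, tk_zero] at this

theorem es_mul_zero {n k m : ℕ} {A B : CF F} (hA : Ch n A) (hB : Ch k B) (h0 : de k B = 0) (hm : n + k = m) :
    pr m (A * B) (es F m) = 0 := by
  have := mul_eg_zero (t := t1 F) (m := m) hA hB h0 (by rw [t1_w, mul_one, hm])
  rwa [hm] at this

theorem es_mul1 (k : ℕ) : pr (k + 1) (es F k * tk F 1) (es F (k + 1)) = 1 := by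
  have := eg_mul1 (t1 F) k
  rwa [t1_w, mul_one] at this

theorem es_deriv (φ ψ : CF F) : st 1 (tk F 1) (φ * ψ) = st 1 (tk F 1) φ * ψ + φ * st 1 (tk F 1) ψ := (t1 F).2.deriv φ ψ

theorem st_tk12 : st 1 (tk F 1) (tk F 2) = tk F 1 := st_tk_tk 1 1
theorem st_tk13 : st 1 (tk F 1) (tk F 3) = tk F 2 := st_tk_tk 2 1
theorem st_tk23 : st 2 (tk F 2) (tk F 3) = tk F 1 := st_tk_tk 1 2

theorem X_norm (k : ℕ) : pr (k + 1 + 2) (es F (k + 1) * tk F 2) (es F (k + 1) * tk F 2) = 2 := by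
  rw [adj' (tk_ir 2).hm, st2_mul, tk_self, es_st2, es_st, st_tk12, mul_one, zero_mul, add_zero, pr_add', (es_ir _).self,
    pr_comm, es_mul1]
  norm_num

theorem X_B (k : ℕ) : pr (k + 2 + 1) (es F (k + 2) * tk F 1) (es F (k + 1) * tk F 2) ≠ 0 := by
  rw [adj' (tk_ir 1).hm, es_deriv, es_st, st_tk12, pr_add', pr_comm, es_mul_zero (es_ir k).ch (tk_ir 2).ch de_tk2 rfl,
    pr_comm, es_mul1]
  norm_num

theorem X_C (k : ℕ) : pr (k + 3) (es F k * tk F 3) (es F (k + 1) * tk F 2) ≠ 0 := by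
  rw [adj' (tk_ir 3).hm, st3_mul, st_hm_lt (tk_ir 2).hm (by norm_num), tk_self, es_st, es_st2, es_st3]
  simp only [mul_zero, zero_mul, mul_one, add_zero, zero_add]
  rw [(es_ir k).self]; exact one_ne_zero

theorem X_D (k : ℕ) : pr (k + 2 + 1) (es F (k + 2) * tk F 1) (es F k * tk F 3) = 0 := by
  rw [adj' (tk_ir 1).hm, es_deriv, st_tk13, pr_add', pr_comm (k + 2) _ (es F k * tk F 2), es_mul_zero (es_ir k).ch (tk_ir 2).ch de_tk2 rfl,
    pr_comm, add_zero]
  rcases k with _ | k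
  · rw [es_zero, st_one one_ne_zero, zero_mul, pr_zero]
  · rw [es_st, es_mul_zero (es_ir k).ch (tk_ir 3).ch de_tk3 rfl]

theorem common {n : ℕ} {A B : CF F} (hA : Ch n A) (h : pr n A B ≠ 0) : ∃ π, Ir n π ∧ pr n A π ≠ 0 ∧ pr n B π ≠ 0 := by
  rw [hA.hm.pr_eq] at h
  obtain ⟨α, hα, hne⟩ := Finset.exists_ne_zero_of_sum_ne_zero h
  exact ⟨α, mem_irF.1 hα, left_ne_zero_of_mul hne, by rw [pr_comm]; exact right_ne_zero_of_mul hne⟩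

theorem X_E (k : ℕ) {α : CF F} (hα : Ir (k + 3) α) (h : pr (k + 3) (es F (k + 1) * tk F 2) α ≠ 0) :
    pr (k + 3) (es F (k + 2) * tk F 1) α ≠ 0 ∨ pr (k + 3) (es F k * tk F 3) α ≠ 0 := by
  have hX : Ch (k + 3) (es F (k + 1) * tk F 2) := (es_ir (k + 1)).ch.mul (tk_ir 2).ch
  have hP : Ch (k + 3) (es F (k + 2) * tk F 1) := (es_ir (k + 2)).ch.mul (tk_ir 1).ch
  have hR : Ch (k + 3) (es F k * tk F 3) := (es_ir k).ch.mul (tk_ir 3).ch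
  obtain ⟨β, hβ, b1, b2⟩ := common hP (X_B k)
  obtain ⟨γ, hγ, c1, c2⟩ := common hR (X_C k)
  by_cases e1 : α = β
  · subst e1; exact Or.inl b1
  by_cases e2 : α = γ
  · subst e2; exact Or.inr c1
  exfalso
  have e3 : β ≠ γ := by
    rintro rfl
    have h1 := hP.mult hR hβ b1 c1
    exact h1 (X_D k)
  have h1 := hX.sub_irr hβ b2
  have h2 := h1.sub_irr hγ (by rwa [pr_sub, hβ.orth hγ e3, sub_zero])
  have h3 := h2.sub_irr hα (by rwa [pr_sub, pr_sub, hβ.orth hα (Ne.symm e1), hγ.orth hα (Ne.symm e2), sub_zero, sub_zero])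
  set X := es F (k + 1) * tk F 2 with hXd
  have hn : pr (k + 3) X X = 2 := X_norm k
  have e : pr (k + 3) X X = pr (k + 3) (X - β - γ - α) X + pr (k + 3) β X + pr (k + 3) γ X + pr (k + 3) α X := by
    simp only [pr_sub]; ring
  obtain ⟨m1, k1⟩ := pr_nat h3 hX
  obtain ⟨m2, k2⟩ := pr_nat hβ.ch hX
  obtain ⟨m3, k3⟩ := pr_nat hγ.ch hX
  obtain ⟨m4, k4⟩ := pr_nat hα.ch hX
  rw [pr_comm] at b2 c2 h
  rw [k2] at b2
  rw [k3] at c2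
  rw [k4] at h
  rw [k1, k2, k3, k4, hn] at e
  have e' : 2 = m1 + m2 + m3 + m4 := by exact_mod_cast e
  have : m2 ≠ 0 := by exact_mod_cast b2
  have : m3 ≠ 0 := by exact_mod_cast c2
  have : m4 ≠ 0 := by exact_mod_cast h
  omega

theorem gr_tk3 (h2 : qr F = 2) : gr 3 (tk F 3) ≤ 1 := by
  rw [gr_tk, cNr, h2]; norm_num [Finset.prod_range_succ]

theorem gr_es_le (h2 : qr F = 2) (k : ℕ) : gr k (es F k) ≤ 4 := by
  have := gr_eg_le (t1 F) k
  rw [t1_w, mul_one, pow_one, h2] at this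
  refine le_trans this ?_
  norm_num [CC]

theorem bd_two (hq : qr F = 2) {m : ℕ} {σ : CF F} (hσ : Oc (t1 F) m σ) : gr m σ ≤ 16 := by
  induction m using Nat.strong_induction_on generalizing σ with
  | _ m ih =>
    have hσi : Ir m σ := by have := hσ.ir; rwa [t1_w, mul_one] at this
    by_cases h3 : st 3 (tk F 3) σ = 0
    swap
    · obtain ⟨a, b, τ, hab, hb, h1, h2', h4⟩ := st_ex (tk_ir 3) hσ h3
      rw [t1_w, mul_one] at hb h4
      subst hb hab
      have hτ : Ir a τ := by have := h1.ir; rwa [t1_w, mul_one] at this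
      refine (gr_le (hτ.ch.mul (tk_ir 3).ch) hσi h4).trans ?_
      rw [gr_mul hτ.ch (tk_ir 3).ch]
      have h5 := ih a (by omega) h1
      have h6 := gr_tk3 hq
      have h7 := (tk_ir (F := F) 3).ch.gr_nonneg
      have h8 := hτ.ch.gr_nonneg
      nlinarith
    · set P : ℕ → Prop := fun k => st k (es F k) σ ≠ 0 with hP
      have hP0 : P 0 := by
        show st 0 (es F 0) σ ≠ 0
        rw [es_zero, st_zero_one]; exact hσi.ne_zero
      set k := Nat.findGreatest P m with hk
      have hPk : P k := Nat.findGreatest_spec (Nat.zero_le m) hP0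
      have hmax : ∀ j, k < j → st j (es F j) σ = 0 := by
        intro j hj
        by_cases hjm : j ≤ m
        · by_contra hc
          exact Nat.findGreatest_is_greatest hj hjm hc
        · exact st_hm_lt hσi.hm (by omega) _
      obtain ⟨a, b, τ, hab, hb, h1, h2', h4⟩ := st_ex (es_ir k) hσ hPk
      rw [t1_w, mul_one] at hb h4
      rw [← hb] at hab
      clear hb h2' b
      have hτ : Ir a τ := by have := h1.ir; rwa [t1_w, mul_one] at this
      have hσk : Ir (a + k) σ := by rwa [hab]
      have hτ2 : st (2 * (t1 F).w) (h2 (t1 F)) τ = 0 := by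
        by_contra hc
        obtain ⟨a', b', τ', hab', hb', g1, g2, g4⟩ := st_ex (h2_ir (t1 F)) h1 hc
        rw [← tk_two] at g4
        have hb2 : b' = 2 := by rw [t1_w] at hb'; omega
        subst hb2
        rw [t1_w, mul_one, mul_one] at g4
        have hτ' : Ir a' τ' := by have := g1.ir; rwa [t1_w, mul_one] at this
        subst hab'
        have g5 := mul_mono (hτ'.ch.mul (tk_ir 2).ch) hτ (es_ir k).ch hσk g4 h4
        have e1 : a' + 2 + k = (k + 2) + a' := by ring
        rw [show τ' * tk F 2 * es F k = (es F k * tk F 2) * τ' by ring, e1] at g5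
        rw [e1] at hσk
        obtain ⟨α, hα, q1, q2⟩ := ex_factor ((es_ir k).ch.mul (tk_ir 2).ch) hτ'.ch hσk g5
        have c1 : pr (k + 2) (es F (k + 1) * tk F 1) α = 0 := by
          by_contra hne
          have := mul_mono ((es_ir (k + 1)).ch.mul (tk_ir 1).ch) hα hτ'.ch hσk hne q2
          rw [show es F (k + 1) * tk F 1 * τ' = (τ' * tk F 1) * es F (k + 1) by ring,
            show k + 2 + a' = a' + 1 + (k + 1) by ring, adj' (es_ir (k + 1)).hm, hmax _ (by omega), pr_zero'] at this
          exact this rfl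
        have c2 : ∀ j, k = j + 1 → pr (k + 2) (es F j * tk F 3) α = 0 := by
          intro j hj
          by_contra hne
          have := mul_mono (A := es F j * tk F 3) (by rw [hj]; exact (es_ir j).ch.mul (tk_ir 3).ch) hα hτ'.ch hσk hne q2
          rw [show es F j * tk F 3 * τ' = (τ' * es F j) * tk F 3 by ring,
            show k + 2 + a' = a' + j + 3 by omega, adj' (tk_ir 3).hm, h3, pr_zero'] at this
          exact this rfl
        clear_value k
        rcases k with _ | j
        · rw [es_zero, one_mul, zero_add] at q1
          rw [zero_add] at hα
          have : tk F 2 = α := by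
            by_contra hne; exact q1 ((tk_ir 2).orth hα hne)
          subst this
          rw [zero_add, es_one, ← pow_two] at c1
          exact (tk_oc (F := F) 2).ne c1
        · rcases X_E j hα q1 with h | h
          · exact h c1
          · exact h (c2 j rfl)
      have hτe : τ = es F a := eg_of_h2 h1 hτ2
      subst hτe
      rw [← hab]
      refine (gr_le (hτ.ch.mul (es_ir k).ch) hσk h4).trans ?_
      rw [gr_mul hτ.ch (es_ir k).ch]
      have h5 := gr_es_le hq k
      have h6 := gr_es_le hq a
      have h7 := (es_ir (F := F) k).ch.gr_nonneg
      have h8 := hτ.ch.gr_nonneg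
      nlinarith
end LMT

namespace LMT
variable {F : Type} [Field F]
variable {V V' E Q E' Q' : Type} [AddCommGroup V] [Module F V] [Finite V]
  [AddCommGroup V'] [Module F V'] [Finite V'] [AddCommGroup E] [Module F E] [Finite E]
  [AddCommGroup Q] [Module F Q] [Finite Q] [AddCommGroup E'] [Module F E'] [Finite E']
  [AddCommGroup Q'] [Module F Q'] [Finite Q']

variable [Finite F]

/-- bound for `gr` on the block of one cuspidal -/
noncomputable def Cq (Q : ℝ) : ℝ := if Q = 2 then 16 else CC Q

theorem nc_one : nc F 1 + 1 = Nat.card F := by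
  have := nc_sum (F := F) (n := 1) one_ne_zero
  simpa using this

theorem w_one_eq (hq : qr F = 2) (t : Cs F) (ht : t.w = 1) : t = t1 F := by
  have h2 : Nat.card F = 2 := by unfold qr at hq; exact_mod_cast hq
  have h1 := nc_one (F := F)
  have h : (Wd F 1).card ≤ 1 := by unfold nc at h1; omega
  exact Finset.card_le_one.1 h t (mem_Wd.2 ht) (t1 F) (mem_Wd.2 t1_w)

theorem qw_eq_two {d : ℕ} (hd : d ≠ 0) (h : qr F ^ d = 2) : qr F = 2 ∧ d = 1 := by
  have hq := qr_two (F := F)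
  have h1 : d = 1 := by
    by_contra hne
    have : qr F ^ 2 ≤ qr F ^ d := pow_le_pow_right₀ (by linarith) (by omega)
    nlinarith
  subst h1
  exact ⟨by simpa using h, rfl⟩

theorem qw_three {d : ℕ} (hd : d ≠ 0) (h : qr F ^ d ≠ 2) : 3 ≤ qr F ^ d := by
  have hq := qr_two (F := F)
  have h1 : 2 ≤ qr F ^ d := le_trans hq (le_self_pow₀ (by linarith) hd)
  unfold qr at *
  have h2 : 2 ≤ Nat.card F ^ d := by exact_mod_cast h1
  have h3 : Nat.card F ^ d ≠ 2 := by exact_mod_cast h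
  have : 3 ≤ Nat.card F ^ d := by omega
  exact_mod_cast this

theorem bd_one {t : Cs F} {m : ℕ} {σ : CF F} (hσ : Oc t m σ) : gr (m * t.w) σ ≤ Cq (qr F ^ t.w) := by
  unfold Cq
  split_ifs with h
  · obtain ⟨h1, h2⟩ := qw_eq_two t.2.ne h
    have := w_one_eq h1 t h2
    subst this
    rw [t1_w, mul_one]
    exact bd_two h1 hσ
  · exact bd_three (qw_three t.2.ne h) hσ

theorem CC_one {Q : ℝ} (hQ : 2 ≤ Q) : 1 ≤ CC Q := by
  unfold CC
  rw [le_div_iff₀ (by nlinarith)]; nlinarith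

theorem Cq_one {Q : ℝ} (hQ : 2 ≤ Q) : 1 ≤ Cq Q := by
  unfold Cq; split_ifs
  · norm_num
  · exact CC_one hQ

theorem bd_pd {n : ℕ} {M : Multiset (Cs F)} {π : CF F} (hπ : Ir n π) (hM : dg M = n) (h : pr n (pd M) π ≠ 0) :
    gr n π ≤ ∏ t ∈ M.toFinset, Cq (qr F ^ t.w) := by
  induction hc : M.toFinset.card generalizing n M π with
  | zero =>
    rw [Finset.card_eq_zero, Multiset.toFinset_eq_empty] at hc
    subst hc hM
    rw [hπ.eq_one]
    have := gr_eg (t1 F) 0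
    rw [eg_zero] at this
    simpa using this.le
  | succ k ih =>
    obtain ⟨t, ht⟩ : M.toFinset.Nonempty := by rw [← Finset.card_pos]; omega
    set M' := M.filter (fun s => s ≠ t) with hM'
    set m := M.count t with hm
    have e : M = M' + Multiset.replicate m t := by
      rw [hM', hm, ← Multiset.filter_eq', add_comm]
      conv_lhs => rw [← Multiset.filter_add_not (fun s => s = t) M]
    have hT : M'.toFinset = M.toFinset.erase t := by
      ext s; simp [hM', and_comm]
    have hn : n = dg M' + m * t.w := by rw [← hM, e, dg_add, dg_replicate]
    rw [e, pd_add, pd_replicate, hn] at h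
    rw [hn] at hπ
    obtain ⟨α, hα, a1, a2⟩ := ex_factor (pd_ch M') (pw_ch t m) hπ h
    rw [mul_comm α, add_comm (dg M')] at a2
    rw [add_comm (dg M')] at hπ
    obtain ⟨β, hβ, b1, b2⟩ := ex_factor (pw_ch t m) hα.ch hπ a2
    have i1 := ih hα rfl a1 (by rw [hT, Finset.card_erase_of_mem ht]; omega)
    have i2 := bd_one (t := t) (m := m) ⟨hβ, b1⟩
    have i3 := gr_le (hβ.ch.mul hα.ch) hπ b2
    rw [gr_mul hβ.ch hα.ch, add_comm (m * t.w), ← hn] at i3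
    refine i3.trans ?_
    rw [← Finset.mul_prod_erase _ _ ht, ← hT]
    exact mul_le_mul i2 i1 hα.ch.gr_nonneg (le_trans zero_le_one (Cq_one (qw_two t)))

theorem ms_w_le {M : Multiset (Cs F)} : ∑ t ∈ M.toFinset, t.w ≤ dg M := by
  unfold dg
  rw [Finset.sum_multiset_map_count]
  apply Finset.sum_le_sum
  intro t ht
  have : 1 ≤ M.count t := Multiset.one_le_count_iff_mem.2 (Multiset.mem_toFinset.1 ht)
  rw [smul_eq_mul]
  exact Nat.le_mul_of_pos_left _ this

theorem bd_gen {n : ℕ} {π : CF F} (hπ : Ir n π) : ∃ S : Finset (Cs F), ∑ t ∈ S, t.w ≤ n ∧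
    gr n π ≤ ∏ t ∈ S, Cq (qr F ^ t.w) := by
  obtain ⟨M, hM, h⟩ := ex_cs hπ
  exact ⟨M.toFinset, hM ▸ ms_w_le, bd_pd hπ hM h⟩

theorem nc_le {d : ℕ} (hd : d ≠ 0) : (d : ℝ) * nc F d ≤ qr F ^ d - 1 := by
  have h := nc_sum (F := F) hd
  have h1 : d * nc F d ≤ ∑ e ∈ d.divisors, e * nc F e :=
    Finset.single_le_sum (f := fun e => e * nc F e) (fun _ _ => Nat.zero_le _) (Nat.mem_divisors_self d hd)
  have h2 : d * nc F d + 1 ≤ Nat.card F ^ d := by omega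
  have h3 : (d : ℝ) * nc F d + 1 ≤ qr F ^ d := by unfold qr; exact_mod_cast h2
  linarith

noncomputable def Hr (m : ℕ) : ℝ := ∑ d ∈ Finset.Icc 1 m, 1 / (d : ℝ)

theorem sum_S {n m : ℕ} {S : Finset (Cs F)} (hS : ∑ t ∈ S, t.w ≤ n) (hm : n * (qr F - 1) ≤ qr F ^ (m + 1) - 1) :
    ∑ t ∈ S, 1 / (qr F ^ t.w - 1) ≤ Hr (m + 1) := by
  have hq := qr_two (F := F)
  have hpos : ∀ d : ℕ, d ≠ 0 → 0 < qr F ^ d - 1 := by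
    intro d hd
    obtain ⟨i, rfl⟩ := Nat.exists_eq_succ_of_ne_zero hd
    exact qr_pow_gt i
  rw [← Finset.sum_filter_add_sum_filter_not S (fun t => t.w ≤ m), Hr, Finset.sum_Icc_succ_top (by omega)]
  apply add_le_add
  · have h1 : ∑ t ∈ S.filter (fun t => t.w ≤ m), 1 / (qr F ^ t.w - 1) ≤ ∑ t ∈ TT F m, 1 / (qr F ^ t.w - 1) := by
      apply Finset.sum_le_sum_of_subset_of_nonneg
      · intro t ht; exact mem_TT.2 (Finset.mem_filter.1 ht).2
      · intro t _ _; exact (one_div_pos.2 (hpos _ t.2.ne)).le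
    refine h1.trans ?_
    rw [sum_TT_w m (fun d => 1 / (qr F ^ d - 1))]
    apply Finset.sum_le_sum
    intro d hd
    have hd0 : d ≠ 0 := by have := (Finset.mem_Icc.1 hd).1; omega
    have h2 := nc_le (F := F) hd0
    have h3 := hpos d hd0
    have h4 : (0 : ℝ) < d := by exact_mod_cast Nat.pos_of_ne_zero hd0
    rw [nsmul_eq_mul, mul_one_div, div_le_div_iff₀ h3 h4]
    linarith
  · have h0 := hpos (m + 1) (by omega)
    have hm1 : (0 : ℝ) < ((m + 1 : ℕ) : ℝ) := by positivity
    have h1 : ∀ t ∈ S.filter (fun t => ¬ t.w ≤ m), 1 / (qr F ^ t.w - 1) ≤ t.w * (1 / (((m + 1 : ℕ) : ℝ) * (qr F ^ (m + 1) - 1))) := by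
      intro t ht
      have h2 : m + 1 ≤ t.w := by have := (Finset.mem_filter.1 ht).2; omega
      have h3 : qr F ^ (m + 1) ≤ qr F ^ t.w := pow_le_pow_right₀ (by linarith) h2
      have h4 : ((m + 1 : ℕ) : ℝ) ≤ t.w := by exact_mod_cast h2
      rw [mul_one_div, div_le_div_iff₀ (hpos _ t.2.ne) (by positivity), one_mul]
      exact mul_le_mul h4 (by linarith) h0.le (by linarith)
    refine (Finset.sum_le_sum h1).trans ?_
    rw [← Finset.sum_mul]
    have h5 : (∑ t ∈ S.filter (fun t => ¬ t.w ≤ m), (t.w : ℝ)) ≤ n := by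
      have : ∑ t ∈ S.filter (fun t => ¬ t.w ≤ m), t.w ≤ n :=
        (Finset.sum_le_sum_of_subset (Finset.filter_subset _ _)).trans hS
      exact_mod_cast this
    have h6 : (n : ℝ) ≤ qr F ^ (m + 1) - 1 := by
      have : (0 : ℝ) ≤ n := Nat.cast_nonneg n
      nlinarith
    rw [mul_one_div, div_le_div_iff₀ (by positivity) hm1, one_mul]
    nlinarith

theorem Hr_le (m : ℕ) : Hr (m + 2) ≤ 3 / 2 + Real.log (m + 1) := by
  induction m with
  | zero => simp [Hr, Finset.sum_Icc_succ_top]; norm_num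
  | succ m ih =>
    have e : Hr (m + 1 + 2) = Hr (m + 2) + 1 / ((m + 3 : ℕ) : ℝ) := by
      unfold Hr
      rw [show m + 1 + 2 = (m + 2) + 1 by ring, Finset.sum_Icc_succ_top (by omega)]
    rw [e]
    have h0 : (0 : ℝ) < m + 1 := by positivity
    have h1 : Real.log (((m + 1 : ℕ) : ℝ) + 1) = Real.log (m + 1) + Real.log ((m + 2) / (m + 1)) := by
      rw [← Real.log_mul h0.ne' (by positivity)]
      congr 1; push_cast; field_simp; ring
    rw [h1]
    have h2 : 1 / ((m + 3 : ℕ) : ℝ) ≤ Real.log ((m + 2) / (m + 1)) := by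
      have h3 := Real.one_sub_inv_le_log_of_pos (show (0 : ℝ) < (m + 2) / (m + 1) by positivity)
      refine le_trans ?_ h3
      rw [inv_div, one_sub_div (by positivity), div_le_div_iff₀ (by positivity) (by positivity)]
      push_cast
      nlinarith
    linarith
end LMT

namespace LMT
variable {F : Type} [Field F]
variable {V V' E Q E' Q' : Type} [AddCommGroup V] [Module F V] [Finite V]
  [AddCommGroup V'] [Module F V'] [Finite V'] [AddCommGroup E] [Module F E] [Finite E]
  [AddCommGroup Q] [Module F Q] [Finite Q] [AddCommGroup E'] [Module F E'] [Finite E']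
  [AddCommGroup Q'] [Module F Q'] [Finite Q']

variable [Finite F]

noncomputable def Pr (F : Type) (n : ℕ) : ℝ := ∏ i ∈ Finset.range n, (1 - 1 / qr F ^ (i + 1))

theorem choose_succ_two (n : ℕ) : (n + 1).choose 2 = n + n.choose 2 := by
  rw [Nat.choose_succ_succ' n 1, Nat.choose_one_right]

theorem cNr_Pr (n : ℕ) : cNr F n = Pr F n * (qr F ^ n * qr F ^ (n.choose 2)) := by
  have hq := qr_two (F := F)
  induction n with
  | zero => simp [cNr, Pr]
  | succ n ih =>
    have e1 : cNr F (n + 1) = cNr F n * (qr F ^ (n + 1) - 1) := Finset.prod_range_succ _ _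
    have e2 : Pr F (n + 1) = Pr F n * (1 - 1 / qr F ^ (n + 1)) := Finset.prod_range_succ _ _
    rw [e1, e2, ih, choose_succ_two, pow_add]
    have : qr F ^ (n + 1) ≠ 0 := by positivity
    field_simp
    ring

theorem ratio_eq {n D : ℕ} {φ : CF F} (h : φ.ev (1 : GS F n) = D) : (D : ℝ) / qr F ^ (n * (n - 1) / 2) = gr n φ * Pr F n := by
  have hq := qr_two (F := F)
  have h1 := cNr_pos (F := F) n
  rw [gr_of h, ← Nat.choose_two_right, div_mul_eq_mul_div, eq_div_iff h1.ne', cNr_Pr]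
  have : qr F ^ n.choose 2 ≠ 0 := by positivity
  field_simp

theorem Pr_fac (i : ℕ) : 0 ≤ 1 - 1 / qr F ^ (i + 1) ∧ 1 - 1 / qr F ^ (i + 1) ≤ 1 := by
  have h := qr_pow_gt (F := F) i
  have h1 : 1 / qr F ^ (i + 1) ≤ 1 := by rw [div_le_one (by linarith)]; linarith
  have h2 : 0 ≤ 1 / qr F ^ (i + 1) := by
    apply div_nonneg <;> linarith
  constructor <;> linarith

theorem Pr_nonneg (n : ℕ) : 0 ≤ Pr F n := Finset.prod_nonneg fun i _ => (Pr_fac i).1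
theorem Pr_le_one (n : ℕ) : Pr F n ≤ 1 := Finset.prod_le_one (fun i _ => (Pr_fac i).1) fun i _ => (Pr_fac i).2

theorem Pr_le_half (hq : qr F = 2) {n : ℕ} (hn : 1 ≤ n) : Pr F n ≤ 1 / 2 := by
  obtain ⟨k, rfl⟩ : ∃ k, n = k + 1 := ⟨n - 1, by omega⟩
  unfold Pr
  rw [Finset.prod_range_succ']
  have h1 : (∏ i ∈ Finset.range k, (1 - 1 / qr F ^ (i + 1 + 1))) ≤ 1 :=
    Finset.prod_le_one (fun i _ => (Pr_fac (i + 1)).1) fun i _ => (Pr_fac (i + 1)).2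
  rw [hq] at *
  norm_num at *
  linarith

theorem CC_exp {Q κ : ℝ} (hQ : 3 ≤ Q) (h : Q ^ 2 - 1 ≤ κ * (Q ^ 2 - Q - 1)) : CC Q ≤ Real.exp (κ * (1 / (Q - 1))) := by
  refine le_trans ?_ (Real.add_one_le_exp _)
  unfold CC
  have h1 : 0 < Q ^ 2 - Q - 1 := by nlinarith
  have h2 : 0 < Q - 1 := by linarith
  rw [mul_one_div, div_add_one h2.ne', div_le_div_iff₀ h1 h2]
  nlinarith

theorem exp_pow_le {x b : ℝ} (k j : ℕ) (hk : k ≠ 0) (hb : 0 ≤ b) (hx : k * x = j) (h : (2.7182818286 : ℝ) ^ j < b ^ k) : Real.exp x < b := by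
  by_contra hc
  push Not at hc
  have h1 : b ^ k ≤ Real.exp x ^ k := pow_le_pow_left₀ hb hc k
  rw [← Real.exp_nat_mul, hx] at h1
  have h2 : Real.exp (j : ℝ) = Real.exp 1 ^ j := by rw [← Real.exp_nat_mul, mul_one]
  rw [h2] at h1
  have h3 : Real.exp 1 ^ j ≤ (2.7182818286 : ℝ) ^ j := pow_le_pow_left₀ (Real.exp_pos _).le Real.exp_one_lt_d9.le j
  linarith

theorem upper {n D : ℕ} (hn : 1 ≤ n) {π : CF F} (hπ : Ir n π) (h : π.ev (1 : GS F n) = D) :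
    (D : ℝ) / qr F ^ (n * (n - 1) / 2) < 13 * Real.logb (qr F) (n * (qr F - 1) + qr F) ^ (2.54 : ℝ) := by
  have hq := qr_two (F := F)
  set L := Real.logb (qr F) (n * (qr F - 1) + qr F) with hL
  have hn' : (1 : ℝ) ≤ n := by exact_mod_cast hn
  have hA : 0 < n * (qr F - 1) + qr F := by nlinarith
  have hL1 : 1 ≤ L := by
    rw [hL, Real.le_logb_iff_rpow_le (by linarith) hA, Real.rpow_one]; nlinarith
  obtain ⟨m, hm⟩ : ∃ m : ℕ, ⌊L⌋₊ = m + 1 := by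
    have : 1 ≤ ⌊L⌋₊ := Nat.le_floor (by simpa using hL1)
    exact ⟨⌊L⌋₊ - 1, by omega⟩
  have hmL : ((m : ℝ) + 1) ≤ L := by
    have := Nat.floor_le (show 0 ≤ L by linarith)
    rw [hm] at this; exact_mod_cast this
  have hLm : L < ((m + 1 + 1 : ℕ) : ℝ) := by
    have := Nat.lt_floor_add_one L
    rw [hm] at this; exact_mod_cast this
  rw [hL, Real.logb_lt_iff_lt_rpow (by linarith) hA, Real.rpow_natCast] at hLm
  obtain ⟨S, hS, hg⟩ := bd_gen hπ
  have hs := sum_S (m := m + 1) hS (by linarith)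
  have hH := Hr_le m
  rw [ratio_eq h]
  have hm0 : (0 : ℝ) < m + 1 := by positivity
  have hm1 : (1 : ℝ) ≤ m + 1 := by have : (0 : ℝ) ≤ m := Nat.cast_nonneg m; linarith
  have hP0 := Pr_nonneg (F := F) n
  have key : ∀ κ : ℝ, 0 ≤ κ → ∏ t ∈ S, Real.exp (κ * (1 / (qr F ^ t.w - 1))) ≤ Real.exp (κ * (3 / 2)) * ((m : ℝ) + 1) ^ κ := by
    intro κ hκ
    rw [← Real.exp_sum, ← Finset.mul_sum, Real.rpow_def_of_pos hm0, ← Real.exp_add]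
    apply Real.exp_le_exp.2
    have : κ * ∑ t ∈ S, 1 / (qr F ^ t.w - 1) ≤ κ * (3 / 2 + Real.log (m + 1)) := mul_le_mul_of_nonneg_left (hs.trans hH) hκ
    linarith
  by_cases h2 : qr F = 2
  · set A : Cs F → ℝ := fun t => if t = t1 F then 16 * Real.exp (-(7 / 5)) else 1 with hAd
    have e1 : Real.exp (7 / 5) < 16 := exp_pow_le 5 7 (by norm_num) (by norm_num) (by norm_num) (by norm_num)
    have e2 : 1 ≤ 16 * Real.exp (-(7 / 5)) := by
      rw [Real.exp_neg, ← div_eq_mul_inv, le_div_iff₀ (Real.exp_pos _)]; linarith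
    have hA1 : ∏ t ∈ S, A t ≤ 16 * Real.exp (-(7 / 5)) := by
      rw [hAd, Finset.prod_ite_eq']
      split_ifs
      · exact le_rfl
      · exact e2
    have hb : ∏ t ∈ S, Cq (qr F ^ t.w) ≤ ∏ t ∈ S, A t * Real.exp (7 / 5 * (1 / (qr F ^ t.w - 1))) := by
      apply Finset.prod_le_prod
      · intro t _; exact le_trans zero_le_one (Cq_one (qw_two t))
      · intro t _
        by_cases ht : t = t1 F
        · subst ht
          rw [hAd, t1_w, h2]
          simp only [if_true, pow_one, Cq]
          rw [mul_assoc, ← Real.exp_add]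
          norm_num
        · have hw : t.w ≠ 1 := fun hw => ht (w_one_eq h2 t hw)
          have hw' : (2 : ℕ) ≤ t.w := by have := t.w_pos; omega
          have h4 : (4 : ℝ) ≤ qr F ^ t.w := by
            rw [h2]
            calc (4 : ℝ) = 2 ^ 2 := by norm_num
              _ ≤ _ := pow_le_pow_right₀ (by norm_num) hw'
          simp only [hAd, if_neg ht, one_mul]
          unfold Cq
          rw [if_neg (by linarith)]
          apply CC_exp (by linarith)
          nlinarith
    rw [Finset.prod_mul_distrib] at hb
    have k1 := key (7 / 5) (by norm_num)
    have k2 : gr n π ≤ 16 * Real.exp (-(7 / 5)) * (Real.exp (7 / 5 * (3 / 2)) * ((m : ℝ) + 1) ^ (7 / 5 : ℝ)) :=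
      hg.trans (hb.trans (mul_le_mul hA1 k1 (Finset.prod_nonneg fun _ _ => (Real.exp_pos _).le) (by positivity)))
    have e3 : Real.exp (7 / 10) < 2.1 := exp_pow_le 10 7 (by norm_num) (by norm_num) (by norm_num) (by norm_num)
    have e4 : 16 * Real.exp (-(7 / 5)) * (Real.exp (7 / 5 * (3 / 2)) * ((m : ℝ) + 1) ^ (7 / 5 : ℝ)) = 16 * Real.exp (7 / 10) * ((m : ℝ) + 1) ^ (7 / 5 : ℝ) := by
      rw [show (7 / 10 : ℝ) = -(7 / 5) + 7 / 5 * (3 / 2) by norm_num, Real.exp_add]; ring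
    rw [e4] at k2
    have hX : 0 < ((m : ℝ) + 1) ^ (7 / 5 : ℝ) := by positivity
    have k3 : gr n π * Pr F n < 16.9 * ((m : ℝ) + 1) ^ (7 / 5 : ℝ) := by
      have := mul_le_mul k2 (Pr_le_half h2 hn) hP0 (by positivity)
      nlinarith
    refine k3.trans_le ?_
    by_cases hm' : m = 0
    · subst hm'
      have hL2 : 1.5 ≤ L := by
        rw [hL, Real.le_logb_iff_rpow_le (by linarith) hA, h2]
        have : (2 : ℝ) ^ (1.5 : ℝ) ≤ 3 := by
          have h3 : ((2 : ℝ) ^ (1.5 : ℝ)) ^ 2 = 8 := by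
            rw [← Real.rpow_natCast, ← Real.rpow_mul (by norm_num)]; norm_num
          have h4 : 0 ≤ (2 : ℝ) ^ (1.5 : ℝ) := by positivity
          nlinarith
        linarith
      have : L ≤ L ^ (2.54 : ℝ) := Real.self_le_rpow_of_one_le hL1 (by norm_num)
      norm_num at *
      linarith
    · have hm2 : (2 : ℝ) ≤ m + 1 := by
        have : (1 : ℝ) ≤ m := by exact_mod_cast Nat.pos_of_ne_zero hm'
        linarith
      have a1 : ((m : ℝ) + 1) ^ (2.54 : ℝ) ≤ L ^ (2.54 : ℝ) := Real.rpow_le_rpow hm0.le hmL (by norm_num)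
      have a2 : ((m : ℝ) + 1) ^ (1 + 7 / 5 : ℝ) ≤ ((m : ℝ) + 1) ^ (2.54 : ℝ) := Real.rpow_le_rpow_of_exponent_le hm1 (by norm_num)
      rw [Real.rpow_add hm0, Real.rpow_one] at a2
      nlinarith
  · have h3 : 3 ≤ qr F := by
      have := qw_three (F := F) one_ne_zero (by rwa [pow_one])
      rwa [pow_one] at this
    have hb : ∏ t ∈ S, Cq (qr F ^ t.w) ≤ ∏ t ∈ S, Real.exp (8 / 5 * (1 / (qr F ^ t.w - 1))) := by
      apply Finset.prod_le_prod
      · intro t _; exact le_trans zero_le_one (Cq_one (qw_two t))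
      · intro t _
        have h4 : 3 ≤ qr F ^ t.w := le_trans h3 (le_self_pow₀ (by linarith) t.2.ne)
        unfold Cq
        rw [if_neg (by linarith)]
        apply CC_exp h4
        nlinarith
    have k1 := key (8 / 5) (by norm_num)
    have k2 := hg.trans (hb.trans k1)
    have e3 : Real.exp (8 / 5 * (3 / 2)) < 13 := exp_pow_le 5 12 (by norm_num) (by norm_num) (by norm_num) (by norm_num)
    have a1 : ((m : ℝ) + 1) ^ (2.54 : ℝ) ≤ L ^ (2.54 : ℝ) := Real.rpow_le_rpow hm0.le hmL (by norm_num)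
    have a2 : ((m : ℝ) + 1) ^ (8 / 5 : ℝ) ≤ ((m : ℝ) + 1) ^ (2.54 : ℝ) := Real.rpow_le_rpow_of_exponent_le hm1 (by norm_num)
    have hX : 0 < ((m : ℝ) + 1) ^ (8 / 5 : ℝ) := by positivity
    have k3 : gr n π * Pr F n ≤ gr n π := mul_le_of_le_one_right hπ.ch.gr_nonneg (Pr_le_one n)
    nlinarith
end LMT

namespace LMT
variable {F : Type} [Field F]
variable {V V' E Q E' Q' : Type} [AddCommGroup V] [Module F V] [Finite V]
  [AddCommGroup V'] [Module F V'] [Finite V'] [AddCommGroup E] [Module F E] [Finite E]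
  [AddCommGroup Q] [Module F Q] [Finite Q] [AddCommGroup E'] [Module F E'] [Finite E']
  [AddCommGroup Q'] [Module F Q'] [Finite Q']

section grp
variable {G H C K : Type} [Group G] [Finite G] [Group H] [Finite H] [CommGroup C] [Finite C] [Group K] [Finite K]

theorem dual_finite : Finite (C →* ℂˣ) := inferInstance

theorem mdual_sum (z : C) : sm (fun a : C →* ℂˣ => ((a z : ℂˣ) : ℂ)) = if z = 1 then (Nat.card C : ℂ) else 0 := by
  haveI : NeZero (Monoid.exponent C) := ⟨Monoid.exponent_ne_zero_of_finite⟩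
  split_ifs with h
  · subst h
    simp only [map_one, Units.val_one]
    rw [sm_const, CommGroup.card_monoidHom_of_hasEnoughRootsOfUnity C ℂ, mul_one]
  · obtain ⟨b, hb⟩ := CommGroup.exists_apply_ne_one_of_hasEnoughRootsOfUnity C ℂ h
    have h1 := sm_equiv (Equiv.mulLeft b) (fun a : C →* ℂˣ => ((a z : ℂˣ) : ℂ))
    simp only [Equiv.coe_mulLeft, MonoidHom.mul_apply, Units.val_mul] at h1
    rw [sm_mul_left] at h1
    have h2 : ((b z : ℂˣ) : ℂ) ≠ 1 := by
      intro h; exact hb (Units.ext h)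
    by_contra hne
    exact h2 (mul_right_cancel₀ hne (by rw [h1, one_mul]))


noncomputable def chw (χ : G → ℂ) (c : C →* G) (ω : C →* ℂˣ) (g : G) : ℂ := av (fun z => χ (g * c z) * ((ω z⁻¹ : ℂˣ) : ℂ))

theorem chw_char {χ : G → ℂ} (h : IsChar χ) (c : C →* G) (hc : ∀ z g, c z * g = g * c z) (ω : C →* ℂˣ) : IsChar (chw χ c ω) := by
  let m : G × C →* G := MonoidHom.mk' (fun p => p.1 * c p.2) (by
    rintro ⟨a, z⟩ ⟨b, y⟩
    simp only [Prod.mk_mul_mk, map_mul]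
    rw [mul_assoc, ← mul_assoc b, ← hc z b]; simp only [mul_assoc])
  have h1 := (h.comap m).mul (IsChar.ofHom ((ω⁻¹).comp (MonoidHom.snd G C)))
  have h2 := h1.average (MonoidHom.inl G C) (MonoidHom.inr G C) (fun a b => ⟨b, by simp⟩)
  convert h2 using 1
  ext g
  unfold chw
  apply av_congr
  intro z
  simp [m]

theorem chw_sum (χ : G → ℂ) (c : C →* G) (g : G) : sm (fun ω : C →* ℂˣ => chw χ c ω g) = χ g := by
  unfold chw
  rw [← av_sm_comm]
  have : ∀ z : C, sm (fun ω : C →* ℂˣ => χ (g * c z) * ((ω z⁻¹ : ℂˣ) : ℂ)) = if z = 1 then χ g * Nat.card C else 0 := by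
    intro z
    rw [sm_mul_left, mdual_sum]
    by_cases h : z = 1
    · subst h; simp
    · simp [h]
  simp only [this]
  rw [av, sm_single 1 _ (fun b hb => if_neg hb), if_pos rfl]
  have : (Nat.card C : ℂ) ≠ 0 := by exact_mod_cast Nat.card_pos.ne'
  field_simp

theorem schur {χ : G → ℂ} (hχ : IsIrr χ) (c : C →* G) (hc : ∀ z g, c z * g = g * c z) :
    ∃ ω : C →* ℂˣ, ∀ z g, χ (c z * g) = ω z * χ g := by
  cases nonempty_fintype (C →* ℂˣ)
  have hs : χ = ∑ ω : C →* ℂˣ, chw χ c ω := by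
    ext g
    rw [Finset.sum_apply, ← sm_eq (fun ω : C →* ℂˣ => chw χ c ω g), chw_sum]
  have hn : ∀ ψ : G → ℂ, IsIrr ψ → ∃ f : (C →* ℂˣ) → ℕ, ip χ ψ = ((∑ ω, f ω : ℕ) : ℂ) ∧ ∀ ω, ip (chw χ c ω) ψ = f ω := by
    intro ψ hψ
    choose f hf using fun ω => ip_char_nat (chw_char hχ.1 c hc ω) hψ.1
    refine ⟨f, ?_, hf⟩
    conv_lhs => rw [hs, ip_sum]
    push_cast
    exact Finset.sum_congr rfl fun ω _ => hf ω
  obtain ⟨f, h1, h2⟩ := hn χ hχ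
  rw [hχ.2] at h1
  have h1' : 1 = ∑ ω, f ω := by exact_mod_cast h1
  obtain ⟨ω, -, hω⟩ := Finset.exists_ne_zero_of_sum_ne_zero (show ∑ ω, f ω ≠ 0 by omega)
  have hω1 : f ω = 1 := by
    have := Finset.single_le_sum (f := f) (fun _ _ => Nat.zero_le _) (Finset.mem_univ ω)
    omega
  have he : chw χ c ω - χ = 0 := by
    apply cls_eq_zero
    · intro g h
      have a1 := (chw_char hχ.1 c hc ω).cls g h
      have a2 := hχ.1.cls g h
      simp only [Pi.sub_apply, a1, a2]
    · intro ψ hψ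
      rw [ip_sub]
      by_cases hne : χ = ψ
      · subst hne; rw [h2, hω1, hχ.2]; simp
      · obtain ⟨f', g1, g2⟩ := hn ψ hψ
        rw [irr_orth hχ hψ hne] at g1 ⊢
        have g1' : ∑ ω, f' ω = 0 := by exact_mod_cast g1.symm
        rw [g2, (Finset.sum_eq_zero_iff.1 g1') ω (Finset.mem_univ _)]; simp
  refine ⟨ω, fun z g => ?_⟩
  have he' : chw χ c ω = χ := sub_eq_zero.1 he
  conv_lhs => rw [← he']
  conv_rhs => rw [← he']
  unfold chw
  rw [← av_mul_left, ← av_equiv (Equiv.mulLeft z⁻¹)]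
  apply av_congr
  intro y
  rw [hc, Equiv.coe_mulLeft, mul_assoc, ← map_mul, mul_inv_cancel_left]
  simp only [mul_inv, inv_inv, map_mul, Units.val_mul]
  ring

theorem descend {χ : H → ℂ} (hχ : IsIrr χ) (f : H →* K) (hf : Function.Surjective f)
    (h : ∀ a b, f a = f b → χ a = χ b) : ∃ ψ : K → ℂ, IsIrr ψ ∧ ψ 1 = χ 1 := by
  let s := Function.surjInv hf
  have hs : ∀ x, f (s x) = x := Function.surjInv_eq hf
  have h1 : ∀ a, χ (s (f a)) = χ a := fun a => h _ _ (hs _)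
  have hi : ∀ θ : K → ℂ, ip (fun x => χ (s x)) θ = ip χ (fun a => θ (f a)) := by
    intro θ
    unfold ip
    rw [← av_hom f hf]
    apply av_congr; intro a
    show χ (s (f a)) * θ (f a)⁻¹ = χ a * θ (f a⁻¹)
    rw [h1, map_inv]
  refine ⟨fun x => χ (s x), ⟨?_, ?_⟩, ?_⟩
  · apply IsCls.isChar
    · intro g k
      have : χ (s (k * g * k⁻¹)) = χ (s k * s g * (s k)⁻¹) := h _ _ (by simp only [hs, map_mul, map_inv])
      show χ (s (k * g * k⁻¹)) = χ (s g)
      rw [this, hχ.1.cls]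
    · intro θ hθ
      rw [hi]
      exact ip_char_nat hχ.1 (hθ.1.comap f)
  · rw [hi, ← hχ.2]
    unfold ip
    apply av_congr; intro a
    show χ a * χ (s (f a⁻¹)) = χ a * χ a⁻¹
    rw [h1]
  · exact h _ _ (by rw [hs, map_one])

theorem sl_irr {χ : G → ℂ} (hχ : IsIrr χ) (D : G →* C) (hD : Function.Surjective D) (i : H →* G) (hi : Function.Injective i)
    (hr : ∀ g, D g = 1 ↔ ∃ x, i x = g) (ht : ∀ a : C →* ℂˣ, a ≠ 1 → (fun g => (a (D g) : ℂ) * χ g) ≠ χ) :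
    IsIrr (fun x => χ (i x)) := by
  refine ⟨hχ.1.comap i, ?_⟩
  have hcard : Nat.card G = Nat.card H * Nat.card C := by
    have e1 := Subgroup.card_eq_card_quotient_mul_card_subgroup D.ker
    have e2 : Nat.card (G ⧸ D.ker) = Nat.card C := Nat.card_congr (QuotientGroup.quotientKerEquivOfSurjective D hD).toEquiv
    have e3 : D.ker = i.range := by ext g; rw [MonoidHom.mem_ker, hr]; rfl
    have e4 : Nat.card D.ker = Nat.card H := by rw [e3]; exact (Nat.card_congr (MonoidHom.ofInjective hi).toEquiv).symm
    rw [e1, e2, e4, mul_comm]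
  have key : ∀ f : G → ℂ, av (fun x => f (i x)) = sm (fun a : C →* ℂˣ => av (fun g => (a (D g) : ℂ) * f g)) := by
    intro f
    rw [← av_sm_comm]
    simp only [sm_mul_right, mdual_sum]
    unfold av
    rw [hcard]
    have e : sm (fun g => (if D g = 1 then (Nat.card C : ℂ) else 0) * f g) = Nat.card C * sm (fun x => f (i x)) := by
      have e1 : ∀ g, (if D g = 1 then (Nat.card C : ℂ) else 0) * f g = Nat.card C * (if D g = 1 then f g else 0) := by
        intro g; split_ifs <;> simp
      simp only [e1]
      rw [sm_mul_left, ← sm_subtype (fun g => D g = 1)]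
      congr 1
      let E : H ≃ {g // D g = 1} := Equiv.ofBijective (fun x => ⟨i x, (hr _).2 ⟨x, rfl⟩⟩)
        ⟨fun a b hab => hi (congrArg Subtype.val hab), fun ⟨g, hg⟩ => by
          obtain ⟨x, hx⟩ := (hr g).1 hg
          exact ⟨x, Subtype.ext hx⟩⟩
      rw [← sm_equiv E]
      rfl
    rw [e]
    have h1 : (Nat.card C : ℂ) ≠ 0 := by exact_mod_cast Nat.card_pos.ne'
    have h2 : (Nat.card H : ℂ) ≠ 0 := by exact_mod_cast Nat.card_pos.ne'
    push_cast
    field_simp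
  have e0 : ip (fun x => χ (i x)) (fun x => χ (i x)) = av (fun x => (fun g => χ g * χ g⁻¹) (i x)) := by
    unfold ip; apply av_congr; intro x; beta_reduce; rw [map_inv]
  rw [e0]
  refine (key (fun g => χ g * χ g⁻¹)).trans ?_
  rw [sm_single 1]
  · rw [← hχ.2]; unfold ip; apply av_congr; intro g; simp
  · intro a ha
    have h3 : IsChar (fun g => (a (D g) : ℂ) * χ g) := (IsChar.ofHom (a.comp D)).mul hχ.1
    have h4 : IsIrr (fun g => (a (D g) : ℂ) * χ g) := by
      refine ⟨h3, ?_⟩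
      rw [← hχ.2]; unfold ip; apply av_congr; intro g
      have : ((a (D g) : ℂˣ) : ℂ) * ((a (D g⁻¹) : ℂˣ) : ℂ) = 1 := by
        rw [← Units.val_mul, ← map_mul, ← map_mul]; simp
      linear_combination (χ g * χ g⁻¹) * this
    rw [← irr_orth h4 hχ (ht a ha)]
    unfold ip; apply av_congr; intro g; ring

end grp
end LMT

namespace LMT
variable {F : Type} [Field F]
variable {V V' E Q E' Q' : Type} [AddCommGroup V] [Module F V] [Finite V]
  [AddCommGroup V'] [Module F V'] [Finite V'] [AddCommGroup E] [Module F E] [Finite E]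
  [AddCommGroup Q] [Module F Q] [Finite Q] [AddCommGroup E'] [Module F E'] [Finite E']
  [AddCommGroup Q'] [Module F Q'] [Finite Q']

variable [Finite F]

theorem det_conj' (f : V ≃ₗ[F] V') (g : V ≃ₗ[F] V) (g' : V' ≃ₗ[F] V') (h : ∀ v, f (g v) = g' (f v)) :
    LinearEquiv.det g = LinearEquiv.det g' := by
  apply Units.ext
  rw [LinearEquiv.coe_det, LinearEquiv.coe_det, ← LinearMap.det_conj (g : V →ₗ[F] V) f]
  congr 1
  apply LinearMap.ext; intro v
  simp [h]

/-- twist by a character of the determinant -/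
noncomputable def tw (a : Fˣ →* ℂˣ) (φ : CF F) : CF F :=
  CF.mk' (fun _ _ _ _ g => (a (LinearEquiv.det g) : ℂ) * φ.ev g) (by
    intro V V' _ _ _ _ _ _ f g g' h
    rw [det_conj' f g g' h, CF.ev_inv φ f g g' h])
theorem tw_ev (a : Fˣ →* ℂˣ) (φ : CF F) (g : V ≃ₗ[F] V) : (tw a φ).ev g = (a (LinearEquiv.det g) : ℂ) * φ.ev g := rfl

theorem tw_mul (a : Fˣ →* ℂˣ) (φ ψ : CF F) : tw a (φ * ψ) = tw a φ * tw a ψ := by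
  apply CF.ext'
  intro V _ _ _ g
  rw [tw_ev, CF.ev_mul, CF.ev_mul, ← sm_mul_left]
  apply sm_congr; intro W
  by_cases h : ∀ v ∈ W, g v ∈ W
  · rw [tm_pos _ _ _ _ h, tm_pos _ _ _ _ h, tw_ev, tw_ev]
    have : LinearEquiv.det g = LinearEquiv.det (sub g W h) * LinearEquiv.det (quo g W h) := by
      apply Units.ext
      rw [Units.val_mul, LinearEquiv.coe_det, LinearEquiv.coe_det, LinearEquiv.coe_det]
      exact LinearMap.det_eq_det_mul_det W (g : V →ₗ[F] V) h
    rw [this, map_mul, Units.val_mul]; ring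
  · rw [tm, dif_neg h, tm, dif_neg h, mul_zero]

theorem tw_pr (a : Fˣ →* ℂˣ) (n : ℕ) (φ χ : CF F) : pr n (tw a φ) (tw a χ) = pr n φ χ := by
  rw [pr_ip, pr_ip]
  unfold ip
  apply av_congr; intro g
  beta_reduce
  rw [tw_ev, tw_ev]
  have : ((a (LinearEquiv.det g) : ℂˣ) : ℂ) * ((a (LinearEquiv.det g⁻¹) : ℂˣ) : ℂ) = 1 := by
    rw [← Units.val_mul, ← map_mul, ← map_mul]; simp
  linear_combination (φ.ev g * χ.ev g⁻¹) * this

theorem tw_ir (a : Fˣ →* ℂˣ) {n : ℕ} {φ : CF F} (h : Ir n φ) : Ir n (tw a φ) := by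
  refine ⟨fun V _ _ _ g hg => by rw [tw_ev, h.1 V g hg, mul_zero], ?_, ?_⟩
  · exact (IsChar.ofHom (a.comp LinearEquiv.det)).mul h.2.1
  · have := tw_pr a n φ φ
    rw [pr_ip, pr_ip, h.2.2] at this
    exact this

/-- the degree one cuspidal attached to a linear character -/
noncomputable def ta (a : Fˣ →* ℂˣ) : Cs F :=
  ⟨(1, tw a (tk F 1)), ⟨one_ne_zero, tw_ir a (tk_ir 1), by intro a b ha hb hab; omega⟩⟩
theorem ta_w (a : Fˣ →* ℂˣ) : (ta a).w = 1 := rfl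
theorem ta_c (a : Fˣ →* ℂˣ) : (ta a).c = tw a (tk F 1) := rfl

/-- scalar matrices -/
noncomputable def cz (V : Type) [AddCommGroup V] [Module F V] : Fˣ →* (V ≃ₗ[F] V) := DistribMulAction.toModuleAut F V
theorem cz_apply (z : Fˣ) (v : V) : cz V z v = (z : F) • v := rfl
theorem cz_comm (z : Fˣ) (g : V ≃ₗ[F] V) : cz V z * g = g * cz V z := by
  apply LinearEquiv.ext; intro v
  show cz V z (g v) = g (cz V z v)
  rw [cz_apply, cz_apply, map_smul]

theorem cz_det1 (z : Fˣ) : LinearEquiv.det (cz (St F 1) z) = z := by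
  apply Units.ext
  rw [LinearEquiv.coe_det]
  have : ((cz (St F 1) z : St F 1 ≃ₗ[F] St F 1) : St F 1 →ₗ[F] St F 1) = (z : F) • LinearMap.id := by
    apply LinearMap.ext; intro v; rfl
  rw [this, LinearMap.det_smul]; simp

theorem ta_ne {a : Fˣ →* ℂˣ} (h : a ≠ 1) : ta a ≠ t1 F := by
  intro h1
  apply h
  have h2 : (ta a).c = (t1 F).c := by rw [h1]
  rw [ta_c, t1_c] at h2
  ext z
  have h3 := congrArg (fun φ : CF F => φ.ev (cz (St F 1) z)) h2
  simp only [tw_ev, tk_ev, cz_det1, mul_one] at h3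
  simpa using h3

noncomputable def zs (z : Fˣ) (φ : CF F) : CF F :=
  CF.mk' (fun V _ _ _ g => φ.ev (cz V z * g)) (by
    intro V V' _ _ _ _ _ _ f g g' h
    apply CF.ev_inv φ f
    intro v
    show f (cz V z (g v)) = cz V' z (g' (f v))
    rw [cz_apply, cz_apply, map_smul, h])
theorem zs_ev (z : Fˣ) (φ : CF F) (g : V ≃ₗ[F] V) : (zs z φ).ev g = φ.ev (cz V z * g) := rfl

theorem zs_hm (z : Fˣ) {n : ℕ} {φ : CF F} (h : Hm n φ) : Hm n (zs z φ) := fun V _ _ _ _ hg => h V _ hg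

theorem zs_mul (z : Fˣ) (φ ψ : CF F) : zs z (φ * ψ) = zs z φ * zs z ψ := by
  apply CF.ext'
  intro V _ _ _ g
  rw [zs_ev, CF.ev_mul, CF.ev_mul]
  apply sm_congr; intro W
  by_cases h : ∀ v ∈ W, g v ∈ W
  · have h' : ∀ v ∈ W, (cz V z * g) v ∈ W := fun v hv => W.smul_mem _ (h v hv)
    rw [tm_pos _ _ _ _ h, tm_pos _ _ _ _ h', zs_ev, zs_ev]
    have e1 : sub (cz V z * g) W h' = cz W z * sub g W h := by apply LinearEquiv.ext; intro v; rfl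
    have e2 : quo (cz V z * g) W h' = cz (V ⧸ W) z * quo g W h := by
      apply LinearEquiv.ext; intro v
      obtain ⟨v, rfl⟩ := W.mkQ_surjective v
      rfl
    rw [e1, e2]
  · have h' : ¬ ∀ v ∈ W, (cz V z * g) v ∈ W := by
      intro h'
      apply h; intro v hv
      have := W.smul_mem ((z⁻¹ : Fˣ) : F) (h' v hv)
      have e : ((z⁻¹ : Fˣ) : F) • (cz V z * g) v = g v := by
        show ((z⁻¹ : Fˣ) : F) • ((z : F) • g v) = g v
        rw [smul_smul]; simp
      rwa [e] at this
    rw [tm, dif_neg h', tm, dif_neg h]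

theorem zs_pr (z : Fˣ) (n : ℕ) (φ χ : CF F) : pr n (zs z φ) χ = pr n φ (zs z χ) := by
  rw [pr_ip, pr_ip]
  unfold ip
  rw [← av_equiv (Equiv.mulLeft (cz (St F n) z)⁻¹)]
  apply av_congr; intro g
  beta_reduce
  rw [zs_ev, zs_ev, Equiv.coe_mulLeft, mul_inv_cancel_left, mul_inv_rev, inv_inv, cz_comm]

theorem zs_ir {n : ℕ} {φ : CF F} (h : Ir n φ) : ∃ ω : Fˣ →* ℂˣ, ∀ z, zs z φ = (ω z : ℂ) • φ := by
  obtain ⟨ω, hω⟩ := schur h.2 (cz (St F n)) cz_comm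
  refine ⟨ω, fun z => ?_⟩
  apply Hm.ext (n := n) (zs_hm z h.1) (h.1.smul _)
  intro g
  exact hω z g

theorem zs_const {n : ℕ} {φ π : CF F} {ω : ℂ} {z : Fˣ} (hφ : zs z φ = ω • φ) (hπ : Ir n π) (h : pr n φ π ≠ 0) :
    zs z π = ω • π := by
  obtain ⟨ω', h'⟩ := zs_ir hπ
  have := zs_pr z n φ π
  rw [hφ, h' z, pr_smul, pr_smul'] at this
  rw [h' z, mul_right_cancel₀ h this]

theorem zs_tk (z : Fˣ) (k : ℕ) : zs z (tk F k) = tk F k := by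
  apply Hm.ext (n := k) (zs_hm z (tk_ir k).1) (tk_ir k).1
  intro g
  rw [zs_ev, tk_ev, tk_ev]

theorem zs_pow (z : Fˣ) (φ : CF F) (h : zs z φ = φ) (k : ℕ) : zs z (φ ^ k) = φ ^ k := by
  induction k with
  | zero =>
    rw [pow_zero]
    apply CF.ext'; intro V _ _ _ g; rw [zs_ev, CF.ev_one, CF.ev_one]
  | succ k ih => rw [pow_succ, zs_mul, ih, h]

theorem zs_es (z : Fˣ) (k : ℕ) : zs z (es F k) = es F k := by
  have h := (eg_oc (t1 F) k).ne
  have := zs_const (ω := 1) (z := z) (by rw [one_smul]; exact zs_pow z _ (zs_tk z 1) k) (eg_ir (t1 F) k) h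
  rwa [one_smul] at this

theorem zs_pd (M : Multiset (Cs F)) : ∃ ω : Fˣ →* ℂˣ, ∀ z, zs z (pd M) = (ω z : ℂ) • pd M := by
  induction M using Multiset.induction_on with
  | empty =>
    refine ⟨1, fun z => ?_⟩
    rw [MonoidHom.one_apply, Units.val_one, one_smul, pd_zero]
    simpa using zs_pow z 1 (by apply CF.ext'; intro V _ _ _ g; rw [zs_ev, CF.ev_one, CF.ev_one]) 1
  | cons t M ih =>
    obtain ⟨ω, h⟩ := ih
    obtain ⟨ω', h'⟩ := zs_ir t.2.ir
    refine ⟨ω * ω', fun z => ?_⟩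
    have h2 : zs z t.c = (ω' z : ℂ) • t.c := h' z
    rw [pd_cons, zs_mul, h, h2, CF.smul_mul', CF.mul_smul', smul_smul]
    simp

theorem zs_ta (a : Fˣ →* ℂˣ) (z : Fˣ) : zs z (ta a).c = (a z : ℂ) • (ta a).c := by
  rw [ta_c]
  apply Hm.ext (n := 1) (zs_hm z (tw_ir a (tk_ir 1)).1) ((tw_ir a (tk_ir 1)).1.smul _)
  intro g
  rw [zs_ev, tw_ev, CF.ev_smul, tw_ev, map_mul, map_mul, cz_det1, tk_ev, tk_ev]
  simp

end LMT

namespace LMT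
variable {F : Type} [Field F]
variable {V V' E Q E' Q' : Type} [AddCommGroup V] [Module F V] [Finite V]
  [AddCommGroup V'] [Module F V'] [Finite V'] [AddCommGroup E] [Module F E] [Finite E]
  [AddCommGroup Q] [Module F Q] [Finite Q] [AddCommGroup E'] [Module F E'] [Finite E']
  [AddCommGroup Q'] [Module F Q'] [Finite Q']

variable [Finite F]

theorem st_es_ne {s : Cs F} (hs : s ≠ t1 F) (k : ℕ) : st s.w s.c (es F k) = 0 := by
  by_contra h
  obtain ⟨a, b, τ, -, hk, -, hb, -⟩ := st_ex (k := s.w) (X := s.c) s.2.ir (eg_oc (t1 F) k) h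
  have h1 := hb.ne
  rw [← pd_replicate] at h1
  apply h1
  have h2 : s.c = pd {s} := by rw [← Multiset.cons_zero, pd_cons, pd_zero, one_mul]
  rw [h2]
  apply pd_orth (dg_replicate _ _)
  intro h3
  apply hs
  have : s ∈ Multiset.replicate b (t1 F) := by rw [h3]; simp
  exact Multiset.eq_of_mem_replicate this

theorem st_lo {s : Cs F} (hs : s ≠ t1 F) (k : ℕ) (M : Multiset (Cs F)) :
    st s.w s.c (es F k * pd M) = (M.count s : ℂ) • (es F k * pd (M.erase s)) := by
  rw [st_deriv s.2.ne s.2.cu, st_es_ne hs, zero_mul, zero_add, st_pd, CF.mul_smul']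

theorem lo_ir (k : ℕ) {M : Multiset (Cs F)} (hM : M.Nodup) (h1 : t1 F ∉ M) : Ir (k + dg M) (es F k * pd M) := by
  refine Ir.mk' ((es_ir k).ch.mul (pd_ch M)) ?_
  induction M using Multiset.induction_on with
  | empty => rw [dg_zero, pd_zero, mul_one, add_zero]; exact (es_ir k).self
  | cons t N ih =>
    rw [Multiset.nodup_cons] at hM
    rw [Multiset.mem_cons, not_or] at h1
    have ht : t ≠ t1 F := fun h => h1.1 h.symm
    have h2 : es F k * pd (t ::ₘ N) = es F k * pd N * t.c := by rw [pd_cons, mul_assoc]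
    conv_lhs => enter [2]; rw [h2]
    rw [dg_cons, ← add_assoc, adj' (k := t.w) t.2.ir.hm]
    rw [st_lo ht, Multiset.count_cons_self, Multiset.erase_cons_head, Multiset.count_eq_zero_of_notMem hM.1]
    rw [pr_smul', ih hM.2 h1.2]
    simp

theorem st1_lo (k : ℕ) {M : Multiset (Cs F)} (h1 : t1 F ∉ M) : st 1 (tk F 1) (es F (k + 1) * pd M) = es F k * pd M := by
  have h2 := st_pd (t1 F) M
  rw [Multiset.count_eq_zero_of_notMem h1, t1_w, t1_c] at h2
  rw [es_deriv, es_st, h2]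
  simp

theorem lo_tw (k : ℕ) {M : Multiset (Cs F)} (hM : M.Nodup) (h1 : t1 F ∉ M) {a : Fˣ →* ℂˣ} (ha : a ≠ 1) :
    tw a (es F (k + 2) * pd M) ≠ es F (k + 2) * pd M := by
  intro h
  have hz : ∀ φ n, pr (n + 1 + 1) (φ * (ta a).c * (ta a).c) (es F (k + 2) * pd M) = 0 := by
    intro φ n
    rw [adj' (k := 1) (ta a).2.ir.hm, adj' (k := 1) (ta a).2.ir.hm]
    have e1 := st_lo (ta_ne ha) (k + 2) M
    have e2 := st_lo (ta_ne ha) (k + 2) (M.erase (ta a))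
    rw [Multiset.count_eq_zero_of_notMem (fun hh => (hM.mem_erase_iff.1 hh).1 rfl)] at e2
    rw [ta_w] at e1 e2
    show pr n φ (st 1 (ta a).c (st 1 (ta a).c _)) = 0
    rw [e1, st_smul', e2, pr_smul']
    simp [pr_zero']
  have h2 := tw_pr a (k + dg M + 1 + 1) (es F k * pd M * tk F 1 * tk F 1) (es F (k + 2) * pd M)
  rw [h, tw_mul, tw_mul, ← ta_c, hz, adj' (tk_ir 1).hm, adj' (tk_ir 1).hm, st1_lo _ h1, st1_lo _ h1,
    (lo_ir k hM h1).self] at h2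
  exact zero_ne_one h2

end LMT

namespace LMT
variable {F : Type} [Field F]
variable {V V' E Q E' Q' : Type} [AddCommGroup V] [Module F V] [Finite V]
  [AddCommGroup V'] [Module F V'] [Finite V'] [AddCommGroup E] [Module F E] [Finite E]
  [AddCommGroup Q] [Module F Q] [Finite Q] [AddCommGroup E'] [Module F E'] [Finite E']
  [AddCommGroup Q'] [Module F Q'] [Finite Q']

variable [Finite F]
open Matrix in
theorem glE_scalar {n : ℕ} (r : Fˣ) : glE F n (GeneralLinearGroup.scalar (Fin n) r) = cz (St F n) r := by
  apply LinearEquiv.ext; intro v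
  rw [glE_apply, cz_apply]
  ext i
  simp [GeneralLinearGroup.scalar, Matrix.mulVec_diagonal]

open Matrix in
theorem glE_det {n : ℕ} (g : GL (Fin n) F) : LinearEquiv.det (glE F n g) = GeneralLinearGroup.det g := by
  apply Units.ext
  rw [LinearEquiv.coe_det]
  have : ((glE F n g : St F n ≃ₗ[F] St F n) : St F n →ₗ[F] St F n) = Matrix.toLin' (g : Matrix (Fin n) (Fin n) F) := by
    apply LinearMap.ext; intro v; rfl
  rw [this, LinearMap.det_toLin']; rfl

instance finGL (n : ℕ) : Finite (Matrix.GeneralLinearGroup (Fin n) F) := Finite.of_equiv _ (glE F n).symm.toEquiv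
instance finSL (n : ℕ) : Finite (Matrix.SpecialLinearGroup (Fin n) F) :=
  Finite.of_injective _ (Matrix.SpecialLinearGroup.toGL_injective (n := Fin n) (R := F))
instance finPGL (n : ℕ) : Finite (ProjGL n F) := Finite.of_surjective _ (QuotientGroup.mk'_surjective _)
instance finPSL (n : ℕ) : Finite (Matrix.ProjectiveSpecialLinearGroup (Fin n) F) :=
  Finite.of_surjective _ (QuotientGroup.mk'_surjective _)

open Matrix in
theorem low_grp {n D : ℕ} (hn : 1 ≤ n) {π : CF F} (hπ : Ir n π) (hz : ∀ z, zs z π = π)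
    (ht : ∀ a : Fˣ →* ℂˣ, a ≠ 1 → tw a π ≠ π) (hD : π.ev (1 : GS F n) = D) :
    D ≤ maxIrrDeg (ProjGL n F) ∧ D ≤ maxIrrDeg (ProjectiveSpecialLinearGroup (Fin n) F) := by
  let χ : GL (Fin n) F → ℂ := fun g => π.ev (glE F n g)
  have hχ : IsIrr χ := hπ.2.comap (glE F n).toMonoidHom (glE F n).surjective
  have hsc : ∀ (a : GL (Fin n) F) r, χ (a * GeneralLinearGroup.scalar (Fin n) r) = χ a := by
    intro a r
    show π.ev _ = π.ev _
    rw [map_mul, glE_scalar, ← cz_comm]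
    conv_rhs => rw [← hz r]
    rw [zs_ev]
  have h1 : χ 1 = D := by show π.ev _ = _; rw [map_one, hD]
  haveI : Nonempty (Fin n) := ⟨⟨0, hn⟩⟩
  constructor
  · obtain ⟨ψ, h2, h3⟩ := descend hχ (QuotientGroup.mk' (Subgroup.center (GL (Fin n) F))) (QuotientGroup.mk'_surjective _) (by
      intro a b hab
      have hc : a⁻¹ * b ∈ Subgroup.center (GL (Fin n) F) := QuotientGroup.eq.1 hab
      rw [GeneralLinearGroup.center_eq_range_scalar] at hc
      obtain ⟨r, hr⟩ := hc
      have : b = a * GeneralLinearGroup.scalar (Fin n) r := by rw [hr, mul_inv_cancel_left]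
      rw [this, hsc])
    exact le_maxIrrDeg h2 (h3.trans h1)
  · have hs : IsIrr (fun x : SpecialLinearGroup (Fin n) F => χ (SpecialLinearGroup.toGL x)) := by
      refine sl_irr hχ GeneralLinearGroup.det GeneralLinearGroup.det_surjective SpecialLinearGroup.toGL
        SpecialLinearGroup.toGL_injective ?_ ?_
      · intro g
        constructor
        · intro h
          refine ⟨⟨g.1, ?_⟩, Units.ext rfl⟩
          have := congrArg Units.val h
          exact this
        · rintro ⟨x, rfl⟩
          exact Units.ext x.2
      · intro a ha he
        apply ht a ha
        have hi := tw_ir a hπ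
        apply hi.1.ext hπ.1
        intro g
        obtain ⟨x, rfl⟩ := (glE F n).surjective g
        rw [tw_ev, glE_det]
        exact congrFun he x
    obtain ⟨ψ, h2, h3⟩ := descend hs (QuotientGroup.mk' (Subgroup.center (SpecialLinearGroup (Fin n) F))) (QuotientGroup.mk'_surjective _) (by
      intro a b hab
      have hc : a⁻¹ * b ∈ Subgroup.center (SpecialLinearGroup (Fin n) F) := QuotientGroup.eq.1 hab
      obtain ⟨r, hr, hr'⟩ := Matrix.SpecialLinearGroup.mem_center_iff.1 hc
      have hr0 : r ≠ 0 := by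
        rintro rfl
        rw [Fintype.card_fin, zero_pow (by omega)] at hr
        exact zero_ne_one hr
      have : SpecialLinearGroup.toGL b = SpecialLinearGroup.toGL a * GeneralLinearGroup.scalar (Fin n) (Units.mk0 r hr0) := by
        have e : SpecialLinearGroup.toGL (a⁻¹ * b) = GeneralLinearGroup.scalar (Fin n) (Units.mk0 r hr0) := by
          apply Units.ext
          exact hr'.symm
        rw [← e, map_mul, map_inv, mul_inv_cancel_left]
      rw [this, hsc])
    refine le_maxIrrDeg h2 (h3.trans ?_)
    rw [map_one, h1]

theorem one_le_deg (G : Type) [Group G] [Finite G] : 1 ≤ maxIrrDeg G := le_maxIrrDeg triv_irr (by simp)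

/-- both projective groups contain a character of degree ratio at least that of `es k * pd M` -/
theorem low_M {k : ℕ} {M : Multiset (Cs F)} (hM : M.Nodup) (hw : ∀ t ∈ M, 2 ≤ t.w) (hk : 3 ≤ k) :
    ∃ D : ℕ, (∃ j ≥ k - 1, j ≤ k ∧ gr j (es F j) * gr (dg M) (pd M) * Pr F (k + dg M) ≤ D / qr F ^ ((k + dg M) * (k + dg M - 1) / 2)) ∧
    D ≤ maxIrrDeg (ProjGL (k + dg M) F) ∧ D ≤ maxIrrDeg (Matrix.ProjectiveSpecialLinearGroup (Fin (k + dg M)) F) := by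
  obtain ⟨ω, hω⟩ := zs_pd M
  have h1 : ∀ a : Fˣ →* ℂˣ, ta a ∉ M := fun a h => by have := hw _ h; rw [ta_w] at this; omega
  have h1' : t1 F ∉ M := fun h => by have := hw _ h; rw [t1_w] at this; omega
  by_cases ho : ω = 1
  · subst ho
    have hI := lo_ir k hM h1'
    obtain ⟨D, hD⟩ := hI.ch.ev1
    refine ⟨D, ⟨k, by omega, le_rfl, ?_⟩, low_grp (by omega) hI ?_ ?_ hD⟩
    · rw [ratio_eq hD, gr_mul (es_ir k).ch (pd_ch M)]
    · intro z
      rw [zs_mul, zs_es, hω]; simp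
    · intro a ha
      obtain ⟨j, rfl⟩ : ∃ j, k = j + 2 := ⟨k - 2, by omega⟩
      exact lo_tw j hM h1' ha
  · have ho' : ω⁻¹ ≠ 1 := by
      intro h; apply ho; ext z
      have := congrArg (fun f : Fˣ →* ℂˣ => f z) h
      simp only [MonoidHom.inv_apply, MonoidHom.one_apply, inv_eq_one] at this
      rw [this]; simp
    obtain ⟨j, rfl⟩ : ∃ j, k = j + 2 + 1 := ⟨k - 3, by omega⟩
    have hN : (ta ω⁻¹ ::ₘ M).Nodup := Multiset.nodup_cons.2 ⟨h1 _, hM⟩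
    have hN' : t1 F ∉ ta ω⁻¹ ::ₘ M := by
      rw [Multiset.mem_cons, not_or]; exact ⟨fun h => ta_ne ho' h.symm, h1'⟩
    have hI := lo_ir (j + 2) hN hN'
    have e : j + 2 + dg (ta ω⁻¹ ::ₘ M) = j + 2 + 1 + dg M := by rw [dg_cons, ta_w]; ring
    have hP : Ch (dg M + 1) (pd M * (ta ω⁻¹).c) := (pd_ch M).mul (ta ω⁻¹).2.ir.ch
    have e2 : gr (j + 2 + 1 + dg M) (es F (j + 2) * pd (ta ω⁻¹ ::ₘ M)) = gr (j + 2) (es F (j + 2)) * (gr (dg M) (pd M) * gr 1 (ta ω⁻¹).c) := by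
      rw [pd_cons, ← gr_mul (b := 1) (pd_ch M) (ta ω⁻¹).2.ir.ch, ← gr_mul (es_ir _).ch hP]
      congr 1; ring
    rw [e] at hI
    obtain ⟨D, hD⟩ := hI.ch.ev1
    refine ⟨D, ⟨j + 2, by omega, by omega, ?_⟩, low_grp (by omega) hI ?_ ?_ hD⟩
    · rw [ratio_eq hD, e2]
      apply mul_le_mul_of_nonneg_right _ (Pr_nonneg _)
      rw [← mul_assoc]
      apply le_mul_of_one_le_right
      · exact mul_nonneg (es_ir _).ch.gr_nonneg (pd_ch M).gr_nonneg
      · have hg := gr_eg (ta ω⁻¹) 1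
        rw [eg_one, ta_w, Finset.prod_range_one, one_mul] at hg
        rw [hg]
        simp only [zero_add, pow_one]
        have := qr_two (F := F)
        rw [le_div_iff₀ (by linarith)]; linarith
    · intro z
      rw [zs_mul, zs_es, pd_cons, zs_mul, hω, zs_ta, CF.smul_mul', CF.mul_smul', CF.mul_smul', CF.mul_smul', smul_smul]
      have : ((ω z : ℂˣ) : ℂ) * ((ω⁻¹ z : ℂˣ) : ℂ) = 1 := by
        rw [← Units.val_mul]; simp
      rw [this, one_smul]
    · intro a ha
      exact lo_tw j hN hN' ha

end LMT

namespace LMT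
variable {F : Type} [Field F]
variable {V V' E Q E' Q' : Type} [AddCommGroup V] [Module F V] [Finite V]
  [AddCommGroup V'] [Module F V'] [Finite V'] [AddCommGroup E] [Module F E] [Finite E]
  [AddCommGroup Q] [Module F Q] [Finite Q] [AddCommGroup E'] [Module F E'] [Finite E']
  [AddCommGroup Q'] [Module F Q'] [Finite Q']

variable [Finite F]

theorem gr_es_Pr (k : ℕ) : gr k (es F k) * Pr F k = 1 := by
  have h := gr_eg (t1 F) k
  rw [t1_w, mul_one, pow_one] at h
  show gr k (eg (t1 F) k) * Pr F k = 1
  rw [h, Pr, ← Finset.prod_mul_distrib]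
  apply Finset.prod_eq_one
  intro i _
  have := qr_pow_gt (F := F) i
  have h2 : qr F ^ (i + 1) - 1 ≠ 0 := this.ne'
  have h3 : qr F ^ (i + 1) ≠ 0 := by linarith
  field_simp

theorem low_one {n : ℕ} (hn : 1 ≤ n) : ∃ D : ℕ, (D : ℝ) / qr F ^ (n * (n - 1) / 2) = 1 ∧
    D ≤ maxIrrDeg (ProjGL n F) ∧ D ≤ maxIrrDeg (Matrix.ProjectiveSpecialLinearGroup (Fin n) F) := by
  by_cases h1 : n = 1
  · subst h1
    exact ⟨1, by simp, one_le_deg _, one_le_deg _⟩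
  · obtain ⟨D, hD⟩ := (es_ir (F := F) n).ch.ev1
    refine ⟨D, ?_, low_grp hn (es_ir n) (fun z => zs_es z n) ?_ hD⟩
    · rw [ratio_eq hD, gr_es_Pr]
    · intro a ha
      obtain ⟨j, rfl⟩ : ∃ j, n = j + 2 := ⟨n - 2, by omega⟩
      have := lo_tw j (M := 0) Multiset.nodup_zero (by simp) ha
      simpa using this

theorem Pr_succ (n : ℕ) : Pr F (n + 1) = Pr F n * (1 - 1 / qr F ^ (n + 1)) := Finset.prod_range_succ _ _

theorem Pr_low {j : ℕ} (i : ℕ) : Pr F j * (1 - 1 / qr F ^ j + 1 / qr F ^ (j + i)) ≤ Pr F (j + i) := by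
  have hq := qr_two (F := F)
  induction i with
  | zero => simp
  | succ i ih =>
    rw [← add_assoc, Pr_succ]
    refine le_trans ?_ (mul_le_mul_of_nonneg_right ih (Pr_fac (j + i)).1)
    rw [mul_assoc]
    apply mul_le_mul_of_nonneg_left _ (Pr_nonneg _)
    have hp : 0 < qr F ^ (j + i) := by positivity
    have hpj : 0 < qr F ^ j := by positivity
    set y := 1 / qr F ^ (j + i + 1) with hy
    have hy0 : 0 ≤ y := by positivity
    have e : 1 / qr F ^ (j + i) = qr F * y := by rw [hy, pow_succ]; field_simp
    have hle : 1 / qr F ^ (j + i) ≤ 1 / qr F ^ j :=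
      one_div_le_one_div_of_le hpj (pow_le_pow_right₀ (by linarith) (by omega))
    rw [e] at hle ⊢
    nlinarith [mul_nonneg hy0 (sub_nonneg.2 hle), mul_nonneg hy0 (sub_nonneg.2 hq)]

theorem es_Pr_low {j n : ℕ} (hj : 2 ≤ j) (hn : j ≤ n) : 3 / 4 ≤ gr j (es F j) * Pr F n := by
  have hq := qr_two (F := F)
  obtain ⟨i, rfl⟩ := Nat.exists_eq_add_of_le hn
  have h1 := mul_le_mul_of_nonneg_left (Pr_low (F := F) (j := j) i) (es_ir (F := F) j).ch.gr_nonneg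
  rw [← mul_assoc, gr_es_Pr, one_mul] at h1
  refine le_trans ?_ h1
  have h2 : (4 : ℝ) ≤ qr F ^ j := by
    calc (4 : ℝ) = 2 ^ 2 := by norm_num
      _ ≤ qr F ^ 2 := by gcongr
      _ ≤ qr F ^ j := pow_le_pow_right₀ (by linarith) hj
  have h3 : 1 / qr F ^ j ≤ 1 / 4 := one_div_le_one_div_of_le (by norm_num) h2
  have h4 : 0 ≤ 1 / qr F ^ (j + i) := by positivity
  linarith

theorem gr_pd (M : Multiset (Cs F)) : Real.exp (M.map fun t => 1 / qr F ^ t.w).sum ≤ gr (dg M) (pd M) := by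
  have hq := qr_two (F := F)
  induction M using Multiset.induction_on with
  | empty =>
    have := gr_es_Pr (F := F) 0
    rw [es_zero] at this
    simp only [Pr, Finset.range_zero, Finset.prod_empty, mul_one] at this
    simp [this]
  | cons t M ih =>
    rw [Multiset.map_cons, Multiset.sum_cons, dg_cons, pd_cons, gr_mul (b := t.w) (pd_ch M) t.2.ir.ch, add_comm, Real.exp_add]
    apply mul_le_mul ih _ (Real.exp_pos _).le (pd_ch M).gr_nonneg
    have hg := gr_eg t 1
    rw [eg_one, Finset.prod_range_one, one_mul] at hg
    rw [hg]
    simp only [zero_add, pow_one]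
    have h2 : 2 ≤ qr F ^ t.w := le_trans hq (le_self_pow₀ (by linarith) t.2.ne)
    set Q := qr F ^ t.w
    have h3 := Real.one_sub_le_exp_neg (1 / Q)
    rw [Real.exp_neg] at h3
    have h4 : 1 - 1 / Q = (Q - 1) / Q := by field_simp
    rw [h4] at h3
    rw [← inv_div (Q - 1) Q]
    have h5 : 0 < (Q - 1) / Q := div_pos (by linarith) (by linarith)
    rw [le_inv_comm₀ (Real.exp_pos _) h5]
    exact h3

theorem nc_ge {d : ℕ} (hd : 6 ≤ d) : 3 / 4 * qr F ^ d ≤ d * nc F d := by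
  have hq : 2 ≤ Nat.card F := by have := qr_two (F := F); unfold qr at this; exact_mod_cast this
  have h := nc_sum (F := F) (n := d) (by omega)
  rw [← Nat.cons_self_properDivisors (by omega), Finset.sum_cons] at h
  have h1 : ∑ e ∈ d.properDivisors, e * nc F e ≤ ∑ e ∈ d.properDivisors, Nat.card F ^ e := by
    apply Finset.sum_le_sum
    intro e he
    have he0 : e ≠ 0 := by
      rintro rfl
      have := (Nat.mem_properDivisors.1 he).1
      rw [zero_dvd_iff] at this; omega
    have h2 := nc_le (F := F) he0
    unfold qr at h2
    have : ((e * nc F e : ℕ) : ℝ) ≤ ((Nat.card F ^ e : ℕ) : ℝ) := by push_cast; linarith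
    exact_mod_cast this
  have h2 : ∑ e ∈ d.properDivisors, Nat.card F ^ e < Nat.card F ^ (d - 2) := by
    apply Nat.geomSum_lt hq
    intro e he
    obtain ⟨⟨c, hc⟩, hlt⟩ := Nat.mem_properDivisors.1 he
    have : 2 ≤ c := by
      rcases c with _ | _ | c
      · omega
      · omega
      · omega
    have : e * 2 ≤ d := by rw [hc]; exact Nat.mul_le_mul_left _ this
    omega
  have h3 : Nat.card F ^ d ≤ d * nc F d + Nat.card F ^ (d - 2) := by omega
  have h4 : (qr F : ℝ) ^ d ≤ d * nc F d + qr F ^ (d - 2) := by unfold qr; exact_mod_cast h3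
  have h5 : 4 * qr F ^ (d - 2) ≤ qr F ^ d := by
    have e : d = d - 2 + 2 := by omega
    conv_rhs => rw [e, pow_add, mul_comm]
    have := qr_two (F := F)
    gcongr
    nlinarith
  linarith

theorem nc_pr {d : ℕ} (hd : d.Prime) : (d : ℝ) * nc F d = qr F ^ d - qr F := by
  have h := nc_sum (F := F) (n := d) hd.ne_zero
  rw [hd.sum_divisors] at h
  have h1 := nc_one (F := F)
  have h2 : d * nc F d + Nat.card F = Nat.card F ^ d := by omega
  unfold qr
  have h3 : ((d * nc F d + Nat.card F : ℕ) : ℝ) = ((Nat.card F ^ d : ℕ) : ℝ) := by rw [h2]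
  push_cast at h3
  linarith

theorem nc_le2 {d : ℕ} (hd : 2 ≤ d) : (d : ℝ) * nc F d ≤ qr F ^ d - qr F := by
  have h := nc_sum (F := F) (n := d) (by omega)
  have h1 := nc_one (F := F)
  have h2 : ∑ e ∈ ({1, d} : Finset ℕ), e * nc F e ≤ ∑ e ∈ d.divisors, e * nc F e := by
    apply Finset.sum_le_sum_of_subset
    intro x hx
    rw [Finset.mem_insert, Finset.mem_singleton] at hx
    rw [Nat.mem_divisors]
    rcases hx with rfl | rfl
    · exact ⟨one_dvd _, by omega⟩
    · exact ⟨dvd_rfl, by omega⟩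
  rw [Finset.sum_pair (by omega)] at h2
  have h3 : d * nc F d + Nat.card F ≤ Nat.card F ^ d := by omega
  unfold qr
  have h4 : ((d * nc F d + Nat.card F : ℕ) : ℝ) ≤ ((Nat.card F ^ d : ℕ) : ℝ) := by exact_mod_cast h3
  push_cast at h4
  linarith

end LMT

namespace LMT
variable {F : Type} [Field F]
variable {V V' E Q E' Q' : Type} [AddCommGroup V] [Module F V] [Finite V]
  [AddCommGroup V'] [Module F V'] [Finite V'] [AddCommGroup E] [Module F E] [Finite E]
  [AddCommGroup Q] [Module F Q] [Finite Q] [AddCommGroup E'] [Module F E'] [Finite E']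
  [AddCommGroup Q'] [Module F Q'] [Finite Q']

variable [Finite F]

theorem geo_low (m : ℕ) (hm : 1 ≤ m) : (∑ d ∈ Finset.Icc 2 m, qr F ^ d) * (qr F - 1) = qr F ^ (m + 1) - qr F ^ 2 := by
  induction m, hm using Nat.le_induction with
  | base => simp
  | succ m hm ih =>
    rw [Finset.sum_Icc_succ_top (by omega), add_mul, ih]; ring

theorem harm_low (m : ℕ) (hm : 5 ≤ m) : Real.log (((m : ℝ) + 1) / 6) ≤ ∑ d ∈ Finset.Icc 6 m, 1 / (d : ℝ) := by
  induction m, hm using Nat.le_induction with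
  | base => norm_num
  | succ m hm ih =>
    rw [Finset.sum_Icc_succ_top (by omega)]
    have hp : (0 : ℝ) < m + 1 := by positivity
    have h : (((m + 1 : ℕ) : ℝ) + 1) / 6 = ((m : ℝ) + 1) / 6 * (1 + 1 / ((m + 1 : ℕ) : ℝ)) := by
      push_cast; field_simp
    rw [h, Real.log_mul (by positivity) (by positivity)]
    have h2 := Real.log_le_sub_one_of_pos (x := 1 + 1 / ((m + 1 : ℕ) : ℝ)) (by positivity)
    linarith

noncomputable def MM (F : Type) [Field F] [Finite F] (m : ℕ) : Multiset (Cs F) := ((TT F m).filter fun t => 2 ≤ t.w).val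

theorem sum_MM {A : Type*} [AddCommMonoid A] {m : ℕ} (hm : 1 ≤ m) (f : ℕ → A) :
    ((MM F m).map fun t => f t.w).sum = ∑ d ∈ Finset.Icc 2 m, nc F d • f d := by
  have h0 : ((MM F m).map fun t => f t.w).sum = ∑ t ∈ (TT F m).filter (fun t => 2 ≤ t.w), f t.w := rfl
  rw [h0, Finset.sum_filter]
  have h := sum_TT_w (F := F) m (fun d => if 2 ≤ d then f d else 0)
  refine Eq.trans h ?_
  rw [← Finset.add_sum_Ioc_eq_sum_Icc hm]
  simp only [show ¬ (2 ≤ 1) by omega, if_false, smul_zero, zero_add]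
  apply Finset.sum_congr
  · ext d; simp only [Finset.mem_Ioc, Finset.mem_Icc]; omega
  · intro d hd
    rw [if_pos (Finset.mem_Icc.1 hd).1]

theorem dg_MM {m : ℕ} (hm : 5 ≤ m) : (dg (MM F m) : ℝ) + 8 ≤ ∑ d ∈ Finset.Icc 2 m, qr F ^ d := by
  have hq := qr_two (F := F)
  have h : dg (MM F m) = ∑ d ∈ Finset.Icc 2 m, nc F d • d := sum_MM (by omega) (fun d => d)
  rw [h]
  push_cast
  have h2 : ∑ d ∈ Finset.Icc 2 m, ((nc F d • d : ℕ) : ℝ) ≤ ∑ d ∈ Finset.Icc 2 m, (qr F ^ d - qr F) := by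
    apply Finset.sum_le_sum
    intro d hd
    have := nc_le2 (F := F) (Finset.mem_Icc.1 hd).1
    rw [smul_eq_mul]; push_cast; linarith
  have h3 : ∑ d ∈ Finset.Icc 2 m, (qr F ^ d - qr F) = ∑ d ∈ Finset.Icc 2 m, qr F ^ d - (m - 1 : ℕ) * qr F := by
    rw [Finset.sum_sub_distrib, Finset.sum_const, Nat.card_Icc, nsmul_eq_mul]; rfl
  have h4 : (4 : ℝ) ≤ (m - 1 : ℕ) := by exact_mod_cast (by omega : 4 ≤ m - 1)
  have h5 : (8 : ℝ) ≤ (m - 1 : ℕ) * qr F := by nlinarith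
  push_cast at h2
  linarith

theorem sum_low {m : ℕ} (hm : 5 ≤ m) :
    1 / 2 + 3 / 4 * Real.log (((m : ℝ) + 1) / 6) ≤ ((MM F m).map fun t => 1 / qr F ^ t.w).sum := by
  have hq := qr_two (F := F)
  rw [sum_MM (F := F) (by omega) (fun d => 1 / qr F ^ d)]
  have hs : ∑ d ∈ insert 2 (insert 3 (Finset.Icc 6 m)), nc F d • (1 / qr F ^ d) ≤ ∑ d ∈ Finset.Icc 2 m, nc F d • (1 / qr F ^ d) := by
    apply Finset.sum_le_sum_of_subset_of_nonneg
    · intro d hd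
      simp only [Finset.mem_insert, Finset.mem_Icc] at hd ⊢
      omega
    · intro d _ _
      positivity
  refine le_trans ?_ hs
  rw [Finset.sum_insert (by simp), Finset.sum_insert (by simp)]
  have h2 : 1 / 4 ≤ nc F 2 • (1 / qr F ^ 2) := by
    have := nc_pr (F := F) Nat.prime_two
    rw [nsmul_eq_mul, mul_one_div, le_div_iff₀ (by positivity)]
    push_cast at this
    nlinarith
  have h3 : 1 / 4 ≤ nc F 3 • (1 / qr F ^ 3) := by
    have := nc_pr (F := F) Nat.prime_three
    rw [nsmul_eq_mul, mul_one_div, le_div_iff₀ (by positivity)]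
    push_cast at this
    nlinarith [mul_nonneg (by linarith : 0 ≤ qr F) (by nlinarith : 0 ≤ qr F ^ 2 - 4)]
  have h6 : 3 / 4 * ∑ d ∈ Finset.Icc 6 m, 1 / (d : ℝ) ≤ ∑ d ∈ Finset.Icc 6 m, nc F d • (1 / qr F ^ d) := by
    rw [Finset.mul_sum]
    apply Finset.sum_le_sum
    intro d hd
    have hd6 := (Finset.mem_Icc.1 hd).1
    have := nc_ge (F := F) hd6
    have hdp : (0 : ℝ) < d := by exact_mod_cast (by omega : 0 < d)
    rw [nsmul_eq_mul, mul_one_div, mul_one_div, div_le_div_iff₀ hdp (by positivity)]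
    linarith
  have := harm_low m hm
  linarith

theorem num_low {m : ℕ} {L : ℝ} (hm : 5 ≤ m) (hL0 : 0 < L) (hL : L < m + 2) :
    1 / 4 * L ^ (3 / 4 : ℝ) < 3 / 4 * Real.exp (1 / 2 + 3 / 4 * Real.log (((m : ℝ) + 1) / 6)) := by
  have hm' : (5 : ℝ) ≤ m := by exact_mod_cast hm
  set y : ℝ := ((m : ℝ) + 1) / 6 with hy
  have hy0 : 0 < y := by positivity
  have h1 : L ≤ 7 * y := by rw [hy]; linarith
  have h2 : L ^ (3 / 4 : ℝ) ≤ 7 ^ (3 / 4 : ℝ) * y ^ (3 / 4 : ℝ) := by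
    rw [← Real.mul_rpow (by norm_num) hy0.le]
    exact Real.rpow_le_rpow hL0.le h1 (by norm_num)
  have h3 : (7 : ℝ) ^ (3 / 4 : ℝ) < 4.5 := by
    rw [show (4.5 : ℝ) = (4.5 ^ (4 / 3 : ℝ)) ^ (3 / 4 : ℝ) by rw [← Real.rpow_mul (by norm_num)]; norm_num]
    apply Real.rpow_lt_rpow (by norm_num) _ (by norm_num)
    rw [show (7 : ℝ) = (343 : ℝ) ^ (1 / 3 : ℝ) by
      rw [show (343 : ℝ) = 7 ^ (3 : ℝ) by norm_num, ← Real.rpow_mul (by norm_num)]; norm_num]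
    rw [show (4.5 : ℝ) ^ (4 / 3 : ℝ) = ((4.5 : ℝ) ^ (4 : ℝ)) ^ (1 / 3 : ℝ) by
      rw [← Real.rpow_mul (by norm_num)]; norm_num]
    apply Real.rpow_lt_rpow (by norm_num) _ (by norm_num)
    rw [show (4 : ℝ) = ((4 : ℕ) : ℝ) by norm_num, Real.rpow_natCast]; norm_num
  have h4 : Real.exp (1 / 2 + 3 / 4 * Real.log y) = Real.exp (1 / 2) * y ^ (3 / 4 : ℝ) := by
    rw [Real.exp_add, Real.rpow_def_of_pos hy0, mul_comm (Real.log y)]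
  rw [h4]
  have h5 := Real.add_one_le_exp (1 / 2 : ℝ)
  have h6 : 0 < y ^ (3 / 4 : ℝ) := Real.rpow_pos_of_pos hy0 _
  nlinarith [mul_pos h6 (sub_pos.2 h3), mul_nonneg h6.le (sub_nonneg.2 h5)]

theorem six_low {L : ℝ} (h0 : 0 ≤ L) (h : L ≤ 6) : 1 / 4 * L ^ (3 / 4 : ℝ) < 1 := by
  have h2 : L ^ (3 / 4 : ℝ) ≤ 6 ^ (3 / 4 : ℝ) := Real.rpow_le_rpow h0 h (by norm_num)
  have h3 : (6 : ℝ) ^ (3 / 4 : ℝ) < 4 := by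
    have h4 : ((6 : ℝ) ^ (3 / 4 : ℝ)) ^ 4 = 216 := by
      rw [← Real.rpow_natCast, ← Real.rpow_mul (by norm_num)]
      rw [show (3 / 4 : ℝ) * ((4 : ℕ) : ℝ) = ((3 : ℕ) : ℝ) by norm_num, Real.rpow_natCast]; norm_num
    refine lt_of_pow_lt_pow_left₀ 4 (by norm_num) ?_
    rw [h4]; norm_num
  linarith

theorem lower {n : ℕ} (hn : 1 ≤ n) {L : ℝ}
    (hL : L = Real.logb (qr F) (((n : ℝ) - 1) * (1 - 1 / qr F) + qr F ^ 2)) :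
    ∃ D : ℕ, 1 / 4 * L ^ (3 / 4 : ℝ) < (D : ℝ) / qr F ^ (n * (n - 1) / 2) ∧
      D ≤ maxIrrDeg (ProjGL n F) ∧ D ≤ maxIrrDeg (Matrix.ProjectiveSpecialLinearGroup (Fin n) F) := by
  have hq := qr_two (F := F)
  have hn' : (1 : ℝ) ≤ n := by exact_mod_cast hn
  set X : ℝ := ((n : ℝ) - 1) * (1 - 1 / qr F) + qr F ^ 2 with hX
  have hq1 : 0 ≤ 1 - 1 / qr F := by
    rw [sub_nonneg, div_le_one (by linarith)]; linarith
  have hXq : qr F ^ 2 ≤ X := by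
    rw [hX]; nlinarith [mul_nonneg (sub_nonneg.2 hn') hq1]
  have hX0 : 0 < X := lt_of_lt_of_le (by positivity) hXq
  have hL2 : 0 ≤ L := by
    rw [hL]; apply Real.logb_nonneg (by linarith); nlinarith
  by_cases h6 : L ≤ 6
  · obtain ⟨D, h1, h2⟩ := low_one (F := F) hn
    exact ⟨D, by rw [h1]; exact six_low hL2 h6, h2⟩
  · push Not at h6
    obtain ⟨m, hm⟩ : ∃ m, ⌊L⌋₊ = m + 1 := ⟨⌊L⌋₊ - 1, by
      have : 6 ≤ ⌊L⌋₊ := Nat.le_floor (by exact_mod_cast h6.le)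
      omega⟩
    have hm5 : 5 ≤ m := by
      have : 6 ≤ ⌊L⌋₊ := Nat.le_floor (by exact_mod_cast h6.le)
      omega
    have hf1 := Nat.floor_le hL2
    have hf2 := Nat.lt_floor_add_one L
    rw [hm] at hf1 hf2
    push_cast at hf2
    have hXm : qr F ^ (m + 1) ≤ X := by
      rw [hL, Real.le_logb_iff_rpow_le (by linarith) hX0, Real.rpow_natCast] at hf1
      exact hf1
    have hgeo := geo_low (F := F) m (by omega)
    have hdg := dg_MM (F := F) hm5
    set S := ∑ d ∈ Finset.Icc 2 m, qr F ^ d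
    have hS : S ≤ n - 1 := by
      have e1 : S * (qr F - 1) ≤ ((n : ℝ) - 1) * (1 - 1 / qr F) := by rw [hgeo]; linarith
      have e2 : 1 - 1 / qr F ≤ qr F - 1 := by
        have : 0 ≤ 1 / qr F := by positivity
        linarith
      have e3 : ((n : ℝ) - 1) * (1 - 1 / qr F) ≤ ((n : ℝ) - 1) * (qr F - 1) :=
        mul_le_mul_of_nonneg_left e2 (by linarith)
      exact le_of_mul_le_mul_right (e1.trans e3) (by linarith)
    have hdn : dg (MM F m) + 9 ≤ n := by
      have : ((dg (MM F m) : ℝ) + 9) ≤ n := by linarith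
      exact_mod_cast this
    obtain ⟨k, hk⟩ : ∃ k, k + dg (MM F m) = n := ⟨n - dg (MM F m), by omega⟩
    have hM : (MM F m).Nodup := Finset.nodup _
    have hw : ∀ t ∈ MM F m, 2 ≤ t.w := fun t ht => (Finset.mem_filter.1 (show t ∈ (TT F m).filter (fun t => 2 ≤ t.w) from ht)).2
    obtain ⟨D, ⟨j, hj, hjk, hD⟩, h2⟩ := low_M hM hw (k := k) (by omega)
    rw [hk] at hD h2
    refine ⟨D, lt_of_lt_of_le ?_ hD, h2⟩
    have g1 := es_Pr_low (F := F) (j := j) (n := n) (by omega) (by omega)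
    have g2 := gr_pd (MM F m)
    have g3 := Real.exp_le_exp.2 (sum_low (F := F) hm5)
    have g4 := num_low hm5 (L := L) (by linarith) (by linarith)
    refine lt_of_lt_of_le g4 ?_
    rw [mul_right_comm]
    exact mul_le_mul g1 (g3.trans g2) (Real.exp_pos _).le (by linarith)

end LMT

namespace LMT
variable {F : Type} [Field F]
variable {V V' E Q E' Q' : Type} [AddCommGroup V] [Module F V] [Finite V]
  [AddCommGroup V'] [Module F V'] [Finite V'] [AddCommGroup E] [Module F E] [Finite E]
  [AddCommGroup Q] [Module F Q] [Finite Q] [AddCommGroup E'] [Module F E'] [Finite E']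
  [AddCommGroup Q'] [Module F Q'] [Finite Q']

variable [Finite F]

theorem upper_gl {n : ℕ} (hn : 1 ≤ n) :
    (maxIrrDeg (Matrix.GeneralLinearGroup (Fin n) F) : ℝ) / qr F ^ (n * (n - 1) / 2) <
      13 * Real.logb (qr F) (n * (qr F - 1) + qr F) ^ (2.54 : ℝ) := by
  obtain ⟨χ, h1, h2⟩ := exists_maxIrrDeg (Matrix.GeneralLinearGroup (Fin n) F)
  have h3 : IsIrr (fun g : GS F n => χ ((glE F n).symm g)) :=
    h1.comap (glE F n).symm.toMonoidHom (glE F n).symm.surjective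
  refine upper hn (irr_ext h3) ?_
  rw [ext_ev, map_one, h2]

theorem bounds {n b D E : ℕ} (hn : 1 ≤ n)
    (hE : (E : ℝ) / qr F ^ (n * (n - 1) / 2) = 1) (hEb : E ≤ b)
    (hD : 1 / 4 * (Real.logb (qr F) (((n : ℝ) - 1) * (1 - 1 / qr F) + qr F ^ 2)) ^ (3 / 4 : ℝ) < (D : ℝ) / qr F ^ (n * (n - 1) / 2))
    (hDb : D ≤ b) (hb : b ≤ maxIrrDeg (Matrix.GeneralLinearGroup (Fin n) F)) :
    LMTBounds (Nat.card F) n b := by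
  have hq := qr_two (F := F)
  have hn' : (1 : ℝ) ≤ n := by exact_mod_cast hn
  have hqp : 0 < qr F ^ (n * (n - 1) / 2) := by positivity
  have mono : ∀ {x y : ℕ}, x ≤ y → (x : ℝ) / qr F ^ (n * (n - 1) / 2) ≤ (y : ℝ) / qr F ^ (n * (n - 1) / 2) := by
    intro x y h
    exact div_le_div_of_nonneg_right (by exact_mod_cast h) hqp.le
  have h1 := mono hEb
  rw [hE] at h1
  have h2 := lt_of_lt_of_le hD (mono hDb)
  have h3 := lt_of_le_of_lt (mono hb) (upper_gl (F := F) hn)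
  have hq2 : 1 / qr F ≤ 1 / 2 := one_div_le_one_div_of_le (by norm_num) hq
  have hX : ((n : ℝ) + 7) / 2 ≤ ((n : ℝ) - 1) * (1 - 1 / qr F) + qr F ^ 2 := by nlinarith
  refine ⟨max_le h1 h2.le, h3, lt_of_le_of_lt ?_ h2, lt_of_lt_of_le h3 ?_⟩
  · apply mul_le_mul_of_nonneg_left _ (by norm_num)
    apply Real.rpow_le_rpow _ _ (by norm_num)
    · exact Real.logb_nonneg (by change 1 < qr F; linarith) (by linarith)
    · exact Real.logb_le_logb_of_le (by change 1 < qr F; linarith) (by linarith) hX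
  · apply mul_le_mul_of_nonneg_left _ (by norm_num)
    have h5 : (1 : ℝ) ≤ n * (qr F - 1) + qr F := by nlinarith
    apply Real.rpow_le_rpow _ _ (by norm_num)
    · exact Real.logb_nonneg (by linarith) h5
    · change _ ≤ 1 + Real.logb (qr F) _
      rw [show 1 + Real.logb (qr F) ((n : ℝ) + 1) = Real.logb (qr F) (qr F * (n + 1)) by
        rw [Real.logb_mul (by linarith) (by linarith), Real.logb_self_eq_one (by linarith)]]
      exact Real.logb_le_logb_of_le (by linarith) (by linarith) (by nlinarith)

end LMT

open Matrix in
theorem stmt4 (q n : ℕ) (hn : 1 ≤ n)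
    (F : Type) [Field F] [Fintype F] (hF : Fintype.card F = q) :
    LMTBounds q n (maxIrrDeg (Matrix.GeneralLinearGroup (Fin n) F)) ∧
    LMTBounds q n (maxIrrDeg (ProjGL n F)) ∧
    LMTBounds q n (maxIrrDeg (Matrix.SpecialLinearGroup (Fin n) F)) ∧
    LMTBounds q n (maxIrrDeg (ProjectiveSpecialLinearGroup (Fin n) F)) := by
  obtain rfl : Nat.card F = q := by rw [Nat.card_eq_fintype_card, hF]
  obtain ⟨E, hE, hE1, hE2⟩ := LMT.low_one (F := F) hn
  obtain ⟨D, hD, hD1, hD2⟩ := LMT.lower (F := F) hn rfl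
  have a1 : maxIrrDeg (ProjGL n F) ≤ maxIrrDeg (Matrix.GeneralLinearGroup (Fin n) F) :=
    LMT.maxIrrDeg_le_of_surj (QuotientGroup.mk' (Subgroup.center (GL (Fin n) F))) (QuotientGroup.mk'_surjective _)
  have a2 : maxIrrDeg (Matrix.SpecialLinearGroup (Fin n) F) ≤ maxIrrDeg (Matrix.GeneralLinearGroup (Fin n) F) :=
    LMT.maxIrrDeg_le_of_inj SpecialLinearGroup.toGL SpecialLinearGroup.toGL_injective
  have a3 : maxIrrDeg (ProjectiveSpecialLinearGroup (Fin n) F) ≤ maxIrrDeg (Matrix.SpecialLinearGroup (Fin n) F) :=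
    LMT.maxIrrDeg_le_of_surj (QuotientGroup.mk' (Subgroup.center (SpecialLinearGroup (Fin n) F))) (QuotientGroup.mk'_surjective _)
  exact ⟨LMT.bounds hn hE (hE1.trans a1) hD (hD1.trans a1) le_rfl,
    LMT.bounds hn hE hE1 hD hD1 a1,
    LMT.bounds hn hE (hE2.trans a3) hD (hD2.trans a3) a2,
    LMT.bounds hn hE hE2 hD hD2 (a3.trans a2)⟩
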